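/- Let u_n be the largest atom of S_n. Then (u_n : ℝ)/p_n tends to 3 as n → ∞. -/

import Mathlib

open Filter Pointwise

/-- `nthPrime n` is the `n`-th prime number (1-indexed): `nthPrime 1 = 2`, etc. -/
noncomputable def nthPrime (n : ℕ) : ℕ := Nat.nth Nat.Prime (n - 1)

/-- `S n` is the additive submonoid of `ℕ` generated by the primes `q ≥ nthPrime n`. -/
def S (n : ℕ) : AddSubmonoid ℕ :=
  AddSubmonoid.closure {q : ℕ | q.Prime ∧ nthPrime n ≤ q}

/-- `frob n` is the Frobenius number of `S n`: the largest natural number not in `S n`. -/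
noncomputable def frob (n : ℕ) : ℕ := sSup {m : ℕ | m ∉ S n}

/-- `genus n` is the number of natural numbers not in `S n`. -/
noncomputable def genus (n : ℕ) : ℕ := {m : ℕ | m ∉ S n}.ncard

/-- `atoms n` is the minimal generating set `S n \ {0} \ ((S n \ {0}) + (S n \ {0}))`. -/
def atoms (n : ℕ) : Set ℕ :=
  ((S n : Set ℕ) \ {0}) \ (((S n : Set ℕ) \ {0}) + ((S n : Set ℕ) \ {0}))

/-- `u n` is the largest atom of `S n`. -/
noncomputable def u (n : ℕ) : ℕ := sSup (atoms n)

/-- `e n` is the embedding dimension of `S n`: the number of atoms. -/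
noncomputable def e (n : ℕ) : ℕ := (atoms n).ncard

namespace TernaryPrimes

open MeasureTheory Complex

/-- The triangle function, supported on `[-1, 1]`. -/
noncomputable def tri (t : ℝ) : ℝ := max 0 (1 - |t|)

/-- The Fejér kernel, which is the Fourier transform of `tri`. -/
noncomputable def fejer (x : ℝ) : ℝ := Real.sinc (x / 2) ^ 2

lemma continuous_tri : Continuous tri := by unfold tri; fun_prop

lemma continuous_fejer : Continuous fejer := by unfold fejer; fun_prop

lemma tri_nonneg (t : ℝ) : 0 ≤ tri t := le_max_left _ _

lemma fejer_nonneg (x : ℝ) : 0 ≤ fejer x := sq_nonneg _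

lemma tri_eq_zero {t : ℝ} (ht : t ∉ Set.Ioc (-1 : ℝ) 1) : tri t = 0 := by
  unfold tri
  apply max_eq_left
  rw [Set.mem_Ioc] at ht
  by_contra! h
  have := abs_lt.1 (show |t| < 1 by linarith)
  exact ht ⟨this.1, this.2.le⟩

lemma fejer_le (x : ℝ) : fejer x ≤ 5 * (1 + x ^ 2)⁻¹ := by
  have h1 : fejer x ≤ 1 := by
    unfold fejer
    have := Real.abs_sinc_le_one (x / 2)
    rw [← sq_abs]
    exact pow_le_one₀ (abs_nonneg _) this
  have h2 : x ^ 2 * fejer x ≤ 4 := by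
    by_cases hx : x = 0
    · simp [hx]
    unfold fejer
    rw [Real.sinc_of_ne_zero (by simpa using hx)]
    have := Real.sin_sq_le_one (x / 2)
    have e : x ^ 2 * (Real.sin (x / 2) / (x / 2)) ^ 2 = 4 * Real.sin (x / 2) ^ 2 := by
      field_simp
      norm_num; ring
    linarith
  rw [← div_eq_mul_inv, le_div_iff₀ (by positivity)]
  nlinarith

lemma integrable_fejer : Integrable fejer := by
  apply (integrable_inv_one_add_sq.const_mul 5).mono' continuous_fejer.aestronglyMeasurable
  filter_upwards with x
  rw [Real.norm_of_nonneg (fejer_nonneg x)]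
  exact fejer_le x

lemma integral_fejer_pos : 0 < ∫ x, fejer x := by
  rw [integral_pos_iff_support_of_nonneg fejer_nonneg integrable_fejer]
  apply IsOpen.measure_pos
  · exact continuous_fejer.isOpen_support
  · exact ⟨0, by simp [fejer]⟩

lemma fourier_tri (x : ℝ) : ∫ t : ℝ, (tri t : ℂ) * exp (I * t * x) = (fejer x : ℂ) := by
  have h1 : ∫ t : ℝ, (tri t : ℂ) * exp (I * t * x) =
      ∫ t : ℝ in (-1)..1, (tri t : ℂ) * exp (I * t * x) := by
    rw [intervalIntegral.integral_of_le (by norm_num), setIntegral_eq_integral_of_forall_compl_eq_zero]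
    intro t ht
    simp [tri_eq_zero ht]
  have hc : ∀ a b : ℝ, IntervalIntegrable (fun t : ℝ => (tri t : ℂ) * exp (I * t * x)) volume a b := by
    intro a b
    apply Continuous.intervalIntegrable
    have := continuous_tri
    fun_prop
  have h2 : ∫ t : ℝ in (-1)..1, (tri t : ℂ) * exp (I * t * x) =
      ∫ t : ℝ in (0)..1, ((2 * (1 - t) * Real.cos (t * x) : ℝ) : ℂ) := by
    rw [← intervalIntegral.integral_add_adjacent_intervals (hc (-1) 0) (hc 0 1)]
    have : ∫ t : ℝ in (-1)..0, (tri t : ℂ) * exp (I * t * x) =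
        ∫ t : ℝ in (0)..1, (tri (-t) : ℂ) * exp (I * (-t : ℝ) * x) := by
      have := intervalIntegral.integral_comp_neg (a := 0) (b := 1)
        (fun t : ℝ => (tri t : ℂ) * exp (I * t * x))
      simp only [neg_zero] at this
      exact this.symm
    rw [this, ← intervalIntegral.integral_add]
    · apply intervalIntegral.integral_congr
      intro t ht
      rw [Set.uIcc_of_le (by norm_num)] at ht
      have e1 : tri t = 1 - t := by
        unfold tri
        rw [abs_of_nonneg ht.1, max_eq_right (by linarith [ht.2])]
      have e2 : tri (-t) = 1 - t := by
        unfold tri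
        rw [abs_neg, abs_of_nonneg ht.1, max_eq_right (by linarith [ht.2])]
      simp only [e1, e2]
      push_cast
      rw [Complex.cos]
      have : I * (-(t : ℂ)) * x = -(t * x) * I := by ring
      have e3 : I * (t : ℂ) * x = (t * x) * I := by ring
      rw [this, e3]
      ring
    · apply Continuous.intervalIntegrable
      have := continuous_tri
      fun_prop
    · exact hc 0 1
  rw [h1, h2, intervalIntegral.integral_ofReal]
  congr 1
  by_cases hx : x = 0
  · subst hx
    have hd : ∀ t ∈ Set.uIcc (0 : ℝ) 1, HasDerivAt (fun t : ℝ => 2 * t - t ^ 2)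
        (2 * (1 - t) * Real.cos (t * 0)) t := by
      intro t _
      have := ((hasDerivAt_id t).const_mul 2).sub (hasDerivAt_pow 2 t)
      refine this.congr_deriv ?_
      simp
      ring
    rw [intervalIntegral.integral_eq_sub_of_hasDerivAt hd]
    · simp [fejer]; norm_num
    · apply Continuous.intervalIntegrable; fun_prop
  · have hd : ∀ t ∈ Set.uIcc (0 : ℝ) 1, HasDerivAt
        (fun t : ℝ => 2 * ((1 - t) * Real.sin (t * x) / x - Real.cos (t * x) / x ^ 2))
        (2 * (1 - t) * Real.cos (t * x)) t := by
      intro t _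
      have ht := (hasDerivAt_id t).mul_const x
      have h1 := ((hasDerivAt_const t (1 : ℝ)).sub (hasDerivAt_id t)).mul ht.sin
      have := ((h1.div_const x).sub (ht.cos.div_const (x ^ 2))).const_mul 2
      refine this.congr_deriv ?_
      simp
      field_simp
      ring
    rw [intervalIntegral.integral_eq_sub_of_hasDerivAt hd]
    · unfold fejer
      rw [Real.sinc_of_ne_zero (by simpa using hx)]
      have h4 := Real.cos_two_mul (x / 2)
      rw [show 2 * (x / 2) = x by ring] at h4
      have h3 := Real.sin_sq_add_cos_sq (x / 2)
      simp
      field_simp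
      linarith
    · apply Continuous.intervalIntegrable; fun_prop

lemma tri_scale_fourier {l : ℝ} (hl : 0 < l) (x : ℝ) :
    ∫ t : ℝ, (tri (t / l) : ℂ) * exp (I * t * x) = ((l * fejer (l * x) : ℝ) : ℂ) := by
  have h := Measure.integral_comp_div (fun t : ℝ => (tri t : ℂ) * exp (I * t * (l * x : ℝ))) l
  rw [fourier_tri, abs_of_pos hl] at h
  rw [ofReal_mul, ← Complex.real_smul, ← h]
  congr 1
  ext t
  congr 2
  have : (l : ℂ) ≠ 0 := by exact_mod_cast hl.ne'
  push_cast
  field_simp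

lemma integral_smoothing_eq {h : ℝ → ℝ} (hm : Measurable h) {C : ℝ} (hb : ∀ u, |h u| ≤ C)
    (h0 : ∀ u < 0, h u = 0) {G : ℂ → ℂ}
    (hL : ∀ z : ℂ, 0 < z.re → ∫ u : ℝ, (h u : ℂ) * exp (-(z * u)) = G z)
    {l : ℝ} (hl : 0 < l) {s : ℝ} (hs : 0 < s) (y : ℝ) :
    ∫ u : ℝ, ((h u * Real.exp (-(s * u)) * (l * fejer (l * (y - u))) : ℝ) : ℂ) =
      ∫ t : ℝ, (tri (t / l) : ℂ) * exp (I * t * y) * G (s + I * t) := by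
  have h_int : Integrable (fun u : ℝ => (h u : ℂ) * (Real.exp (-(s * u)) : ℝ)) := by
    have h1 : Integrable (Set.indicator (Set.Ioi 0) (fun u : ℝ => Real.exp (-s * u))) :=
      (integrable_indicator_iff measurableSet_Ioi).2 (exp_neg_integrableOn_Ioi 0 hs)
    apply (h1.const_mul C).mono'
    · apply Measurable.aestronglyMeasurable; fun_prop
    · filter_upwards [Measure.ae_ne volume (0 : ℝ)] with u hu
      rcases lt_or_gt_of_ne hu with hu | hu
      · simp [h0 u hu, hu.le]
      · rw [Set.indicator_of_mem (by exact hu), norm_mul, norm_real, norm_real,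
          Real.norm_of_nonneg (Real.exp_nonneg _)]
        have e : -(s * u) = -s * u := by ring
        rw [e]
        exact mul_le_mul_of_nonneg_right (hb u) (Real.exp_nonneg _)
  have h_int2 : Integrable (fun t : ℝ => (tri (t / l) : ℂ) * exp (I * t * y)) := by
    apply Continuous.integrable_of_hasCompactSupport
    · have := continuous_tri; fun_prop
    · apply HasCompactSupport.mul_right
      apply HasCompactSupport.intro (isCompact_Icc (a := -l) (b := l))
      intro x hx
      rw [tri_eq_zero]; · simp
      intro hh
      apply hx
      rw [Set.mem_Ioc, lt_div_iff₀ hl, div_le_iff₀ hl] at hh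
      exact ⟨by linarith [hh.1], by linarith [hh.2]⟩
  have hprod := h_int.mul_prod h_int2
  have hprod2 : Integrable (fun p : ℝ × ℝ => ((h p.1 : ℂ) * (Real.exp (-(s * p.1)) : ℝ)) *
      ((tri (p.2 / l) : ℂ) * exp (I * p.2 * y)) * exp (-(I * p.2 * p.1))) := by
    apply hprod.mono
    · apply AEStronglyMeasurable.mul hprod.aestronglyMeasurable
      apply Continuous.aestronglyMeasurable
      fun_prop
    · filter_upwards with p
      rw [norm_mul _ (exp _)]
      have : ‖exp (-(I * p.2 * p.1))‖ = 1 := by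
        rw [norm_exp]; simp
      rw [this, mul_one]
  have := integral_integral_swap (f := fun u t : ℝ => ((h u : ℂ) * (Real.exp (-(s * u)) : ℝ)) *
      ((tri (t / l) : ℂ) * exp (I * t * y)) * exp (-(I * t * u))) hprod2
  convert this using 1
  · congr 1; ext u
    have e1 : ∀ t : ℝ, (h u : ℂ) * (Real.exp (-(s * u)) : ℝ) *
      ((tri (t / l) : ℂ) * exp (I * t * y)) * exp (-(I * t * u)) =
       (h u : ℂ) * (Real.exp (-(s * u)) : ℝ) * ((tri (t / l) : ℂ) * exp (I * t * (y - u : ℝ))) := by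
      intro t
      have : exp (I * t * (y - u : ℝ)) = exp (I * t * y) * exp (-(I * t * u)) := by
        rw [← exp_add]; congr 1; push_cast; ring
      rw [this]; ring
    simp_rw [e1]
    rw [integral_const_mul, tri_scale_fourier hl]
    push_cast; ring
  · congr 1; ext t
    rw [← hL _ (by simp [hs]), ← integral_const_mul]
    congr 1; ext u
    have : exp (-((s + I * t) * u)) = (Real.exp (-(s * u)) : ℝ) * exp (-(I * t * u)) := by
      rw [ofReal_exp, ← exp_add]; congr 1; push_cast; ring
    rw [this]; ring

lemma integral_smoothing_limit {h : ℝ → ℝ} (hm : Measurable h) {C : ℝ} (hb : ∀ u, |h u| ≤ C)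
    (h0 : ∀ u < 0, h u = 0) {G : ℂ → ℂ} (hG : ContinuousOn G {z | 0 ≤ z.re})
    (hL : ∀ z : ℂ, 0 < z.re → ∫ u : ℝ, (h u : ℂ) * exp (-(z * u)) = G z)
    {l : ℝ} (hl : 0 < l) (y : ℝ) :
    ∫ u : ℝ, ((h u * (l * fejer (l * (y - u))) : ℝ) : ℂ) =
      ∫ t : ℝ, (tri (t / l) : ℂ) * exp (I * t * y) * G (I * t) := by
  have hfej : Integrable (fun u : ℝ => fejer (l * (y - u))) := by
    have := (integrable_fejer.comp_mul_left' hl.ne').comp_sub_left y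
    exact this
  have hcf := continuous_fejer
  have t1 : Tendsto (fun s : ℝ => ∫ u : ℝ, ((h u * Real.exp (-(s * u)) * (l * fejer (l * (y - u))) : ℝ) : ℂ))
      (nhdsWithin 0 (Set.Ioi 0)) (nhds (∫ u : ℝ, ((h u * (l * fejer (l * (y - u))) : ℝ) : ℂ))) := by
    apply tendsto_integral_filter_of_dominated_convergence (fun u => C * (l * fejer (l * (y - u))))
    · filter_upwards with s
      apply Measurable.aestronglyMeasurable
      have := hcf.measurable
      fun_prop
    · filter_upwards [self_mem_nhdsWithin] with s hs
      filter_upwards with u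
      rw [norm_real, norm_mul, Real.norm_of_nonneg (mul_nonneg hl.le (fejer_nonneg _))]
      apply mul_le_mul_of_nonneg_right _ (mul_nonneg hl.le (fejer_nonneg _))
      rcases lt_or_ge u 0 with hu | hu
      · simp [h0 u hu]; exact (abs_nonneg _).trans (hb 0)
      · rw [norm_mul, Real.norm_of_nonneg (Real.exp_nonneg _)]
        have : Real.exp (-(s * u)) ≤ 1 := Real.exp_le_one_iff.2 (by have : 0 < s := hs; nlinarith)
        have h2 := hb u
        rw [Real.norm_eq_abs]
        nlinarith [abs_nonneg (h u)]
    · exact (hfej.const_mul l).const_mul C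
    · filter_upwards with u
      have : Tendsto (fun s : ℝ => ((h u * Real.exp (-(s * u)) * (l * fejer (l * (y - u))) : ℝ) : ℂ))
        (nhds 0) (nhds (((h u * Real.exp (-(0 * u)) * (l * fejer (l * (y - u))) : ℝ) : ℂ))) := by
        apply Continuous.tendsto' _ _ _ rfl
        fun_prop
      simp only [zero_mul, neg_zero, Real.exp_zero, mul_one] at this
      exact this.mono_left nhdsWithin_le_nhds
  have hK : IsCompact (Set.Icc (0 : ℝ) 1 ×ℂ Set.Icc (-l) l) := isCompact_Icc.reProdIm isCompact_Icc
  obtain ⟨B, hB⟩ := hK.exists_bound_of_continuousOn (f := G)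
    (hG.mono fun z hz => by exact hz.1.1)
  have hct := continuous_tri
  have htri : Integrable (fun t : ℝ => tri (t / l)) := by
    apply Continuous.integrable_of_hasCompactSupport
    · fun_prop
    · apply HasCompactSupport.intro (isCompact_Icc (a := -l) (b := l))
      intro x hx
      rw [tri_eq_zero]
      intro hh
      apply hx
      rw [Set.mem_Ioc, lt_div_iff₀ hl, div_le_iff₀ hl] at hh
      exact ⟨by linarith [hh.1], by linarith [hh.2]⟩
  have t2 : Tendsto (fun s : ℝ => ∫ t : ℝ, (tri (t / l) : ℂ) * exp (I * t * y) * G (s + I * t))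
      (nhdsWithin 0 (Set.Ioi 0)) (nhds (∫ t : ℝ, (tri (t / l) : ℂ) * exp (I * t * y) * G (I * t))) := by
    apply tendsto_integral_filter_of_dominated_convergence (fun t => tri (t / l) * B)
    · filter_upwards [self_mem_nhdsWithin] with s hs
      apply Continuous.aestronglyMeasurable
      apply Continuous.mul (by fun_prop)
      apply hG.comp_continuous (by fun_prop)
      intro t
      have : 0 < s := hs
      simp [this.le]
    · have : Set.Ioo (0 : ℝ) 1 ∈ nhdsWithin (0 : ℝ) (Set.Ioi 0) := Ioo_mem_nhdsGT one_pos
      filter_upwards [this] with s hs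
      filter_upwards with t
      have e : ‖exp (I * t * y)‖ = 1 := by rw [norm_exp]; simp
      rw [norm_mul, norm_mul, e, mul_one, norm_real, Real.norm_of_nonneg (tri_nonneg _)]
      by_cases ht : t / l ∈ Set.Ioc (-1 : ℝ) 1
      · apply mul_le_mul_of_nonneg_left _ (tri_nonneg _)
        apply hB
        rw [Set.mem_Ioc, lt_div_iff₀ hl, div_le_iff₀ hl] at ht
        rw [mem_reProdIm]
        constructor
        · simpa using ⟨hs.1.le, hs.2.le⟩
        · simpa using ⟨by linarith [ht.1], by linarith [ht.2]⟩
      · simp [tri_eq_zero ht]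
    · exact htri.mul_const B
    · filter_upwards with t
      apply Tendsto.const_mul
      have hc : ContinuousWithinAt G {z | 0 ≤ z.re} (I * t) := hG _ (by simp)
      have : Tendsto (fun s : ℝ => (s : ℂ) + I * t) (nhdsWithin 0 (Set.Ioi 0))
          (nhdsWithin (I * t) {z | 0 ≤ z.re}) := by
        apply tendsto_nhdsWithin_of_tendsto_nhds_of_eventually_within
        · have : Tendsto (fun s : ℝ => (s : ℂ) + I * t) (nhds 0) (nhds (I * t)) := by
            apply Continuous.tendsto' (by fun_prop); simp
          exact this.mono_left nhdsWithin_le_nhds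
        · filter_upwards [self_mem_nhdsWithin] with s hs
          have : 0 < s := hs
          simp [this.le]
      exact hc.tendsto.comp this
  refine tendsto_nhds_unique t1 (t2.congr' ?_)
  filter_upwards [self_mem_nhdsWithin] with s hs
  exact (integral_smoothing_eq hm hb h0 hL hl hs y).symm

lemma tendsto_smoothing {h : ℝ → ℝ} (hm : Measurable h) {C : ℝ} (hb : ∀ u, |h u| ≤ C)
    (h0 : ∀ u < 0, h u = 0) {G : ℂ → ℂ} (hG : ContinuousOn G {z | 0 ≤ z.re})
    (hL : ∀ z : ℂ, 0 < z.re → ∫ u : ℝ, (h u : ℂ) * exp (-(z * u)) = G z)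
    {l : ℝ} (hl : 0 < l) :
    Tendsto (fun y : ℝ => ∫ v : ℝ, h (y - v / l) * fejer v) atTop (nhds 0) := by
  have key := fun y => integral_smoothing_limit hm hb h0 hG hL hl y
  have rl := Real.tendsto_integral_exp_smul_cocompact (fun t : ℝ => (tri (t / l) : ℂ) * G (I * t))
  have hy : Tendsto (fun y : ℝ => -(y / (2 * Real.pi))) atTop (cocompact ℝ) := by
    apply Tendsto.mono_right _ atBot_le_cocompact
    apply tendsto_neg_atTop_atBot.comp
    exact tendsto_id.atTop_div_const (by positivity)
  have := rl.comp hy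
  have h2 : Tendsto (fun y : ℝ => ((∫ v : ℝ, h (y - v / l) * fejer v : ℝ) : ℂ)) atTop (nhds 0) := by
    refine this.congr fun y => ?_
    simp only [Function.comp]
    have e1 : ∀ t : ℝ, Real.fourierChar (-(t * -(y / (2 * Real.pi)))) • ((tri (t / l) : ℂ) * G (I * t)) =
        (tri (t / l) : ℂ) * exp (I * t * y) * G (I * t) := by
      intro t
      rw [Circle.smul_def, Real.fourierChar_apply, smul_eq_mul]
      have : (2 * Real.pi * (-(t * -(y / (2 * Real.pi)))) : ℝ) = t * y := by
        have := Real.pi_pos; field_simp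
      rw [this]
      push_cast
      rw [show (t : ℂ) * y * I = I * t * y by ring]
      ring
    simp_rw [e1]
    rw [← key y]
    have e2 := integral_ofReal (𝕜 := ℂ) (μ := volume) (f := fun u : ℝ => h u * (l * fejer (l * (y - u))))
    refine Eq.trans e2 ?_
    have h3 := integral_sub_left_eq_self (fun u : ℝ => h u * (l * fejer (l * (y - u)))) volume y
    rw [← h3]
    simp only [sub_sub_cancel]
    have h4 := Measure.integral_comp_div (fun u : ℝ => h (y - u) * (l * fejer (l * u))) l
    rw [abs_of_pos hl] at h4
    have h5 : ∫ v : ℝ, h (y - v / l) * (l * fejer (l * (v / l))) = l * ∫ v : ℝ, h (y - v / l) * fejer v := by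
      rw [← integral_const_mul]
      congr 1; ext v
      rw [mul_div_cancel₀ _ hl.ne']; ring
    rw [h5, smul_eq_mul] at h4
    exact congrArg _ (mul_left_cancel₀ hl.ne' h4).symm
  have h6 := (continuous_re.tendsto 0).comp h2
  simpa [Function.comp_def] using h6

/-- A Wiener–Ikehara type Tauberian theorem for bounded slowly decreasing functions. -/
theorem tauberian {h : ℝ → ℝ} (hm : Measurable h) {C c : ℝ} (hc : 0 ≤ c) (hb : ∀ u, |h u| ≤ C)
    (h0 : ∀ u < 0, h u = 0)
    (hslow : ∀ u ≥ 0, ∀ v ≥ 0, (h u + c) * Real.exp (-v) ≤ h (u + v) + c)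
    {G : ℂ → ℂ} (hG : ContinuousOn G {z | 0 ≤ z.re})
    (hL : ∀ z : ℂ, 0 < z.re → ∫ u : ℝ, (h u : ℂ) * exp (-(z * u)) = G z) :
    Tendsto h atTop (nhds 0) := by
  have hC : 0 ≤ C := (abs_nonneg _).trans (hb 0)
  set k := ∫ v, fejer v with hk
  have hkpos : 0 < k := integral_fejer_pos
  have htail : Tendsto (fun V : ℝ => ∫ v, Set.indicator {v : ℝ | V < |v|} fejer v) atTop (nhds 0) := by
    have : Tendsto (fun V : ℝ => ∫ v, Set.indicator {v : ℝ | V < |v|} fejer v) atTop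
        (nhds (∫ v : ℝ, (0 : ℝ))) := by
      apply tendsto_integral_filter_of_dominated_convergence fejer
      · filter_upwards with V
        exact (continuous_fejer.measurable.indicator (measurableSet_lt measurable_const
          (by fun_prop))).aestronglyMeasurable
      · filter_upwards with V
        filter_upwards with v
        rw [norm_indicator_eq_indicator_norm]
        apply (Set.indicator_le_self' (fun x _ => norm_nonneg _) v).trans
        rw [Real.norm_of_nonneg (fejer_nonneg v)]
      · exact integrable_fejer
      · filter_upwards with v
        apply tendsto_const_nhds.congr'
        filter_upwards [eventually_ge_atTop |v|] with V hV
        rw [Set.indicator_of_notMem]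
        simpa using hV
    simpa using this
  have slow : ∀ u ≥ 0, ∀ w ≥ 0, h u ≤ h (u + w) + (C + c) * w := by
    intro u hu w hw
    have h1 := hslow u hu w hw
    have h2 := Real.one_sub_le_exp_neg w
    have h3 := abs_le.1 (hb u)
    have h4 := Real.exp_le_one_iff.2 (show -w ≤ 0 by linarith)
    have h5 : (h u + c) * (1 - Real.exp (-w)) ≤ (C + c) * w := by
      apply (mul_le_mul_of_nonneg_right (show h u + c ≤ C + c by linarith) (by linarith)).trans
      exact mul_le_mul_of_nonneg_left (by linarith) (by linarith)
    linarith
  rw [Metric.tendsto_atTop]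
  intro ε hε
  set δ := ε * k / (3 * (2 * C + 1)) with hδ
  have hδpos : 0 < δ := by positivity
  obtain ⟨V, hV⟩ := ((htail.eventually (gt_mem_nhds hδpos)).and (eventually_ge_atTop (1 : ℝ))).exists
  obtain ⟨hV, hV1⟩ := hV
  set l := 6 * (C + c + 1) * 2 * V / ε with hl
  have hlpos : 0 < l := by positivity
  have hP := tendsto_smoothing hm hb h0 hG hL hlpos
  set P := fun y : ℝ => ∫ v : ℝ, h (y - v / l) * fejer v
  have hη : (C + c) * (2 * V / l) ≤ ε / 6 := by
    rw [hl]
    have : (C + c) * (2 * V / (6 * (C + c + 1) * 2 * V / ε)) = (C + c) / (C + c + 1) * (ε / 6) := by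
      field_simp
    rw [this]
    have : (C + c) / (C + c + 1) ≤ 1 := by rw [div_le_one (by positivity)]; linarith
    nlinarith
  have hPe : ∀ᶠ y in atTop, |P y| < ε * k / 6 := by
    have := hP.eventually (Metric.ball_mem_nhds 0 (show 0 < ε * k / 6 by positivity))
    filter_upwards [this] with y hy
    simpa [Real.dist_eq] using hy
  have hI : ∀ y, Integrable (fun v => h (y - v / l) * fejer v) := by
    intro y
    apply integrable_fejer.bdd_mul (c := C)
    · apply Measurable.aestronglyMeasurable; fun_prop
    · filter_upwards with v
      exact hb _
  have hIt : Integrable (Set.indicator {v : ℝ | V < |v|} fejer) :=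
    integrable_fejer.indicator (measurableSet_lt measurable_const (by fun_prop))
  have hδ2 : 2 * C * δ ≤ ε * k / 3 := by
    have : (2 * C + 1) * δ = ε * k / 3 := by rw [hδ]; field_simp
    nlinarith
  obtain ⟨Y, hY⟩ := eventually_atTop.1 hPe
  refine ⟨max Y 0 + 2 * V / l, fun y hy => ?_⟩
  have hyV : 0 ≤ V / l := by positivity
  have e2V : 2 * V / l = V / l + V / l := by ring
  have hy1 : Y ≤ y - V / l := by linarith [le_max_left Y 0]
  have hy2 : 2 * V / l ≤ y := by linarith [le_max_right Y 0]
  have bound : ∀ a b : ℝ, (∀ v, |v| ≤ V → a ≤ b * h (y + b * (V / l) - v / l) + ε / 6) → |a| ≤ C → |b| = 1 →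
      a * k ≤ b * P (y + b * (V / l)) + ε / 6 * k + 2 * C * δ := by
    intro a b hab ha hb1
    calc a * k = ∫ v, a * fejer v := by rw [integral_const_mul]
      _ ≤ ∫ v, (b * (h (y + b * (V / l) - v / l) * fejer v) + ε / 6 * fejer v +
          2 * C * Set.indicator {v : ℝ | V < |v|} fejer v) := by
        apply integral_mono (integrable_fejer.const_mul a)
        · exact (((hI _).const_mul b).add (integrable_fejer.const_mul _)).add (hIt.const_mul _)
        · intro v
          simp only
          by_cases hv : V < |v|
          · rw [Set.indicator_of_mem (by exact hv)]
            have h1 := hb (y + b * (V / l) - v / l)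
            have h2 : |b * h (y + b * (V / l) - v / l)| ≤ C := by rwa [abs_mul, hb1, one_mul]
            have h3 := abs_le.1 h2
            have h4 := abs_le.1 ha
            nlinarith [fejer_nonneg v]
          · rw [Set.indicator_of_notMem (by exact hv)]
            have := hab v (not_lt.1 hv)
            nlinarith [fejer_nonneg v]
      _ = b * P (y + b * (V / l)) + ε / 6 * k + 2 * C * ∫ v, Set.indicator {v : ℝ | V < |v|} fejer v := by
        rw [integral_add, integral_add, integral_const_mul, integral_const_mul, integral_const_mul]
        · exact (hI _).const_mul b
        · exact integrable_fejer.const_mul _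
        · exact ((hI _).const_mul b).add (integrable_fejer.const_mul _)
        · exact hIt.const_mul _
      _ ≤ _ := by nlinarith
  have up := bound (h y) 1 (by
    intro v hv
    rw [abs_le] at hv
    have := slow y (by linarith) ((V - v) / l) (div_nonneg (by linarith) hlpos.le)
    have e : y + (V - v) / l = y + 1 * (V / l) - v / l := by ring
    rw [e] at this
    have : (C + c) * ((V - v) / l) ≤ (C + c) * (2 * V / l) := by
      apply mul_le_mul_of_nonneg_left _ (by linarith)
      apply div_le_div_of_nonneg_right _ hlpos.le
      linarith
    linarith) (hb y) (by simp)
  have low := bound (-h y) (-1) (by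
    intro v hv
    rw [abs_le] at hv
    have h1 : (V + v) / l ≤ 2 * V / l := by
      apply div_le_div_of_nonneg_right _ hlpos.le
      linarith
    have := slow (y - (V + v) / l) (by linarith) ((V + v) / l) (div_nonneg (by linarith) hlpos.le)
    rw [sub_add_cancel] at this
    have e : y - (V + v) / l = y + -1 * (V / l) - v / l := by ring
    rw [e] at this
    have : (C + c) * ((V + v) / l) ≤ (C + c) * (2 * V / l) := by
      apply mul_le_mul_of_nonneg_left h1 (by linarith)
    linarith) (by rw [abs_neg]; exact hb y) (by simp)
  have p1 := abs_lt.1 (hY (y + 1 * (V / l)) (by linarith))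
  have p2 := abs_lt.1 (hY (y + -1 * (V / l)) (by linarith))
  rw [Real.dist_eq, sub_zero, abs_lt]
  constructor
  · have : -h y * k < ε * k := by nlinarith
    have := lt_of_mul_lt_mul_right this hkpos.le
    linarith
  · have : h y * k < ε * k := by nlinarith
    exact lt_of_mul_lt_mul_right this hkpos.le

lemma laplace_partial_sums {f : ℕ → ℝ} (hf : ∀ n, 0 ≤ f n) {C : ℝ}
    (hC : ∀ n : ℕ, ∑ k ∈ Finset.Icc 1 n, f k ≤ C * n) {z : ℂ} (hz : 0 < z.re) :
    ∫ u in Set.Ioi (0 : ℝ), ((∑ k ∈ Finset.Icc 1 ⌊Real.exp u⌋₊, f k : ℝ) * Real.exp (-u) : ℝ) * exp (-(z * u)) =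
      LSeries (fun n => (f n : ℂ)) (z + 1) / (z + 1) := by
  have hz1 : z + 1 ≠ 0 := by
    intro h
    have := congrArg re h
    simp at this
    linarith
  rw [LSeries_eq_mul_integral_of_nonneg f zero_le_one (s := z + 1) (by simpa using hz) ?_ hf,
    mul_div_cancel_left₀ _ hz1]
  · have him : Set.image Real.exp (Set.Ioi 0) = Set.Ioi 1 := by
      ext x
      constructor
      · rintro ⟨y, hy, rfl⟩
        exact Real.one_lt_exp_iff.2 hy
      · intro hx
        exact ⟨Real.log x, Real.log_pos hx, Real.exp_log (zero_lt_one.trans hx)⟩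
    rw [← him, integral_image_eq_integral_abs_deriv_smul measurableSet_Ioi
      (fun x _ => (Real.hasDerivAt_exp x).hasDerivWithinAt) Real.exp_injective.injOn]
    apply setIntegral_congr_fun measurableSet_Ioi
    intro u _
    simp only [Complex.real_smul, abs_of_pos (Real.exp_pos u)]
    have e1 : ((Real.exp u : ℝ) : ℂ) ^ (-(z + 1 + 1)) = exp (-(u * (z + 1 + 1))) := by
      rw [cpow_def_of_ne_zero (by exact_mod_cast (Real.exp_pos u).ne'), ← ofReal_log (Real.exp_nonneg u),
        Real.log_exp]
      congr 1; ring
    rw [e1]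
    push_cast
    have e2 : exp (-(u * (z + 1 + 1))) = exp (-u) * exp (-u) * exp (-(z * u)) := by
      rw [← exp_add, ← exp_add]; congr 1; ring
    have e3 : exp u * exp (-u) = 1 := by rw [← exp_add]; simp
    rw [e2]
    linear_combination (-(∑ x ∈ Finset.Icc 1 ⌊Real.exp u⌋₊, (f x : ℂ)) * exp (-u) * exp (-(z * u))) * e3
  · apply Asymptotics.IsBigO.of_bound C
    filter_upwards with n
    rw [Real.norm_of_nonneg (Finset.sum_nonneg fun i _ => hf i)]
    simpa using hC n

/-- A Wiener–Ikehara theorem: if the Dirichlet series of a nonnegative sequence with linearly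
bounded partial sums minus `c / (s - 1)` extends continuously to `1 ≤ s.re`, then the partial sums
are asymptotic to `c * n`. -/
theorem wienerIkehara {f : ℕ → ℝ} (hf : ∀ n, 0 ≤ f n) {C : ℝ}
    (hC : ∀ n : ℕ, ∑ k ∈ Finset.Icc 1 n, f k ≤ C * n) {c : ℝ} (hc : 0 ≤ c) {F : ℂ → ℂ}
    (hF : ContinuousOn F {s | 1 ≤ s.re})
    (hFL : ∀ s : ℂ, 1 < s.re → F s = LSeries (fun n => (f n : ℂ)) s - c / (s - 1)) :
    Tendsto (fun n : ℕ => (∑ k ∈ Finset.Icc 1 n, f k) / n) atTop (nhds c) := by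
  set A : ℝ → ℝ := fun x => ∑ k ∈ Finset.Icc 1 ⌊x⌋₊, f k with hA
  have hAmono : Monotone A := by
    intro x y hxy
    apply Finset.sum_le_sum_of_subset_of_nonneg
    · exact Finset.Icc_subset_Icc_right (Nat.floor_mono hxy)
    · exact fun i _ _ => hf i
  have hA0 : ∀ x, 0 ≤ A x := fun x => Finset.sum_nonneg fun i _ => hf i
  have hC0 : 0 ≤ C := by
    have := (Finset.sum_nonneg fun i (_ : i ∈ Finset.Icc 1 1) => hf i).trans (hC 1)
    simpa using this
  have hAC : ∀ u : ℝ, A (Real.exp u) * Real.exp (-u) ≤ C := by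
    intro u
    rw [Real.exp_neg, ← div_eq_mul_inv, div_le_iff₀ (Real.exp_pos u)]
    apply (hC _).trans
    exact mul_le_mul_of_nonneg_left (Nat.floor_le (Real.exp_nonneg u)) hC0
  set h : ℝ → ℝ := Set.indicator (Set.Ici 0) (fun u => A (Real.exp u) * Real.exp (-u) - c) with hh
  have hm : Measurable h := by
    apply Measurable.indicator _ measurableSet_Ici
    have := hAmono.measurable
    fun_prop
  have hpos : ∀ u ≥ 0, h u = A (Real.exp u) * Real.exp (-u) - c := fun u hu =>
    Set.indicator_of_mem hu _
  have hneg : ∀ u < 0, h u = 0 := fun u hu => Set.indicator_of_notMem (by simpa using hu) _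
  have hb : ∀ u, |h u| ≤ C + c := by
    intro u
    rcases lt_or_ge u 0 with hu | hu
    · rw [hneg u hu]; simp; linarith
    · rw [hpos u hu, abs_le]
      have := hAC u
      have := mul_nonneg (hA0 (Real.exp u)) (Real.exp_nonneg (-u))
      constructor <;> linarith
  have lim : Tendsto h atTop (nhds 0) := by
    refine tauberian hm hc hb hneg ?_ (G := fun z => (F (z + 1) - c) / (z + 1)) ?_ ?_
    · intro u hu v hv
      rw [hpos u hu, hpos (u + v) (add_nonneg hu hv)]
      have e : Real.exp (-(u + v)) = Real.exp (-u) * Real.exp (-v) := by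
        rw [← Real.exp_add]; congr 1; ring
      rw [e]
      have := hAmono (Real.exp_le_exp.2 (show u ≤ u + v by linarith))
      have := mul_le_mul_of_nonneg_right this
        (mul_nonneg (Real.exp_nonneg (-u)) (Real.exp_nonneg (-v)))
      linarith
    · apply ContinuousOn.div
      · apply ContinuousOn.sub _ continuousOn_const
        apply hF.comp (by fun_prop)
        intro z hz
        have : 0 ≤ z.re := hz
        simpa using this
      · fun_prop
      · intro z hz h0
        have : 0 ≤ z.re := hz
        have := congrArg re h0
        simp at this
        linarith
    · intro z hz
      have hz0 : z ≠ 0 := by rintro rfl; simp at hz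
      have hz1 : z + 1 ≠ 0 := by
        intro h
        have := congrArg re h
        simp at this
        linarith
      have hexp : IntegrableOn (fun u : ℝ => exp (-z * u)) (Set.Ioi 0) :=
        integrableOn_exp_mul_complex_Ioi (by simpa using hz) 0
      have e1 : ∫ u : ℝ, (h u : ℂ) * exp (-(z * u)) =
          ∫ u in Set.Ioi (0 : ℝ), (((A (Real.exp u) * Real.exp (-u) : ℝ) : ℂ) * exp (-(z * u)) - c * exp (-z * u)) := by
        rw [← integral_Ici_eq_integral_Ioi, ← integral_indicator measurableSet_Ici]
        congr 1; ext u
        by_cases hu : u ∈ Set.Ici (0 : ℝ)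
        · rw [Set.indicator_of_mem hu, hpos u hu]
          push_cast; rw [neg_mul]; ring
        · rw [Set.indicator_of_notMem hu, hneg u (by simpa using hu)]; simp
      rw [e1, integral_sub]
      · rw [laplace_partial_sums hf hC hz, integral_const_mul,
          integral_exp_mul_complex_Ioi (by simpa using hz), hFL (z + 1) (by simpa using hz)]
        simp
        field_simp
        ring
      · have hm1 : Measurable fun u : ℝ => ((A (Real.exp u) * Real.exp (-u) : ℝ) : ℂ) := by
          have := hAmono.measurable
          fun_prop
        have := hexp.bdd_mul (c := C) (f := fun u : ℝ => ((A (Real.exp u) * Real.exp (-u) : ℝ) : ℂ))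
          hm1.aestronglyMeasurable (by
            filter_upwards with u
            rw [norm_real, Real.norm_of_nonneg (mul_nonneg (hA0 _) (Real.exp_nonneg _))]
            exact hAC u)
        simpa only [neg_mul] using this
      · exact hexp.const_mul _
  have hlog : Tendsto (fun n : ℕ => Real.log n) atTop atTop :=
    Real.tendsto_log_atTop.comp tendsto_natCast_atTop_atTop
  have := (lim.comp hlog).add_const c
  rw [zero_add] at this
  refine this.congr' ?_
  filter_upwards [eventually_ge_atTop 1] with n hn
  have hn0 : (0 : ℝ) < n := by exact_mod_cast hn
  simp only [Function.comp]
  rw [hpos _ (Real.log_nonneg (by exact_mod_cast hn)), Real.exp_neg, Real.exp_log hn0]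
  simp only [hA, Nat.floor_natCast]
  rw [div_eq_mul_inv]; ring

/-- The prime number theorem in arithmetic progressions to a fixed modulus, for `Λ`. -/
theorem tendsto_sum_residueClass {q : ℕ} [NeZero q] {a : ZMod q} (ha : IsUnit a) :
    Tendsto (fun n : ℕ => (∑ k ∈ Finset.Icc 1 n, ArithmeticFunction.vonMangoldt.residueClass a k) / n)
      atTop (nhds ((q.totient : ℝ)⁻¹)) := by
  refine wienerIkehara (ArithmeticFunction.vonMangoldt.residueClass_nonneg a) (C := Real.log 4 + 4) ?_
    (by positivity) (ArithmeticFunction.vonMangoldt.continuousOn_LFunctionResidueClassAux a) ?_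
  · intro n
    have h1 := Chebyshev.psi_le_const_mul_self (x := n) (Nat.cast_nonneg n)
    apply le_trans _ h1
    rw [Chebyshev.psi, Nat.floor_natCast]
    exact Finset.sum_le_sum fun i _ => ArithmeticFunction.vonMangoldt.residueClass_le a i
  · intro s hs
    rw [ArithmeticFunction.vonMangoldt.eqOn_LFunctionResidueClassAux ha hs]
    simp

/-- The additive character `x ↦ exp (2πix)`. -/
noncomputable def ex (x : ℝ) : ℂ := exp (2 * Real.pi * x * I)

lemma ex_add (x y : ℝ) : ex (x + y) = ex x * ex y := by
  unfold ex; rw [← exp_add]; congr 1; push_cast; ring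

@[simp] lemma ex_zero : ex 0 = 1 := by simp [ex]

@[simp] lemma norm_ex (x : ℝ) : ‖ex x‖ = 1 := by
  unfold ex; rw [norm_exp]; simp

@[fun_prop] lemma continuous_ex : Continuous ex := by unfold ex; fun_prop

@[simp] lemma ex_int (n : ℤ) : ex n = 1 := by
  unfold ex; rw [exp_eq_one_iff]; exact ⟨n, by push_cast; ring⟩

@[simp] lemma ex_nat (n : ℕ) : ex n = 1 := by exact_mod_cast ex_int n

lemma ex_add_int (x : ℝ) (n : ℤ) : ex (x + n) = ex x := by rw [ex_add, ex_int, mul_one]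

lemma ex_neg (x : ℝ) : ex (-x) = starRingEnd ℂ (ex x) := by
  unfold ex; rw [← exp_conj]; congr 1; simp [Complex.conj_ofNat]

lemma ex_nat_mul (n : ℕ) (x : ℝ) : ex (n * x) = ex x ^ n := by
  unfold ex; rw [← exp_nat_mul]; congr 1; push_cast; ring

lemma ex_eq_one_iff {x : ℝ} : ex x = 1 ↔ ∃ n : ℤ, x = n := by
  constructor
  · intro h
    unfold ex at h
    rw [exp_eq_one_iff] at h
    obtain ⟨n, hn⟩ := h
    refine ⟨n, ?_⟩
    have : (2 * Real.pi * I : ℂ) ≠ 0 := by simp [Real.pi_ne_zero]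
    have h2 : (2 * Real.pi * I : ℂ) * x = (2 * Real.pi * I : ℂ) * n := by
      linear_combination hn
    exact_mod_cast mul_left_cancel₀ this h2
  · rintro ⟨n, rfl⟩; exact ex_int n

lemma integral_ex_int (n : ℤ) : ∫ x in (0 : ℝ)..1, ex (n * x) = if n = 0 then 1 else 0 := by
  split_ifs with h
  · simp [h]
  · have hn : (n : ℂ) ≠ 0 := by exact_mod_cast h
    have hc : (2 * Real.pi * n * I : ℂ) ≠ 0 := by simp [Real.pi_ne_zero, h]
    have := integral_exp_mul_complex (a := 0) (b := 1) hc
    have e : ∀ x : ℝ, ex (n * x) = exp (2 * Real.pi * n * I * x) := by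
      intro x; unfold ex; congr 1; push_cast; ring
    simp_rw [e, this]
    have h1 : exp (2 * Real.pi * n * I * (1 : ℝ)) = 1 := by
      rw [exp_eq_one_iff]; exact ⟨n, by push_cast; ring⟩
    rw [h1]; simp

/-- The exponential sum with coefficients `w` on the finite set `s`. -/
noncomputable def expSum (s : Finset ℕ) (w : ℕ → ℝ) (x : ℝ) : ℂ := ∑ n ∈ s, (w n : ℂ) * ex (n * x)

@[fun_prop] lemma continuous_expSum (s : Finset ℕ) (w : ℕ → ℝ) : Continuous (expSum s w) := by
  unfold expSum; fun_prop

lemma expSum_add_int (s : Finset ℕ) (w : ℕ → ℝ) (x : ℝ) (m : ℤ) :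
    expSum s w (x + m) = expSum s w x := by
  unfold expSum
  refine Finset.sum_congr rfl fun n _ => ?_
  rw [mul_add, ← Int.cast_natCast, ← Int.cast_mul, ex_add_int]

lemma periodic_expSum (s : Finset ℕ) (w : ℕ → ℝ) : Function.Periodic (expSum s w) 1 := by
  intro x; exact_mod_cast expSum_add_int s w x 1

lemma norm_expSum_le (s : Finset ℕ) {w : ℕ → ℝ} (hw : ∀ n ∈ s, 0 ≤ w n) (x : ℝ) :
    ‖expSum s w x‖ ≤ ∑ n ∈ s, w n := by
  unfold expSum
  apply norm_sum_le_of_le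
  intro n hn
  rw [norm_mul, norm_ex, mul_one, norm_real, Real.norm_of_nonneg (hw n hn)]

/-- Parseval's identity. -/
lemma integral_norm_sq_expSum (s : Finset ℕ) (w : ℕ → ℝ) :
    ∫ x in (0 : ℝ)..1, ‖expSum s w x‖ ^ 2 = ∑ n ∈ s, w n ^ 2 := by
  have e : ∀ x : ℝ, ((‖expSum s w x‖ ^ 2 : ℝ) : ℂ) =
      ∑ n ∈ s, ∑ m ∈ s, (w n * w m : ℂ) * ex (((n : ℤ) - m : ℤ) * x) := by
    intro x
    have h1 : ((‖expSum s w x‖ ^ 2 : ℝ) : ℂ) = expSum s w x * starRingEnd ℂ (expSum s w x) := by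
      rw [mul_conj, normSq_eq_norm_sq]
    rw [h1]
    unfold expSum
    rw [map_sum, Finset.sum_mul_sum]
    refine Finset.sum_congr rfl fun n _ => Finset.sum_congr rfl fun m _ => ?_
    rw [map_mul, ← ex_neg, conj_ofReal]
    have : ((((n : ℤ) - m : ℤ) : ℝ) * x) = n * x + -(m * x) := by push_cast; ring
    rw [this, ex_add]
    ring
  have h2 : ((∫ x in (0 : ℝ)..1, ‖expSum s w x‖ ^ 2 : ℝ) : ℂ) = ((∑ n ∈ s, w n ^ 2 : ℝ) : ℂ) := by
    rw [← intervalIntegral.integral_ofReal]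
    simp_rw [e]
    rw [intervalIntegral.integral_finsetSum]
    · rw [ofReal_sum]
      refine Finset.sum_congr rfl fun n hn => ?_
      rw [intervalIntegral.integral_finsetSum]
      · simp only [intervalIntegral.integral_const_mul, integral_ex_int]
        rw [Finset.sum_eq_single n]
        · simp; ring
        · intro b _ hb
          rw [if_neg]; · simp
          omega
        · exact fun h => absurd hn h
      · intro m _
        apply Continuous.intervalIntegrable; fun_prop
    · intro n _
      apply Continuous.intervalIntegrable; fun_prop
  exact_mod_cast h2

/-- Disjoint short intervals modulo one carry at most a bounded multiple of the integral over a period. -/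
lemma sum_integral_le_of_separated {ι : Type*} (t : Finset ι) (x : ι → ℝ) {d : ℝ} (hd : 0 < d)
    (hd1 : d ≤ 1) {g : ℝ → ℝ} (hg : Continuous g) (hg0 : ∀ x, 0 ≤ g x) (hp : Function.Periodic g 1)
    (hsep : ∀ i ∈ t, ∀ j ∈ t, i ≠ j → ∀ m : ℤ, 2 * d ≤ |x i - x j - m|) :
    ∑ i ∈ t, ∫ b in (-d)..d, g (x i + b) ≤ 3 * ∫ y in (0 : ℝ)..1, g y := by
  set z : ι → ℝ := fun i => Int.fract (x i) with hz
  have e1 : ∀ i, ∫ b in (-d)..d, g (x i + b) = ∫ y in Set.Ioo (z i - d) (z i + d), g y := by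
    intro i
    rw [← integral_Ioc_eq_integral_Ioo, ← intervalIntegral.integral_of_le (by linarith)]
    have h2 := intervalIntegral.integral_comp_add_left (a := -d) (b := d) g (z i)
    rw [← sub_eq_add_neg] at h2
    rw [← h2]
    congr 1; ext b
    have : x i + b = z i + b + (⌊x i⌋ : ℤ) * 1 := by
      have := Int.fract_add_floor (x i)
      simp only [hz]; linarith
    rw [this, hp.int_mul]
  simp_rw [e1]
  have hInt : ∀ a b : ℝ, IntegrableOn g (Set.Ioo a b) := fun a b =>
    (hg.integrableOn_Icc).mono_set Set.Ioo_subset_Icc_self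
  rw [← integral_biUnion_finset]
  · have hper : ∫ y in Set.Ioo (-1 : ℝ) 2, g y = 3 * ∫ y in (0 : ℝ)..1, g y := by
      rw [← integral_Ioc_eq_integral_Ioo, ← intervalIntegral.integral_of_le (by norm_num)]
      have h3 := hp.intervalIntegral_add_zsmul_eq 3 (-1) (fun a b => hg.intervalIntegrable a b)
      norm_num at h3
      rw [h3]
      have := hp.intervalIntegral_add_eq (-1) 0
      norm_num at this
      rw [this]
    rw [← hper]
    apply setIntegral_mono_set (hInt _ _)
    · filter_upwards with y using hg0 y
    · apply LE.le.eventuallyLE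
      intro y hy
      simp only [Set.mem_iUnion] at hy
      obtain ⟨i, _, hy⟩ := hy
      have h1 := Int.fract_nonneg (x i)
      have h2 := Int.fract_lt_one (x i)
      exact ⟨by linarith [hy.1], by linarith [hy.2]⟩
  · intro i _; exact measurableSet_Ioo
  · intro i hi j hj hij
    rw [Function.onFun, Set.disjoint_left]
    intro y hy1 hy2
    have := hsep i hi j hj hij (⌊x i⌋ - ⌊x j⌋)
    have e : x i - x j - ((⌊x i⌋ - ⌊x j⌋ : ℤ) : ℝ) = z i - z j := by
      simp only [hz, Int.fract]; push_cast; ring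
    rw [e] at this
    have h3 : |z i - z j| < 2 * d := by
      rw [abs_lt]
      constructor <;> linarith [hy1.1, hy1.2, hy2.1, hy2.2]
    linarith
  · intro i _; exact hInt _ _

/-- The residues `b < k` coprime to `k`. -/
def units (k : ℕ) : Finset ℕ := (Finset.range k).filter k.Coprime

lemma card_units (k : ℕ) : (units k).card = k.totient := by
  rw [units, Nat.totient_eq_card_coprime]

lemma sum_range_eq_sum_divisors_units {n : ℕ} (hn : 0 < n) (f : ℝ → ℂ) :
    ∑ j ∈ Finset.range n, f (j / n) = ∑ d ∈ n.divisors, ∑ b ∈ units d, f (b / d) := by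
  rw [Finset.sum_sigma']
  refine Finset.sum_bij' (fun j _ => (⟨n / n.gcd j, j / n.gcd j⟩ : (_ : ℕ) × ℕ))
    (fun x _ => n / x.1 * x.2) ?_ ?_ ?_ ?_ ?_
  · intro j hj
    have hg : 0 < n.gcd j := Nat.gcd_pos_of_pos_left _ hn
    simp only [Finset.mem_sigma, Nat.mem_divisors, units, Finset.mem_filter, Finset.mem_range] at *
    refine ⟨⟨Nat.div_dvd_of_dvd (Nat.gcd_dvd_left _ _), hn.ne'⟩, ?_, Nat.coprime_div_gcd_div_gcd hg⟩
    exact Nat.div_lt_div_of_lt_of_dvd (Nat.gcd_dvd_left _ _) hj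
  · rintro ⟨d, b⟩ h
    simp only [Finset.mem_sigma, Nat.mem_divisors, units, Finset.mem_filter, Finset.mem_range] at *
    obtain ⟨⟨⟨c, rfl⟩, _⟩, hb, _⟩ := h
    have hd : 0 < d := by omega
    have hc : 0 < c := Nat.pos_of_mul_pos_left hn
    rw [Nat.mul_div_cancel_left _ hd, mul_comm d]
    exact Nat.mul_lt_mul_of_pos_left hb hc
  · intro j hj
    simp only
    have hg : 0 < n.gcd j := Nat.gcd_pos_of_pos_left _ hn
    rw [Nat.div_div_self (Nat.gcd_dvd_left _ _) hn.ne', Nat.mul_div_cancel' (Nat.gcd_dvd_right _ _)]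
  · rintro ⟨d, b⟩ h
    simp only [Finset.mem_sigma, Nat.mem_divisors, units, Finset.mem_filter, Finset.mem_range] at *
    obtain ⟨⟨⟨c, rfl⟩, _⟩, hb, hco⟩ := h
    have hd : 0 < d := by omega
    have hc : 0 < c := Nat.pos_of_mul_pos_left hn
    rw [Nat.mul_div_cancel_left _ hd]
    have : (d * c).gcd (c * b) = c := by
      rw [mul_comm d, Nat.gcd_mul_left, hco, mul_one]
    rw [this, Nat.mul_div_cancel _ hc, Nat.mul_div_cancel_left _ hc]
  · intro j hj
    have hg : 0 < n.gcd j := Nat.gcd_pos_of_pos_left _ hn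
    simp only
    congr 1
    rw [Nat.cast_div (Nat.gcd_dvd_left _ _) (by exact_mod_cast hg.ne'),
      Nat.cast_div (Nat.gcd_dvd_right _ _) (by exact_mod_cast hg.ne')]
    have : (n : ℝ) ≠ 0 := by exact_mod_cast hn.ne'
    have : ((n.gcd j : ℕ) : ℝ) ≠ 0 := by exact_mod_cast hg.ne'
    field_simp

lemma sum_range_ex_div {n : ℕ} (hn : 0 < n) :
    ∑ j ∈ Finset.range n, ex (j / n) = if n = 1 then 1 else 0 := by
  split_ifs with h
  · subst h; simp
  · have h1 : ex (1 / n) ≠ 1 := by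
      intro h2
      obtain ⟨m, hm⟩ := ex_eq_one_iff.1 h2
      have hn' : (n : ℝ) ≠ 0 := by exact_mod_cast hn.ne'
      field_simp at hm
      have hm' : (1 : ℤ) = n * m := by exact_mod_cast hm
      have := Int.eq_one_or_neg_one_of_mul_eq_one hm'.symm
      omega
    have e : ∀ j : ℕ, ex (j / n) = ex (1 / n) ^ j := by
      intro j; rw [← ex_nat_mul]; congr 1; ring
    simp_rw [e]
    rw [geom_sum_eq h1, ← ex_nat_mul]
    have : (n : ℝ) * (1 / n) = (1 : ℕ) := by
      have hn' : (n : ℝ) ≠ 0 := by exact_mod_cast hn.ne'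
      field_simp; simp
    rw [this, ex_nat]; simp

/-- The Ramanujan sum `c_k(1)` is `μ k`. -/
lemma sum_units_ex {k : ℕ} (hk : 0 < k) :
    ∑ b ∈ units k, ex (b / k) = ArithmeticFunction.moebius k := by
  have := (ArithmeticFunction.sum_eq_iff_sum_mul_moebius_eq (R := ℂ)
    (f := fun d => ∑ b ∈ units d, ex (b / d)) (g := fun n => if n = 1 then 1 else 0)).1
    (fun n hn => by rw [← sum_range_eq_sum_divisors_units hn, sum_range_ex_div hn]) k hk
  rw [← this, Finset.sum_eq_single (k, 1)]
  · simp
  · rintro ⟨a, b⟩ h1 h2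
    rw [if_neg]; · simp
    rintro h3
    simp only at h3
    subst h3
    simp at h1
    exact h2 (by rw [h1.1])
  · intro h; simp [hk.ne'] at h

lemma sum_units_ex_mul {k n : ℕ} (hk : 0 < k) (hn : n.Coprime k) :
    ∑ b ∈ units k, ex (n * (b / k)) = ArithmeticFunction.moebius k := by
  rw [← sum_units_ex hk]
  have hk' : (k : ℝ) ≠ 0 := by exact_mod_cast hk.ne'
  refine Finset.sum_nbij (fun b => (n * b) % k) ?_ ?_ ?_ ?_
  · intro b hb
    simp only [units, Finset.mem_filter, Finset.mem_range] at *
    refine ⟨Nat.mod_lt _ hk, ?_⟩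
    rw [Nat.Coprime, Nat.gcd_comm, ← Nat.gcd_rec]
    exact Nat.Coprime.mul_right hn.symm hb.2
  · intro b hb c hc h
    simp only [units, Finset.coe_filter, Finset.mem_range, Set.mem_ofPred_eq] at *
    have : b ≡ c [MOD k] := Nat.ModEq.cancel_left_of_coprime hn.symm h
    exact Nat.ModEq.eq_of_lt_of_lt this hb.1 hc.1
  · apply Finset.surjOn_of_injOn_of_card_le _ _ _ le_rfl
    · intro b hb
      simp only [units, Finset.coe_filter, Finset.mem_range, Set.mem_ofPred_eq] at *
      refine ⟨Nat.mod_lt _ hk, ?_⟩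
      rw [Nat.Coprime, Nat.gcd_comm, ← Nat.gcd_rec]
      exact Nat.Coprime.mul_right hn.symm hb.2
    · intro b hb c hc h
      simp only [units, Finset.coe_filter, Finset.mem_range, Set.mem_ofPred_eq] at *
      have : b ≡ c [MOD k] := Nat.ModEq.cancel_left_of_coprime hn.symm h
      exact Nat.ModEq.eq_of_lt_of_lt this hb.1 hc.1
  · intro b _
    have h1 : ((n * b % k : ℕ) : ℝ) = n * b - k * ((n * b / k : ℕ) : ℝ) := by
      have := Nat.mod_add_div (n * b) k
      rw [eq_sub_iff_add_eq]; exact_mod_cast this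
    have : (n : ℝ) * (b / k) = ((n * b % k : ℕ) : ℝ) / k + (((n * b / k : ℕ) : ℤ) : ℝ) := by
      rw [h1, Int.cast_natCast]; field_simp; ring
    rw [this, ex_add_int]

lemma sum_units_expSum {s : Finset ℕ} (w : ℕ → ℝ) {k : ℕ} (hk : 0 < k)
    (hs : ∀ n ∈ s, n.Coprime k) (x : ℝ) :
    ∑ b ∈ units k, expSum s w (x + b / k) = ArithmeticFunction.moebius k * expSum s w x := by
  unfold expSum
  rw [Finset.sum_comm, Finset.mul_sum]
  refine Finset.sum_congr rfl fun n hn => ?_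
  simp_rw [mul_add, ex_add]
  rw [← sum_units_ex_mul hk (hs n hn), Finset.sum_mul]
  exact Finset.sum_congr rfl fun b _ => by ring

lemma norm_sq_expSum_le {s : Finset ℕ} (w : ℕ → ℝ) {k : ℕ} (hk : Squarefree k)
    (hs : ∀ n ∈ s, n.Coprime k) (x : ℝ) :
    ‖expSum s w x‖ ^ 2 / k.totient ≤ ∑ b ∈ units k, ‖expSum s w (x + b / k)‖ ^ 2 := by
  have hk0 : 0 < k := Nat.pos_of_ne_zero hk.ne_zero
  have hphi : (0 : ℝ) < k.totient := by exact_mod_cast Nat.totient_pos.2 hk0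
  have h1 := sum_units_expSum w hk0 hs x
  have h2 : ‖expSum s w x‖ ≤ ∑ b ∈ units k, ‖expSum s w (x + b / k)‖ := by
    have hmu : ‖(ArithmeticFunction.moebius k : ℂ)‖ = 1 := by
      rw [Complex.norm_intCast]
      exact_mod_cast (ArithmeticFunction.abs_moebius_eq_one_of_squarefree hk)
    calc ‖expSum s w x‖ = ‖∑ b ∈ units k, expSum s w (x + b / k)‖ := by
          rw [h1, norm_mul, hmu, one_mul]
      _ ≤ _ := norm_sum_le _ _
  rw [div_le_iff₀ hphi]
  calc ‖expSum s w x‖ ^ 2 ≤ (∑ b ∈ units k, ‖expSum s w (x + b / k)‖) ^ 2 := by gcongr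
    _ ≤ (units k).card * ∑ b ∈ units k, ‖expSum s w (x + b / k)‖ ^ 2 := sq_sum_le_card_mul_sum_sq
    _ = _ := by rw [card_units]; ring

lemma farey_sep {D k k' b b' : ℕ} (hD : 0 < D) (hk : 0 < k) (hk' : 0 < k') (hDk : D.Coprime k)
    (hDk' : D.Coprime k') (hb : b ∈ units k) (hb' : b' ∈ units k') {x x' : ℝ}
    (hx : x ∈ Set.Ico (0 : ℝ) 1) (hx' : x' ∈ Set.Ico (0 : ℝ) 1) {z : ℤ} (hz : D * (x - x') = z)
    (hne : ¬ (x = x' ∧ k = k' ∧ b = b')) (m : ℤ) :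
    1 ≤ (D * k * k' : ℝ) * |(x + b / k) - (x' + b' / k') - m| := by
  simp only [units, Finset.mem_filter, Finset.mem_range] at hb hb'
  have hkr : (k : ℝ) ≠ 0 := by exact_mod_cast hk.ne'
  have hkr' : (k' : ℝ) ≠ 0 := by exact_mod_cast hk'.ne'
  set y := (x + b / k) - (x' + b' / k') - m with hy
  set w : ℤ := k * k' * z + D * (b * k' - b' * k - m * k * k') with hw
  have hwy : (w : ℝ) = D * k * k' * y := by
    rw [hw, hy]
    push_cast
    rw [← hz]
    field_simp
    ring
  have hpos : (0 : ℝ) ≤ D * k * k' := by positivity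
  by_cases hw0 : w = 0
  · exfalso
    apply hne
    have h1 : ((k * k' : ℕ) : ℤ) * z = D * (b' * k - b * k' + m * k * k') := by
      push_cast; linear_combination hw0
    have h2 : ((k * k' : ℕ) : ℤ) ∣ (b' * k - b * k' + m * k * k') := by
      apply Int.dvd_of_dvd_mul_right_of_gcd_one (Dvd.intro _ h1)
      rw [Int.gcd_natCast_natCast]
      exact (Nat.Coprime.mul_right hDk hDk').symm
    have h3 : ((k * k' : ℕ) : ℤ) ∣ (b' * k - b * k') := by
      have : ((k * k' : ℕ) : ℤ) ∣ m * k * k' := ⟨m, by push_cast; ring⟩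
      have := dvd_sub h2 this
      simpa using this
    have h4 : k ∣ k' := by
      have : (k : ℤ) ∣ b * k' := by
        have h5 : (k : ℤ) ∣ b' * k - b * k' := (Dvd.intro (k' : ℤ) (by push_cast; ring)).trans h3
        have := dvd_sub (Dvd.intro_left (b' : ℤ) rfl : (k : ℤ) ∣ b' * k) h5
        simpa using this
      exact hb.2.dvd_of_dvd_mul_left (by exact_mod_cast this)
    have h4' : k' ∣ k := by
      have : (k' : ℤ) ∣ b' * k := by
        have h5 : (k' : ℤ) ∣ b' * k - b * k' := (Dvd.intro_left (k : ℤ) (by push_cast; ring)).trans h3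
        have := dvd_add h5 (Dvd.intro_left (b : ℤ) rfl : (k' : ℤ) ∣ b * k')
        simpa using this
      exact hb'.2.dvd_of_dvd_mul_left (by exact_mod_cast this)
    have hkk := Nat.dvd_antisymm h4 h4'
    subst hkk
    have h5 : (k : ℤ) ∣ (b' : ℤ) - b := by
      have : (k : ℤ) * k ∣ k * (b' - b) := by
        have e : (k : ℤ) * (b' - b) = b' * k - b * k := by ring
        rw [e]; exact_mod_cast h3
      exact (mul_dvd_mul_iff_left (by exact_mod_cast hk.ne')).1 this
    have h6 : b = b' := by
      have := Int.eq_zero_of_abs_lt_dvd h5 (by rw [abs_lt]; constructor <;> omega)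
      omega
    subst h6
    refine ⟨?_, rfl, rfl⟩
    have hy0 : y = 0 := by
      have : D * k * k * y = 0 := by rw [← hwy, hw0]; simp
      have hD' : (D : ℝ) ≠ 0 := by exact_mod_cast hD.ne'
      simpa [hD', hkr] using this
    have h7 : x - x' = m := by rw [hy] at hy0; linarith
    have h8 : m = 0 := by
      have h9 : |(m : ℝ)| < 1 := by
        rw [← h7, abs_lt]; constructor <;> linarith [hx.1, hx.2, hx'.1, hx'.2]
      exact Int.abs_lt_one_iff.1 (by exact_mod_cast h9)
    rw [h8] at h7; push_cast at h7; linarith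
  · rw [← abs_of_nonneg hpos, ← abs_mul, ← hwy]
    exact_mod_cast Int.one_le_abs hw0

/-- A large sieve inequality for sequences supported on integers coprime to the sieving moduli. -/
theorem large_sieve {s : Finset ℕ} (w : ℕ → ℝ) {K : Finset ℕ} {R : ℕ} (hK : ∀ k ∈ K, Squarefree k)
    (hKR : ∀ k ∈ K, k ≤ R) (hs : ∀ n ∈ s, ∀ k ∈ K, n.Coprime k) {T : Finset ℝ}
    (hT : ∀ x ∈ T, x ∈ Set.Ico (0 : ℝ) 1) {D : ℕ}
    (hD : ∀ x ∈ T, ∀ x' ∈ T, ∃ D' : ℕ, 0 < D' ∧ D' ≤ D ∧ (∀ k ∈ K, D'.Coprime k) ∧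
      ∃ z : ℤ, D' * (x - x') = z) {d : ℝ} (hd : 0 < d) (hd1 : d ≤ 1) (hdR : 2 * d * (D * R * R) ≤ 1) :
    (∑ k ∈ K, (k.totient : ℝ)⁻¹) * ∑ x ∈ T, ∫ b in (-d)..d, ‖expSum s w (x + b)‖ ^ 2 ≤
      3 * ∑ n ∈ s, w n ^ 2 := by
  set g : ℝ → ℝ := fun x => ‖expSum s w x‖ ^ 2 with hg
  have hgc : Continuous g := by fun_prop
  have h1 := sum_integral_le_of_separated (T ×ˢ (K.sigma units))
    (fun i : ℝ × (_ : ℕ) × ℕ => i.1 + (i.2.2 : ℝ) / i.2.1) hd hd1 hgc (fun x => by positivity)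
    (by intro x; simp only [hg, periodic_expSum s w x]) ?_
  · rw [integral_norm_sq_expSum] at h1
    refine le_trans ?_ h1
    rw [Finset.sum_product, Finset.mul_sum]
    refine Finset.sum_le_sum fun x _ => ?_
    rw [Finset.sum_sigma, Finset.sum_mul]
    refine Finset.sum_le_sum fun k hk => ?_
    simp only
    rw [← intervalIntegral.integral_const_mul, ← intervalIntegral.integral_finsetSum]
    · apply intervalIntegral.integral_mono_on (by linarith)
      · apply Continuous.intervalIntegrable; fun_prop
      · apply Continuous.intervalIntegrable; fun_prop
      · intro b _
        have := norm_sq_expSum_le w (hK k hk) (fun n hn => hs n hn k hk) (x + b)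
        rw [div_eq_inv_mul] at this
        refine this.trans (le_of_eq (Finset.sum_congr rfl fun c _ => ?_))
        simp only [hg]
        congr 3; ring
    · intro i _
      apply Continuous.intervalIntegrable; fun_prop
  · rintro ⟨x, k, b⟩ hi ⟨x', k', b'⟩ hj hij m
    simp only [Finset.mem_product, Finset.mem_sigma] at hi hj
    obtain ⟨D', hD0, hDD, hDk, z, hz⟩ := hD x hi.1 x' hj.1
    have := farey_sep hD0 (Nat.pos_of_ne_zero (hK k hi.2.1).ne_zero)
      (Nat.pos_of_ne_zero (hK k' hj.2.1).ne_zero) (hDk k hi.2.1) (hDk k' hj.2.1) hi.2.2 hj.2.2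
      (hT x hi.1) (hT x' hj.1) hz (by rintro ⟨rfl, rfl, rfl⟩; exact hij rfl) m
    simp only
    set y := |(x + b / k) - (x' + b' / k') - m|
    have h2 : (D' * k * k' : ℝ) ≤ D * R * R := by
      have := hKR k hi.2.1
      have := hKR k' hj.2.1
      gcongr
    have hy : 0 ≤ y := abs_nonneg _
    have h3 : 1 ≤ (D * R * R : ℝ) * y := this.trans (mul_le_mul_of_nonneg_right h2 hy)
    by_contra! hlt
    have h4 : 0 < (D * R * R : ℝ) := by
      by_contra! h
      nlinarith
    nlinarith

lemma sum_le_sum_of_injOn {ι κ : Type*} [DecidableEq κ] {s : Finset ι} {t : Finset κ} {f : ι → ℝ}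
    {g : κ → ℝ} (φ : ι → κ) (hm : ∀ i ∈ s, φ i ∈ t) (hi : Set.InjOn φ s)
    (hfg : ∀ i ∈ s, f i ≤ g (φ i)) (hg : ∀ j ∈ t, 0 ≤ g j) : ∑ i ∈ s, f i ≤ ∑ j ∈ t, g j :=
  calc ∑ i ∈ s, f i ≤ ∑ i ∈ s, g (φ i) := Finset.sum_le_sum hfg
    _ = ∑ j ∈ s.image φ, g j := (Finset.sum_image hi).symm
    _ ≤ _ := Finset.sum_le_sum_of_subset_of_nonneg
      (fun j hj => by obtain ⟨i, h, rfl⟩ := Finset.mem_image.1 hj; exact hm i h)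
      (fun j hj _ => hg j hj)

/-- The squarefree integers up to `R` that are coprime to `D`. -/
def sqfreeCoprime (D R : ℕ) : Finset ℕ :=
  (Finset.Icc 1 R).filter fun k => Squarefree k ∧ D.Coprime k

lemma mem_sqfreeCoprime {D R k : ℕ} :
    k ∈ sqfreeCoprime D R ↔ (1 ≤ k ∧ k ≤ R) ∧ Squarefree k ∧ D.Coprime k := by
  simp [sqfreeCoprime]

lemma log_le_two_mul_sum_squarefree (R : ℕ) :
    Real.log R ≤ 2 * ∑ k ∈ sqfreeCoprime 1 R, (k : ℝ)⁻¹ := by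
  rcases Nat.eq_zero_or_pos R with rfl | hR
  · simp [sqfreeCoprime]
  have h1 : Real.log R ≤ ∑ n ∈ Finset.Icc 1 R, (n : ℝ)⁻¹ := by
    have := log_add_one_le_harmonic R
    rw [harmonic_eq_sum_Icc] at this
    push_cast at this
    refine le_trans (Real.log_le_log (by exact_mod_cast hR) (by linarith)) this
  have h2 : ∑ n ∈ Finset.Icc 1 R, (n : ℝ)⁻¹ ≤
      ∑ x ∈ (Finset.Ioo 0 (R + 1)) ×ˢ sqfreeCoprime 1 R, ((x.1 : ℝ) ^ 2)⁻¹ * (x.2 : ℝ)⁻¹ := by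
    choose a b ha hb hab hsq using fun n : ℕ => Nat.sq_mul_squarefree_of_pos (Nat.succ_pos n)
    have key : ∀ n, 1 ≤ n → b (n - 1) ^ 2 * a (n - 1) = n := by
      intro n hn; rw [hab]; omega
    refine sum_le_sum_of_injOn (fun n => (b (n - 1), a (n - 1))) ?_ ?_ ?_ ?_
    · intro n hn
      rw [Finset.mem_Icc] at hn
      have h3 := key n hn.1
      have ha' := ha (n - 1)
      have hb' := hb (n - 1)
      simp only [Finset.mem_product, Finset.mem_Ioo, mem_sqfreeCoprime]
      refine ⟨⟨hb', ?_⟩, ⟨ha', ?_⟩, hsq _, Nat.coprime_one_left _⟩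
      · have : b (n - 1) ≤ b (n - 1) ^ 2 * a (n - 1) := by nlinarith
        omega
      · have : a (n - 1) ≤ b (n - 1) ^ 2 * a (n - 1) := Nat.le_mul_of_pos_left _ (by positivity)
        omega
    · intro n hn m hm h
      simp only [Finset.coe_Icc, Set.mem_Icc] at hn hm
      simp only [Prod.mk.injEq] at h
      rw [← key n hn.1, ← key m hm.1, h.1, h.2]
    · intro n hn
      rw [Finset.mem_Icc] at hn
      simp only
      rw [← mul_inv]
      exact le_of_eq (by congr 1; exact_mod_cast (key n hn.1).symm)
    · intro x _; positivity
  have h3 : ∑ s ∈ Finset.Ioo 0 (R + 1), ((s : ℝ) ^ 2)⁻¹ ≤ 2 := by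
    have := sum_Ioo_inv_sq_le (α := ℝ) 0 (R + 1)
    simpa using this
  rw [Finset.sum_product] at h2
  simp only at h2
  rw [← Finset.sum_mul_sum] at h2
  exact h1.trans (h2.trans (mul_le_mul_of_nonneg_right h3 (Finset.sum_nonneg fun _ _ => by positivity)))

lemma prod_primeFactors_split {k : ℕ} (hk : Squarefree k) (P : Finset ℕ) :
    (∏ p ∈ k.primeFactors ∩ P, p) * (∏ p ∈ k.primeFactors \ P, p) = k := by
  rw [Finset.prod_inter_mul_prod_sdiff, Nat.prod_primeFactors_of_squarefree hk]

lemma log_le_sum_squarefree {D : ℕ} (hD : 0 < D) (R : ℕ) :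
    Real.log R ≤ 2 * (∏ p ∈ D.primeFactors, (1 + (p : ℝ)⁻¹)) * ∑ k ∈ sqfreeCoprime D R, (k : ℝ)⁻¹ := by
  refine (log_le_two_mul_sum_squarefree R).trans ?_
  rw [mul_assoc]
  refine mul_le_mul_of_nonneg_left ?_ zero_le_two
  rw [Finset.prod_one_add, Finset.sum_mul_sum, ← Finset.sum_product']
  refine sum_le_sum_of_injOn
    (fun k => (k.primeFactors ∩ D.primeFactors, ∏ p ∈ k.primeFactors \ D.primeFactors, p)) ?_ ?_ ?_ ?_
  · intro k hk
    rw [mem_sqfreeCoprime] at hk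
    have e := prod_primeFactors_split hk.2.1 D.primeFactors
    have hpos : ∀ p ∈ k.primeFactors, 0 < p := fun p hp => (Nat.prime_of_mem_primeFactors hp).pos
    have h1 : 0 < ∏ p ∈ k.primeFactors ∩ D.primeFactors, p :=
      Finset.prod_pos fun p hp => hpos p (Finset.mem_inter.1 hp).1
    have h2 : 0 < ∏ p ∈ k.primeFactors \ D.primeFactors, p :=
      Finset.prod_pos fun p hp => hpos p (Finset.mem_sdiff.1 hp).1
    simp only [Finset.mem_product, Finset.mem_powerset, mem_sqfreeCoprime]
    refine ⟨Finset.inter_subset_right, ⟨h2, ?_⟩, ?_, ?_⟩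
    · refine le_trans ?_ hk.1.2
      conv_rhs => rw [← e]
      exact Nat.le_mul_of_pos_left _ h1
    · exact hk.2.1.squarefree_of_dvd (Dvd.intro_left _ e)
    · refine Nat.Coprime.prod_right fun p hp => ?_
      rw [Finset.mem_sdiff] at hp
      have hpp := Nat.prime_of_mem_primeFactors hp.1
      refine ((Nat.Prime.coprime_iff_not_dvd hpp).2 fun h => hp.2 ?_).symm
      exact Nat.mem_primeFactors.2 ⟨hpp, h, hD.ne'⟩
  · intro k hk l hl h
    rw [Finset.mem_coe, mem_sqfreeCoprime] at hk hl
    simp only [Prod.mk.injEq] at h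
    rw [← prod_primeFactors_split hk.2.1 D.primeFactors, ← prod_primeFactors_split hl.2.1 D.primeFactors,
      h.1, h.2]
  · intro k hk
    rw [mem_sqfreeCoprime] at hk
    simp only
    rw [Finset.prod_inv_distrib, ← mul_inv]
    have e := congrArg (Nat.cast (R := ℝ)) (prod_primeFactors_split hk.2.1 D.primeFactors)
    rw [Nat.cast_mul, Nat.cast_prod] at e
    rw [e]
  · rintro ⟨t, v⟩ _
    simp only
    positivity

lemma totient_le_self_real (k : ℕ) : (k.totient : ℝ) ≤ k := by exact_mod_cast Nat.totient_le k

lemma log_le_sum_totient {D : ℕ} (hD : 0 < D) (R : ℕ) :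
    Real.log R ≤ 2 * (∏ p ∈ D.primeFactors, (1 + (p : ℝ)⁻¹)) *
      ∑ k ∈ sqfreeCoprime D R, (k.totient : ℝ)⁻¹ := by
  refine (log_le_sum_squarefree hD R).trans (mul_le_mul_of_nonneg_left ?_ (by positivity))
  refine Finset.sum_le_sum fun k hk => ?_
  rw [mem_sqfreeCoprime] at hk
  have : (0 : ℝ) < k.totient := by exact_mod_cast Nat.totient_pos.2 hk.1.1
  exact inv_anti₀ this (totient_le_self_real k)

lemma totient_mul_prod_le {q : ℕ} : (q.totient : ℝ) * ∏ p ∈ q.primeFactors, (1 + (p : ℝ)⁻¹) ≤ q := by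
  have := Nat.totient_eq_mul_prod_factors q
  have h : (q.totient : ℝ) = q * ∏ p ∈ q.primeFactors, (1 - (p : ℝ)⁻¹) := by
    have := congrArg (fun x : ℚ => (x : ℝ)) this
    push_cast at this
    exact this
  rw [h, mul_assoc, ← Finset.prod_mul_distrib]
  have : ∏ p ∈ q.primeFactors, ((1 - (p : ℝ)⁻¹) * (1 + (p : ℝ)⁻¹)) ≤ 1 := by
    apply Finset.prod_le_one
    · intro p hp
      have : (1 : ℝ) ≤ p := by exact_mod_cast (Nat.prime_of_mem_primeFactors hp).one_le
      have := inv_le_one_of_one_le₀ this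
      have : 0 ≤ (p : ℝ)⁻¹ := by positivity
      nlinarith
    · intro p _
      nlinarith [sq_nonneg ((p : ℝ)⁻¹)]
  nlinarith [Nat.cast_nonneg (α := ℝ) q]

lemma half_le_norm_ex {y : ℝ} (hy : |y| ≤ 1 / 8) : 1 / 2 ≤ (ex y).re := by
  unfold ex
  have : (2 * Real.pi * y * I : ℂ) = ((2 * Real.pi * y : ℝ) : ℂ) * I := by push_cast; ring
  rw [this, exp_ofReal_mul_I_re]
  have h1 := Real.one_sub_sq_div_two_le_cos (x := 2 * Real.pi * y)
  have hpi := Real.pi_lt_d2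
  have hpi0 := Real.pi_pos
  have h2 : |2 * Real.pi * y| ≤ 3.15 / 4 := by
    rw [abs_mul, abs_of_pos (by positivity)]
    nlinarith [abs_nonneg y]
  have h3 := sq_le_sq' (by linarith [(abs_le.1 h2).1]) (abs_le.1 h2).2
  norm_num at h3 ⊢
  linarith

/-- The primes in `(x, x + H]` congruent to `a` modulo `q`. -/
def primesAP (x H q a : ℕ) : Finset ℕ :=
  (Finset.Ioc x (x + H)).filter fun p => p.Prime ∧ p ≡ a [MOD q]

lemma norm_expSum_primesAP {x H q a : ℕ} (hq : 0 < q) {c : ℕ} {b : ℝ} (hb : H * |b| ≤ 1 / 8) :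
    ((primesAP x H q a).card : ℝ) / 2 ≤ ‖expSum (primesAP x H q a) 1 (c / q + b)‖ := by
  have hq' : (q : ℝ) ≠ 0 := by exact_mod_cast hq.ne'
  have e : ∀ p ∈ primesAP x H q a, ex (p * (c / q + b)) = ex (a * c / q) * ex (x * b) * ex ((p - x) * b) := by
    intro p hp
    simp only [primesAP, Finset.mem_filter] at hp
    obtain ⟨m, hm⟩ := (Nat.modEq_iff_dvd.1 hp.2.2.symm)
    have hm' : (p : ℝ) = a + q * m := by
      have : (p : ℤ) = a + q * m := by linarith
      exact_mod_cast this
    have : (p : ℝ) * (c / q + b) = a * c / q + (x * b) + ((p - x) * b) + ((m * c : ℤ) : ℝ) := by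
      push_cast
      have : (p : ℝ) * (c / q + b) = p * (c / q) + p * b := by ring
      rw [this]
      nth_rw 1 [hm']
      field_simp
      ring
    rw [this, ex_add_int, ex_add, ex_add]
  unfold expSum
  have e2 : ∑ n ∈ primesAP x H q a, (((1 : ℕ → ℝ) n : ℝ) : ℂ) * ex (n * (c / q + b)) =
      ex (a * c / q) * ex (x * b) * ∑ p ∈ primesAP x H q a, ex ((p - x) * b) := by
    rw [Finset.mul_sum]
    refine Finset.sum_congr rfl fun p hp => ?_
    rw [e p hp]; simp
  rw [e2, norm_mul, norm_mul, norm_ex, norm_ex, one_mul, one_mul]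
  refine le_trans ?_ (re_le_norm _)
  rw [re_sum, div_eq_mul_one_div, ← nsmul_eq_mul]
  apply Finset.card_nsmul_le_sum
  intro p hp
  apply half_le_norm_ex
  simp only [primesAP, Finset.mem_filter, Finset.mem_Ioc] at hp
  have h1 : (x : ℝ) ≤ p := by exact_mod_cast hp.1.1.le
  have h2 : (p : ℝ) ≤ x + H := by exact_mod_cast hp.1.2
  rw [abs_mul, abs_of_nonneg (by linarith)]
  exact le_trans (mul_le_mul_of_nonneg_right (by linarith) (abs_nonneg b)) hb

set_option maxHeartbeats 1000000 in
/-- The Brun–Titchmarsh inequality (with an unspecified constant), for primes beyond the sieving level. -/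
theorem brun_titchmarsh {x H q a : ℕ} (hq : 0 < q) (hqH : q < H) (hHx : H ≤ x) :
    ((primesAP x H q a).card : ℝ) * q.totient * Real.log (H / q) ≤ 1000 * H := by
  have hq0 : (0 : ℝ) < q := by exact_mod_cast hq
  have hH0 : (0 : ℝ) < H := by exact_mod_cast hq.trans hqH
  set y : ℝ := H / q with hy
  have hy1 : 1 < y := by rw [hy, lt_div_iff₀ hq0]; simpa using (by exact_mod_cast hqH : (q : ℝ) < H)
  set R := ⌊2 * Real.sqrt y⌋₊ with hR
  have hsq : Real.sqrt y ^ 2 = y := Real.sq_sqrt (by linarith)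
  have hs1 : 1 ≤ Real.sqrt y := by rw [Real.one_le_sqrt]; exact hy1.le
  have hRle : (R : ℝ) ≤ 2 * Real.sqrt y := Nat.floor_le (by positivity)
  have hRge : Real.sqrt y ≤ R := by
    have := Nat.lt_floor_add_one (2 * Real.sqrt y)
    rw [← hR] at this
    linarith
  set A := primesAP x H q a with hA
  set cnt : ℝ := (A.card : ℝ) with hcnt
  have hRx : R ≤ x := by
    refine le_trans ?_ hHx
    by_contra! h
    have h1 : (H : ℝ) + 1 ≤ R := by exact_mod_cast h
    have h2 : (2 : ℝ) ≤ H := by exact_mod_cast (show 2 ≤ H by omega)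
    have h3 : y ≤ H := by
      rw [hy, div_le_iff₀ hq0]
      have : (1 : ℝ) ≤ q := by exact_mod_cast hq
      nlinarith
    nlinarith
  have hls := large_sieve (s := A) 1 (K := sqfreeCoprime q R) (R := R)
    (fun k hk => (mem_sqfreeCoprime.1 hk).2.1) (fun k hk => (mem_sqfreeCoprime.1 hk).1.2)
    (by
      intro p hp k hk
      rw [mem_sqfreeCoprime] at hk
      simp only [hA, primesAP, Finset.mem_filter, Finset.mem_Ioc] at hp
      rw [Nat.Prime.coprime_iff_not_dvd hp.2.1]
      intro h
      have := Nat.le_of_dvd hk.1.1 h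
      omega)
    (T := (Finset.range q).image fun c : ℕ => (c : ℝ) / q)
    (by
      intro t ht
      obtain ⟨c, hc, rfl⟩ := Finset.mem_image.1 ht
      rw [Finset.mem_range] at hc
      constructor
      · positivity
      · rw [div_lt_one hq0]; exact_mod_cast hc)
    (D := q)
    (by
      intro t ht t' ht'
      obtain ⟨c, hc, rfl⟩ := Finset.mem_image.1 ht
      obtain ⟨c', hc', rfl⟩ := Finset.mem_image.1 ht'
      refine ⟨q, hq, le_rfl, fun k hk => (mem_sqfreeCoprime.1 hk).2.2, (c : ℤ) - c', ?_⟩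
      push_cast
      field_simp)
    (d := 1 / (8 * H)) (by positivity)
    (by
      rw [div_le_one (by positivity)]
      have : (1 : ℝ) ≤ H := by exact_mod_cast (show 1 ≤ H by omega)
      linarith)
    (by
      have h1 : (R : ℝ) * R ≤ 4 * y := by nlinarith
      have h2 : (q : ℝ) * R * R ≤ 4 * H := by
        have : (q : ℝ) * y = H := by rw [hy]; field_simp
        nlinarith
      calc 2 * (1 / (8 * H)) * ((q : ℝ) * R * R) ≤ 2 * (1 / (8 * H)) * (4 * H) := by gcongr
        _ = 1 := by field_simp; norm_num)
  have hI : ∀ t ∈ (Finset.range q).image fun c : ℕ => (c : ℝ) / q,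
      cnt ^ 2 / (16 * H) ≤ ∫ b in (-(1 / (8 * H : ℝ)))..(1 / (8 * H)), ‖expSum A 1 (t + b)‖ ^ 2 := by
    intro t ht
    obtain ⟨c, hc, rfl⟩ := Finset.mem_image.1 ht
    have hle : -(1 / (8 * H : ℝ)) ≤ 1 / (8 * H) := by
      have : 0 < 1 / (8 * H : ℝ) := by positivity
      linarith
    have h1 : ∫ b in (-(1 / (8 * H : ℝ)))..(1 / (8 * H)), (cnt / 2) ^ 2 = cnt ^ 2 / (16 * H) := by
      rw [intervalIntegral.integral_const, smul_eq_mul]; field_simp; ring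
    rw [← h1]
    apply intervalIntegral.integral_mono_on hle
    · apply Continuous.intervalIntegrable; fun_prop
    · apply Continuous.intervalIntegrable; fun_prop
    · intro b hb
      have hb' : |b| ≤ 1 / (8 * H) := abs_le.2 hb
      have := norm_expSum_primesAP (x := x) (H := H) (q := q) (a := a) hq (c := c) (b := b) (by
        calc (H : ℝ) * |b| ≤ H * (1 / (8 * H)) := by gcongr
          _ = 1 / 8 := by field_simp)
      gcongr
  have hsum := Finset.card_nsmul_le_sum _ _ _ hI
  rw [Finset.card_image_of_injective _ (by
    intro c c' h
    simp only at h
    field_simp at h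
    exact_mod_cast h), Finset.card_range, nsmul_eq_mul] at hsum
  have hw : ∑ n ∈ A, ((1 : ℕ → ℝ) n) ^ 2 = cnt := by simp [hcnt]
  rw [hw] at hls
  set G := ∑ k ∈ sqfreeCoprime q R, (k.totient : ℝ)⁻¹ with hG
  have hG0 : 0 ≤ G := Finset.sum_nonneg fun _ _ => by positivity
  have hlogG := log_le_sum_totient hq R
  rw [← hG] at hlogG
  have hc0 : 0 ≤ cnt := Nat.cast_nonneg _
  have h5 : G * (q * (cnt ^ 2 / (16 * H))) ≤ 3 * cnt := (mul_le_mul_of_nonneg_left hsum hG0).trans hls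
  have h6 : G * q * cnt ≤ 48 * H := by
    rcases hc0.eq_or_lt with h | h
    · rw [← h]; simp
    · have e : G * (q * (cnt ^ 2 / (16 * H))) = cnt * (G * q * cnt) / (16 * H) := by ring
      rw [e, div_le_iff₀ (by positivity)] at h5
      have : cnt * (G * q * cnt) ≤ cnt * (48 * H) := by linarith
      exact le_of_mul_le_mul_left this h
  have h7 : Real.log y ≤ 2 * Real.log R := by
    have : Real.log y = 2 * Real.log (Real.sqrt y) := by
      rw [Real.log_sqrt (by linarith)]; ring
    rw [this]
    have := Real.log_le_log (by linarith) hRge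
    linarith
  have h8 := totient_mul_prod_le (q := q)
  set P := ∏ p ∈ q.primeFactors, (1 + (p : ℝ)⁻¹)
  calc cnt * q.totient * Real.log y ≤ cnt * q.totient * (4 * P * G) := by
        gcongr; linarith
    _ = 4 * (cnt * G) * (q.totient * P) := by ring
    _ ≤ 4 * (cnt * G) * q := by gcongr
    _ ≤ 1000 * H := by nlinarith

lemma eventually_log_pow_le (B : ℕ) (c : ℝ) {ε : ℝ} (hε : 0 < ε) :
    ∀ᶠ N : ℕ in atTop, c * Real.log N ^ B ≤ (N : ℝ) ^ ε := by
  have h := (isLittleO_log_rpow_rpow_atTop (B : ℝ) hε).bound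
    (show 0 < (|c| + 1)⁻¹ by positivity)
  filter_upwards [tendsto_natCast_atTop_atTop.eventually h, eventually_ge_atTop 1] with N hN h1
  have hl : 0 ≤ Real.log N := Real.log_nonneg (by exact_mod_cast h1)
  rw [Real.rpow_natCast, Real.norm_of_nonneg (by positivity), Real.norm_of_nonneg (by positivity),
    inv_mul_eq_div, le_div_iff₀ (by positivity)] at hN
  refine le_trans ?_ hN
  nlinarith [le_abs_self c, pow_nonneg hl B]

lemma tendsto_log_nat : Tendsto (fun N : ℕ => Real.log N) atTop atTop :=
  Real.tendsto_log_atTop.comp tendsto_natCast_atTop_atTop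

lemma sum_primes_inv_le (J : ℕ) :
    ∑ p ∈ (Finset.Icc 1 (2 ^ (J + 1))).filter Nat.Prime, (p : ℝ)⁻¹ ≤ 1 / 2 + 4 * harmonic J := by
  induction J with
  | zero =>
    have : (Finset.Icc 1 (2 ^ (0 + 1))).filter Nat.Prime = {2} := by decide
    rw [this]; simp
  | succ J ih =>
    have hsplit : (Finset.Icc 1 (2 ^ (J + 1 + 1))).filter Nat.Prime =
        (Finset.Icc 1 (2 ^ (J + 1))).filter Nat.Prime ∪
        (Finset.Ioc (2 ^ (J + 1)) (2 ^ (J + 2))).filter Nat.Prime := by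
      ext p
      have : 2 ^ (J + 1) ≤ 2 ^ (J + 2) := Nat.pow_le_pow_right (by norm_num) (by omega)
      simp only [Finset.mem_filter, Finset.mem_Icc, Finset.mem_union, Finset.mem_Ioc]
      constructor
      · rintro ⟨⟨h1, h2⟩, h3⟩
        by_cases h : p ≤ 2 ^ (J + 1)
        · exact Or.inl ⟨⟨h1, h⟩, h3⟩
        · exact Or.inr ⟨⟨by omega, h2⟩, h3⟩
      · rintro (⟨⟨h1, h2⟩, h3⟩ | ⟨⟨h1, h2⟩, h3⟩)
        · exact ⟨⟨h1, by omega⟩, h3⟩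
        · exact ⟨⟨h3.one_le, h2⟩, h3⟩
    have hb : ∑ p ∈ (Finset.Ioc (2 ^ (J + 1)) (2 ^ (J + 2))).filter Nat.Prime, (p : ℝ)⁻¹ ≤
        4 * ((J : ℝ) + 1)⁻¹ := by
      have h2 : (0 : ℝ) < Real.log 2 := Real.log_pos one_lt_two
      have hth := Chebyshev.theta_le_log4_mul_x (x := ((2 ^ (J + 2) : ℕ) : ℝ)) (by positivity)
      have hl4 : Real.log 4 = 2 * Real.log 2 := by
        rw [show (4 : ℝ) = 2 ^ 2 by norm_num, Real.log_pow]; norm_num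
      have e : ∀ p ∈ (Finset.Ioc (2 ^ (J + 1)) (2 ^ (J + 2))).filter Nat.Prime,
          (p : ℝ)⁻¹ ≤ Real.log p * ((2 : ℝ) ^ (J + 1) * ((J + 1) * Real.log 2))⁻¹ := by
        intro p hp
        simp only [Finset.mem_filter, Finset.mem_Ioc] at hp
        have hp1 : (2 : ℝ) ^ (J + 1) ≤ p := by exact_mod_cast hp.1.1.le
        have hlog : ((J : ℝ) + 1) * Real.log 2 ≤ Real.log p := by
          have := Real.log_le_log (by positivity) hp1
          rw [Real.log_pow] at this
          push_cast at this
          exact this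
        rw [← div_eq_mul_inv, le_div_iff₀ (by positivity),
          inv_mul_le_iff₀ (by linarith [pow_pos (two_pos (α := ℝ)) (J + 1)])]
        exact mul_le_mul hp1 hlog (by positivity) (by positivity)
      refine (Finset.sum_le_sum e).trans ?_
      rw [← Finset.sum_mul, ← div_eq_mul_inv, div_le_iff₀ (by positivity)]
      have : ∑ p ∈ (Finset.Ioc (2 ^ (J + 1)) (2 ^ (J + 2))).filter Nat.Prime, Real.log p ≤
          Chebyshev.theta ((2 ^ (J + 2) : ℕ) : ℝ) := by
        rw [Chebyshev.theta_eq_sum_Icc, Nat.floor_natCast]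
        refine Finset.sum_le_sum_of_subset_of_nonneg ?_ ?_
        · intro p
          simp only [Finset.mem_filter, Finset.mem_Ioc, Finset.mem_Icc]
          exact fun h => ⟨⟨Nat.zero_le _, h.1.2⟩, h.2⟩
        · intro p hp _
          exact Real.log_natCast_nonneg p
      refine this.trans (hth.trans (le_of_eq ?_))
      rw [hl4]; push_cast; field_simp; ring
    rw [hsplit, Finset.sum_union, harmonic_succ]
    · push_cast; linarith
    · rw [Finset.disjoint_left]
      intro p
      simp only [Finset.mem_filter, Finset.mem_Icc, Finset.mem_Ioc]
      omega

lemma prod_primes_le (J : ℕ) (hJ : 1 ≤ J) :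
    ∏ p ∈ (primorial (2 ^ J)).primeFactors, (1 + (p : ℝ)⁻¹) ≤ 200 * (J : ℝ) ^ 4 := by
  obtain ⟨J, rfl⟩ : ∃ k, J = k + 1 := ⟨J - 1, by omega⟩
  have e : (primorial (2 ^ (J + 1))).primeFactors = (Finset.Icc 1 (2 ^ (J + 1))).filter Nat.Prime := by
    ext p
    rw [Nat.mem_primeFactors]
    simp only [Finset.mem_filter, Finset.mem_Icc]
    constructor
    · rintro ⟨h1, h2, _⟩
      exact ⟨⟨h1.one_le, h1.dvd_primorial_iff.1 h2⟩, h1⟩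
    · rintro ⟨⟨_, h2⟩, h3⟩
      exact ⟨h3, h3.dvd_primorial_iff.2 h2, (primorial_pos _).ne'⟩
  rw [e]
  have h1 : ∏ p ∈ (Finset.Icc 1 (2 ^ (J + 1))).filter Nat.Prime, (1 + (p : ℝ)⁻¹) ≤
      Real.exp (∑ p ∈ (Finset.Icc 1 (2 ^ (J + 1))).filter Nat.Prime, (p : ℝ)⁻¹) := by
    rw [Real.exp_sum]
    refine Finset.prod_le_prod (fun p _ => by positivity) fun p _ => ?_
    linarith [Real.add_one_le_exp ((p : ℝ)⁻¹)]
  refine h1.trans ?_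
  have h2 := sum_primes_inv_le J
  have hJ0 : (0 : ℝ) < J + 1 := by positivity
  have h3 : (harmonic J : ℝ) ≤ 1 + Real.log (J + 1) := by
    have h := harmonic_le_one_add_log J
    rcases Nat.eq_zero_or_pos J with rfl | hp
    · simp
    · have : Real.log J ≤ Real.log (J + 1) := Real.log_le_log (by exact_mod_cast hp) (by linarith)
      linarith
  calc Real.exp _ ≤ Real.exp (5 + Real.log (J + 1) * 4) := Real.exp_le_exp.2 (by linarith)
    _ = Real.exp 1 ^ 5 * (J + 1) ^ 4 := by
      have h5 : Real.exp 5 = Real.exp 1 ^ 5 := by rw [← Real.exp_nat_mul]; norm_num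
      rw [Real.exp_add, Real.exp_mul, Real.exp_log hJ0, h5]; norm_cast
    _ ≤ 200 * ((J + 1 : ℕ) : ℝ) ^ 4 := by
      push_cast
      have h := Real.exp_one_lt_d9
      have : Real.exp 1 ^ 5 ≤ 2.72 ^ 5 := by
        have := Real.exp_pos 1
        gcongr; linarith
      have h6 : Real.exp 1 ^ 5 ≤ 200 := this.trans (by norm_num)
      gcongr

/-- Fractions in `[0, 1)` with denominator at most `Q`. -/
noncomputable def farey (Q : ℕ) : Finset ℝ :=
  (Finset.Icc 1 Q).biUnion fun q => (Finset.range q).image fun a : ℕ => (a : ℝ) / q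

lemma mem_farey {Q : ℕ} {x : ℝ} : x ∈ farey Q ↔ ∃ q a : ℕ, 0 < q ∧ q ≤ Q ∧ a < q ∧ x = a / q := by
  simp only [farey, Finset.mem_biUnion, Finset.mem_Icc, Finset.mem_image, Finset.mem_range]
  constructor
  · rintro ⟨q, hq, a, ha, rfl⟩; exact ⟨q, a, hq.1, hq.2, ha, rfl⟩
  · rintro ⟨q, a, h1, h2, h3, rfl⟩; exact ⟨q, ⟨h1, h2⟩, a, h3, rfl⟩

/-- The primes in `(X, Y]`. -/
def primesIoc (X Y : ℕ) : Finset ℕ := (Finset.Ioc X Y).filter Nat.Prime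

lemma mem_primesIoc {X Y p : ℕ} : p ∈ primesIoc X Y ↔ (X < p ∧ p ≤ Y) ∧ p.Prime := by
  simp [primesIoc]

lemma sum_primesIoc_log_le (X Y : ℕ) : ∑ p ∈ primesIoc X Y, Real.log p ≤ 2 * Y := by
  have h := Chebyshev.theta_le_log4_mul_x (x := (Y : ℝ)) (by positivity)
  have h4 : Real.log 4 ≤ 2 := by
    have : Real.log 4 = 2 * Real.log 2 := by
      rw [show (4 : ℝ) = 2 ^ 2 by norm_num, Real.log_pow]; norm_num
    linarith [Real.log_two_lt_d9]
  have : ∑ p ∈ primesIoc X Y, Real.log p ≤ Chebyshev.theta (Y : ℝ) := by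
    rw [Chebyshev.theta_eq_sum_Icc, Nat.floor_natCast]
    refine Finset.sum_le_sum_of_subset_of_nonneg ?_ ?_
    · intro p
      simp only [mem_primesIoc, Finset.mem_filter, Finset.mem_Icc]
      exact fun h => ⟨⟨by omega, h.1.2⟩, h.2⟩
    · intro p hp _
      exact Real.log_natCast_nonneg p
  nlinarith [Nat.cast_nonneg (α := ℝ) Y]

/-- An `L²` bound on major arcs for exponential sums over primes which is free of powers of `log N`. -/
theorem sum_integral_farey_le (B : ℕ) : ∀ᶠ N : ℕ in atTop, ∀ X Y J : ℕ, N ≤ 4 * X → Y ≤ N → 1 ≤ J →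
    (2 : ℝ) ^ J ≤ Real.log N ^ B →
    ∑ x ∈ farey (2 ^ J), ∫ b in (-((2 : ℝ) ^ J / N))..((2 : ℝ) ^ J / N),
      ‖expSum (primesIoc X Y) (fun n => Real.log n) (x + b)‖ ^ 2 ≤ 20000 * (J : ℝ) ^ 4 * N := by
  filter_upwards [eventually_log_pow_le (3 * B) 2 (ε := 1 / 2) (by norm_num),
    eventually_ge_atTop (2 ^ 16), eventually_log_pow_le B 1 (ε := 1) one_pos] with N hN1 hN2 hN3
  intro X Y J hX hY hJ hQ
  have hNr : (2 : ℝ) ^ 16 ≤ N := by exact_mod_cast hN2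
  have hN0 : (0 : ℝ) < N := lt_of_lt_of_le (by norm_num) hNr
  set Q : ℕ := 2 ^ J with hQdef
  have hQr : ((Q : ℕ) : ℝ) = 2 ^ J := by simp [hQdef]
  have hQ0 : (0 : ℝ) < 2 ^ J := by positivity
  set R := ⌊(N : ℝ) ^ (1 / 4 : ℝ)⌋₊ with hR
  have hRle : (R : ℝ) ≤ (N : ℝ) ^ (1 / 4 : ℝ) := Nat.floor_le (by positivity)
  have h16 : (16 : ℝ) ≤ (N : ℝ) ^ (1 / 4 : ℝ) := by
    have := Real.rpow_le_rpow (by norm_num) hNr (show (0 : ℝ) ≤ 1 / 4 by norm_num)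
    refine le_trans (le_of_eq ?_) this
    rw [← Real.rpow_natCast, ← Real.rpow_mul (by norm_num)]; norm_num
  have hR2 : (R : ℝ) * R ≤ (N : ℝ) ^ (1 / 2 : ℝ) := by
    calc (R : ℝ) * R ≤ (N : ℝ) ^ (1 / 4 : ℝ) * (N : ℝ) ^ (1 / 4 : ℝ) := by gcongr
      _ = _ := by rw [← Real.rpow_add hN0]; norm_num
  have hRge : (N : ℝ) ^ (1 / 8 : ℝ) ≤ R := by
    have h1 : (N : ℝ) ^ (1 / 4 : ℝ) = (N : ℝ) ^ (1 / 8 : ℝ) * (N : ℝ) ^ (1 / 8 : ℝ) := by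
      rw [← Real.rpow_add hN0]; norm_num
    have h2 : (0 : ℝ) ≤ (N : ℝ) ^ (1 / 8 : ℝ) := by positivity
    have h3 := Nat.lt_floor_add_one ((N : ℝ) ^ (1 / 4 : ℝ))
    rw [← hR] at h3
    nlinarith
  have hlogR : Real.log N / 8 ≤ Real.log R := by
    have := Real.log_le_log (by positivity) hRge
    rw [Real.log_rpow hN0] at this
    linarith
  have hlogN : 0 < Real.log N := Real.log_pos (by linarith)
  have hRX : R ≤ X := by
    have h1 : (N : ℝ) = (N : ℝ) ^ (1 / 4 : ℝ) * ((N : ℝ) ^ (1 / 4 : ℝ) * (N : ℝ) ^ (1 / 2 : ℝ)) := by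
      rw [← Real.rpow_add hN0, ← Real.rpow_add hN0]; norm_num
    have h2 : (1 : ℝ) ≤ (N : ℝ) ^ (1 / 2 : ℝ) := Real.one_le_rpow (by linarith) (by norm_num)
    have h3 : (N : ℝ) ≤ 4 * X := by exact_mod_cast hX
    have h5 : 16 * 1 ≤ (N : ℝ) ^ (1 / 4 : ℝ) * (N : ℝ) ^ (1 / 2 : ℝ) := by gcongr
    have h6 : (N : ℝ) ^ (1 / 4 : ℝ) * 16 ≤ N := by
      conv_rhs => rw [h1]
      gcongr; linarith
    have : (R : ℝ) ≤ X := by linarith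
    exact_mod_cast this
  set w : ℕ → ℝ := fun n => Real.log n with hw
  have hls := large_sieve (s := primesIoc X Y) w
    (K := sqfreeCoprime (primorial Q) R) (R := R)
    (fun k hk => (mem_sqfreeCoprime.1 hk).2.1) (fun k hk => (mem_sqfreeCoprime.1 hk).1.2)
    (by
      intro p hp k hk
      rw [mem_sqfreeCoprime] at hk
      rw [mem_primesIoc] at hp
      rw [Nat.Prime.coprime_iff_not_dvd hp.2]
      intro h
      have := Nat.le_of_dvd hk.1.1 h
      omega)
    (T := farey Q)
    (by
      intro t ht
      obtain ⟨q, a, hq, _, ha, rfl⟩ := mem_farey.1 ht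
      have hq0 : (0 : ℝ) < q := by exact_mod_cast hq
      refine ⟨by positivity, ?_⟩
      rw [div_lt_one hq0]; exact_mod_cast ha)
    (D := Q ^ 2)
    (by
      intro t ht t' ht'
      obtain ⟨q, a, hq, hqQ, ha, rfl⟩ := mem_farey.1 ht
      obtain ⟨q', a', hq', hqQ', ha', rfl⟩ := mem_farey.1 ht'
      refine ⟨q * q', by positivity, ?_, ?_, (a : ℤ) * q' - a' * q, ?_⟩
      · rw [sq]; exact Nat.mul_le_mul hqQ hqQ'
      · intro k hk
        rw [mem_sqfreeCoprime] at hk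
        have aux : ∀ m : ℕ, 0 < m → m ≤ Q → m.Coprime k := by
          intro m hm hmQ
          refine Nat.coprime_of_dvd fun p hp hpm hpk => ?_
          have := Nat.le_of_dvd hm hpm
          have hpd : p ∣ primorial Q := hp.dvd_primorial_iff.2 (by omega)
          exact Nat.not_coprime_of_dvd_of_dvd hp.one_lt hpd hpk hk.2.2
        exact Nat.Coprime.mul_left (aux q hq hqQ) (aux q' hq' hqQ')
      · have : (q : ℝ) ≠ 0 := by exact_mod_cast hq.ne'
        have : (q' : ℝ) ≠ 0 := by exact_mod_cast hq'.ne'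
        push_cast
        field_simp)
    (d := (2 : ℝ) ^ J / N) (by positivity)
    (by
      rw [div_le_one hN0]
      rw [one_mul, Real.rpow_one] at hN3
      exact hQ.trans hN3)
    (by
      push_cast
      rw [hQr]
      have h3 : 2 * ((2 : ℝ) ^ J) ^ 3 ≤ (N : ℝ) ^ (1 / 2 : ℝ) := by
        refine le_trans ?_ hN1
        rw [mul_comm 3 B, pow_mul]
        gcongr
      calc 2 * ((2 : ℝ) ^ J / N) * (((2 : ℝ) ^ J) ^ 2 * R * R)
          = (2 * ((2 : ℝ) ^ J) ^ 3) * (R * R) / N := by ring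
        _ ≤ (N : ℝ) ^ (1 / 2 : ℝ) * (N : ℝ) ^ (1 / 2 : ℝ) / N := by gcongr
        _ = 1 := by
          rw [← Real.rpow_add hN0, div_eq_one_iff_eq hN0.ne']; norm_num)
  set I₀ := ∑ x ∈ farey Q, ∫ b in (-((2 : ℝ) ^ J / N))..((2 : ℝ) ^ J / N),
      ‖expSum (primesIoc X Y) w (x + b)‖ ^ 2
  have hI0 : 0 ≤ I₀ := Finset.sum_nonneg fun x _ => by
    apply intervalIntegral.integral_nonneg
    · have : 0 ≤ (2 : ℝ) ^ J / N := by positivity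
      linarith
    · intro b _; positivity
  have hw2 : ∑ n ∈ primesIoc X Y, w n ^ 2 ≤ Real.log N * (2 * N) := by
    calc ∑ n ∈ primesIoc X Y, w n ^ 2 ≤ ∑ n ∈ primesIoc X Y, Real.log N * Real.log n := by
          refine Finset.sum_le_sum fun p hp => ?_
          rw [mem_primesIoc] at hp
          rw [sq]
          have h1 : (0 : ℝ) < p := by exact_mod_cast hp.2.pos
          have h2 : (p : ℝ) ≤ N := by exact_mod_cast hp.1.2.trans hY
          exact mul_le_mul_of_nonneg_right (Real.log_le_log h1 h2) (Real.log_natCast_nonneg p)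
      _ ≤ Real.log N * (2 * Y) := by
          rw [← Finset.mul_sum]
          exact mul_le_mul_of_nonneg_left (sum_primesIoc_log_le X Y) hlogN.le
      _ ≤ Real.log N * (2 * N) := by
          have : (Y : ℝ) ≤ N := by exact_mod_cast hY
          gcongr
  have hG := log_le_sum_totient (primorial_pos Q) R
  set G := ∑ k ∈ sqfreeCoprime (primorial Q) R, (k.totient : ℝ)⁻¹ with hGdef
  have hG0 : 0 ≤ G := Finset.sum_nonneg fun _ _ => by positivity
  have hP := prod_primes_le J hJ
  rw [← hQdef] at hP
  set P := ∏ p ∈ (primorial Q).primeFactors, (1 + (p : ℝ)⁻¹)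
  have h9 : Real.log N / 8 ≤ 400 * (J : ℝ) ^ 4 * G := by
    have : P * G ≤ 200 * (J : ℝ) ^ 4 * G := by gcongr
    linarith
  have h10 : Real.log N / 8 * I₀ ≤ Real.log N / 8 * (20000 * (J : ℝ) ^ 4 * N) := by
    calc Real.log N / 8 * I₀ ≤ 400 * (J : ℝ) ^ 4 * G * I₀ := by gcongr
      _ = 400 * (J : ℝ) ^ 4 * (G * I₀) := by ring
      _ ≤ 400 * (J : ℝ) ^ 4 * (3 * (Real.log N * (2 * N))) :=
        mul_le_mul_of_nonneg_left (hls.trans (by linarith)) (by positivity)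
      _ = Real.log N / 8 * (19200 * (J : ℝ) ^ 4 * N) := by ring
      _ ≤ _ := by gcongr; norm_num
  exact le_of_mul_le_mul_left h10 (by positivity)

end TernaryPrimes

namespace TernaryPrimes

open MeasureTheory Complex
open scoped ArithmeticFunction.Moebius ArithmeticFunction.vonMangoldt ArithmeticFunction.zeta

/-- The exponential sum over `n ≤ N` twisted by a product `f m * g n` with `m * n ≤ N`. -/
noncomputable def bilin (N : ℕ) (f g : ℕ → ℝ) (x : ℝ) : ℂ :=
  ∑ m ∈ Finset.Ioc 0 N, ∑ n ∈ Finset.Ioc 0 (N / m), (f m * g n : ℝ) * ex ((m * n : ℕ) * x)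

lemma sum_divisorsAntidiagonal_eq {M : Type*} [AddCommMonoid M] (F : ℕ → ℕ → M) (N : ℕ) :
    ∑ n ∈ Finset.Ioc 0 N, ∑ x ∈ n.divisorsAntidiagonal, F x.1 x.2 =
      ∑ m ∈ Finset.Ioc 0 N, ∑ n ∈ Finset.Ioc 0 (N / m), F m n := by
  rw [Finset.sum_sigma', Finset.sum_sigma']
  refine Finset.sum_bij' (fun x _ => ⟨x.2.1, x.2.2⟩) (fun x _ => ⟨x.1 * x.2, (x.1, x.2)⟩) ?_ ?_ ?_ ?_ ?_
  · rintro ⟨n, a, b⟩ h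
    simp only [Finset.mem_sigma, Finset.mem_Ioc, Nat.mem_divisorsAntidiagonal] at h ⊢
    obtain ⟨⟨h1, h2⟩, h3, h4⟩ := h
    have ha : 0 < a := Nat.pos_of_ne_zero (by rintro rfl; simp at h3; omega)
    have hb : 0 < b := Nat.pos_of_ne_zero (by rintro rfl; simp at h3; omega)
    refine ⟨⟨ha, ?_⟩, hb, ?_⟩
    · nlinarith
    · rw [Nat.le_div_iff_mul_le ha, mul_comm]; omega
  · rintro ⟨a, b⟩ h
    simp only [Finset.mem_sigma, Finset.mem_Ioc, Nat.mem_divisorsAntidiagonal] at h ⊢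
    obtain ⟨⟨h1, h2⟩, h3, h4⟩ := h
    rw [Nat.le_div_iff_mul_le h1, mul_comm] at h4
    exact ⟨⟨by positivity, h4⟩, trivial, by positivity⟩
  · rintro ⟨n, a, b⟩ h
    simp only [Finset.mem_sigma, Nat.mem_divisorsAntidiagonal] at h
    obtain ⟨_, rfl, _⟩ := h
    rfl
  · rintro ⟨a, b⟩ h; rfl
  · rintro ⟨n, a, b⟩ h; rfl

lemma expSum_mul (f g : ArithmeticFunction ℝ) (N : ℕ) (x : ℝ) :
    expSum (Finset.Ioc 0 N) (⇑(f * g)) x = bilin N f g x := by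
  unfold expSum bilin
  rw [← sum_divisorsAntidiagonal_eq (fun m n => ((f m * g n : ℝ) : ℂ) * ex ((m * n : ℕ) * x))]
  refine Finset.sum_congr rfl fun n _ => ?_
  rw [ArithmeticFunction.mul_apply, ofReal_sum, Finset.sum_mul]
  refine Finset.sum_congr rfl fun y hy => ?_
  rw [(Nat.mem_divisorsAntidiagonal.1 hy).1]

lemma bilin_comm (f g : ArithmeticFunction ℝ) (N : ℕ) (x : ℝ) : bilin N f g x = bilin N g f x := by
  rw [← expSum_mul, mul_comm, expSum_mul]

lemma norm_bilin_le {f g : ℕ → ℝ} (hf : ∀ n, 0 ≤ f n) (hg : ∀ n, 0 ≤ g n) (N : ℕ) (x : ℝ) :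
    ‖bilin N f g x‖ ≤ ∑ m ∈ Finset.Ioc 0 N, f m * ∑ n ∈ Finset.Ioc 0 (N / m), g n := by
  unfold bilin
  refine norm_sum_le_of_le _ fun m _ => ?_
  rw [Finset.mul_sum]
  refine norm_sum_le_of_le _ fun n _ => ?_
  rw [norm_mul, norm_ex, mul_one, norm_real, Real.norm_of_nonneg (mul_nonneg (hf m) (hg n))]

lemma norm_bilin_le_mul {f g : ℕ → ℝ} (hf : ∀ n, 0 ≤ f n) (hg : ∀ n, 0 ≤ g n) {C : ℝ} (hC : 0 ≤ C)
    (hgC : ∀ n : ℕ, ∑ i ∈ Finset.Ioc 0 n, g i ≤ C * n) (N : ℕ) (x : ℝ) :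
    ‖bilin N f g x‖ ≤ C * N * ∑ m ∈ Finset.Ioc 0 N, f m / m := by
  refine (norm_bilin_le hf hg N x).trans ?_
  rw [Finset.mul_sum]
  refine Finset.sum_le_sum fun m hm => ?_
  have hm0 : (0 : ℝ) < m := by exact_mod_cast (Finset.mem_Ioc.1 hm).1
  calc f m * _ ≤ f m * (C * (N / m)) := by
        refine mul_le_mul_of_nonneg_left ((hgC _).trans ?_) (hf m)
        exact mul_le_mul_of_nonneg_left Nat.cast_div_le hC
    _ = _ := by ring

lemma af_sub_apply (f g : ArithmeticFunction ℝ) (n : ℕ) : (f - g) n = f n - g n := by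
  rw [sub_eq_add_neg, ArithmeticFunction.add_apply, ArithmeticFunction.neg_apply, sub_eq_add_neg]

lemma pmul_log_mul (f g : ArithmeticFunction ℝ) :
    (f * g).pmul ArithmeticFunction.log = f.pmul ArithmeticFunction.log * g +
      f * g.pmul ArithmeticFunction.log := by
  ext n
  simp only [ArithmeticFunction.pmul_apply, ArithmeticFunction.mul_apply, ArithmeticFunction.add_apply,
    ArithmeticFunction.log_apply]
  rw [Finset.sum_mul, ← Finset.sum_add_distrib]
  refine Finset.sum_congr rfl fun y hy => ?_
  obtain ⟨h1, h2⟩ := Nat.mem_divisorsAntidiagonal.1 hy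
  have ha : (y.1 : ℝ) ≠ 0 := by rintro h; simp at h; simp [h] at h1; exact h2 h1.symm
  have hb : (y.2 : ℝ) ≠ 0 := by rintro h; simp at h; simp [h] at h1; exact h2 h1.symm
  rw [← h1, Nat.cast_mul, Real.log_mul ha hb]
  ring

lemma moebius_pmul_log_mul_zeta :
    ((μ : ArithmeticFunction ℝ).pmul ArithmeticFunction.log) * (ζ : ArithmeticFunction ℝ) = -Λ := by
  have h := pmul_log_mul (μ : ArithmeticFunction ℝ) (ζ : ArithmeticFunction ℝ)
  have h1 : (1 : ArithmeticFunction ℝ).pmul ArithmeticFunction.log = 0 := by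
    ext n
    by_cases hn : n = 1
    · simp [hn]
    · simp [ArithmeticFunction.one_apply_ne hn]
  have h2 : (ζ : ArithmeticFunction ℝ).pmul ArithmeticFunction.log = ArithmeticFunction.log :=
    ArithmeticFunction.zeta_pmul _
  rw [ArithmeticFunction.coe_moebius_mul_coe_zeta, h1, h2,
    ArithmeticFunction.moebius_mul_log_eq_vonMangoldt] at h
  exact eq_neg_of_add_eq_zero_left h.symm

lemma moebius_pmul_log_log_mul_zeta :
    (((μ : ArithmeticFunction ℝ).pmul ArithmeticFunction.log).pmul ArithmeticFunction.log) *
      (ζ : ArithmeticFunction ℝ) = Λ * Λ - (Λ).pmul ArithmeticFunction.log := by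
  have h := pmul_log_mul ((μ : ArithmeticFunction ℝ).pmul ArithmeticFunction.log) (ζ : ArithmeticFunction ℝ)
  have h2 : (ζ : ArithmeticFunction ℝ).pmul ArithmeticFunction.log = ArithmeticFunction.log :=
    ArithmeticFunction.zeta_pmul _
  have h3 : (μ : ArithmeticFunction ℝ).pmul ArithmeticFunction.log = -(Λ * μ) := by
    have := congrArg (· * (μ : ArithmeticFunction ℝ)) moebius_pmul_log_mul_zeta
    simp only [mul_assoc, ArithmeticFunction.coe_zeta_mul_coe_moebius, mul_one] at this
    rw [this, neg_mul]
  have h4 : (μ : ArithmeticFunction ℝ).pmul ArithmeticFunction.log * ArithmeticFunction.log = -(Λ * Λ) := by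
    rw [h3, neg_mul, mul_assoc, ArithmeticFunction.moebius_mul_log_eq_vonMangoldt]
  have h5 : (-Λ : ArithmeticFunction ℝ).pmul ArithmeticFunction.log = -(Λ).pmul ArithmeticFunction.log := by
    ext n; simp
  rw [moebius_pmul_log_mul_zeta, h2, h4, h5] at h
  have := eq_sub_of_add_eq h.symm
  rw [this]; abel

/-- Selberg's twisted divisor sum of type I. -/
noncomputable def selbergSum (N : ℕ) (x : ℝ) : ℂ :=
  bilin N (fun d => (μ d : ℝ) * Real.log (N / d) ^ 2) 1 x

lemma selbergSum_eq (N : ℕ) (x : ℝ) :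
    selbergSum N x = expSum (Finset.Ioc 0 N) (fun n => Real.log N ^ 2 * (1 : ArithmeticFunction ℝ) n +
      Real.log N * Λ n + Λ n * (Real.log N - Real.log n)) x + bilin N Λ Λ x := by
  set F : ArithmeticFunction ℝ := (Real.log N ^ 2) • (μ : ArithmeticFunction ℝ) -
    (2 * Real.log N) • (μ : ArithmeticFunction ℝ).pmul ArithmeticFunction.log +
    ((μ : ArithmeticFunction ℝ).pmul ArithmeticFunction.log).pmul ArithmeticFunction.log with hF
  have h1 : selbergSum N x = bilin N F (ζ : ArithmeticFunction ℝ) x := by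
    unfold selbergSum bilin
    refine Finset.sum_congr rfl fun m hm => Finset.sum_congr rfl fun n hn => ?_
    rw [Finset.mem_Ioc] at hm hn
    have hm0 : (m : ℝ) ≠ 0 := by exact_mod_cast hm.1.ne'
    have hN0 : (N : ℝ) ≠ 0 := by exact_mod_cast (hm.1.trans_le hm.2).ne'
    congr 2
    beta_reduce
    rw [Real.log_div hN0 hm0]
    simp [hF, ArithmeticFunction.natCoe_apply, ArithmeticFunction.zeta_apply, hn.1.ne',
      af_sub_apply]
    ring
  have h2 : F * (ζ : ArithmeticFunction ℝ) = (Real.log N ^ 2) • (1 : ArithmeticFunction ℝ) +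
      (2 * Real.log N) • Λ + (Λ * Λ - (Λ).pmul ArithmeticFunction.log) := by
    rw [hF, add_mul, sub_mul, smul_mul_assoc, smul_mul_assoc, moebius_pmul_log_mul_zeta,
      moebius_pmul_log_log_mul_zeta, ArithmeticFunction.coe_moebius_mul_coe_zeta, smul_neg, sub_neg_eq_add]
  rw [h1, ← expSum_mul, ← expSum_mul, h2]
  unfold expSum
  rw [← Finset.sum_add_distrib]
  refine Finset.sum_congr rfl fun n _ => ?_
  rw [← add_mul]
  congr 1
  simp only [ArithmeticFunction.add_apply, af_sub_apply, ArithmeticFunction.smul_map, ArithmeticFunction.pmul_apply,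
    ArithmeticFunction.log_apply, smul_eq_mul]
  push_cast
  ring

lemma bilin_sub_left (N : ℕ) (f f' g : ArithmeticFunction ℝ) (x : ℝ) :
    bilin N (⇑(f - f')) g x = bilin N f g x - bilin N f' g x := by
  unfold bilin
  rw [← Finset.sum_sub_distrib]
  refine Finset.sum_congr rfl fun m _ => ?_
  rw [← Finset.sum_sub_distrib]
  refine Finset.sum_congr rfl fun n _ => ?_
  rw [af_sub_apply]; push_cast; ring

/-- The function `log` restricted to primes. -/
noncomputable def primeLog : ArithmeticFunction ℝ :=
  ⟨fun n => if n.Prime then Real.log n else 0, by simp⟩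

lemma primeLog_apply (n : ℕ) : primeLog n = if n.Prime then Real.log n else 0 := rfl

lemma primeLog_nonneg (n : ℕ) : 0 ≤ primeLog n := by
  rw [primeLog_apply]; split_ifs <;> positivity

lemma primeLog_le (n : ℕ) : primeLog n ≤ Λ n := by
  rw [primeLog_apply]
  split_ifs with h
  · rw [ArithmeticFunction.vonMangoldt_apply_prime h]
  · exact ArithmeticFunction.vonMangoldt_nonneg

lemma expSum_primeLog (X Y : ℕ) (x : ℝ) :
    expSum (Finset.Ioc X Y) primeLog x = expSum (primesIoc X Y) (fun n => Real.log n) x := by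
  unfold expSum primesIoc
  rw [Finset.sum_filter]
  refine Finset.sum_congr rfl fun n _ => ?_
  rw [primeLog_apply]; split_ifs <;> simp

lemma sum_vonMangoldt_eq (n : ℕ) : ∑ i ∈ Finset.Ioc 0 n, Λ i = Chebyshev.psi n := by
  rw [Chebyshev.psi, Nat.floor_natCast]

lemma sum_primeLog_eq (n : ℕ) : ∑ i ∈ Finset.Ioc 0 n, primeLog i = Chebyshev.theta n := by
  rw [Chebyshev.theta, Nat.floor_natCast, Finset.sum_filter]
  rfl

lemma sum_vonMangoldt_le (n : ℕ) : ∑ i ∈ Finset.Ioc 0 n, Λ i ≤ 6 * n := by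
  rw [sum_vonMangoldt_eq]
  refine (Chebyshev.psi_le_const_mul_self n.cast_nonneg).trans ?_
  have : Real.log 4 ≤ 2 := by
    rw [show (4 : ℝ) = 2 ^ 2 by norm_num, Real.log_pow]
    have := Real.log_two_lt_d9
    push_cast; linarith
  gcongr; linarith

lemma sum_primeLog_le (n : ℕ) : ∑ i ∈ Finset.Ioc 0 n, primeLog i ≤ 6 * n :=
  (Finset.sum_le_sum fun i _ => primeLog_le i).trans (sum_vonMangoldt_le n)

lemma exists_sum_prime_powers_le :
    ∃ K : ℝ, 0 ≤ K ∧ ∀ n : ℕ, ∑ i ∈ Finset.Ioc 0 n, (Λ - primeLog) i ≤ K * √n := by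
  obtain ⟨K, hK⟩ := Chebyshev.psi_sub_theta_le_mul_sqrt
  refine ⟨|K|, abs_nonneg K, fun n => ?_⟩
  simp only [af_sub_apply, Finset.sum_sub_distrib, sum_vonMangoldt_eq, sum_primeLog_eq]
  exact (hK n).trans (mul_le_mul_of_nonneg_right (le_abs_self K) (Real.sqrt_nonneg _))

lemma sum_div_le {g : ℕ → ℝ} {h φ : ℕ → ℝ} (hg : ∀ n, ∑ i ∈ Finset.Ioc 0 n, g i ≤ h n)
    (h0 : 0 ≤ φ 0) (hφ : ∀ n : ℕ, h (n + 1) / ((n + 1) * (n + 2)) ≤ φ (n + 1) - φ n) (N : ℕ) :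
    ∑ m ∈ Finset.Ioc 0 N, g m / m ≤ h N / (N + 1) + φ N := by
  have key : ∑ m ∈ Finset.Ioc 0 N, g m / m ≤ (∑ i ∈ Finset.Ioc 0 N, g i) / (N + 1) + φ N := by
    induction N with
    | zero => simpa using h0
    | succ n ih =>
      have e := hg (n + 1)
      rw [Finset.sum_Ioc_succ_top (Nat.zero_le n)] at e ⊢
      rw [Finset.sum_Ioc_succ_top (Nat.zero_le n)]
      have h1 := hφ n
      have h2 : (∑ i ∈ Finset.Ioc 0 n, g i + g (n + 1)) / (((n : ℝ) + 1) * (n + 2)) ≤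
        h (n + 1) / ((n + 1) * (n + 2)) := by gcongr
      have h3 : (∑ i ∈ Finset.Ioc 0 n, g i + g (n + 1)) / (((n : ℝ) + 1) * (n + 2)) =
          (∑ i ∈ Finset.Ioc 0 n, g i) / (n + 1) + g (n + 1) / (n + 1) -
          (∑ i ∈ Finset.Ioc 0 n, g i + g (n + 1)) / (n + 2) := by
        field_simp; ring
      push_cast
      have h4 : (n : ℝ) + 1 + 1 = n + 2 := by ring
      rw [h4]
      linarith
  refine key.trans ?_
  gcongr
  exact hg N

lemma sum_vonMangoldt_div_le (N : ℕ) :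
    ∑ m ∈ Finset.Ioc 0 N, Λ m / m ≤ 6 + 6 * Real.log (N + 1) := by
  have := sum_div_le (g := Λ) (h := fun n => 6 * n) (φ := fun n => 6 * Real.log (n + 1))
    sum_vonMangoldt_le (by simp) (fun n => ?_) N
  · refine this.trans ?_
    have : 6 * (N : ℝ) / (N + 1) ≤ 6 := by
      rw [div_le_iff₀ (by positivity)]; linarith
    linarith
  · push_cast
    have h1 : (0 : ℝ) < n + 1 := by positivity
    have h2 : (0 : ℝ) < n + 1 + 1 := by positivity
    rw [← mul_sub, ← Real.log_div h2.ne' h1.ne']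
    have h3 := Real.one_sub_inv_le_log_of_pos (div_pos h2 h1)
    have h4 : 6 * ((n : ℝ) + 1) / ((n + 1) * (n + 2)) = 6 * (1 - ((n + 1 + 1) / (n + 1) : ℝ)⁻¹) := by
      field_simp; ring
    rw [h4]
    linarith

lemma exists_sum_prime_powers_div_le :
    ∃ K : ℝ, 0 ≤ K ∧ ∀ N : ℕ, ∑ m ∈ Finset.Ioc 0 N, (Λ - primeLog) m / m ≤ K := by
  obtain ⟨K, hK0, hK⟩ := exists_sum_prime_powers_le
  refine ⟨5 * K, by positivity, fun N => ?_⟩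
  have := sum_div_le (h := fun n => K * √n) (φ := fun n => K * (4 - 2 / √(n + 1 : ℝ)))
    hK (by simp; nlinarith) (fun n => ?_) N
  · refine this.trans ?_
    have h1 : K * √(N : ℝ) / (N + 1) ≤ K := by
      rw [div_le_iff₀ (by positivity)]
      refine mul_le_mul_of_nonneg_left ?_ hK0
      nlinarith [Real.sq_sqrt (Nat.cast_nonneg (α := ℝ) N), Real.sqrt_nonneg (N : ℝ), sq_nonneg (√(N : ℝ) - 1)]
    have h2 : 0 ≤ 2 / √(N + 1 : ℝ) := by positivity
    nlinarith
  · push_cast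
    have ha : 0 < √(n + 1 : ℝ) := by positivity
    have hb : 0 < √(n + 1 + 1 : ℝ) := by positivity
    have ha2 := Real.sq_sqrt (show (0 : ℝ) ≤ n + 1 by positivity)
    have hb2 := Real.sq_sqrt (show (0 : ℝ) ≤ n + 1 + 1 by positivity)
    have hab : √(n + 1 : ℝ) ≤ √(n + 1 + 1 : ℝ) := Real.sqrt_le_sqrt (by linarith)
    set a := √(n + 1 : ℝ)
    set b := √(n + 1 + 1 : ℝ)
    have e1 : ((n : ℝ) + 1) * (n + 2) = a ^ 2 * b ^ 2 := by rw [ha2, hb2]; ring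
    rw [e1, ← mul_sub, mul_div_assoc]
    refine mul_le_mul_of_nonneg_left ?_ hK0
    have e2 : 4 - 2 / b - (4 - 2 / a) = 2 * (b - a) / (a * b) := by field_simp; ring
    rw [e2, div_le_div_iff₀ (by positivity) (by positivity)]
    have e3 : b ^ 2 - a ^ 2 = 1 := by rw [ha2, hb2]; ring
    have e4 : (b - a) * (2 * b) ≥ 1 := by nlinarith
    have : a * (a * b) * 1 ≤ a * (a * b) * ((b - a) * (2 * b)) := by gcongr
    nlinarith

lemma sum_vonMangoldt_mul_log_le (N : ℕ) :
    ∑ n ∈ Finset.Ioc 0 N, Λ n * (Real.log N - Real.log n) ≤ 6 * N := by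
  induction N with
  | zero => simp
  | succ n ih =>
    rw [Finset.sum_Ioc_succ_top (Nat.zero_le n), sub_self, mul_zero, add_zero]
    rcases Nat.eq_zero_or_pos n with rfl | hn
    · simp
    have hn' : (0 : ℝ) < n := by exact_mod_cast hn
    have h1 : ∑ i ∈ Finset.Ioc 0 n, Λ i * (Real.log (n + 1 : ℕ) - Real.log i) =
        ∑ i ∈ Finset.Ioc 0 n, Λ i * (Real.log n - Real.log i) +
        (∑ i ∈ Finset.Ioc 0 n, Λ i) * (Real.log (n + 1 : ℕ) - Real.log n) := by
      rw [Finset.sum_mul, ← Finset.sum_add_distrib]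
      refine Finset.sum_congr rfl fun i _ => by ring
    have h2 : Real.log (n + 1 : ℕ) - Real.log n ≤ 1 / n := by
      rw [← Real.log_div (by positivity) hn'.ne']
      refine (Real.log_le_sub_one_of_pos (by positivity)).trans (le_of_eq ?_)
      push_cast; field_simp; ring
    have h3 : (∑ i ∈ Finset.Ioc 0 n, Λ i) * (Real.log (n + 1 : ℕ) - Real.log n) ≤ 6 * n * (1 / n) := by
      refine mul_le_mul (sum_vonMangoldt_le n) h2 ?_ (by positivity)
      rw [sub_nonneg]
      exact Real.log_le_log hn' (by push_cast; linarith)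
    rw [h1]
    have h4 : 6 * (n : ℝ) * (1 / n) = 6 := by field_simp
    have h5 : ((n + 1 : ℕ) : ℝ) = n + 1 := by push_cast; rfl
    linarith

lemma log_le_two_sqrt (N : ℕ) : Real.log N ≤ 2 * √N := by
  rcases Nat.eq_zero_or_pos N with rfl | hN
  · simp
  have h := Real.log_le_sub_one_of_pos (Real.sqrt_pos.2 (Nat.cast_pos.2 hN : (0 : ℝ) < N))
  rw [Real.log_sqrt N.cast_nonneg] at h
  linarith

lemma selbergSum_eq' {N : ℕ} (hN : 0 < N) (x : ℝ) :
    selbergSum N x = Real.log N ^ 2 * ex x + Real.log N * expSum (Finset.Ioc 0 N) Λ x +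
      expSum (Finset.Ioc 0 N) (fun n => Λ n * (Real.log N - Real.log n)) x + bilin N Λ Λ x := by
  rw [selbergSum_eq]
  congr 1
  have h1 : (Real.log N ^ 2 * ex x : ℂ) =
      ∑ n ∈ Finset.Ioc 0 N, ((Real.log N ^ 2 * (1 : ArithmeticFunction ℝ) n : ℝ) : ℂ) * ex (n * x) := by
    rw [Finset.sum_eq_single_of_mem 1 (by simp; omega)]
    · simp
    · intro b _ hb
      simp [ArithmeticFunction.one_apply_ne hb]
  unfold expSum
  rw [h1, Finset.mul_sum, ← Finset.sum_add_distrib, ← Finset.sum_add_distrib]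
  refine Finset.sum_congr rfl fun n _ => ?_
  push_cast; ring

lemma norm_selbergSum_le {N : ℕ} (hN : 2 ≤ N) (x : ℝ) :
    ‖selbergSum N x‖ ≤ 200 * N * Real.log N := by
  have hN0 : (0 : ℝ) ≤ N := N.cast_nonneg
  have hN2 : (2 : ℝ) ≤ N := by exact_mod_cast hN
  have hL : 0.69 ≤ Real.log N := by
    have := Real.log_two_gt_d9
    have h := Real.log_le_log (by norm_num) hN2
    linarith
  have hL0 : 0 ≤ Real.log N := by linarith
  have hLN : Real.log N ≤ N := (Real.log_le_sub_one_of_pos (by linarith)).trans (by linarith)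
  have hlog1 : Real.log (N + 1) ≤ 2 * Real.log N := by
    rw [← Real.log_rpow (by linarith)]
    refine Real.log_le_log (by positivity) ?_
    norm_cast; nlinarith
  rw [selbergSum_eq' (by omega)]
  have h1 : ‖(Real.log N ^ 2 * ex x : ℂ)‖ ≤ N * Real.log N := by
    rw [norm_mul, norm_ex, mul_one, norm_pow, norm_real, Real.norm_of_nonneg hL0]
    nlinarith
  have h2 : ‖(Real.log N * expSum (Finset.Ioc 0 N) Λ x : ℂ)‖ ≤ 6 * N * Real.log N := by
    rw [norm_mul, norm_real, Real.norm_of_nonneg hL0, mul_comm]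
    refine mul_le_mul_of_nonneg_right ?_ hL0
    exact (norm_expSum_le _ (fun n _ => ArithmeticFunction.vonMangoldt_nonneg) x).trans (sum_vonMangoldt_le N)
  have h3 : ‖expSum (Finset.Ioc 0 N) (fun n => Λ n * (Real.log N - Real.log n)) x‖ ≤ 6 * N := by
    refine (norm_expSum_le _ (fun n hn => ?_) x).trans (sum_vonMangoldt_mul_log_le N)
    rw [Finset.mem_Ioc] at hn
    refine mul_nonneg ArithmeticFunction.vonMangoldt_nonneg (sub_nonneg.2 ?_)
    exact Real.log_le_log (by exact_mod_cast hn.1) (by exact_mod_cast hn.2)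
  have h4 : ‖bilin N Λ Λ x‖ ≤ 6 * N * (6 + 6 * (2 * Real.log N)) := by
    refine (norm_bilin_le_mul (fun n => ArithmeticFunction.vonMangoldt_nonneg)
      (fun n => ArithmeticFunction.vonMangoldt_nonneg) (by norm_num) sum_vonMangoldt_le N x).trans ?_
    gcongr
    refine (sum_vonMangoldt_div_le N).trans ?_
    gcongr
  refine (norm_add_le _ _).trans ((add_le_add (norm_add₃_le) le_rfl).trans ?_)
  nlinarith

lemma exists_selberg_approx : ∃ C : ℝ, 0 ≤ C ∧ ∀ N : ℕ, 2 ≤ N → ∀ x : ℝ,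
    ‖Real.log N * expSum (primesIoc 0 N) (fun n => Real.log n) x - selbergSum N x +
      bilin N primeLog primeLog x‖ ≤ C * N := by
  obtain ⟨K, hK0, hK⟩ := exists_sum_prime_powers_le
  obtain ⟨K', hK'0, hK'⟩ := exists_sum_prime_powers_div_le
  have hd : ∀ n, 0 ≤ (Λ - primeLog) n := fun n => by
    rw [af_sub_apply]; exact sub_nonneg.2 (primeLog_le n)
  refine ⟨4 + 2 * K + 6 + 6 * K' + 6 * K', by positivity, fun N hN x => ?_⟩
  have hN0 : (0 : ℝ) ≤ N := N.cast_nonneg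
  have hL0 : 0 ≤ Real.log N := Real.log_natCast_nonneg N
  have hsq := Real.sq_sqrt hN0
  have hls := log_le_two_sqrt N
  have h1 : ‖(Real.log N ^ 2 * ex x : ℂ)‖ ≤ 4 * N := by
    rw [norm_mul, norm_ex, mul_one, norm_pow, norm_real, Real.norm_of_nonneg hL0]
    nlinarith [Real.sqrt_nonneg (N : ℝ)]
  have h2 : ‖(Real.log N * (expSum (Finset.Ioc 0 N) (⇑(Λ - primeLog)) x) : ℂ)‖ ≤ 2 * K * N := by
    rw [norm_mul, norm_real, Real.norm_of_nonneg hL0]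
    calc _ ≤ 2 * √N * (K * √N) := by
          gcongr
          exact (norm_expSum_le _ (fun n _ => hd n) x).trans (hK N)
      _ = 2 * K * (√(N : ℝ)) ^ 2 := by ring
      _ = _ := by rw [hsq]
  have h3 : ‖expSum (Finset.Ioc 0 N) (fun n => Λ n * (Real.log N - Real.log n)) x‖ ≤ 6 * N := by
    refine (norm_expSum_le _ (fun n hn => ?_) x).trans (sum_vonMangoldt_mul_log_le N)
    rw [Finset.mem_Ioc] at hn
    refine mul_nonneg ArithmeticFunction.vonMangoldt_nonneg (sub_nonneg.2 ?_)
    exact Real.log_le_log (by exact_mod_cast hn.1) (by exact_mod_cast hn.2)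
  have h4 : ‖bilin N (⇑(Λ - primeLog)) Λ x‖ ≤ 6 * K' * N := by
    refine (norm_bilin_le_mul hd
      (fun n => ArithmeticFunction.vonMangoldt_nonneg) (by norm_num) sum_vonMangoldt_le N x).trans ?_
    have := mul_le_mul_of_nonneg_left (hK' N) (show (0 : ℝ) ≤ 6 * N by positivity)
    linarith
  have h5 : ‖bilin N (⇑(Λ - primeLog)) primeLog x‖ ≤ 6 * K' * N := by
    refine (norm_bilin_le_mul hd primeLog_nonneg (by norm_num) sum_primeLog_le N x).trans ?_
    have := mul_le_mul_of_nonneg_left (hK' N) (show (0 : ℝ) ≤ 6 * N by positivity)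
    linarith
  have e1 : expSum (Finset.Ioc 0 N) (⇑(Λ - primeLog)) x =
      expSum (Finset.Ioc 0 N) Λ x - expSum (Finset.Ioc 0 N) primeLog x := by
    unfold expSum
    rw [← Finset.sum_sub_distrib]
    refine Finset.sum_congr rfl fun n _ => ?_
    rw [af_sub_apply]; push_cast; ring
  have e2 := bilin_sub_left N Λ primeLog Λ x
  have e3 := bilin_sub_left N Λ primeLog primeLog x
  rw [bilin_comm Λ primeLog] at e3
  rw [selbergSum_eq' (by omega), ← expSum_primeLog]
  have key : Real.log N * expSum (Finset.Ioc 0 N) primeLog x -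
      (Real.log N ^ 2 * ex x + Real.log N * expSum (Finset.Ioc 0 N) Λ x +
      expSum (Finset.Ioc 0 N) (fun n => Λ n * (Real.log N - Real.log n)) x + bilin N Λ Λ x) +
      bilin N primeLog primeLog x =
      -((Real.log N ^ 2 * ex x + Real.log N * expSum (Finset.Ioc 0 N) (⇑(Λ - primeLog)) x +
      expSum (Finset.Ioc 0 N) (fun n => Λ n * (Real.log N - Real.log n)) x) +
      bilin N (⇑(Λ - primeLog)) Λ x + bilin N (⇑(Λ - primeLog)) primeLog x) := by
    rw [e1, e2, e3]; ring
  rw [key, norm_neg]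
  refine (norm_add₃_le).trans ((add_le_add (add_le_add (norm_add₃_le) le_rfl) le_rfl).trans ?_)
  linarith

lemma norm_ex_sub_le (y z : ℝ) : ‖ex y - ex z‖ ≤ 7 * |y - z| := by
  have h1 : ex y - ex z = ex z * (exp (I * ((2 * Real.pi * (y - z) : ℝ) : ℂ)) - 1) := by
    have : ex y = ex z * ex (y - z) := by rw [← ex_add]; congr 1; ring
    rw [this, mul_sub, mul_one]
    unfold ex
    congr 3; push_cast; ring
  rw [h1, norm_mul, norm_ex, one_mul]
  refine Real.norm_exp_I_mul_ofReal_sub_one_le.trans ?_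
  rw [Real.norm_eq_abs, abs_mul, abs_of_pos (by positivity)]
  have := Real.pi_lt_d2
  gcongr
  linarith

lemma le_norm_ex_sub_one {θ δ : ℝ} (h : ∀ k : ℤ, δ ≤ |θ - k|) : 4 * δ ≤ ‖ex θ - 1‖ := by
  set t := θ - round θ with ht
  have h1 : ex θ = exp (I * ((2 * Real.pi * t : ℝ) : ℂ)) := by
    have : ex θ = ex t := by
      rw [← ex_add_int t (round θ)]; congr 1; rw [ht]; ring
    rw [this]; unfold ex; congr 1; push_cast; ring
  have h2 : |t| ≤ 1 / 2 := abs_sub_round θ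
  have hpi := Real.pi_pos
  have h3 : |Real.pi * t| ≤ Real.pi / 2 := by
    rw [abs_mul, abs_of_pos hpi]; nlinarith
  have h4 := Real.mul_abs_le_abs_sin h3
  rw [h1, norm_exp_I_mul_ofReal_sub_one, show 2 * Real.pi * t / 2 = Real.pi * t by ring, norm_mul,
    Real.norm_eq_abs, Real.norm_eq_abs, abs_two]
  rw [abs_mul, abs_of_pos hpi] at h4
  have h5 : 2 / Real.pi * (Real.pi * |t|) = 2 * |t| := by field_simp
  have := h (round θ)
  linarith

lemma norm_sum_ex_le {θ δ : ℝ} (hδ : 0 < δ) (h : ∀ k : ℤ, δ ≤ |θ - k|) (a b : ℕ) :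
    ‖∑ n ∈ Finset.Ioc a b, ex (n * θ)‖ ≤ 1 / (2 * δ) := by
  rcases le_or_gt b a with hab | hab
  · rw [Finset.Ioc_eq_empty (by omega)]; simp [hδ.le]
  have h1 := le_norm_ex_sub_one h
  have h2 : (ex θ - 1) * ∑ n ∈ Finset.Ioc a b, ex (n * θ) = ex ((b + 1 : ℕ) * θ) - ex ((a + 1 : ℕ) * θ) := by
    induction b, hab using Nat.le_induction with
    | base =>
      have : Finset.Ioc a (a + 1) = {a + 1} := by ext; simp
      rw [Nat.succ_eq_add_one, this]
      simp only [Finset.sum_singleton, ex_nat_mul]; ring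
    | succ n hn ih =>
      rw [Finset.sum_Ioc_succ_top (by omega), mul_add, ih]
      simp only [ex_nat_mul]; ring
  have h3 : ‖ex θ - 1‖ * ‖∑ n ∈ Finset.Ioc a b, ex (n * θ)‖ ≤ 2 := by
    rw [← norm_mul, h2]
    refine (norm_sub_le _ _).trans ?_
    rw [norm_ex, norm_ex]; norm_num
  rw [le_div_iff₀ (by positivity)]
  nlinarith [norm_nonneg (∑ n ∈ Finset.Ioc a b, ex (n * θ))]

lemma norm_mul_sum_ex_sub_le (d K : ℕ) (β : ℝ) :
    ‖d * ∑ n ∈ Finset.Ioc 0 K, ex ((d * n : ℕ) * β) - ∑ m ∈ Finset.Ioc 0 (d * K), ex (m * β)‖ ≤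
      K * (d * (7 * (d * |β|))) := by
  induction K with
  | zero => simp
  | succ K ih =>
    rw [Finset.sum_Ioc_succ_top (Nat.zero_le K),
      ← Finset.sum_Ioc_consecutive _ (Nat.zero_le (d * K)) (Nat.mul_le_mul_left d (Nat.le_succ K))]
    have h1 : ‖d * ex ((d * (K + 1) : ℕ) * β) - ∑ m ∈ Finset.Ioc (d * K) (d * (K + 1)), ex (m * β)‖ ≤
        d * (7 * (d * |β|)) := by
      have hc : (Finset.Ioc (d * K) (d * (K + 1))).card = d := by
        rw [Nat.card_Ioc, mul_add, mul_one, Nat.add_sub_cancel_left]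
      have e1 : (d : ℂ) * ex ((d * (K + 1) : ℕ) * β) =
          ∑ m ∈ Finset.Ioc (d * K) (d * (K + 1)), ex ((d * (K + 1) : ℕ) * β) := by
        rw [Finset.sum_const, hc, nsmul_eq_mul]
      rw [e1, ← Finset.sum_sub_distrib]
      refine (norm_sum_le_of_le (f := fun m : ℕ => ex ((d * (K + 1) : ℕ) * β) - ex (m * β))
        (n := fun _ => 7 * (d * |β|)) _ fun m hm => ?_).trans ?_
      · refine (norm_ex_sub_le _ _).trans ?_
        rw [Finset.mem_Ioc] at hm
        rw [← sub_mul, abs_mul]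
        gcongr
        have h2 : (m : ℝ) ≤ (d * (K + 1) : ℕ) := by exact_mod_cast hm.2
        have h3 : (d * K : ℕ) ≤ (m : ℝ) := by exact_mod_cast hm.1.le
        rw [abs_of_nonneg (by linarith)]
        push_cast at *
        linarith
      · rw [Finset.sum_const, hc, nsmul_eq_mul]
    calc _ = ‖(d * ∑ n ∈ Finset.Ioc 0 K, ex ((d * n : ℕ) * β) - ∑ m ∈ Finset.Ioc 0 (d * K), ex (m * β)) +
          (d * ex ((d * (K + 1) : ℕ) * β) - ∑ m ∈ Finset.Ioc (d * K) (d * (K + 1)), ex (m * β))‖ := by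
          congr 1; ring
      _ ≤ _ := (norm_add_le _ _).trans (add_le_add ih h1)
      _ = _ := by push_cast; ring

lemma norm_sum_ex_sub_le {d N : ℕ} (hd : 0 < d) (β : ℝ) :
    ‖∑ n ∈ Finset.Ioc 0 (N / d), ex ((d * n : ℕ) * β) - (d : ℂ)⁻¹ * ∑ m ∈ Finset.Ioc 0 N, ex (m * β)‖ ≤
      7 * (N * |β|) + 1 := by
  have hd' : (0 : ℝ) < d := by exact_mod_cast hd
  have hdc : (d : ℂ) ≠ 0 := by exact_mod_cast hd.ne'
  have h1 := norm_mul_sum_ex_sub_le d (N / d) β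
  have hle : d * (N / d) ≤ N := Nat.mul_div_le N d
  have h2 : ‖∑ m ∈ Finset.Ioc (d * (N / d)) N, ex (m * β)‖ ≤ d := by
    refine (norm_sum_le_of_le (n := fun _ => 1) _ fun m _ => (norm_ex _).le).trans ?_
    rw [Finset.sum_const, Nat.card_Ioc, nsmul_eq_mul, mul_one]
    have := Nat.mod_lt N hd
    have := Nat.div_add_mod N d
    exact_mod_cast (by omega : N - d * (N / d) ≤ d)
  have h3 : ((N / d : ℕ) : ℝ) * d ≤ N := by rw [mul_comm]; exact_mod_cast hle
  have h4 : (d : ℝ) * ‖∑ n ∈ Finset.Ioc 0 (N / d), ex ((d * n : ℕ) * β) -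
      (d : ℂ)⁻¹ * ∑ m ∈ Finset.Ioc 0 N, ex (m * β)‖ ≤ d * (7 * (N * |β|) + 1) := by
    have e1 : (d : ℂ) * (∑ n ∈ Finset.Ioc 0 (N / d), ex ((d * n : ℕ) * β) -
        (d : ℂ)⁻¹ * ∑ m ∈ Finset.Ioc 0 N, ex (m * β)) =
        (d * ∑ n ∈ Finset.Ioc 0 (N / d), ex ((d * n : ℕ) * β) -
          ∑ m ∈ Finset.Ioc 0 (d * (N / d)), ex (m * β)) - ∑ m ∈ Finset.Ioc (d * (N / d)) N, ex (m * β) := by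
      rw [mul_sub, mul_inv_cancel_left₀ hdc, sub_sub,
        Finset.sum_Ioc_consecutive _ (Nat.zero_le _) hle]
    rw [← norm_natCast (α := ℂ) d, ← norm_mul, e1, norm_natCast]
    refine (norm_sub_le _ _).trans ((add_le_add h1 h2).trans ?_)
    have : ((N / d : ℕ) : ℝ) * (d * (7 * (d * |β|))) ≤ N * (7 * (d * |β|)) := by
      rw [← mul_assoc]; gcongr
    linarith
  exact le_of_mul_le_mul_left h4 hd'

lemma sum_Ioc_inv_le {D N : ℕ} (hD : 0 < D) (hDN : D ≤ N) :
    ∑ d ∈ Finset.Ioc D N, (1 / d : ℝ) ≤ Real.log (N / D) := by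
  have hD' : (0 : ℝ) < D := by exact_mod_cast hD
  induction N, hDN using Nat.le_induction with
  | base => simp [hD'.ne']
  | succ n hn ih =>
    rw [Finset.sum_Ioc_succ_top hn]
    have hn' : (0 : ℝ) < n := by exact_mod_cast hD.trans_le hn
    have hn1 : (0 : ℝ) < (n + 1 : ℕ) := by positivity
    have h := Real.one_sub_inv_le_log_of_pos (div_pos hn1 hn')
    rw [Real.log_div hn1.ne' hn'.ne'] at h
    rw [Real.log_div hn'.ne' hD'.ne'] at ih
    rw [Real.log_div hn1.ne' hD'.ne']
    have : (1 / (n + 1 : ℕ) : ℝ) = 1 - ((n + 1 : ℕ) / n : ℝ)⁻¹ := by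
      field_simp; push_cast; ring
    linarith

lemma norm_selbergSum_sub_le {N D q a : ℕ} {β K : ℝ} (hD : 0 < D) (hDN : D ≤ N) (hq : 0 < q)
    (ha : a.Coprime q) (hβ : N * |β| ≤ K) (hK : 2 * q * K * D ≤ N) :
    ‖selbergSum N (a / q + β) - (∑ d ∈ (Finset.Ioc 0 D).filter (q ∣ ·),
      μ d * Real.log (N / d) ^ 2 / d : ℝ) * ∑ m ∈ Finset.Ioc 0 N, ex (m * β)‖ ≤
      D * (Real.log N ^ 2 * (q + 7 * K + 1)) + N * Real.log (N / D) ^ 3 := by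
  have hN : 0 < N := hD.trans_le hDN
  have hN' : (0 : ℝ) < N := by exact_mod_cast hN
  have hD' : (0 : ℝ) < D := by exact_mod_cast hD
  have hq' : (0 : ℝ) < q := by exact_mod_cast hq
  have hK0 : 0 ≤ K := le_trans (by positivity) hβ
  set G : ℕ → ℂ := fun d => ∑ n ∈ Finset.Ioc 0 (N / d), ex ((d * n : ℕ) * (a / q + β)) with hG
  set c : ℕ → ℝ := fun d => μ d * Real.log (N / d) ^ 2 with hc
  set E : ℂ := ∑ m ∈ Finset.Ioc 0 N, ex (m * β) with hE
  have hmu : ∀ d, |(μ d : ℝ)| ≤ 1 := fun d => by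
    exact_mod_cast ArithmeticFunction.abs_moebius_le_one
  have e1 : selbergSum N (a / q + β) = ∑ d ∈ Finset.Ioc 0 D, c d * G d + ∑ d ∈ Finset.Ioc D N, c d * G d := by
    rw [Finset.sum_Ioc_consecutive _ (Nat.zero_le D) hDN]
    unfold selbergSum bilin
    refine Finset.sum_congr rfl fun d _ => ?_
    rw [hG, Finset.mul_sum]
    simp [hc]
  have e2 : ((∑ d ∈ (Finset.Ioc 0 D).filter (q ∣ ·), μ d * Real.log (N / d) ^ 2 / d : ℝ) : ℂ) * E =
      ∑ d ∈ Finset.Ioc 0 D, c d * (if q ∣ d then (d : ℂ)⁻¹ * E else 0) := by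
    rw [Finset.sum_filter, ofReal_sum, Finset.sum_mul]
    refine Finset.sum_congr rfl fun d _ => ?_
    split_ifs
    · simp [hc]; ring
    · simp
  have hlow : ‖∑ d ∈ Finset.Ioc 0 D, c d * G d -
      ∑ d ∈ Finset.Ioc 0 D, c d * (if q ∣ d then (d : ℂ)⁻¹ * E else 0)‖ ≤
      D * (Real.log N ^ 2 * (q + 7 * K + 1)) := by
    rw [← Finset.sum_sub_distrib]
    refine (norm_sum_le_of_le (n := fun _ => Real.log N ^ 2 * (q + 7 * K + 1)) _ fun d hd => ?_).trans
      (by rw [Finset.sum_const, Nat.card_Ioc, nsmul_eq_mul, Nat.sub_zero])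
    rw [Finset.mem_Ioc] at hd
    have hd0 : (0 : ℝ) < d := by exact_mod_cast hd.1
    have hd1 : (1 : ℝ) ≤ d := by exact_mod_cast hd.1
    have hdN : (d : ℝ) ≤ N := by exact_mod_cast hd.2.trans hDN
    rw [← mul_sub, norm_mul]
    refine mul_le_mul ?_ ?_ (norm_nonneg _) (by positivity)
    · rw [norm_real, Real.norm_eq_abs, hc, abs_mul, abs_of_nonneg (sq_nonneg (Real.log (N / d)))]
      refine (mul_le_of_le_one_left (sq_nonneg _) (hmu d)).trans ?_
      have h0 : 0 ≤ Real.log (N / d) := Real.log_nonneg (by rw [le_div_iff₀ hd0]; linarith)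
      gcongr
      exact div_le_self hN'.le hd1
    · split_ifs with hqd
      · have : G d = ∑ n ∈ Finset.Ioc 0 (N / d), ex ((d * n : ℕ) * β) := by
          rw [hG]
          refine Finset.sum_congr rfl fun n _ => ?_
          obtain ⟨m, rfl⟩ := hqd
          rw [← ex_add_int (((q * m * n : ℕ) : ℝ) * β) ((m * n * a : ℕ) : ℤ)]
          congr 1
          push_cast
          field_simp
          ring
        rw [this]
        refine (norm_sum_ex_sub_le hd.1 β).trans ?_
        linarith
      · rw [sub_zero]
        have key : ∀ k : ℤ, 1 / (2 * (q : ℝ)) ≤ |d * (a / q + β) - k| := by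
          intro k
          have h1 : (1 : ℝ) ≤ |(d * a - k * q : ℝ)| := by
            have : (1 : ℤ) ≤ |(d * a - k * q : ℤ)| := by
              refine Int.one_le_abs fun h0 => hqd ?_
              have : (q : ℤ) ∣ (d * a : ℕ) := ⟨k, by push_cast; linarith⟩
              exact (Nat.Coprime.dvd_of_dvd_mul_right ha.symm (by exact_mod_cast this))
            exact_mod_cast this
          have h2 : 1 / (q : ℝ) ≤ |(d * a / q - k : ℝ)| := by
            have : (d * a / q - k : ℝ) = (d * a - k * q) / q := by field_simp
            rw [this, abs_div, abs_of_pos hq']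
            gcongr
          have h3 : |(d * β : ℝ)| ≤ 1 / (2 * q) := by
            rw [abs_mul, abs_of_pos hd0, le_div_iff₀ (by positivity)]
            have hdD : (d : ℝ) ≤ D := by exact_mod_cast hd.2
            have h4 : N * (d * |β| * (2 * q)) ≤ N * 1 := by
              calc N * (d * |β| * (2 * q)) = 2 * q * (N * |β|) * d := by ring
                _ ≤ 2 * q * K * D := by gcongr
                _ ≤ N * 1 := by linarith
            exact le_of_mul_le_mul_left h4 hN'
          have h5 : (d * (a / q + β) - k : ℝ) = (d * a / q - k) - (-(d * β)) := by ring
          have h6 := abs_sub_abs_le_abs_sub (d * a / q - k : ℝ) (-(d * β))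
          rw [abs_neg] at h6
          rw [h5]
          have h7 : 1 / (q : ℝ) = 1 / (2 * q) + 1 / (2 * q) := by field_simp; ring
          linarith
        have h8 := norm_sum_ex_le (by positivity) key 0 (N / d)
        have h9 : G d = ∑ n ∈ Finset.Ioc 0 (N / d), ex (n * (d * (a / q + β))) := by
          rw [hG]
          refine Finset.sum_congr rfl fun n _ => ?_
          congr 1; push_cast; ring
        rw [h9]
        refine h8.trans ?_
        have : 1 / (2 * (1 / (2 * (q : ℝ)))) = q := by field_simp
        linarith
  have hhigh : ‖∑ d ∈ Finset.Ioc D N, c d * G d‖ ≤ N * Real.log (N / D) ^ 3 := by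
    have hl0 : 0 ≤ Real.log (N / D) := Real.log_nonneg (by
      rw [le_div_iff₀ hD']; simpa using (Nat.cast_le (α := ℝ)).2 hDN)
    refine (norm_sum_le_of_le (f := fun d => (c d : ℂ) * G d)
      (n := fun d => N * Real.log (N / D) ^ 2 * (1 / d : ℝ)) _ fun d hd => ?_).trans ?_
    · rw [Finset.mem_Ioc] at hd
      have hd0 : (0 : ℝ) < d := by exact_mod_cast hD.trans hd.1
      have hDd : (D : ℝ) ≤ d := by exact_mod_cast hd.1.le
      have hdN : (d : ℝ) ≤ N := by exact_mod_cast hd.2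
      have h1 : ‖(c d : ℂ)‖ ≤ Real.log (N / D) ^ 2 := by
        rw [norm_real, Real.norm_eq_abs, hc, abs_mul, abs_of_nonneg (sq_nonneg (Real.log (N / d)))]
        refine (mul_le_of_le_one_left (sq_nonneg _) (hmu d)).trans ?_
        have h0 : 0 ≤ Real.log (N / d) := Real.log_nonneg (by rw [le_div_iff₀ hd0]; linarith)
        gcongr
      have h2 : ‖G d‖ ≤ N / d := by
        refine (norm_sum_le_of_le (n := fun _ => 1) _ fun m _ => (norm_ex _).le).trans ?_
        rw [Finset.sum_const, Nat.card_Ioc, nsmul_eq_mul, mul_one, Nat.sub_zero]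
        exact Nat.cast_div_le
      rw [norm_mul]
      calc _ ≤ Real.log (N / D) ^ 2 * (N / d) := by gcongr
        _ = _ := by ring
    · rw [← Finset.mul_sum]
      calc _ ≤ N * Real.log (N / D) ^ 2 * Real.log (N / D) := by
            gcongr; exact sum_Ioc_inv_le hD hDN
        _ = _ := by ring
  rw [e1, e2]
  calc _ = ‖(∑ d ∈ Finset.Ioc 0 D, c d * G d -
      ∑ d ∈ Finset.Ioc 0 D, c d * (if q ∣ d then (d : ℂ)⁻¹ * E else 0)) + ∑ d ∈ Finset.Ioc D N, c d * G d‖ := by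
        congr 1; ring
    _ ≤ _ := (norm_add_le _ _).trans (add_le_add hlow hhigh)

lemma eventually_log_log_pow_le (c : ℝ) :
    ∀ᶠ N : ℕ in atTop, c * Real.log (Real.log N) ^ 3 ≤ √(Real.log N) := by
  have h1 : ∀ᶠ x : ℝ in atTop, c * Real.log x ^ 3 ≤ √x := by
    have h := (isLittleO_log_rpow_rpow_atTop 3 (show (0 : ℝ) < 1 / 2 by norm_num)).bound
      (show (0 : ℝ) < (|c| + 1)⁻¹ by positivity)
    filter_upwards [h, eventually_ge_atTop 1] with x hx hx1
    have hl : 0 ≤ Real.log x := Real.log_nonneg hx1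
    rw [Real.norm_of_nonneg (by positivity), Real.norm_of_nonneg (by positivity),
      ← Real.sqrt_eq_rpow, inv_mul_eq_div, le_div_iff₀ (by positivity)] at hx
    have e : Real.log x ^ (3 : ℝ) = Real.log x ^ 3 := by exact_mod_cast Real.rpow_natCast (Real.log x) 3
    rw [e] at hx
    have : c ≤ |c| := le_abs_self c
    nlinarith [pow_nonneg hl 3]
  exact tendsto_log_nat.eventually h1

lemma eventually_selbergSum (B : ℕ) : ∀ᶠ N : ℕ in atTop, ∃ P : ℕ → ℝ, ∀ (q a : ℕ) (β : ℝ), 0 < q →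
    (q : ℝ) ≤ Real.log N ^ B → a.Coprime q → N * |β| ≤ Real.log N ^ B →
    ‖selbergSum N (a / q + β) - P q * ∑ m ∈ Finset.Ioc 0 N, ex (m * β)‖ ≤ N * √(Real.log N) := by
  have hll := eventually_log_log_pow_le (2 * (2 * B + 4) ^ 3)
  have hL := tendsto_log_nat.eventually_ge_atTop 400
  have hp := eventually_log_pow_le (2 * B + 3) 1 (show (0 : ℝ) < 1 by norm_num)
  filter_upwards [hll, hL, hp, eventually_gt_atTop 0] with N hll hL hp hN
  set L := Real.log N with hLdef
  have hL0 : 0 < L := by linarith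
  have hN' : (0 : ℝ) < N := by exact_mod_cast hN
  rw [one_mul, Real.rpow_one] at hp
  have hB' : 0 < L ^ (2 * B + 3) := by positivity
  set D := ⌊N / L ^ (2 * B + 3)⌋₊ with hDdef
  have hy1 : 1 ≤ N / L ^ (2 * B + 3) := by rwa [le_div_iff₀ hB', one_mul]
  have hD1 : 1 ≤ D := Nat.le_floor (by simpa using hy1)
  have hDle : (D : ℝ) ≤ N / L ^ (2 * B + 3) := Nat.floor_le (by positivity)
  have hDge : N / L ^ (2 * B + 3) ≤ 2 * D := by
    have h1 := Nat.lt_floor_add_one (N / L ^ (2 * B + 3))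
    have h2 : (1 : ℝ) ≤ D := by exact_mod_cast hD1
    rw [← hDdef] at h1
    linarith
  have hDN : D ≤ N := by
    have : (D : ℝ) ≤ N := hDle.trans (div_le_self hN'.le (one_le_pow₀ (by linarith)))
    exact_mod_cast this
  have hD0 : (0 : ℝ) < D := by exact_mod_cast hD1
  refine ⟨fun q => ∑ d ∈ (Finset.Ioc 0 D).filter (q ∣ ·), μ d * Real.log (N / d) ^ 2 / d,
    fun q a β hq hqL ha hβ => ?_⟩
  have hLB : 1 ≤ L ^ B := one_le_pow₀ (by linarith)
  have hDL : D * L ^ (2 * B + 3) ≤ N := by rwa [le_div_iff₀ hB'] at hDle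
  have e3 : L ^ (2 * B + 3) = L ^ B * L ^ B * L ^ 3 := by ring
  refine (norm_selbergSum_sub_le (K := L ^ B) (by omega) hDN hq ha hβ ?_).trans ?_
  · calc 2 * q * L ^ B * D ≤ 2 * L ^ B * L ^ B * D := by gcongr
      _ ≤ L ^ 3 * L ^ B * L ^ B * D := by
        gcongr
        nlinarith [sq_nonneg L]
      _ = D * L ^ (2 * B + 3) := by rw [e3]; ring
      _ ≤ N := hDL
  · have h1 : D * (L ^ 2 * (q + 7 * L ^ B + 1)) ≤ N := by
      calc D * (L ^ 2 * (q + 7 * L ^ B + 1)) ≤ D * (L ^ 2 * (L * L ^ B)) := by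
            gcongr
            nlinarith
        _ = D * (1 * L ^ B * L ^ 3) := by ring
        _ ≤ D * (L ^ B * L ^ B * L ^ 3) := by gcongr
        _ ≤ N := by rw [← e3]; exact hDL
    have h2 : Real.log (N / D) ≤ (2 * B + 4) * Real.log L := by
      have : (N / D : ℝ) ≤ L * L ^ (2 * B + 3) := by
        rw [div_le_iff₀ hD0]
        rw [div_le_iff₀ hB'] at hDge
        nlinarith [mul_pos hD0 hB']
      refine (Real.log_le_log (by positivity) this).trans (le_of_eq ?_)
      rw [← pow_succ', Real.log_pow]; push_cast; ring
    have h3 : 0 ≤ Real.log (N / D) := Real.log_nonneg (by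
      rw [le_div_iff₀ hD0]; simpa using (Nat.cast_le (α := ℝ)).2 hDN)
    have h4 : Real.log (N / D) ^ 3 ≤ √L / 2 := by
      calc _ ≤ ((2 * B + 4) * Real.log L) ^ 3 := by gcongr
        _ ≤ _ := by
          rw [mul_pow]; linarith
    have h5 : 2 ≤ √L := by rw [Real.le_sqrt (by norm_num) hL0.le]; linarith
    have h6 : N * Real.log (N / D) ^ 3 ≤ N * (√L / 2) := by gcongr
    nlinarith

/-- The type I sum on a major arc does not depend on the numerator and decays in `β`. -/
lemma eventually_selbergSum_le (B : ℕ) : ∀ᶠ N : ℕ in atTop, ∀ (q a : ℕ) (β : ℝ), 0 < q →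
    (q : ℝ) ≤ Real.log N ^ B → a.Coprime q → N * |β| ≤ Real.log N ^ B →
    (|β| * ‖selbergSum N (a / q + β)‖ ≤ 201 * Real.log N + |β| * (N * √(Real.log N))) ∧
    ∀ b : ℕ, b.Coprime q → ‖selbergSum N (a / q + β) - selbergSum N (b / q + β)‖ ≤
      2 * (N * √(Real.log N)) := by
  have hp := eventually_log_pow_le B 2 (show (0 : ℝ) < 1 by norm_num)
  have hL := tendsto_log_nat.eventually_ge_atTop 4
  filter_upwards [eventually_selbergSum B, eventually_ge_atTop 2, hp, hL] with N hN hN2 hp hL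
  rw [Real.rpow_one] at hp
  obtain ⟨P, hP⟩ := hN
  have hN' : (0 : ℝ) < N := by positivity
  intro q a β hq hqL ha hβ
  constructor
  · have h0 := hP q a 0 hq hqL ha (by simp; positivity)
    have h1 := norm_selbergSum_le hN2 (a / q + 0)
    simp only [mul_zero, ex_zero, Finset.sum_const, Nat.card_Ioc, Nat.sub_zero, nsmul_eq_mul, mul_one] at h0
    have h2 : |P q| * N ≤ N * √(Real.log N) + 200 * N * Real.log N := by
      have : ‖(P q * N : ℂ)‖ = |P q| * N := by rw [norm_mul, norm_real, norm_natCast, Real.norm_eq_abs]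
      rw [← this]
      refine (norm_le_norm_sub_add _ _).trans (add_le_add ?_ h1)
      rwa [norm_sub_rev]
    have h3 : |P q| ≤ 201 * Real.log N := by
      have h4 : √(Real.log N) ≤ Real.log N := by
        rw [Real.sqrt_le_left (by linarith)]; nlinarith
      have h5 : |P q| * N ≤ (201 * Real.log N) * N := by nlinarith
      exact le_of_mul_le_mul_right h5 hN'
    rcases eq_or_ne β 0 with rfl | hβ0
    · simp; linarith
    have hb : 0 < |β| := abs_pos.2 hβ0
    have h6 : ‖∑ m ∈ Finset.Ioc 0 N, ex (m * β)‖ ≤ 1 / (2 * |β|) := by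
      refine norm_sum_ex_le hb (fun k => ?_) 0 N
      have hb2 : |β| ≤ 1 / 2 := by
        have : N * |β| ≤ N * (1 / 2) := by linarith
        exact le_of_mul_le_mul_left this hN'
      rcases eq_or_ne k 0 with rfl | hk
      · simp
      · have h7 : (1 : ℝ) ≤ |(k : ℝ)| := by exact_mod_cast Int.one_le_abs hk
        have h8 := abs_sub_abs_le_abs_sub (k : ℝ) β
        rw [abs_sub_comm] at h8
        linarith
    have h7 := hP q a β hq hqL ha hβ
    have h8 : ‖selbergSum N (a / q + β)‖ ≤ N * √(Real.log N) + 201 * Real.log N * (1 / (2 * |β|)) := by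
      have h9 : ‖(P q : ℂ) * ∑ m ∈ Finset.Ioc 0 N, ex (m * β)‖ ≤ 201 * Real.log N * (1 / (2 * |β|)) := by
        rw [norm_mul, norm_real, Real.norm_eq_abs]; gcongr
      exact (norm_le_norm_sub_add _ _).trans (add_le_add h7 h9)
    calc _ ≤ |β| * (N * √(Real.log N) + 201 * Real.log N * (1 / (2 * |β|))) := by gcongr
      _ = 201 * Real.log N / 2 + |β| * (N * √(Real.log N)) := by field_simp; ring
      _ ≤ _ := by linarith
  · intro b hb
    have h1 := hP q a β hq hqL ha hβ
    have h2 := hP q b β hq hqL hb hβ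
    rw [norm_sub_rev] at h2
    refine (norm_sub_le_norm_sub_add_norm_sub _
      (P q * ∑ m ∈ Finset.Ioc 0 N, ex (m * β)) _).trans ?_
    linarith

lemma sum_log_le_of_subset_primesAP {x H q a y : ℕ} {s : Finset ℕ} (hs : s ⊆ primesAP x H q a)
    (hy : ∀ p ∈ s, p ≤ y) (hq : 0 < q) (hqH : q < H) (hHx : H ≤ x) (hyH : y * q ^ 2 ≤ H ^ 2) :
    (∑ p ∈ s, Real.log p) * q.totient ≤ 2000 * H := by
  have hq0 : (0 : ℝ) < q := by exact_mod_cast hq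
  have hqH' : (q : ℝ) < H := by exact_mod_cast hqH
  have hl : 0 ≤ Real.log (H / q) := Real.log_nonneg (by rw [le_div_iff₀ hq0]; linarith)
  have h1 : ∑ p ∈ s, Real.log p ≤ (primesAP x H q a).card * (2 * Real.log (H / q)) := by
    calc ∑ p ∈ s, Real.log p ≤ ∑ p ∈ s, 2 * Real.log (H / q) := by
          refine Finset.sum_le_sum fun p hp => ?_
          have hp0 : (0 : ℝ) < p := by
            have := (Finset.mem_filter.1 (hs hp)).2.1.pos
            exact_mod_cast this
          have : (p : ℝ) ≤ (H / q) ^ 2 := by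
            rw [div_pow, le_div_iff₀ (by positivity)]
            exact_mod_cast (Nat.mul_le_mul_right _ (hy p hp)).trans hyH
          calc Real.log p ≤ Real.log ((H / q) ^ 2) := Real.log_le_log hp0 this
            _ = _ := by rw [Real.log_pow]; push_cast; ring
      _ = (s.card : ℝ) * (2 * Real.log (H / q)) := by rw [Finset.sum_const, nsmul_eq_mul]
      _ ≤ _ := by
        gcongr
  have h2 := brun_titchmarsh (a := a) hq hqH hHx
  have h3 : (0 : ℝ) ≤ q.totient := Nat.cast_nonneg _
  nlinarith [mul_le_mul_of_nonneg_right h1 h3]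

lemma sum_primeLog_window_le {x V q c Y : ℕ} (hq : 0 < q) (hqV : q < V) (hVx : V ≤ x)
    (hY : Y * q ^ 2 ≤ V ^ 2) (t : ℕ) :
    (∑ n ∈ Finset.Ioc x (x + t * V), if n ≤ Y ∧ n ≡ c [MOD q] then primeLog n else 0) * q.totient ≤
      t * (2000 * V) := by
  induction t with
  | zero => simp
  | succ t ih =>
    rw [← Finset.sum_Ioc_consecutive _ (show x ≤ x + t * V by omega)
      (show x + t * V ≤ x + (t + 1) * V by rw [add_mul]; omega), add_mul]
    have h1 : ∑ n ∈ Finset.Ioc (x + t * V) (x + (t + 1) * V),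
        (if n ≤ Y ∧ n ≡ c [MOD q] then primeLog n else 0) =
        ∑ p ∈ (primesAP (x + t * V) V q c).filter (· ≤ Y), Real.log p := by
      rw [primesAP, Finset.filter_filter, Finset.sum_filter,
        show x + (t + 1) * V = x + t * V + V by ring]
      refine Finset.sum_congr rfl fun n _ => ?_
      rw [primeLog_apply]
      by_cases h1 : n ≤ Y <;> by_cases h2 : n ≡ c [MOD q] <;> by_cases h3 : n.Prime <;> simp [h1, h2, h3]
    have h2 := sum_log_le_of_subset_primesAP (Finset.filter_subset (· ≤ Y) (primesAP (x + t * V) V q c))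
      (fun p hp => (Finset.mem_filter.1 hp).2) hq hqV (by omega) hY
    rw [h1]
    push_cast
    linarith

lemma sum_range_ex_mul {q a : ℕ} (hq : 0 < q) (ha : a.Coprime q) (n m : ℕ) :
    ∑ r ∈ Finset.range q, ex (((n : ℝ) - m) * (r * a / q)) = if n ≡ m [MOD q] then (q : ℂ) else 0 := by
  have hq' : (q : ℝ) ≠ 0 := by exact_mod_cast hq.ne'
  set θ : ℝ := ((n : ℝ) - m) * a / q with hθ
  have e1 : ∀ r ∈ Finset.range q, ex (((n : ℝ) - m) * (r * a / q)) = ex θ ^ r := fun r _ => by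
    rw [← ex_nat_mul]; congr 1; rw [hθ]; ring
  have e2 : ex θ = 1 ↔ n ≡ m [MOD q] := by
    rw [ex_eq_one_iff, Nat.ModEq.comm, Nat.modEq_iff_dvd]
    constructor
    · rintro ⟨k, hk⟩
      rw [hθ, div_eq_iff hq'] at hk
      have hk' : ((n : ℤ) - m) * a = k * q := by exact_mod_cast hk
      have h2 : IsCoprime (q : ℤ) (a : ℤ) := Nat.isCoprime_iff_coprime.2 ha.symm
      exact h2.dvd_of_dvd_mul_right ⟨k, by rw [hk']; ring⟩
    · rintro ⟨k, hk⟩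
      refine ⟨k * a, ?_⟩
      have hk' : ((n : ℝ) - m) = q * k := by exact_mod_cast hk
      rw [hθ, hk']; push_cast; field_simp
  rw [Finset.sum_congr rfl e1]
  split_ifs with h
  · rw [e2.2 h]; simp
  · have h1 : ex θ ≠ 1 := fun h' => h (e2.1 h')
    rw [geom_sum_eq h1, ← ex_nat_mul]
    have : (q : ℝ) * θ = (((n : ℤ) - m) * a : ℤ) := by rw [hθ]; push_cast; field_simp
    rw [this, ex_int]; simp

lemma sum_range_norm_sq_eq {q a : ℕ} (hq : 0 < q) (ha : a.Coprime q) (s : Finset ℕ) (c : ℕ → ℂ) :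
    ((∑ r ∈ Finset.range q, ‖∑ n ∈ s, c n * ex (n * (r * a / q))‖ ^ 2 : ℝ) : ℂ) =
      q * ∑ n ∈ s, ∑ m ∈ s, if n ≡ m [MOD q] then c n * starRingEnd ℂ (c m) else 0 := by
  have h1 : ∀ r : ℕ, ((‖∑ n ∈ s, c n * ex (n * (r * a / q))‖ ^ 2 : ℝ) : ℂ) =
      ∑ n ∈ s, ∑ m ∈ s, c n * starRingEnd ℂ (c m) * ex (((n : ℝ) - m) * (r * a / q)) := by
    intro r
    rw [ofReal_pow, ← mul_conj', map_sum, Finset.sum_mul_sum]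
    refine Finset.sum_congr rfl fun n _ => Finset.sum_congr rfl fun m _ => ?_
    rw [map_mul, ← ex_neg, sub_mul, sub_eq_add_neg, ex_add]
    ring
  rw [ofReal_sum, Finset.sum_congr rfl fun r _ => h1 r, Finset.sum_comm, Finset.mul_sum]
  refine Finset.sum_congr rfl fun n _ => ?_
  rw [Finset.sum_comm, Finset.mul_sum]
  refine Finset.sum_congr rfl fun m _ => ?_
  rw [← Finset.mul_sum, sum_range_ex_mul hq ha]
  split_ifs <;> ring

/-- Exponential sums over initial segments of an arithmetic progression. -/
lemma norm_sum_filter_ex_le {J H M : ℕ} (hH : 0 < H) (Z : ℕ) {t δ : ℝ} (hδ : 0 < δ)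
    (h : ∀ k : ℤ, δ ≤ |H * t - k|) :
    ‖∑ j ∈ (Finset.range J).filter (fun j => M + j * H ≤ Z), ex ((M + j * H : ℕ) * t)‖ ≤ 1 / (2 * δ) := by
  rcases lt_or_ge Z M with hZ | hZ
  · rw [Finset.filter_false_of_mem (fun j _ => by have := Nat.zero_le (j * H); omega)]
    simp [hδ.le]
  have e1 : (Finset.range J).filter (fun j => M + j * H ≤ Z) = Finset.range (min J ((Z - M) / H + 1)) := by
    ext j
    rw [Finset.mem_filter, Finset.mem_range, Finset.mem_range, lt_min_iff, Nat.lt_succ_iff,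
      Nat.le_div_iff_mul_le hH]
    omega
  rw [e1, Finset.range_eq_Ico]
  generalize min J ((Z - M) / H + 1) = K
  have e2 : ∑ j ∈ Finset.Ico 0 K, ex ((M + j * H : ℕ) * t) =
      ex ((M - H) * t) * ∑ n ∈ Finset.Ioc 0 K, ex (n * (H * t)) := by
    rw [Finset.mul_sum]
    refine Finset.sum_bij' (fun j _ => j + 1) (fun n _ => n - 1) ?_ ?_ ?_ ?_ ?_
    · intro j hj; rw [Finset.mem_Ico] at hj; rw [Finset.mem_Ioc]; omega
    · intro j hj; rw [Finset.mem_Ioc] at hj; rw [Finset.mem_Ico]; omega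
    · intro j _; rfl
    · intro j hj; rw [Finset.mem_Ioc] at hj; omega
    · intro j _
      rw [← ex_add]; congr 1; push_cast; ring
  rw [e2, norm_mul, norm_ex, one_mul]
  exact norm_sum_ex_le hδ h 0 K

/-- Coefficients of the inner sum of the type II sum on a short block starting at `x`. -/
noncomputable def blockCoeff (N : ℕ) (β : ℝ) (x n : ℕ) : ℂ :=
  if x * n ≤ N then (primeLog n : ℂ) * ex (x * (n * β)) else 0

/-- The inner sum of the type II sum for a short block starting at `x`, in the residue class `r`. -/
noncomputable def blockSum (N V Y q a : ℕ) (β : ℝ) (x r : ℕ) : ℂ :=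
  ∑ n ∈ Finset.Ioc V Y, blockCoeff N β x n * ex (n * (r * a / q))

/-- The correlation of the blocks between `n` and `m`. -/
noncomputable def blockCorr (N M J H : ℕ) (β : ℝ) (n m : ℕ) : ℂ :=
  ∑ j ∈ (Finset.range J).filter (fun j => M + j * H ≤ N / max n m),
    ex ((M + j * H : ℕ) * (((n : ℝ) - m) * β))

lemma sum_norm_sq_blockSum_le {N M J H V Y q a : ℕ} {β : ℝ} (hq : 0 < q) (ha : a.Coprime q) :
    ∑ j ∈ Finset.range J, ∑ r ∈ Finset.range q, ‖blockSum N V Y q a β (M + j * H) r‖ ^ 2 ≤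
      q * ∑ n ∈ Finset.Ioc V Y, ∑ m ∈ Finset.Ioc V Y,
        if n ≡ m [MOD q] then primeLog n * (primeLog m * ‖blockCorr N M J H β n m‖) else 0 := by
  have h1 : ((∑ j ∈ Finset.range J, ∑ r ∈ Finset.range q,
      ‖blockSum N V Y q a β (M + j * H) r‖ ^ 2 : ℝ) : ℂ) =
      q * ∑ n ∈ Finset.Ioc V Y, ∑ m ∈ Finset.Ioc V Y,
        if n ≡ m [MOD q] then (primeLog n : ℂ) * (primeLog m * blockCorr N M J H β n m) else 0 := by
    rw [ofReal_sum]
    unfold blockSum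
    rw [Finset.sum_congr rfl fun j _ => sum_range_norm_sq_eq hq ha _ _, ← Finset.mul_sum,
      Finset.sum_comm]
    congr 1
    refine Finset.sum_congr rfl fun n hn => ?_
    rw [Finset.sum_comm]
    refine Finset.sum_congr rfl fun m hm => ?_
    split_ifs with h
    · unfold blockCorr
      rw [Finset.mul_sum, Finset.mul_sum, Finset.sum_filter]
      refine Finset.sum_congr rfl fun j _ => ?_
      rw [Finset.mem_Ioc] at hn hm
      have hmax : 0 < max n m := lt_max_of_lt_left (by omega)
      have hiff : M + j * H ≤ N / max n m ↔ (M + j * H) * n ≤ N ∧ (M + j * H) * m ≤ N := by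
        rw [Nat.le_div_iff_mul_le hmax]
        rcases le_total n m with h' | h'
        · rw [max_eq_right h']
          exact ⟨fun h => ⟨(Nat.mul_le_mul_left _ h').trans h, h⟩, fun h => h.2⟩
        · rw [max_eq_left h']
          exact ⟨fun h => ⟨h, (Nat.mul_le_mul_left _ h').trans h⟩, fun h => h.1⟩
      unfold blockCoeff
      by_cases h1 : (M + j * H) * n ≤ N <;> by_cases h2 : (M + j * H) * m ≤ N
      · rw [if_pos h1, if_pos h2, if_pos (hiff.2 ⟨h1, h2⟩), map_mul, ← ex_neg, conj_ofReal]
        have : (M + j * H : ℕ) * (((n : ℝ) - m) * β) = (M + j * H : ℕ) * (n * β) +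
          -((M + j * H : ℕ) * (m * β)) := by ring
        rw [this, ex_add]; ring
      all_goals simp [h1, h2, hiff]
    · simp
  have h2 := congrArg norm h1
  rw [norm_real, Real.norm_of_nonneg (by positivity)] at h2
  rw [h2, norm_mul, norm_natCast]
  refine mul_le_mul_of_nonneg_left ?_ (Nat.cast_nonneg _)
  refine norm_sum_le_of_le _ fun n _ => norm_sum_le_of_le _ fun m _ => ?_
  split_ifs
  · rw [norm_mul, norm_mul, norm_real, norm_real, Real.norm_of_nonneg (primeLog_nonneg n),
      Real.norm_of_nonneg (primeLog_nonneg m)]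
  · simp

lemma norm_blockCorr_le (N M J H : ℕ) (β : ℝ) (n m : ℕ) : ‖blockCorr N M J H β n m‖ ≤ J := by
  refine (norm_sum_le_of_le (n := fun _ => 1) _ fun m _ => (norm_ex _).le).trans ?_
  rw [Finset.sum_const, nsmul_eq_mul, mul_one]
  exact_mod_cast (Finset.card_filter_le _ _).trans (by simp)

lemma norm_blockCorr_le_of_far {N M J H V Y : ℕ} {β G : ℝ} (hH : 0 < H) (hV : 0 < V) {n m : ℕ}
    (hn : n ∈ Finset.Ioc V Y) (hm : m ∈ Finset.Ioc V Y) (hnm : n + V ≤ m ∨ m + V ≤ n)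
    (hβ : H * Y * |β| ≤ 1 / 2) (hG : (J : ℝ) ≤ G ∨ (β ≠ 0 ∧ 1 / (2 * (H * V * |β|)) ≤ G)) :
    ‖blockCorr N M J H β n m‖ ≤ G := by
  rcases hG with hG | ⟨hβ0, hG⟩
  · exact (norm_blockCorr_le N M J H β n m).trans hG
  refine le_trans ?_ hG
  have hb : 0 < |β| := abs_pos.2 hβ0
  have hH' : (0 : ℝ) < H := by exact_mod_cast hH
  have hV' : (0 : ℝ) < V := by exact_mod_cast hV
  rw [Finset.mem_Ioc] at hn hm
  have hVY : (V : ℝ) ≤ Y := by exact_mod_cast hn.1.le.trans hn.2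
  have hnm1 : (V : ℝ) ≤ |(n : ℝ) - m| := by
    rw [le_abs]
    rcases hnm with h | h
    · right; have : ((n + V : ℕ) : ℝ) ≤ m := by exact_mod_cast h
      push_cast at this; linarith
    · left; have : ((m + V : ℕ) : ℝ) ≤ n := by exact_mod_cast h
      push_cast at this; linarith
  have hnm2 : |(n : ℝ) - m| ≤ Y := by
    have h1 : (n : ℝ) ≤ Y := by exact_mod_cast hn.2
    have h2 : (m : ℝ) ≤ Y := by exact_mod_cast hm.2
    have h3 : (0 : ℝ) ≤ n := n.cast_nonneg
    have h4 : (0 : ℝ) ≤ m := m.cast_nonneg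
    rw [abs_le]; constructor <;> linarith
  refine norm_sum_filter_ex_le hH _ (by positivity) fun k => ?_
  have e1 : |(H : ℝ) * (((n : ℝ) - m) * β)| = H * |(n : ℝ) - m| * |β| := by
    rw [abs_mul, abs_mul, abs_of_pos hH', mul_assoc]
  have e2 : H * V * |β| ≤ H * |(n : ℝ) - m| * |β| := by gcongr
  have e3 : H * |(n : ℝ) - m| * |β| ≤ H * Y * |β| := by gcongr
  rcases eq_or_ne k 0 with rfl | hk
  · rw [Int.cast_zero, sub_zero, e1]; exact e2
  · have h7 : (1 : ℝ) ≤ |(k : ℝ)| := by exact_mod_cast Int.one_le_abs hk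
    have h8 := abs_sub_abs_le_abs_sub (k : ℝ) ((H : ℝ) * (((n : ℝ) - m) * β))
    rw [abs_sub_comm, e1] at h8
    linarith

lemma secondMoment_blockSum_le {N M J H V Y q a k : ℕ} {β G : ℝ} (hq : 0 < q) (ha : a.Coprime q)
    (hH : 0 < H) (hqV : q < V) (hYV : Y * q ^ 2 ≤ V ^ 2) (hYk : Y ≤ V + 2 * k * V)
    (hβ : H * Y * |β| ≤ 1 / 2) (hG0 : 0 ≤ G)
    (hG : (J : ℝ) ≤ G ∨ (β ≠ 0 ∧ 1 / (2 * (H * V * |β|)) ≤ G)) :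
    (∑ j ∈ Finset.range J, ∑ r ∈ Finset.range q, ‖blockSum N V Y q a β (M + j * H) r‖ ^ 2) * q.totient ≤
      q * (6 * Y * (2000 * V * (2 * J + 2 * k * G))) := by
  have hV : 0 < V := by omega
  have hφ : (0 : ℝ) ≤ q.totient := Nat.cast_nonneg _
  refine (mul_le_mul_of_nonneg_right (sum_norm_sq_blockSum_le hq ha) hφ).trans ?_
  rw [mul_assoc]
  refine mul_le_mul_of_nonneg_left ?_ (Nat.cast_nonneg _)
  have hinner : ∀ n ∈ Finset.Ioc V Y, (∑ m ∈ Finset.Ioc V Y,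
      if n ≡ m [MOD q] then primeLog m * ‖blockCorr N M J H β n m‖ else 0) * q.totient ≤
      2000 * V * (2 * J + 2 * k * G) := by
    intro n hn
    set w : ℕ → ℝ := fun m => if m ≤ Y ∧ m ≡ n [MOD q] then primeLog m else 0 with hw
    have hw0 : ∀ m, 0 ≤ w m := fun m => by
      rw [hw]; beta_reduce; split_ifs
      · exact primeLog_nonneg m
      · exact le_rfl
    set x := max V (n - V) with hx
    have h1 : ∑ m ∈ Finset.Ioc V Y, (if n ≡ m [MOD q] then primeLog m * ‖blockCorr N M J H β n m‖ else 0) ≤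
        J * ∑ m ∈ Finset.Ioc x (x + 2 * V), w m + G * ∑ m ∈ Finset.Ioc V (V + 2 * k * V), w m := by
      have h2 : ∑ m ∈ Finset.Ioc V Y, (if n ≡ m [MOD q] then primeLog m * ‖blockCorr N M J H β n m‖ else 0) ≤
          ∑ m ∈ Finset.Ioc V Y, (J * (if m ∈ Finset.Ioc x (x + 2 * V) then w m else 0) + G * w m) := by
        refine Finset.sum_le_sum fun m hm => ?_
        have hm' := Finset.mem_Ioc.1 hm
        have hn' := Finset.mem_Ioc.1 hn
        split_ifs with h3 h4 h4
        · have : w m = primeLog m := by rw [hw]; exact if_pos ⟨hm'.2, h3.symm⟩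
          rw [this]
          have := norm_blockCorr_le N M J H β n m
          nlinarith [primeLog_nonneg m, mul_nonneg hG0 (primeLog_nonneg m)]
        · have : w m = primeLog m := by rw [hw]; exact if_pos ⟨hm'.2, h3.symm⟩
          rw [this, mul_zero, zero_add, mul_comm]
          refine mul_le_mul_of_nonneg_right ?_ (primeLog_nonneg m)
          refine norm_blockCorr_le_of_far hH hV hn hm ?_ hβ hG
          rw [Finset.mem_Ioc] at h4
          omega
        · have := hw0 m; positivity
        · have := hw0 m; positivity
      refine h2.trans ?_
      rw [Finset.sum_add_distrib, ← Finset.mul_sum, ← Finset.mul_sum]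
      refine add_le_add (mul_le_mul_of_nonneg_left ?_ (Nat.cast_nonneg _)) (mul_le_mul_of_nonneg_left ?_ hG0)
      · rw [← Finset.sum_filter]
        refine Finset.sum_le_sum_of_subset_of_nonneg (fun m hm => (Finset.mem_filter.1 hm).2) fun m _ _ => hw0 m
      · exact Finset.sum_le_sum_of_subset_of_nonneg (Finset.Ioc_subset_Ioc_right hYk) fun m _ _ => hw0 m
    have h3 := sum_primeLog_window_le (x := x) (c := n) hq hqV (le_max_left _ _) hYV 2
    have h4 := sum_primeLog_window_le (x := V) (c := n) hq hqV le_rfl hYV (2 * k)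
    refine (mul_le_mul_of_nonneg_right h1 hφ).trans ?_
    push_cast at h3 h4
    have h5 := mul_le_mul_of_nonneg_left h3 (Nat.cast_nonneg (α := ℝ) J)
    have h6 := mul_le_mul_of_nonneg_left h4 hG0
    rw [hw]
    linarith
  calc _ = ∑ n ∈ Finset.Ioc V Y, primeLog n * ((∑ m ∈ Finset.Ioc V Y,
      if n ≡ m [MOD q] then primeLog m * ‖blockCorr N M J H β n m‖ else 0) * q.totient) := by
        rw [Finset.sum_mul]
        refine Finset.sum_congr rfl fun n _ => ?_
        rw [← mul_assoc, Finset.mul_sum]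
        congr 1
        refine Finset.sum_congr rfl fun m _ => ?_
        split_ifs <;> ring
    _ ≤ ∑ n ∈ Finset.Ioc V Y, primeLog n * (2000 * V * (2 * J + 2 * k * G)) :=
        Finset.sum_le_sum fun n hn => mul_le_mul_of_nonneg_left (hinner n hn) (primeLog_nonneg n)
    _ = (∑ n ∈ Finset.Ioc V Y, primeLog n) * (2000 * V * (2 * J + 2 * k * G)) := by rw [Finset.sum_mul]
    _ ≤ _ := by
        refine mul_le_mul_of_nonneg_right ?_ (by positivity)
        refine le_trans ?_ (sum_primeLog_le Y)
        exact Finset.sum_le_sum_of_subset_of_nonneg (Finset.Ioc_subset_Ioc_left (Nat.zero_le V))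
          fun m _ _ => primeLog_nonneg m

/-- The part of the type II sum over `m` in the half-open interval from `M` to `M'` only. -/
noncomputable def bilinPart (N M M' : ℕ) (x : ℝ) : ℂ :=
  ∑ m ∈ Finset.Ioc M M', ∑ n ∈ Finset.Ioc 0 (N / m), (primeLog m * primeLog n : ℝ) * ex ((m * n : ℕ) * x)

lemma norm_inner_sub_blockSum_le {N M H V Y q a x m : ℕ} {β : ℝ} (hq : 0 < q) (hM : 0 < M)
    (hY : Y = N / M) (hVY : V ≤ Y) (hMx : M ≤ x) (hxm : x < m) (hmx : m ≤ x + H) :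
    ‖∑ n ∈ Finset.Ioc 0 (N / m), (primeLog n : ℂ) * ex ((m * n : ℕ) * (a / q + β)) -
      blockSum N V Y q a β x (m % q)‖ ≤
      6 * V + 42 * Y ^ 2 * H * |β| + Real.log N * (N * H / M ^ 2 + 1) := by
  have hq' : (q : ℝ) ≠ 0 := by exact_mod_cast hq.ne'
  have hm : 0 < m := by omega
  have hx : 0 < x := by omega
  set f : ℕ → ℂ := fun n => if m * n ≤ N then (primeLog n : ℂ) * ex ((m * n : ℕ) * (a / q + β)) else 0
    with hf
  have e1 : ∑ n ∈ Finset.Ioc 0 (N / m), (primeLog n : ℂ) * ex ((m * n : ℕ) * (a / q + β)) =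
      ∑ n ∈ Finset.Ioc 0 V, f n + ∑ n ∈ Finset.Ioc V Y, f n := by
    rw [Finset.sum_Ioc_consecutive _ (Nat.zero_le V) hVY, hf, ← Finset.sum_filter]
    refine Finset.sum_congr ?_ fun _ _ => rfl
    ext n
    rw [Finset.mem_filter, Finset.mem_Ioc, Finset.mem_Ioc, Nat.le_div_iff_mul_le hm, hY,
      Nat.le_div_iff_mul_le hM, mul_comm m n]
    refine ⟨fun h => ⟨⟨h.1, (Nat.mul_le_mul_left _ (by omega)).trans h.2⟩, h.2⟩, fun h => ⟨h.1.1, h.2⟩⟩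
  have h1 : ‖∑ n ∈ Finset.Ioc 0 V, f n‖ ≤ 6 * V := by
    refine (norm_sum_le_of_le (n := fun n => primeLog n) _ fun n _ => ?_).trans (sum_primeLog_le V)
    rw [hf]; beta_reduce; split_ifs
    · rw [norm_mul, norm_ex, mul_one, norm_real, Real.norm_of_nonneg (primeLog_nonneg n)]
    · rw [norm_zero]; exact primeLog_nonneg n
  have h2 : ‖∑ n ∈ Finset.Ioc V Y, f n - blockSum N V Y q a β x (m % q)‖ ≤
      ∑ n ∈ Finset.Ioc V Y, (primeLog n * (7 * (H * (Y * |β|))) +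
        if n ∈ Finset.Ioc (N / m) (N / x) then Real.log N else 0) := by
    unfold blockSum
    rw [← Finset.sum_sub_distrib]
    refine norm_sum_le_of_le _ fun n hn => ?_
    rw [Finset.mem_Ioc] at hn
    have hpl := primeLog_nonneg n
    have hb := abs_nonneg β
    have hL : 0 ≤ Real.log N := Real.log_natCast_nonneg N
    by_cases hmn : m * n ≤ N
    · have hxn : x * n ≤ N := (Nat.mul_le_mul_right n hxm.le).trans hmn
      have hnot : n ∉ Finset.Ioc (N / m) (N / x) := by
        rw [Finset.mem_Ioc, Nat.div_lt_iff_lt_mul hm]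
        rintro ⟨h, _⟩; rw [mul_comm] at hmn; omega
      have e2 : ex ((m * n : ℕ) * (a / q + β)) = ex (n * ((m % q : ℕ) * a / q)) * ex (m * (n * β)) := by
        obtain ⟨t, ht⟩ : ∃ t : ℕ, (m : ℝ) = q * t + (m % q : ℕ) :=
          ⟨m / q, by exact_mod_cast (Nat.div_add_mod m q).symm⟩
        rw [← ex_add, ← ex_add_int (n * ((m % q : ℕ) * a / q) + m * (n * β)) ((t * n * a : ℕ) : ℤ)]
        congr 1
        generalize ((m % q : ℕ) : ℝ) = r at ht ⊢
        push_cast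
        field_simp
        linear_combination (a : ℝ) * n * ht
      have e3 : f n - blockCoeff N β x n * ex (n * ((m % q : ℕ) * a / q)) =
          primeLog n * (ex (n * ((m % q : ℕ) * a / q)) * (ex (m * (n * β)) - ex (x * (n * β)))) := by
        rw [hf, blockCoeff, if_pos hxn]
        beta_reduce
        rw [if_pos hmn, e2]; ring
      rw [e3, norm_mul, norm_mul, norm_ex, one_mul, norm_real, Real.norm_of_nonneg hpl, if_neg hnot,
        add_zero]
      refine mul_le_mul_of_nonneg_left ?_ hpl
      refine (norm_ex_sub_le _ _).trans ?_
      rw [← sub_mul, abs_mul, abs_mul, Nat.abs_cast]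
      have h3 : |(m : ℝ) - x| ≤ H := by
        have h4 : (x : ℝ) ≤ m := by exact_mod_cast hxm.le
        have h5 : (m : ℝ) ≤ x + H := by exact_mod_cast hmx
        rw [abs_of_nonneg (by linarith)]; linarith
      have h4 : (n : ℝ) ≤ Y := by exact_mod_cast hn.2
      gcongr
    · have e3 : f n = 0 := by rw [hf]; exact if_neg hmn
      rw [e3, zero_sub, norm_neg, norm_mul, norm_ex, mul_one, blockCoeff]
      split_ifs with h3 h4 h4
      · rw [norm_mul, norm_ex, mul_one, norm_real, Real.norm_of_nonneg hpl]
        have h5 : primeLog n ≤ Real.log N := by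
          rw [primeLog_apply]; split_ifs with hp
          · refine Real.log_le_log (by exact_mod_cast hp.pos) ?_
            exact_mod_cast (Nat.le_mul_of_pos_left n hx).trans h3
          · exact hL
        have : 0 ≤ primeLog n * (7 * (H * (Y * |β|))) := by positivity
        linarith
      · exfalso
        apply h4
        rw [Finset.mem_Ioc, Nat.div_lt_iff_lt_mul hm, Nat.le_div_iff_mul_le hx]
        constructor
        · rw [mul_comm]; omega
        · rw [mul_comm]; exact h3
      · rw [norm_zero]; positivity
      · rw [norm_zero]; positivity
  have h3 : ∑ n ∈ Finset.Ioc V Y, (primeLog n * (7 * (H * (Y * |β|))) +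
        if n ∈ Finset.Ioc (N / m) (N / x) then Real.log N else 0) ≤
      42 * Y ^ 2 * H * |β| + Real.log N * (N * H / M ^ 2 + 1) := by
    rw [Finset.sum_add_distrib]
    refine add_le_add ?_ ?_
    · rw [← Finset.sum_mul]
      have : ∑ n ∈ Finset.Ioc V Y, primeLog n ≤ 6 * Y := by
        refine le_trans ?_ (sum_primeLog_le Y)
        exact Finset.sum_le_sum_of_subset_of_nonneg (Finset.Ioc_subset_Ioc_left (Nat.zero_le V))
          fun m _ _ => primeLog_nonneg m
      calc _ ≤ 6 * Y * (7 * (H * (Y * |β|))) := by gcongr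
        _ = _ := by ring
    · rw [← Finset.sum_filter, Finset.sum_const, nsmul_eq_mul, mul_comm]
      refine mul_le_mul_of_nonneg_left ?_ (Real.log_natCast_nonneg N)
      have hc : ((Finset.Ioc V Y).filter (· ∈ Finset.Ioc (N / m) (N / x))).card ≤ N / x - N / m := by
        rw [← Nat.card_Ioc]
        exact Finset.card_le_card fun n hn => (Finset.mem_filter.1 hn).2
      have hle : N / m ≤ N / x := Nat.div_le_div_left hxm.le hx
      have hc' : ((((Finset.Ioc V Y).filter (· ∈ Finset.Ioc (N / m) (N / x))).card : ℕ) : ℝ) ≤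
          (N / x : ℕ) - (N / m : ℕ) := by
        rw [← Nat.cast_sub hle]; exact_mod_cast hc
      refine hc'.trans ?_
      have h4 : ((N / x : ℕ) : ℝ) ≤ N / x := Nat.cast_div_le
      have hm' : (0 : ℝ) < m := by exact_mod_cast hm
      have hx' : (0 : ℝ) < x := by exact_mod_cast hx
      have hM' : (0 : ℝ) < M := by exact_mod_cast hM
      have h5 : (N / m : ℝ) ≤ (N / m : ℕ) + 1 := by
        rw [div_le_iff₀ hm']
        have := Nat.lt_div_mul_add (a := N) hm
        have h6 : (N : ℝ) ≤ (N / m : ℕ) * m + m := by exact_mod_cast this.le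
        linarith
      have h6 : (N / x - N / m : ℝ) ≤ N * H / M ^ 2 := by
        rw [div_sub_div _ _ hx'.ne' hm'.ne', div_le_div_iff₀ (by positivity) (by positivity)]
        have h7 : (m : ℝ) - x ≤ H := by
          have h5 : (m : ℝ) ≤ x + H := by exact_mod_cast hmx
          linarith
        have h8 : (M : ℝ) ≤ x := by exact_mod_cast hMx
        have h9 : (M : ℝ) ≤ m := by exact_mod_cast (hMx.trans hxm.le)
        have h10 : (0 : ℝ) ≤ m - x := by
          have : (x : ℝ) ≤ m := by exact_mod_cast hxm.le
          linarith
        calc (N * m - x * N : ℝ) * M ^ 2 = N * (m - x) * (M * M) := by ring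
          _ ≤ N * H * (x * m) := by gcongr
      linarith
  rw [e1]
  calc _ = ‖∑ n ∈ Finset.Ioc 0 V, f n + (∑ n ∈ Finset.Ioc V Y, f n - blockSum N V Y q a β x (m % q))‖ := by
        congr 1; ring
    _ ≤ _ := (norm_add_le _ _).trans (add_le_add h1 (h2.trans h3))
    _ = _ := by ring

lemma sum_Ioc_add_mul {α : Type*} [AddCommMonoid α] (f : ℕ → α) (M H J : ℕ) :
    ∑ m ∈ Finset.Ioc M (M + J * H), f m =
      ∑ j ∈ Finset.range J, ∑ m ∈ Finset.Ioc (M + j * H) (M + j * H + H), f m := by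
  induction J with
  | zero => simp
  | succ J ih =>
    rw [Finset.sum_range_succ, ← ih, Finset.sum_Ioc_consecutive _ (by omega) (by omega)]
    congr 2; ring

lemma norm_bilinPart_le {N M H J V Y q a k : ℕ} {β G : ℝ} (hq : 0 < q) (ha : a.Coprime q)
    (hJ : 0 < J) (hM : M = J * H) (hY : Y = N / M) (hVY : V ≤ Y)
    (hqV : q < V) (hYV : Y * q ^ 2 ≤ V ^ 2) (hYk : Y ≤ V + 2 * k * V)
    (hqH : q < H) (hMH : 2 * M * q ^ 2 ≤ H ^ 2)
    (hβ : H * Y * |β| ≤ 1 / 2) (hG0 : 0 ≤ G)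
    (hG : (J : ℝ) ≤ G ∨ (β ≠ 0 ∧ 1 / (2 * (H * V * |β|)) ≤ G)) :
    ‖bilinPart N M (2 * M) (a / q + β)‖ ≤
      12 * M * (6 * V + 42 * Y ^ 2 * H * |β| + Real.log N * (N * H / M ^ 2 + 1)) +
      2000 * H / q.totient * √(J * q * (q * (6 * Y * (2000 * V * (2 * J + 2 * k * G))) / q.totient)) := by
  have hH : 0 < H := by omega
  have hMpos : 0 < M := by rw [hM]; positivity
  have hφ : (0 : ℝ) < q.totient := by exact_mod_cast Nat.totient_pos.2 hq
  have hHM : H ≤ M := by rw [hM]; exact Nat.le_mul_of_pos_left _ hJ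
  set E : ℝ := 6 * V + 42 * Y ^ 2 * H * |β| + Real.log N * (N * H / M ^ 2 + 1) with hE
  have hL := Real.log_natCast_nonneg N
  have hE0 : 0 ≤ E := by rw [hE]; positivity
  set b : ℕ → ℕ → ℝ := fun j r => ‖blockSum N V Y q a β (M + j * H) r‖ with hb
  set x : ℝ := a / q + β with hx
  set g : ℕ → ℂ := fun m => ∑ n ∈ Finset.Ioc 0 (N / m), (primeLog m * primeLog n : ℝ) * ex ((m * n : ℕ) * x)
    with hg
  have e0 : bilinPart N M (2 * M) x =
      ∑ j ∈ Finset.range J, ∑ m ∈ Finset.Ioc (M + j * H) (M + j * H + H), g m := by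
    rw [← sum_Ioc_add_mul, bilinPart, ← hM, two_mul]
  have h1 : ∀ j ∈ Finset.range J, ‖∑ m ∈ Finset.Ioc (M + j * H) (M + j * H + H), g m‖ ≤
      ∑ m ∈ Finset.Ioc (M + j * H) (M + j * H + H), (primeLog m * E + primeLog m * b j (m % q)) := by
    intro j hj
    refine norm_sum_le_of_le _ fun m hm => ?_
    rw [Finset.mem_Ioc] at hm
    have h2 := norm_inner_sub_blockSum_le (β := β) (a := a) hq hMpos hY hVY (Nat.le_add_right M (j * H))
      hm.1 hm.2
    have e1 : g m = primeLog m * ∑ n ∈ Finset.Ioc 0 (N / m), (primeLog n : ℂ) * ex ((m * n : ℕ) * x) := by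
      rw [hg, Finset.mul_sum]
      refine Finset.sum_congr rfl fun n _ => ?_
      rw [ofReal_mul, mul_assoc]
    rw [e1, norm_mul, norm_real, Real.norm_of_nonneg (primeLog_nonneg m), ← mul_add]
    refine mul_le_mul_of_nonneg_left ?_ (primeLog_nonneg m)
    have h3 := norm_sub_norm_le (∑ n ∈ Finset.Ioc 0 (N / m), (primeLog n : ℂ) * ex ((m * n : ℕ) * x))
      (blockSum N V Y q a β (M + j * H) (m % q))
    rw [hb]; beta_reduce
    linarith
  have h2 : ∀ j ∈ Finset.range J, (∑ m ∈ Finset.Ioc (M + j * H) (M + j * H + H),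
      primeLog m * b j (m % q)) ≤ 2000 * H / q.totient * ∑ r ∈ Finset.range q, b j r := by
    intro j hj
    rw [← Finset.sum_fiberwise_of_maps_to (t := Finset.range q) (g := fun m => m % q)
      (fun m _ => Finset.mem_range.2 (Nat.mod_lt _ hq)), Finset.mul_sum]
    refine Finset.sum_le_sum fun r hr => ?_
    rw [Finset.sum_congr rfl fun m hm => by rw [(Finset.mem_filter.1 hm).2], ← Finset.sum_mul]
    refine mul_le_mul_of_nonneg_right ?_ (norm_nonneg _)
    rw [le_div_iff₀ hφ]
    have h3 := sum_primeLog_window_le (x := M + j * H) (V := H) (c := r) (Y := 2 * M) hq hqH (by omega) hMH 1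
    rw [one_mul, Nat.cast_one, one_mul] at h3
    refine le_trans (mul_le_mul_of_nonneg_right (le_of_eq ?_) hφ.le) h3
    rw [Finset.sum_filter]
    refine Finset.sum_congr rfl fun m hm => ?_
    have hrq := Finset.mem_range.1 hr
    have h4 : m ≤ 2 * M := by
      have := Finset.mem_Ioc.1 hm
      have h5 : (j + 1) * H ≤ J * H := Nat.mul_le_mul_right _ (Finset.mem_range.1 hj)
      rw [add_mul, one_mul] at h5
      omega
    have h5 : m ≡ r [MOD q] ↔ m % q = r := by rw [Nat.ModEq, Nat.mod_eq_of_lt hrq]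
    simp [h4, h5]
  have h3 : ∑ j ∈ Finset.range J, ∑ m ∈ Finset.Ioc (M + j * H) (M + j * H + H), primeLog m ≤ 12 * M := by
    rw [← sum_Ioc_add_mul, ← hM]
    have h4 := sum_primeLog_le (M + M)
    have h5 : ∑ m ∈ Finset.Ioc M (M + M), primeLog m ≤ ∑ m ∈ Finset.Ioc 0 (M + M), primeLog m :=
      Finset.sum_le_sum_of_subset_of_nonneg (Finset.Ioc_subset_Ioc_left (Nat.zero_le _))
        fun m _ _ => primeLog_nonneg m
    push_cast at h4
    linarith
  have h4 : ∑ j ∈ Finset.range J, ∑ r ∈ Finset.range q, b j r ≤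
      √(J * q * (q * (6 * Y * (2000 * V * (2 * J + 2 * k * G))) / q.totient)) := by
    refine Real.le_sqrt_of_sq_le ?_
    rw [← Finset.sum_product']
    refine (sq_sum_le_card_mul_sum_sq).trans ?_
    rw [Finset.card_product, Finset.card_range, Finset.card_range, Nat.cast_mul]
    refine mul_le_mul_of_nonneg_left ?_ (by positivity)
    rw [le_div_iff₀ hφ, Finset.sum_product' (f := fun j r => b j r ^ 2)]
    exact secondMoment_blockSum_le hq ha hH hqV hYV hYk hβ hG0 hG
  rw [e0]
  calc _ ≤ ∑ j ∈ Finset.range J, ∑ m ∈ Finset.Ioc (M + j * H) (M + j * H + H),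
        (primeLog m * E + primeLog m * b j (m % q)) := norm_sum_le_of_le _ h1
    _ = (∑ j ∈ Finset.range J, ∑ m ∈ Finset.Ioc (M + j * H) (M + j * H + H), primeLog m) * E +
        ∑ j ∈ Finset.range J, ∑ m ∈ Finset.Ioc (M + j * H) (M + j * H + H), primeLog m * b j (m % q) := by
        simp only [Finset.sum_add_distrib, Finset.sum_mul]
    _ ≤ 12 * M * E + ∑ j ∈ Finset.range J, 2000 * H / q.totient * ∑ r ∈ Finset.range q, b j r :=
        add_le_add (mul_le_mul_of_nonneg_right h3 hE0) (Finset.sum_le_sum h2)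
    _ = 12 * M * E + 2000 * H / q.totient * ∑ j ∈ Finset.range J, ∑ r ∈ Finset.range q, b j r := by
        rw [Finset.mul_sum]
    _ ≤ _ := by gcongr

lemma inv_card_add_one_le_prod (s : Finset ℕ) (hs : ∀ p ∈ s, 2 ≤ p) :
    ((s.card : ℝ) + 1)⁻¹ ≤ ∏ p ∈ s, (1 - (p : ℝ)⁻¹) := by
  induction s using Finset.induction_on_max with
  | empty => simp
  | insert a t ha ih =>
    have hat : a ∉ t := fun h => lt_irrefl _ (ha a h)
    rw [Finset.prod_insert hat, Finset.card_insert_of_notMem hat]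
    have ih' := ih fun p hp => hs p (Finset.mem_insert_of_mem hp)
    have h1 : t.card + 2 ≤ a := by
      have h2 : t ⊆ Finset.Ico 2 a := fun p hp =>
        Finset.mem_Ico.2 ⟨hs p (Finset.mem_insert_of_mem hp), ha p hp⟩
      have h3 := Finset.card_le_card h2
      have h4 := hs a (Finset.mem_insert_self _ _)
      rw [Nat.card_Ico] at h3; omega
    have h2 : ((t.card : ℝ) + 2) ≤ a := by exact_mod_cast h1
    have h3 : (a : ℝ)⁻¹ ≤ ((t.card : ℝ) + 2)⁻¹ := inv_anti₀ (by positivity) h2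
    have h4 : (1 - ((t.card : ℝ) + 2)⁻¹) ≤ 1 - (a : ℝ)⁻¹ := by linarith
    have h5 : (0 : ℝ) ≤ 1 - ((t.card : ℝ) + 2)⁻¹ := by
      rw [sub_nonneg]; exact inv_le_one_of_one_le₀ (by linarith [(Nat.cast_nonneg t.card : (0 : ℝ) ≤ _)])
    calc _ = (1 - ((t.card : ℝ) + 2)⁻¹) * ((t.card : ℝ) + 1)⁻¹ := by
          push_cast; field_simp; ring
      _ ≤ _ := mul_le_mul h4 ih' (by positivity) (h5.trans h4)

lemma pow_five_le_totient_pow_six {q : ℕ} (hq : 0 < q) : (q : ℝ) ^ 5 ≤ 2116 * (q.totient : ℝ) ^ 6 := by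
  set w := q.primeFactors.card with hw
  have h1 : (q : ℝ) ≤ (w + 1) * q.totient := by
    have h2 := inv_card_add_one_le_prod q.primeFactors fun p hp => (Nat.prime_of_mem_primeFactors hp).two_le
    have h3 : (q.totient : ℝ) = q * ∏ p ∈ q.primeFactors, (1 - (p : ℝ)⁻¹) := by
      have := congrArg (Rat.cast : ℚ → ℝ) (Nat.totient_eq_mul_prod_factors q)
      push_cast at this; exact this
    rw [h3]
    have h4 : (0 : ℝ) < w + 1 := by positivity
    calc (q : ℝ) = (w + 1) * (q * ((w : ℝ) + 1)⁻¹) := by field_simp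
      _ ≤ _ := by gcongr
  have h2 : (2 : ℝ) ^ w ≤ q := by
    have h3 : 2 ^ w ≤ ∏ p ∈ q.primeFactors, p :=
      Finset.pow_card_le_prod _ _ _ fun p hp => (Nat.prime_of_mem_primeFactors hp).two_le
    exact_mod_cast h3.trans (Nat.le_of_dvd hq (Nat.prod_primeFactors_dvd q))
  have h3 : ∀ n : ℕ, (n + 1) ^ 6 ≤ 2116 * 2 ^ n := by
    intro n
    rcases le_or_gt n 8 with h | h
    · interval_cases n <;> norm_num
    · induction n, h.le using Nat.le_induction with
      | base => norm_num
      | succ n hn ih =>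
        have h4 : (n + 1) ^ 6 ≤ 2116 * 2 ^ n := by
          rcases hn.eq_or_lt with rfl | hn'
          · norm_num
          · exact ih hn'
        have h5 : 9 * (n + 1 + 1) ≤ 10 * (n + 1) := by omega
        have h6 := Nat.pow_le_pow_left h5 6
        rw [mul_pow, mul_pow] at h6
        rw [pow_succ 2 n]
        norm_num at h6
        omega
  have h4 : ((w : ℝ) + 1) ^ 6 ≤ 2116 * q := by
    have : ((w : ℝ) + 1) ^ 6 ≤ 2116 * 2 ^ w := by exact_mod_cast h3 w
    linarith
  have hq' : (0 : ℝ) < q := by exact_mod_cast hq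
  have h5 : (q : ℝ) ^ 6 ≤ ((w + 1) * q.totient) ^ 6 := by gcongr
  rw [mul_pow] at h5
  have h6 : (q : ℝ) * (q : ℝ) ^ 5 ≤ q * (2116 * (q.totient : ℝ) ^ 6) :=
    calc (q : ℝ) * (q : ℝ) ^ 5 = (q : ℝ) ^ 6 := by ring
      _ ≤ ((w : ℝ) + 1) ^ 6 * (q.totient : ℝ) ^ 6 := h5
      _ ≤ 2116 * q * (q.totient : ℝ) ^ 6 := by gcongr
      _ = _ := by ring
  exact le_of_mul_le_mul_left h6 hq'

lemma sq_mul_sqrt_le_totient {q : ℕ} (hq : 0 < q) : (q : ℝ) ^ 2 * √q ≤ 46 * (q.totient : ℝ) ^ 3 := by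
  refine le_of_sq_le_sq ?_ (by positivity)
  rw [mul_pow, Real.sq_sqrt (Nat.cast_nonneg q)]
  have := pow_five_le_totient_pow_six hq
  nlinarith

set_option maxHeartbeats 1000000 in
/-- The type II sum over a dyadic interval on the major arcs. -/
lemma norm_bilinPart_dyadic_le {N M H J q a : ℕ} {β K κ ρ : ℝ} (hq : 0 < q) (ha : a.Coprime q)
    (hM : M = J * H) (hqK : (q : ℝ) ≤ K) (hβK : N * |β| ≤ K)
    (hκ : κ = max (q : ℝ) (N * |β|)) (hρ0 : 0 ≤ ρ) (hρ : ρ ^ 2 * √κ = 1)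
    (hKJ : 2 * K ≤ J) (hJM : 2 * J ^ 2 * K ^ 2 ≤ M) (hMN : 32 * K ^ 3 * M ≤ N) :
    ‖bilinPart N M (2 * M) (a / q + β)‖ ≤ 5000000 * N * ρ + 504 * N * K / J +
      12 * Real.log N * N / J + 12 * Real.log N * M := by
  have hq1 : (1 : ℝ) ≤ q := by exact_mod_cast hq
  have hK1 : 1 ≤ K := hq1.trans hqK
  have hJ0 : (0 : ℝ) < J := by linarith
  have hJ : 0 < J := by exact_mod_cast hJ0
  have hM0 : (0 : ℝ) < M := lt_of_lt_of_le (by positivity) hJM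
  have hMpos : 0 < M := by exact_mod_cast hM0
  have hMr : (M : ℝ) = J * H := by exact_mod_cast hM
  have hH : 2 * J * K ^ 2 ≤ H := by
    refine le_of_mul_le_mul_left ?_ hJ0
    rw [← hMr]; linarith
  have hb := abs_nonneg β
  have hqκ : (q : ℝ) ≤ κ := hκ ▸ le_max_left _ _
  have hβκ : N * |β| ≤ κ := hκ ▸ le_max_right _ _
  have hκK : κ ≤ K := hκ ▸ max_le hqK hβK
  have hκ1 : 1 ≤ κ := hq1.trans hqκ
  set t := √κ with ht
  have ht1 : 1 ≤ t := Real.one_le_sqrt.2 hκ1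
  have htt : t ^ 2 = κ := Real.sq_sqrt (by linarith)
  have hρ1 : ρ ^ 2 ≤ ρ := by
    have h1 : ρ ^ 2 ≤ 1 := by nlinarith [sq_nonneg ρ]
    have h2 : ρ ≤ 1 := by nlinarith
    nlinarith
  set k := ⌈t⌉₊ with hk
  have hkt : t ≤ k := Nat.le_ceil t
  have hk2 : (k : ℝ) ≤ 2 * t := by
    have := (Nat.ceil_lt_add_one (show 0 ≤ t by linarith)).le
    linarith
  have hk0 : (0 : ℝ) < k := by linarith
  have hkpos : 0 < k := by exact_mod_cast hk0
  have hkρ : 1 / (k : ℝ) ≤ ρ ^ 2 := by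
    rw [div_le_iff₀ hk0, ← hρ]; gcongr
  have hkK : (k : ℝ) ^ 2 ≤ 4 * K := by
    calc (k : ℝ) ^ 2 ≤ (2 * t) ^ 2 := by gcongr
      _ = 4 * κ := by rw [mul_pow, htt]; norm_num
      _ ≤ _ := by linarith
  have hkK' : (k : ℝ) ≤ 2 * K := by
    have : t * 1 ≤ t * t := by gcongr
    linarith
  set Y := N / M with hY
  set V := Y / k with hV
  have hYu : (Y : ℝ) * M ≤ N := by exact_mod_cast Nat.div_mul_le_self N M
  have hY1 : (N : ℝ) ≤ Y * M + M := by exact_mod_cast (Nat.lt_div_mul_add (a := N) hMpos).le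
  have hYK : 16 * K ^ 3 ≤ Y := by
    have h1 : 32 * K ^ 3 * M ≤ (Y + 1) * M := by linarith
    have h2 := le_of_mul_le_mul_right h1 hM0
    have h3 : 1 ≤ K ^ 3 := one_le_pow₀ hK1
    linarith
  have hY0 : (1 : ℝ) ≤ Y := by
    have h3 : 1 ≤ K ^ 3 := one_le_pow₀ hK1
    linarith
  have hYl : (N : ℝ) ≤ 2 * Y * M := by nlinarith
  have hVu : (V : ℝ) * k ≤ Y := by exact_mod_cast Nat.div_mul_le_self Y k
  have hV1 : (Y : ℝ) ≤ V * k + k := by exact_mod_cast (Nat.lt_div_mul_add (a := Y) hkpos).le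
  have hKK : K ≤ K ^ 3 := by
    calc K = K ^ 1 := (pow_one K).symm
      _ ≤ K ^ 3 := pow_le_pow_right₀ hK1 (by norm_num)
  have hVl : (Y : ℝ) ≤ 2 * k * V := by
    have : (1 : ℝ) * k ≤ V * k := by
      have h2 : 2 * (k : ℝ) ≤ V * k + k := by linarith
      linarith
    linarith
  have hqV : q < V := by
    have h1 : 4 * K * (4 * K ^ 2) ≤ 4 * K * V := by
      calc 4 * K * (4 * K ^ 2) = 16 * K ^ 3 := by ring
        _ ≤ (2 * k * V : ℝ) := hYK.trans hVl
        _ ≤ 2 * (2 * K) * V := by gcongr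
        _ = _ := by ring
    have h2 := le_of_mul_le_mul_left h1 (by linarith)
    have h3 : K * 1 ≤ K * K := by gcongr
    have : (q : ℝ) < V := by linarith
    exact_mod_cast this
  have hYV : Y * q ^ 2 ≤ V ^ 2 := by
    have h1 : 16 * K * (Y * q ^ 2 : ℝ) ≤ 16 * K * V ^ 2 := by
      calc 16 * K * (Y * q ^ 2 : ℝ) ≤ 16 * K * (Y * K ^ 2) := by gcongr
        _ = 16 * K ^ 3 * Y := by ring
        _ ≤ Y * Y := by gcongr
        _ ≤ (2 * k * V : ℝ) * (2 * k * V) := by gcongr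
        _ = 4 * k ^ 2 * V ^ 2 := by ring
        _ ≤ 4 * (4 * K) * V ^ 2 := by gcongr
        _ = _ := by ring
    exact_mod_cast le_of_mul_le_mul_left h1 (by linarith)
  have hYk : Y ≤ V + 2 * k * V := by
    have : Y ≤ 2 * k * V := by exact_mod_cast hVl
    omega
  have hqH : q < H := by
    have h1 : K * 1 ≤ K * K := by gcongr
    have h2 : 2 * 2 * K ^ 2 ≤ 2 * J * K ^ 2 := by gcongr; linarith
    have : (q : ℝ) < H := by linarith
    exact_mod_cast this
  have hMH : 2 * M * q ^ 2 ≤ H ^ 2 := by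
    have : 2 * (M : ℝ) * q ^ 2 ≤ (H : ℝ) ^ 2 := by
      calc 2 * (M : ℝ) * q ^ 2 ≤ 2 * M * K ^ 2 := by gcongr
        _ = (2 * J * K ^ 2) * H := by rw [hMr]; ring
        _ ≤ H * H := by gcongr
        _ = _ := by ring
    exact_mod_cast this
  have hHYβ : J * (H * Y * |β|) ≤ K := by
    calc J * (H * Y * |β|) = (Y * M) * |β| := by rw [hMr]; ring
      _ ≤ N * |β| := by gcongr
      _ ≤ K := hβK
  have hβ : H * Y * |β| ≤ 1 / 2 := by
    refine le_of_mul_le_mul_left (hHYβ.trans ?_) hJ0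
    linarith
  have hV0 : (0 : ℝ) < V := by
    have : 0 < V := by omega
    exact_mod_cast this
  obtain ⟨G, hG0, hG, hGρ⟩ : ∃ G : ℝ, 0 ≤ G ∧
      ((J : ℝ) ≤ G ∨ (β ≠ 0 ∧ 1 / (2 * (H * V * |β|)) ≤ G)) ∧
      (2 / k + 2 * G / J) ≤ 10 * ρ ^ 2 * √q := by
    have hsq : 1 ≤ √(q : ℝ) := Real.one_le_sqrt.2 hq1
    rcases le_total (N * |β|) q with h | h
    · refine ⟨J, hJ0.le, Or.inl le_rfl, ?_⟩
      have h1 : κ = q := by rw [hκ, max_eq_left h]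
      have h2 : ρ ^ 2 * √q = 1 := by rw [← h1]; exact hρ
      rw [mul_assoc, h2, mul_div_assoc, div_self hJ0.ne']
      have : 2 / (k : ℝ) ≤ 2 := by rw [div_le_iff₀ hk0]; linarith
      linarith
    · have h1 : κ = N * |β| := by rw [hκ, max_eq_right h]
      have hβ0 : 0 < |β| := by
        rcases hb.eq_or_lt with h0 | h0
        · rw [← h0, mul_zero] at h; linarith
        · exact h0
      have hH0 : (0 : ℝ) < H := by
        have : 0 < H := by omega
        exact_mod_cast this
      refine ⟨1 / (2 * (H * V * |β|)), by positivity, Or.inr ⟨abs_pos.1 hβ0, le_rfl⟩, ?_⟩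
      have h2 : 2 * (1 / (2 * (H * V * |β|))) / J ≤ 8 * ρ ^ 2 := by
        have h3 : 2 * (1 / (2 * (H * V * |β|))) / J = 1 / (M * V * |β|) := by
          rw [hMr]; field_simp
        rw [h3, div_le_iff₀ (by positivity)]
        have h4 : κ ≤ 8 * t * (M * V * |β|) := by
          calc κ = N * |β| := h1
            _ ≤ 2 * Y * M * |β| := by gcongr
            _ ≤ 2 * (2 * k * V) * M * |β| := by gcongr
            _ ≤ 2 * (2 * (2 * t) * V) * M * |β| := by gcongr
            _ = _ := by ring
        have h5 : ρ ^ 2 * κ = t := by rw [← htt, sq t, ← mul_assoc, hρ, one_mul]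
        have h6 : t * 1 ≤ t * (8 * ρ ^ 2 * (M * V * |β|)) := by
          calc t * 1 = ρ ^ 2 * κ := by rw [h5, mul_one]
            _ ≤ ρ ^ 2 * (8 * t * (M * V * |β|)) := by gcongr
            _ = _ := by ring
        exact le_of_mul_le_mul_left h6 (by linarith)
      have h3 : 2 / (k : ℝ) ≤ 2 * ρ ^ 2 := by
        calc 2 / (k : ℝ) = 2 * (1 / k) := by ring
          _ ≤ _ := by gcongr
      calc _ ≤ 10 * ρ ^ 2 := by linarith
        _ ≤ _ := le_mul_of_one_le_right (by positivity) hsq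
  have hmain := norm_bilinPart_le hq ha hJ hM hY (Nat.div_le_self Y k) hqV hYV hYk hqH hMH hβ hG0 hG
  have hφ : (0 : ℝ) < q.totient := by exact_mod_cast Nat.totient_pos.2 hq
  have hL := Real.log_natCast_nonneg N
  refine hmain.trans ?_
  have hsecond : 2000 * H / q.totient *
      √(J * q * (q * (6 * Y * (2000 * V * (2 * J + 2 * k * G))) / q.totient)) ≤ 4900000 * N * ρ := by
    rw [← Real.sqrt_sq (show 0 ≤ 2000 * (H : ℝ) / q.totient by positivity),
      ← Real.sqrt_mul (sq_nonneg _)]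
    refine Real.sqrt_le_iff.2 ⟨by positivity, ?_⟩
    have h1 := sq_mul_sqrt_le_totient hq
    have hsq : 0 < √(q : ℝ) := Real.sqrt_pos.2 (by linarith)
    have h2 : (q : ℝ) ^ 2 * √q / q.totient ^ 3 ≤ 46 := by
      rw [div_le_iff₀ (by positivity)]; exact h1
    have h3 : (M : ℝ) * V * k ≤ N := by
      calc (M : ℝ) * V * k = M * (V * k) := by ring
        _ ≤ M * Y := by gcongr
        _ ≤ N := by linarith
    calc (2000 * (H : ℝ) / q.totient) ^ 2 *
          (J * q * (q * (6 * Y * (2000 * V * (2 * J + 2 * k * G))) / q.totient))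
        = 48000000000 * (Y * M) * (M * V * k) * ((2 / k + 2 * G / J) / √q) *
          ((q : ℝ) ^ 2 * √q / q.totient ^ 3) := by
          rw [hMr]; field_simp; ring
      _ ≤ 48000000000 * N * N * (10 * ρ ^ 2) * 46 := by
          have h4 : (2 / k + 2 * G / J) / √q ≤ 10 * ρ ^ 2 := by rw [div_le_iff₀ hsq]; exact hGρ
          have h5 : 0 ≤ (2 / k + 2 * G / J) / √q := by positivity
          gcongr
      _ ≤ (4900000 * N * ρ) ^ 2 := by nlinarith [sq_nonneg (N * ρ)]
  have hfirst : 12 * M * (6 * V + 42 * Y ^ 2 * H * |β| + Real.log N * (N * H / M ^ 2 + 1)) ≤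
      72 * N * ρ + 504 * N * K / J + 12 * Real.log N * N / J + 12 * Real.log N * M := by
    have h1 : (M : ℝ) * V ≤ N * ρ := by
      have h3 : (M : ℝ) * V * k ≤ N := by
        calc (M : ℝ) * V * k = M * (V * k) := by ring
          _ ≤ M * Y := by gcongr
          _ ≤ N := by linarith
      calc (M : ℝ) * V ≤ N / k := by rwa [le_div_iff₀ hk0]
        _ = N * (1 / k) := by ring
        _ ≤ N * ρ := by gcongr; exact hkρ.trans hρ1
    have h2 : (M : ℝ) * (Y ^ 2 * H * |β|) ≤ N * K / J := by
      rw [le_div_iff₀ hJ0]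
      calc (M : ℝ) * (Y ^ 2 * H * |β|) * J = (Y * M) * (J * (H * Y * |β|)) := by ring
        _ ≤ N * K := by gcongr
    have h3 : (M : ℝ) * (N * H / M ^ 2) = N / J := by
      have hH0 : (H : ℝ) ≠ 0 := by rintro h; rw [h, mul_zero] at hMr; exact hM0.ne' hMr
      rw [hMr]; field_simp
    calc _ = 72 * (M * V) + 504 * (M * (Y ^ 2 * H * |β|)) + 12 * Real.log N * (M * (N * H / M ^ 2)) +
          12 * Real.log N * M := by ring
      _ ≤ 72 * (N * ρ) + 504 * (N * K / J) + 12 * Real.log N * (N / J) + 12 * Real.log N * M := by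
          rw [h3]; gcongr
      _ = _ := by ring
  have : 0 ≤ N * ρ := by positivity
  linarith

lemma eventually_log_pow_le_exp_sqrt (B : ℕ) (c : ℝ) :
    ∀ᶠ N : ℕ in atTop, c * Real.log N ^ B ≤ Real.exp (√(Real.log N) / 2) := by
  have h1 : Tendsto (fun N : ℕ => √(Real.log N)) atTop atTop :=
    Real.tendsto_sqrt_atTop.comp tendsto_log_nat
  have h2 := (isLittleO_pow_exp_pos_mul_atTop (2 * B) (show (0 : ℝ) < 1 / 2 by norm_num)).const_mul_left c
  filter_upwards [h1.eventually (h2.bound zero_lt_one)] with N hN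
  rw [one_mul, pow_mul, Real.sq_sqrt (Real.log_natCast_nonneg N), Real.norm_of_nonneg (Real.exp_pos _).le]
    at hN
  refine (le_abs_self _).trans (hN.trans (le_of_eq ?_))
  congr 1; ring

lemma exp_half_le_two_pow {x : ℝ} {s : ℕ} (h : x ≤ s) : Real.exp (x / 2) ≤ 2 ^ s := by
  calc Real.exp (x / 2) ≤ Real.exp (s * Real.log 2) := by
        have := Real.log_two_gt_d9
        have h2 : (0 : ℝ) ≤ s := Nat.cast_nonneg s
        exact Real.exp_le_exp.2 (by nlinarith)
    _ = 2 ^ s := by rw [Real.exp_nat_mul, Real.exp_log two_pos]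

lemma natLog_two_le {N : ℕ} (hN : 0 < N) : (Nat.log 2 N : ℝ) ≤ 2 * Real.log N := by
  have h1 : ((2 : ℝ) ^ Nat.log 2 N) ≤ N := by exact_mod_cast Nat.pow_log_le_self 2 hN.ne'
  have h2 := Real.log_le_log (by positivity) h1
  rw [Real.log_pow] at h2
  have := Real.log_two_gt_d9
  have h3 : (0 : ℝ) ≤ Nat.log 2 N := Nat.cast_nonneg _
  nlinarith

lemma bilin_primeLog_eq (N : ℕ) (x : ℝ) : bilin N primeLog primeLog x =
    ∑ i ∈ Finset.range (Nat.log 2 N + 1), bilinPart N (2 ^ i) (2 * 2 ^ i) x := by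
  have h1 : ∀ t : ℕ, ∑ i ∈ Finset.range t, bilinPart N (2 ^ i) (2 * 2 ^ i) x = bilinPart N 1 (2 ^ t) x := by
    intro t
    induction t with
    | zero => simp [bilinPart]
    | succ t ih =>
      rw [Finset.sum_range_succ, ih]
      unfold bilinPart
      rw [Finset.sum_Ioc_consecutive _ Nat.one_le_two_pow (by omega), pow_succ, mul_comm 2]
  rw [h1, bilin, bilinPart]
  have hlt : N ≤ 2 ^ (Nat.log 2 N + 1) := (Nat.lt_pow_succ_log_self one_lt_two N).le
  symm
  rcases Nat.eq_zero_or_pos N with rfl | hN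
  · simp
  have h2 : ∀ m ∈ Finset.Ioc 0 (2 ^ (Nat.log 2 N + 1)), m ∉ Finset.Ioc 1 (2 ^ (Nat.log 2 N + 1)) →
      ∑ n ∈ Finset.Ioc 0 (N / m), ((primeLog m * primeLog n : ℝ) : ℂ) * ex ((m * n : ℕ) * x) = 0 := by
    intro m hm hm'
    have : m = 1 := by simp only [Finset.mem_Ioc] at hm hm'; omega
    have h0 : primeLog m = 0 := by rw [this, primeLog_apply, if_neg Nat.not_prime_one]
    simp [h0]
  rw [Finset.sum_subset (Finset.Ioc_subset_Ioc_left zero_le_one) h2]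
  symm
  refine Finset.sum_subset (Finset.Ioc_subset_Ioc_right hlt) fun m hm hm' => ?_
  rw [Nat.div_eq_of_lt]
  · simp
  · simp only [Finset.mem_Ioc] at hm hm'; omega

lemma norm_bilinPart_le_trivial {N M : ℕ} (hM : 0 < M) (x : ℝ) :
    ‖bilinPart N M (2 * M) x‖ ≤ 72 * N := by
  have hM' : (0 : ℝ) < M := by exact_mod_cast hM
  have h1 : ∀ m ∈ Finset.Ioc M (2 * M), ‖∑ n ∈ Finset.Ioc 0 (N / m),
      ((primeLog m * primeLog n : ℝ) : ℂ) * ex ((m * n : ℕ) * x)‖ ≤ primeLog m * (6 * (N / M)) := by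
    intro m hm
    rw [Finset.mem_Ioc] at hm
    have h2 : ∀ n ∈ Finset.Ioc 0 (N / m), ‖((primeLog m * primeLog n : ℝ) : ℂ) * ex ((m * n : ℕ) * x)‖ ≤
        primeLog m * primeLog n := fun n _ => by
      rw [norm_mul, norm_ex, mul_one, norm_real,
        Real.norm_of_nonneg (mul_nonneg (primeLog_nonneg m) (primeLog_nonneg n))]
    refine (norm_sum_le_of_le _ h2).trans ?_
    rw [← Finset.mul_sum]
    refine mul_le_mul_of_nonneg_left ((sum_primeLog_le _).trans ?_) (primeLog_nonneg m)
    have h3 : ((N / m : ℕ) : ℝ) ≤ N / m := Nat.cast_div_le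
    have h4 : (N : ℝ) / m ≤ N / M := by
      have : (M : ℝ) ≤ m := by exact_mod_cast hm.1.le
      gcongr
    linarith
  refine (norm_sum_le_of_le _ h1).trans ?_
  rw [← Finset.sum_mul]
  have h2 : ∑ m ∈ Finset.Ioc M (2 * M), primeLog m ≤ 12 * M := by
    refine le_trans (Finset.sum_le_sum_of_subset_of_nonneg (Finset.Ioc_subset_Ioc_left (Nat.zero_le _))
      fun m _ _ => primeLog_nonneg m) ((sum_primeLog_le _).trans (le_of_eq ?_))
    push_cast; ring
  calc _ ≤ 12 * (M : ℝ) * (6 * (N / M)) := by gcongr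
    _ = 72 * N := by field_simp; ring

lemma eventually_norm_bilin_primeLog_le (B : ℕ) : ∀ᶠ N : ℕ in atTop, ∀ (q a : ℕ) (β ρ : ℝ),
    0 < q → a.Coprime q → (q : ℝ) ≤ Real.log N ^ B → N * |β| ≤ Real.log N ^ B →
    0 ≤ ρ → ρ ^ 2 * √(max (q : ℝ) (N * |β|)) = 1 →
    ‖bilin N primeLog primeLog (a / q + β)‖ ≤ 20000000 * N * (Real.log N * ρ + √(Real.log N)) := by
  filter_upwards [eventually_log_pow_le_exp_sqrt (4 * B + 8) 32, tendsto_log_nat.eventually_ge_atTop 2,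
    eventually_gt_atTop 0] with N hA hL2 hN q a β ρ hq ha hqL hβL hρ0 hρ
  set L := Real.log N with hL
  have hL1 : 1 ≤ L := by linarith
  have hsq1 : 1 ≤ √L := Real.one_le_sqrt.2 hL1
  set n := Nat.log 2 N with hn
  have hnL : (n : ℝ) ≤ 2 * L := natLog_two_le hN
  set s := ⌈√L⌉₊ with hs
  have hs2 : (s : ℝ) ≤ 2 * √L := by
    have := (Nat.ceil_lt_add_one (show 0 ≤ √L by linarith)).le
    linarith
  have hA2 : 32 * L ^ (4 * B + 8) ≤ 2 ^ s := hA.trans (exp_half_le_two_pow (Nat.le_ceil _))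
  have hpow : ∀ i ≤ 4 * B + 8, L ^ i ≤ L ^ (4 * B + 8) := fun i hi => pow_le_pow_right₀ hL1 hi
  obtain ⟨b, hb1, hb2⟩ := exists_nat_pow_near (show 1 ≤ L ^ (B + 2) from one_le_pow₀ hL1) one_lt_two
  have hN0 : (0 : ℝ) < N := by exact_mod_cast hN
  have hmain : ∀ i ∈ Finset.range (n + 1), ‖bilinPart N (2 ^ i) (2 * 2 ^ i) (a / q + β)‖ ≤
      (5000000 * N * ρ + 528 * (N / L)) + if s ≤ i ∧ i + s ≤ n then (0 : ℝ) else 72 * N := by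
    intro i hi
    have hr : 0 ≤ 5000000 * N * ρ + 528 * (N / L) := by positivity
    split_ifs with h
    · have hsi : (2 : ℝ) ^ s ≤ 2 ^ i := pow_le_pow_right₀ one_le_two h.1
      have hJ2 : (2 : ℝ) ^ (b + 1) ≤ 2 * L ^ (B + 2) := by rw [pow_succ]; linarith
      have hbi : b + 1 ≤ i := by
        have h1 : (2 : ℝ) ^ (b + 1) ≤ 2 ^ i := by
          have := hpow (B + 2) (by omega)
          have : 0 ≤ L ^ (4 * B + 8) := by positivity
          linarith
        exact (pow_le_pow_iff_right₀ one_lt_two).1 h1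
      have hiN : (2 : ℝ) ^ s * 2 ^ i ≤ N := by
        calc (2 : ℝ) ^ s * 2 ^ i ≤ 2 ^ n := by
              rw [← pow_add]; exact pow_le_pow_right₀ one_le_two (by omega)
          _ ≤ N := by exact_mod_cast Nat.pow_log_le_self 2 hN.ne'
      have hLB : (1 : ℝ) ≤ L ^ B := one_le_pow₀ hL1
      have hJ1 : L ^ B * L ^ 2 ≤ 2 ^ (b + 1) := by rw [← pow_add]; exact hb2.le
      have hLL : 2 ≤ L ^ 2 := by nlinarith
      have key := norm_bilinPart_dyadic_le (N := N) (M := 2 ^ i) (J := 2 ^ (b + 1)) (H := 2 ^ (i - (b + 1)))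
        (K := L ^ B) hq ha (by rw [← pow_add]; congr 1; omega) hqL hβL rfl hρ0 hρ
        (by
          push_cast
          calc 2 * L ^ B = L ^ B * 2 := mul_comm _ _
            _ ≤ L ^ B * L ^ 2 := by gcongr
            _ ≤ _ := hJ1)
        (by
          push_cast
          calc 2 * ((2 : ℝ) ^ (b + 1)) ^ 2 * (L ^ B) ^ 2 ≤ 2 * (2 * L ^ (B + 2)) ^ 2 * (L ^ B) ^ 2 := by gcongr
            _ = 8 * L ^ (4 * B + 4) := by ring
            _ ≤ 32 * L ^ (4 * B + 8) := by
              have := hpow (4 * B + 4) (by omega)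
              have : 0 ≤ L ^ (4 * B + 8) := by positivity
              linarith
            _ ≤ _ := hA2.trans hsi)
        (by
          push_cast
          refine le_trans ?_ hiN
          refine mul_le_mul_of_nonneg_right (le_trans ?_ hA2) (by positivity)
          rw [← pow_mul]
          have := hpow (B * 3) (by omega)
          linarith)
      rw [add_zero]
      push_cast at key
      refine key.trans ?_
      have e1 : 504 * N * L ^ B / 2 ^ (b + 1) ≤ 504 * (N / L) := by
        rw [div_le_iff₀ (by positivity)]
        calc 504 * N * L ^ B = 504 * (N / L) * (L ^ B * L ^ 1) := by field_simp
          _ ≤ 504 * (N / L) * (L ^ B * L ^ 2) := by gcongr <;> norm_num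
          _ ≤ _ := by gcongr
      have e2 : 12 * L * N / 2 ^ (b + 1) ≤ 12 * (N / L) := by
        rw [div_le_iff₀ (by positivity)]
        calc 12 * L * N = 12 * (N / L) * (1 * L ^ 2) := by field_simp
          _ ≤ 12 * (N / L) * (L ^ B * L ^ 2) := by gcongr
          _ ≤ _ := by gcongr
      have e3 : 12 * L * 2 ^ i ≤ 12 * (N / L) := by
        have h3 : L * 2 ^ i ≤ N / L := by
          rw [le_div_iff₀ (by linarith)]
          refine le_trans ?_ hiN
          have := hpow 2 (by omega)
          have h5 : L ^ 2 ≤ 2 ^ s := by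
            have : 0 ≤ L ^ (4 * B + 8) := by positivity
            linarith
          calc L * 2 ^ i * L = L ^ 2 * 2 ^ i := by ring
            _ ≤ _ := by gcongr
        linarith
      linarith
    · have := norm_bilinPart_le_trivial (N := N) (show 0 < 2 ^ i by positivity) (a / q + β)
      linarith
  rw [bilin_primeLog_eq]
  refine (norm_sum_le_of_le _ hmain).trans ?_
  rw [Finset.sum_add_distrib, Finset.sum_const, Finset.card_range, nsmul_eq_mul]
  have hcount : ∑ i ∈ Finset.range (n + 1), (if s ≤ i ∧ i + s ≤ n then (0 : ℝ) else 72 * N) ≤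
      2 * s * (72 * N) := by
    have e1 : ∀ i, (if s ≤ i ∧ i + s ≤ n then (0 : ℝ) else 72 * N) =
        if ¬ (s ≤ i ∧ i + s ≤ n) then (72 * N : ℝ) else 0 := fun i => by split_ifs <;> simp_all
    rw [Finset.sum_congr rfl fun i _ => e1 i, ← Finset.sum_filter, Finset.sum_const, nsmul_eq_mul]
    refine mul_le_mul_of_nonneg_right ?_ (by positivity)
    have h1 : (Finset.range (n + 1)).filter (fun i => ¬ (s ≤ i ∧ i + s ≤ n)) ⊆
        Finset.range s ∪ Finset.Ico (n + 1 - s) (n + 1) := by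
      intro i hi
      simp only [Finset.mem_filter, Finset.mem_range, Finset.mem_union, Finset.mem_Ico] at hi ⊢
      omega
    have h2 := (Finset.card_le_card h1).trans (Finset.card_union_le _ _)
    rw [Finset.card_range, Nat.card_Ico] at h2
    have h3 : ((Finset.range (n + 1)).filter (fun i => ¬ (s ≤ i ∧ i + s ≤ n))).card ≤ 2 * s := by omega
    exact_mod_cast h3
  push_cast
  calc _ ≤ (2 * L + L) * (5000000 * N * ρ + 528 * (N / L)) + 2 * (2 * √L) * (72 * N) := by
        refine add_le_add ?_ (hcount.trans (by gcongr))
        refine mul_le_mul_of_nonneg_right (by linarith) (by positivity)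
    _ = 15000000 * (N * (L * ρ)) + 1584 * N + 288 * (N * √L) := by field_simp; ring
    _ ≤ 20000000 * N * (L * ρ + √L) := by
        have h1 : N * 1 ≤ N * √L := by gcongr
        have h2 : 0 ≤ N * (L * ρ) := by positivity
        linarith

lemma norm_sum_units_expSum_primes_le {q : ℕ} (hq : 0 < q) (N : ℕ) (β : ℝ) :
    ‖∑ b ∈ units q, expSum (primesIoc 0 N) (fun n => Real.log n) (b / q + β)‖ ≤
      2 * N + q.totient * (q * Real.log q) := by
  set w : ℕ → ℝ := fun n => Real.log n with hw
  have hw0 : ∀ n, 0 ≤ w n := fun n => Real.log_natCast_nonneg n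
  set s := primesIoc 0 N
  set s₁ := s.filter (·.Coprime q)
  set s₂ := s.filter (¬ ·.Coprime q)
  have h1 : ∀ x, expSum s w x = expSum s₁ w x + expSum s₂ w x := fun x =>
    (Finset.sum_filter_add_sum_filter_not s _ _).symm
  have h2 : ‖∑ b ∈ units q, expSum s₁ w (b / q + β)‖ ≤ 2 * N := by
    simp_rw [fun b : ℕ => add_comm ((b : ℝ) / q) β]
    rw [sum_units_expSum w hq (fun n hn => (Finset.mem_filter.1 hn).2), norm_mul]
    have h3 : ‖((ArithmeticFunction.moebius q : ℤ) : ℂ)‖ ≤ 1 := by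
      rw [Complex.norm_intCast]; exact_mod_cast ArithmeticFunction.abs_moebius_le_one
    have h4 : ‖expSum s₁ w β‖ ≤ 2 * N := by
      refine (norm_expSum_le s₁ (fun n _ => hw0 n) β).trans ?_
      refine le_trans ?_ (sum_primesIoc_log_le 0 N)
      exact Finset.sum_le_sum_of_subset_of_nonneg (Finset.filter_subset _ _) fun n _ _ => hw0 n
    calc _ ≤ 1 * (2 * (N : ℝ)) := by gcongr
      _ = _ := one_mul _
  have h3 : ∀ b ∈ units q, ‖expSum s₂ w (b / q + β)‖ ≤ q * Real.log q := by
    intro b _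
    refine (norm_expSum_le s₂ (fun n _ => hw0 n) _).trans ?_
    have hs : s₂ ⊆ Finset.Ioc 0 q := by
      intro p hp
      obtain ⟨hp1, hp2⟩ := Finset.mem_filter.1 hp
      have hpp := (mem_primesIoc.1 hp1).2
      rw [hpp.coprime_iff_not_dvd, not_not] at hp2
      exact Finset.mem_Ioc.2 ⟨hpp.pos, Nat.le_of_dvd hq hp2⟩
    calc ∑ n ∈ s₂, w n ≤ ∑ n ∈ Finset.Ioc 0 q, w n :=
          Finset.sum_le_sum_of_subset_of_nonneg hs fun n _ _ => hw0 n
      _ ≤ ∑ n ∈ Finset.Ioc 0 q, Real.log q := Finset.sum_le_sum fun n hn => by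
          rw [Finset.mem_Ioc] at hn
          exact Real.log_le_log (by exact_mod_cast hn.1) (by exact_mod_cast hn.2)
      _ = _ := by simp
  rw [Finset.sum_congr rfl fun b _ => h1 _, Finset.sum_add_distrib]
  refine (norm_add_le _ _).trans (add_le_add h2 ((norm_sum_le_of_le _ h3).trans (le_of_eq ?_)))
  rw [Finset.sum_const, card_units, nsmul_eq_mul]

/-- The bound for the exponential sum over primes on the major arcs. -/
lemma exists_norm_expSum_primes_le : ∃ C : ℝ, 0 ≤ C ∧ ∀ B : ℕ, ∀ᶠ N : ℕ in atTop,
    ∀ (q a : ℕ) (β ρ : ℝ), 0 < q → a.Coprime q → (q : ℝ) ≤ Real.log N ^ B →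
    N * |β| ≤ Real.log N ^ B → 0 ≤ ρ → ρ ^ 2 * √(max (q : ℝ) (N * |β|)) = 1 →
    ‖expSum (primesIoc 0 N) (fun n => Real.log n) (a / q + β)‖ ≤
      C * (N * (ρ + 1 / √(Real.log N))) := by
  obtain ⟨C₀, hC₀, happrox⟩ := exists_selberg_approx
  refine ⟨2 * C₀ + 100000000, by positivity, fun B => ?_⟩
  filter_upwards [eventually_norm_bilin_primeLog_le B, eventually_selbergSum_le B,
    tendsto_log_nat.eventually_ge_atTop 2, eventually_ge_atTop 2,
    eventually_log_pow_le (2 * B + 1) 1 (show (0 : ℝ) < 1 by norm_num)]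
    with N hII hT hL2 hN2 hsmall q a β ρ hq ha hqL hβL hρ0 hρ
  specialize happrox N hN2
  set L := Real.log N with hL
  set F : ℝ → ℂ := expSum (primesIoc 0 N) (fun n => Real.log n) with hF
  have hN0 : (0 : ℝ) < N := by positivity
  have hLpos : 0 < L := by linarith
  have hsq1 : 1 ≤ √L := Real.one_le_sqrt.2 (by linarith)
  have hsqsq : √L * √L = L := Real.mul_self_sqrt hLpos.le
  have hq1 : (1 : ℝ) ≤ q := by exact_mod_cast hq
  set κ := max (q : ℝ) (N * |β|) with hκ
  have hκ1 : 1 ≤ κ := hq1.trans (le_max_left _ _)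
  have hρ4 : ρ ^ 4 * κ = 1 := by
    have h1 : √κ ^ 2 = κ := Real.sq_sqrt (by linarith)
    calc ρ ^ 4 * κ = (ρ ^ 2 * √κ) ^ 2 := by rw [mul_pow, h1]; ring
      _ = 1 := by rw [hρ, one_pow]
  have hρ1 : ρ ≤ 1 := by
    by_contra! h
    have : 1 < ρ ^ 4 := one_lt_pow₀ h (by norm_num)
    nlinarith
  have hρ4' : ρ ^ 4 ≤ ρ := by
    calc ρ ^ 4 ≤ ρ ^ 1 := pow_le_pow_of_le_one hρ0 hρ1 (by norm_num)
      _ = ρ := pow_one ρ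
  have hrw : L * (N * (ρ + 1 / √L)) = N * (L * ρ + √L) := by
    have : L / √L = √L := by rw [div_eq_iff (by positivity)]; exact hsqsq.symm
    calc L * (N * (ρ + 1 / √L)) = N * (L * ρ + L / √L) := by ring
      _ = _ := by rw [this]
  set X := N * (L * ρ + √L) with hX
  have hX1 : N * √L ≤ X := by
    have : 0 ≤ N * (L * ρ) := by positivity
    rw [hX, mul_add]; linarith
  have hX2 : N * (L * ρ) ≤ X := by
    have : 0 ≤ N * √L := by positivity
    rw [hX, mul_add]; linarith
  have hX3 : (N : ℝ) ≤ X := le_trans (by simpa using mul_le_mul_of_nonneg_left hsq1 hN0.le) hX1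
  have hdist : ∀ b : ℕ, b.Coprime q → ‖L * F (b / q + β) - selbergSum N (b / q + β)‖ ≤
      (C₀ + 20000000) * X := by
    intro b hb
    have h1 := happrox (b / q + β)
    have h2 := hII q b β ρ hq hb hqL hβL hρ0 hρ
    have h3 : L * F (b / q + β) - selbergSum N (b / q + β) =
        (L * F (b / q + β) - selbergSum N (b / q + β) + bilin N primeLog primeLog (b / q + β)) -
        bilin N primeLog primeLog (b / q + β) := by ring
    rw [h3]
    refine (norm_sub_le _ _).trans ((add_le_add h1 h2).trans ?_)
    have : C₀ * N ≤ C₀ * X := by gcongr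
    rw [hX] at this ⊢
    linarith
  suffices h : L * ‖F (a / q + β)‖ ≤ (2 * C₀ + 100000000) * X by
    refine le_of_mul_le_mul_left ?_ hLpos
    calc L * ‖F (a / q + β)‖ ≤ (2 * C₀ + 100000000) * X := h
      _ = L * ((2 * C₀ + 100000000) * (N * (ρ + 1 / √L))) := by rw [← hrw]; ring
  have hnormL : ∀ z : ℂ, ‖(L : ℂ) * z‖ = L * ‖z‖ := fun z => by
    rw [norm_mul, norm_real, Real.norm_of_nonneg hLpos.le]
  have hX0 : 0 ≤ X := hN0.le.trans hX3
  rcases le_total (q : ℝ) (N * |β|) with hcase | hcase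
  · have hκe : κ = N * |β| := max_eq_right hcase
    have hβ0 : 0 < |β| := by
      rcases (abs_nonneg β).eq_or_lt with h0 | h0
      · rw [← h0, mul_zero] at hcase; linarith
      · exact h0
    have h1 := (hT q a β hq hqL ha hβL).1
    have h2 : ‖selbergSum N (a / q + β)‖ ≤ 201 * X := by
      refine le_of_mul_le_mul_left (h1.trans ?_) hβ0
      have h3 : L ≤ |β| * (N * (L * ρ)) := by
        calc L = L * (ρ ^ 4 * κ) := by rw [hρ4, mul_one]
          _ ≤ L * (ρ * κ) := by gcongr
          _ = _ := by rw [hκe]; ring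
      have h4 : |β| * (N * √L) ≤ |β| * (201 * (N * √L)) := by
        have : 0 ≤ N * √L := by positivity
        exact mul_le_mul_of_nonneg_left (by linarith) hβ0.le
      rw [hX]
      linarith
    have h3 := norm_sub_norm_le ((L : ℂ) * F (a / q + β)) (selbergSum N (a / q + β))
    have h4 := hdist a ha
    rw [hnormL] at h3
    have : 0 ≤ C₀ * X := by positivity
    linarith
  · have hκe : κ = q := max_eq_left hcase
    set φ : ℝ := (q.totient : ℝ) with hφdef
    have hφ : (0 : ℝ) < φ := by rw [hφdef]; exact_mod_cast Nat.totient_pos.2 hq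
    have hdiff : ∀ b ∈ units q, ‖(L : ℂ) * (F (a / q + β) - F (b / q + β))‖ ≤
        (2 * C₀ + 40000002) * X := by
      intro b hb
      have hb' : b.Coprime q := Nat.Coprime.symm (Finset.mem_filter.1 hb).2
      have h1 := (hT q a β hq hqL ha hβL).2 b hb'
      have h2 := hdist a ha
      have h3 := hdist b hb'
      have h4 : (L : ℂ) * (F (a / q + β) - F (b / q + β)) =
          (L * F (a / q + β) - selbergSum N (a / q + β)) - (L * F (b / q + β) - selbergSum N (b / q + β))
          + (selbergSum N (a / q + β) - selbergSum N (b / q + β)) := by ring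
      rw [h4]
      refine (norm_add_le _ _).trans ((add_le_add (norm_sub_le _ _) le_rfl).trans ?_)
      linarith
    have hsum : ((φ : ℝ) : ℂ) * (L * F (a / q + β)) =
        ∑ b ∈ units q, (L : ℂ) * (F (a / q + β) - F (b / q + β)) + L * ∑ b ∈ units q, F (b / q + β) := by
      rw [Finset.mul_sum, ← Finset.sum_add_distrib]
      simp_rw [← mul_add, sub_add_cancel]
      rw [Finset.sum_const, card_units, nsmul_eq_mul, hφdef, ofReal_natCast]
    have h1 : φ * (L * ‖F (a / q + β)‖) ≤
        φ * ((2 * C₀ + 40000002) * X) + L * (2 * N + φ * (q * Real.log q)) := by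
      have h2 := congrArg norm hsum
      rw [norm_mul, norm_real, Real.norm_of_nonneg hφ.le, hnormL] at h2
      rw [h2]
      refine (norm_add_le _ _).trans (add_le_add ?_ ?_)
      · refine (norm_sum_le_of_le _ hdiff).trans (le_of_eq ?_)
        rw [Finset.sum_const, card_units, nsmul_eq_mul]
      · rw [hnormL]
        exact mul_le_mul_of_nonneg_left (norm_sum_units_expSum_primes_le hq N β) hLpos.le
    have h2 : 1 ≤ 46 * (φ * ρ) := by
      by_contra! h
      have h3 := sq_mul_sqrt_le_totient hq
      have h4 : (46 * (φ * ρ)) ^ 3 < 1 := pow_lt_one₀ (by positivity) h (by norm_num)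
      have h5 : (1 : ℝ) ≤ (q : ℝ) ^ 2 * ρ := by
        rw [hκe] at hρ4
        have h7 : ρ ^ 4 * q ≤ ρ * q := by gcongr
        calc (1 : ℝ) ≤ ρ * q := by rw [← hρ4]; exact h7
          _ ≤ ρ * (q * q) := by gcongr; exact le_mul_of_one_le_left (by linarith) hq1
          _ = _ := by ring
      have h6 : (q : ℝ) ^ 2 * √q * ρ ^ 3 = q ^ 2 * ρ := by
        rw [hκe] at hρ
        calc (q : ℝ) ^ 2 * √q * ρ ^ 3 = q ^ 2 * ρ * (ρ ^ 2 * √q) := by ring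
          _ = _ := by rw [hρ, mul_one]
      have h7 : (q : ℝ) ^ 2 * √q * ρ ^ 3 ≤ 46 * φ ^ 3 * ρ ^ 3 := by gcongr
      have h8 : 0 ≤ φ ^ 3 * ρ ^ 3 := by positivity
      nlinarith
    have h3 : (q : ℝ) * Real.log q * L ≤ N := by
      have h4 : Real.log q ≤ q := (Real.log_le_sub_one_of_pos (by linarith)).trans (by linarith)
      calc (q : ℝ) * Real.log q * L ≤ L ^ B * L ^ B * L := by gcongr; exact h4.trans hqL
        _ = 1 * L ^ (2 * B + 1) := by ring
        _ ≤ (N : ℝ) ^ (1 : ℝ) := hsmall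
        _ = N := Real.rpow_one _
    refine le_of_mul_le_mul_left (h1.trans ?_) hφ
    have h4 : L * N ≤ φ * (46 * X) := by
      calc L * N = L * N * 1 := (mul_one _).symm
        _ ≤ L * N * (46 * (φ * ρ)) := by gcongr
        _ = φ * (46 * (N * (L * ρ))) := by ring
        _ ≤ _ := by gcongr
    have h5 : φ * ((q : ℝ) * Real.log q * L) ≤ φ * X := by gcongr; exact h3.trans hX3
    have h6 : 0 ≤ φ * X := by positivity
    calc _ = φ * ((2 * C₀ + 40000002) * X) + 2 * (L * N) + φ * (q * Real.log q * L) := by ring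
      _ ≤ φ * ((2 * C₀ + 40000002) * X) + 2 * (φ * (46 * X)) + φ * X := by gcongr
      _ ≤ _ := by linarith

lemma sum_le_of_injOn_floor {s : Finset ℕ} {v w : ℕ → ℝ} {M δ : ℝ} {K : ℕ} (hδ : 0 < δ)
    (hK : 1 ≤ 2 * δ * K) (hM : 0 ≤ M) (hv0 : ∀ j ∈ s, 0 ≤ v j) (hv : ∀ j ∈ s, v j ≤ 1 / 2)
    (hinj : Set.InjOn (fun j => ⌊v j / δ⌋₊) s) (hwM : ∀ j ∈ s, w j ≤ M)
    (hw : ∀ j ∈ s, 0 < v j → w j ≤ 1 / (2 * v j)) :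
    ∑ j ∈ s, w j ≤ M + 1 / (2 * δ) * (1 + Real.log K) := by
  set h : ℕ → ℝ := fun c => if c = 0 then M else 1 / (2 * δ) * (c : ℝ)⁻¹ with hh
  have h0 : ∀ c, 0 ≤ h c := fun c => by rw [hh]; beta_reduce; split_ifs <;> positivity
  have h1 : ∑ j ∈ s, w j ≤ ∑ j ∈ s, h ⌊v j / δ⌋₊ := by
    refine Finset.sum_le_sum fun j hj => ?_
    rw [hh]; beta_reduce
    split_ifs with hc
    · exact hwM j hj
    · have hcpos : (0 : ℝ) < ⌊v j / δ⌋₊ := by exact_mod_cast Nat.pos_of_ne_zero hc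
      have h2 : (⌊v j / δ⌋₊ : ℝ) ≤ v j / δ := Nat.floor_le (div_nonneg (hv0 j hj) hδ.le)
      rw [le_div_iff₀ hδ] at h2
      have hvpos : 0 < v j := lt_of_lt_of_le (by positivity) h2
      refine (hw j hj hvpos).trans ?_
      rw [← one_div, div_mul_div_comm, one_mul]
      refine one_div_le_one_div_of_le (by positivity) (by linarith)
  have h2 : ∑ j ∈ s, h ⌊v j / δ⌋₊ = ∑ c ∈ s.image (fun j => ⌊v j / δ⌋₊), h c :=
    (Finset.sum_image hinj).symm
  have h3 : s.image (fun j => ⌊v j / δ⌋₊) ⊆ Finset.range (K + 1) := by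
    intro c hc
    obtain ⟨j, hj, rfl⟩ := Finset.mem_image.1 hc
    rw [Finset.mem_range, Nat.lt_succ_iff]
    refine Nat.floor_le_of_le ?_
    rw [div_le_iff₀ hδ]
    have := hv j hj
    linarith
  have h4 : ∑ c ∈ Finset.range (K + 1), h c ≤ M + 1 / (2 * δ) * (1 + Real.log K) := by
    rw [Finset.sum_range_succ']
    have e1 : ∑ k ∈ Finset.range K, h (k + 1) = 1 / (2 * δ) * ((harmonic K : ℚ) : ℝ) := by
      rw [harmonic, Rat.cast_sum, Finset.mul_sum]
      refine Finset.sum_congr rfl fun k _ => ?_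
      rw [hh]; simp
    have e2 : h 0 = M := by rw [hh]; simp
    rw [e1, e2, add_comm]
    have := harmonic_le_one_add_log K
    gcongr
  exact h1.trans (h2.le.trans ((Finset.sum_le_sum_of_subset_of_nonneg h3 fun c _ _ => h0 c).trans h4))

lemma sum_le_of_separated {s : Finset ℕ} {θ w : ℕ → ℝ} {M δ : ℝ} {K : ℕ} (hδ : 0 < δ)
    (hK : 1 ≤ 2 * δ * K) (hM : 0 ≤ M)
    (hsep : ∀ i ∈ s, ∀ j ∈ s, i ≠ j → ∀ k : ℤ, δ ≤ |θ i - θ j - k|) (hwM : ∀ j ∈ s, w j ≤ M)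
    (hw : ∀ j ∈ s, ∀ η, 0 < η → (∀ k : ℤ, η ≤ |θ j - k|) → w j ≤ 1 / (2 * η)) :
    ∑ j ∈ s, w j ≤ 2 * M + 1 / δ * (1 + Real.log K) := by
  set r : ℕ → ℝ := fun j => θ j - round (θ j) with hr
  have key : ∀ t ⊆ s, (∀ i ∈ t, ∀ j ∈ t, |r i - r j| = |(|r i| - |r j|)|) →
      ∑ j ∈ t, w j ≤ M + 1 / (2 * δ) * (1 + Real.log K) := by
    intro t ht hsgn
    refine sum_le_of_injOn_floor (v := fun j => |r j|) hδ hK hM (fun j _ => abs_nonneg _)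
      (fun j _ => abs_sub_round _) ?_ (fun j hj => hwM j (ht hj)) fun j hj hv => ?_
    · intro i hi j hj hij
      by_contra hne
      have h1 := hsep i (ht hi) j (ht hj) hne (round (θ i) - round (θ j))
      have h2 : |θ i - θ j - ((round (θ i) - round (θ j) : ℤ) : ℝ)| = |r i - r j| := by
        rw [hr]; push_cast; congr 1; ring
      rw [h2, hsgn i hi j hj] at h1
      beta_reduce at hij
      have h3 := Nat.floor_le (div_nonneg (abs_nonneg (r i)) hδ.le)
      have h4 := Nat.lt_floor_add_one (|r i| / δ)
      have h5 := Nat.floor_le (div_nonneg (abs_nonneg (r j)) hδ.le)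
      have h6 := Nat.lt_floor_add_one (|r j| / δ)
      rw [hij] at h3 h4
      have h7 : |(|r i| / δ - |r j| / δ)| < 1 := by rw [abs_lt]; constructor <;> linarith
      rw [← sub_div, abs_div, abs_of_pos hδ, div_lt_one hδ] at h7
      linarith
    · exact hw j (ht hj) _ hv fun k => round_le _ _
  have h1 := key (s.filter fun j => 0 ≤ r j) (Finset.filter_subset _ _) fun i hi j hj => by
    rw [abs_of_nonneg (Finset.mem_filter.1 hi).2, abs_of_nonneg (Finset.mem_filter.1 hj).2]
  have h2 := key (s.filter fun j => ¬ 0 ≤ r j) (Finset.filter_subset _ _) fun i hi j hj => by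
    rw [abs_of_neg (not_le.1 (Finset.mem_filter.1 hi).2), abs_of_neg (not_le.1 (Finset.mem_filter.1 hj).2),
      ← abs_neg]
    congr 1; ring
  rw [← Finset.sum_filter_add_sum_filter_not s fun j => 0 ≤ r j]
  have h3 : 1 / δ * (1 + Real.log K) = 2 * (1 / (2 * δ) * (1 + Real.log K)) := by field_simp
  linarith

/-- Multiples of a real number close to `a / q` are far from the integers. -/
lemma le_abs_mul_sub_int {q a : ℕ} {α : ℝ} (hq : 0 < q) (ha : a.Coprime q)
    (hα : |α - a / q| ≤ 1 / (q : ℝ) ^ 2) {d : ℤ} (hd : d ≠ 0) (hdq : 2 * |d| ≤ q) (k : ℤ) :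
    1 / (2 * (q : ℝ)) ≤ |d * α - k| := by
  have hq0 : (0 : ℝ) < q := by exact_mod_cast hq
  have h1 : (1 : ℝ) / q ≤ |d * (a / q : ℝ) - k| := by
    have h2 : (d * (a / q : ℝ) - k) = ((d * a - k * q : ℤ) : ℝ) / q := by push_cast; field_simp
    rw [h2, abs_div, Nat.abs_cast]
    gcongr
    have h3 : d * a - k * q ≠ 0 := by
      intro h
      have h4 : (q : ℤ) ∣ d * a := ⟨k, by linarith⟩
      have h5 : (q : ℤ) ∣ d := (Nat.isCoprime_iff_coprime.2 ha.symm).dvd_of_dvd_mul_right h4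
      have h6 := Int.le_of_dvd (abs_pos.2 hd) ((dvd_abs _ _).2 h5)
      have : 0 < |d| := abs_pos.2 hd
      omega
    have : (1 : ℤ) ≤ |d * a - k * q| := Int.one_le_abs h3
    exact_mod_cast this
  have h2 : |(d : ℝ) * (α - a / q)| ≤ 1 / (2 * q) := by
    rw [abs_mul]
    have h3 : 2 * |(d : ℝ)| ≤ q := by exact_mod_cast hdq
    calc |(d : ℝ)| * |α - a / q| ≤ (q / 2) * (1 / (q : ℝ) ^ 2) := by gcongr; linarith
      _ = _ := by field_simp
  have h3 : (d * α - k : ℝ) = (d * (a / q : ℝ) - k) + d * (α - a / q) := by ring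
  have h4 := abs_sub_abs_le_abs_sub (d * (a / q : ℝ) - k) (-((d : ℝ) * (α - a / q)))
  rw [abs_neg, sub_neg_eq_add, ← h3] at h4
  have h5 : (1 : ℝ) / q = 1 / (2 * q) + 1 / (2 * q) := by field_simp; norm_num
  linarith

lemma sum_norm_sum_ex_le {q a : ℕ} {α : ℝ} (hq : 2 ≤ q) (ha : a.Coprime q)
    (hα : |α - a / q| ≤ 1 / (q : ℝ) ^ 2) (M M' Y n : ℕ) (g : ℕ → ℕ) (hg : ∀ m, g m ≤ M + M') :
    ∑ m ∈ Finset.Ioc 0 Y, ‖∑ k ∈ Finset.Ioc M (g m), ex (k * (((n : ℝ) - m) * α))‖ ≤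
      (3 * Y / q + 1) * (2 * M' + 2 * q * (1 + Real.log q)) := by
  set w : ℕ → ℝ := fun m => ‖∑ k ∈ Finset.Ioc M (g m), ex (k * (((n : ℝ) - m) * α))‖ with hw
  have hq0 : (0 : ℝ) < q := by positivity
  set h := q / 2 with hh
  have hhpos : 0 < h := by omega
  set J := Y / h + 1 with hJ
  have hYJ : Y ≤ 0 + J * h := by
    have := Nat.lt_div_mul_add (a := Y) hhpos
    rw [hJ, add_mul]; omega
  have h1 : ∑ m ∈ Finset.Ioc 0 Y, w m ≤ ∑ m ∈ Finset.Ioc 0 (0 + J * h), w m :=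
    Finset.sum_le_sum_of_subset_of_nonneg (Finset.Ioc_subset_Ioc_right hYJ) fun m _ _ => norm_nonneg _
  refine h1.trans ?_
  rw [sum_Ioc_add_mul]
  have h2 : ∀ j ∈ Finset.range J, ∑ m ∈ Finset.Ioc (0 + j * h) (0 + j * h + h), w m ≤
      2 * M' + 2 * q * (1 + Real.log q) := by
    intro j _
    have h3 := sum_le_of_separated (s := Finset.Ioc (0 + j * h) (0 + j * h + h))
      (θ := fun m => ((n : ℝ) - m) * α) (w := w) (M := M') (δ := 1 / (2 * q)) (K := q) (by positivity)
      (by field_simp; exact le_rfl) (Nat.cast_nonneg _) ?_ ?_ ?_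
    · refine h3.trans (le_of_eq ?_)
      rw [one_div_one_div]
    · intro i hi j hj hij k
      rw [Finset.mem_Ioc] at hi hj
      have h4 := le_abs_mul_sub_int (d := (j : ℤ) - i) (by omega) ha hα (by omega)
        (by
          have : |(j : ℤ) - i| ≤ h := by rw [abs_le]; constructor <;> omega
          omega) k
      refine h4.trans (le_of_eq ?_)
      push_cast; congr 1; ring
    · intro m _
      rw [hw]; beta_reduce
      refine (norm_sum_le_of_le (n := fun _ => (1 : ℝ)) _ fun k _ => (norm_ex _).le).trans ?_
      rw [Finset.sum_const, Nat.card_Ioc, nsmul_eq_mul, mul_one]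
      have := hg m
      exact_mod_cast (by omega : g m - M ≤ M')
    · intro m _ η hη hk
      exact norm_sum_ex_le hη hk _ _
  refine (Finset.sum_le_sum h2).trans ?_
  rw [Finset.sum_const, Finset.card_range, nsmul_eq_mul]
  have hlog : 0 ≤ Real.log q := Real.log_natCast_nonneg q
  refine mul_le_mul_of_nonneg_right ?_ (by positivity)
  rw [hJ]; push_cast
  have h3 : ((Y / h : ℕ) : ℝ) ≤ Y / h := Nat.cast_div_le
  have h4 : (q : ℝ) ≤ 3 * h := by exact_mod_cast (by omega : q ≤ 3 * h)
  have h5 : (0 : ℝ) < h := by exact_mod_cast hhpos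
  have h6 : (Y : ℝ) / h ≤ 3 * Y / q := by
    rw [div_le_div_iff₀ h5 hq0]
    calc (Y : ℝ) * q ≤ Y * (3 * h) := by gcongr
      _ = _ := by ring
  linarith

lemma norm_sq_sum_dyadic_le {q a N M : ℕ} {α L : ℝ} {F G : ℕ → ℝ} (hq : 2 ≤ q) (ha : a.Coprime q)
    (hα : |α - a / q| ≤ 1 / (q : ℝ) ^ 2) (hM : 0 < M) (hF : ∀ m, |F m| ≤ 1) (hL : 0 ≤ L)
    (hG : ∀ n ≤ N, |G n| ≤ L) :
    ‖∑ m ∈ Finset.Ioc M (2 * M), ∑ n ∈ Finset.Ioc 0 (N / m), ((F m * G n : ℝ) : ℂ) * ex ((m * n : ℕ) * α)‖ ^ 2 ≤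
      M * ((N / M : ℕ) * (L ^ 2 * ((3 * (N / M : ℕ) / q + 1) * (2 * M + 2 * q * (1 + Real.log q))))) := by
  set Y := N / M with hY
  set A : ℕ → ℂ := fun m => ∑ n ∈ Finset.Ioc 0 (N / m), (G n : ℂ) * ex ((m * n : ℕ) * α) with hA
  set T : ℕ → ℕ → ℂ := fun n n' => ∑ m ∈ Finset.Ioc M (min (2 * M) (N / max n n')),
    ex (m * (((n : ℝ) - n') * α)) with hT
  have h1 : ‖∑ m ∈ Finset.Ioc M (2 * M), ∑ n ∈ Finset.Ioc 0 (N / m),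
      ((F m * G n : ℝ) : ℂ) * ex ((m * n : ℕ) * α)‖ ≤ ∑ m ∈ Finset.Ioc M (2 * M), ‖A m‖ := by
    refine norm_sum_le_of_le _ fun m _ => ?_
    have e1 : ∑ n ∈ Finset.Ioc 0 (N / m), ((F m * G n : ℝ) : ℂ) * ex ((m * n : ℕ) * α) = F m * A m := by
      rw [hA, Finset.mul_sum]
      exact Finset.sum_congr rfl fun n _ => by rw [ofReal_mul, mul_assoc]
    rw [e1, norm_mul, norm_real]
    exact mul_le_of_le_one_left (norm_nonneg _) (hF m)
  have h2 : (∑ m ∈ Finset.Ioc M (2 * M), ‖A m‖) ^ 2 ≤ M * ∑ m ∈ Finset.Ioc M (2 * M), ‖A m‖ ^ 2 := by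
    refine sq_sum_le_card_mul_sum_sq.trans (le_of_eq ?_)
    rw [Nat.card_Ioc]; congr 2; omega
  have h3 : ((∑ m ∈ Finset.Ioc M (2 * M), ‖A m‖ ^ 2 : ℝ) : ℂ) =
      ∑ n ∈ Finset.Ioc 0 Y, ∑ n' ∈ Finset.Ioc 0 Y, ((G n * G n' : ℝ) : ℂ) * T n n' := by
    have e1 : ∀ m ∈ Finset.Ioc M (2 * M), ((‖A m‖ ^ 2 : ℝ) : ℂ) = ∑ n ∈ Finset.Ioc 0 Y, ∑ n' ∈ Finset.Ioc 0 Y,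
        if m ≤ N / max n n' then ((G n * G n' : ℝ) : ℂ) * ex (m * (((n : ℝ) - n') * α)) else 0 := by
      intro m hm
      rw [Finset.mem_Ioc] at hm
      have hm0 : 0 < m := by omega
      have e2 : A m = ∑ n ∈ Finset.Ioc 0 Y, if m * n ≤ N then (G n : ℂ) * ex ((m * n : ℕ) * α) else 0 := by
        rw [hA, ← Finset.sum_filter]
        refine Finset.sum_congr ?_ fun _ _ => rfl
        ext n
        rw [Finset.mem_filter, Finset.mem_Ioc, Finset.mem_Ioc, Nat.le_div_iff_mul_le hm0, hY,
          Nat.le_div_iff_mul_le hM, mul_comm m n]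
        exact ⟨fun h => ⟨⟨h.1, (Nat.mul_le_mul_left _ hm.1.le).trans h.2⟩, h.2⟩, fun h => ⟨h.1.1, h.2⟩⟩
      rw [ofReal_pow, ← mul_conj', e2, map_sum, Finset.sum_mul_sum]
      refine Finset.sum_congr rfl fun n hn => Finset.sum_congr rfl fun n' hn' => ?_
      rw [Finset.mem_Ioc] at hn hn'
      have hmax : 0 < max n n' := lt_max_of_lt_left hn.1
      have hiff : m ≤ N / max n n' ↔ m * n ≤ N ∧ m * n' ≤ N := by
        rw [Nat.le_div_iff_mul_le hmax]
        rcases le_total n n' with h' | h'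
        · rw [max_eq_right h']
          exact ⟨fun h => ⟨(Nat.mul_le_mul_left _ h').trans h, h⟩, fun h => h.2⟩
        · rw [max_eq_left h']
          exact ⟨fun h => ⟨h, (Nat.mul_le_mul_left _ h').trans h⟩, fun h => h.1⟩
      by_cases c1 : m * n ≤ N <;> by_cases c2 : m * n' ≤ N
      · rw [if_pos c1, if_pos c2, if_pos (hiff.2 ⟨c1, c2⟩), map_mul, ← ex_neg, conj_ofReal]
        have : m * (((n : ℝ) - n') * α) = (m * n : ℕ) * α + -((m * n' : ℕ) * α) := by push_cast; ring
        rw [this, ex_add, ofReal_mul]; ring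
      all_goals simp [c1, c2, hiff]
    rw [ofReal_sum, Finset.sum_congr rfl e1, Finset.sum_comm]
    refine Finset.sum_congr rfl fun n hn => ?_
    rw [Finset.sum_comm]
    refine Finset.sum_congr rfl fun n' hn' => ?_
    rw [hT, Finset.mul_sum, ← Finset.sum_filter]
    refine Finset.sum_congr ?_ fun _ _ => rfl
    ext m
    simp only [Finset.mem_filter, Finset.mem_Ioc, le_min_iff, and_assoc]
  have h4 : ∑ m ∈ Finset.Ioc M (2 * M), ‖A m‖ ^ 2 ≤
      ∑ n ∈ Finset.Ioc 0 Y, (L ^ 2 * ((3 * Y / q + 1) * (2 * M + 2 * q * (1 + Real.log q)))) := by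
    have e1 := congrArg norm h3
    rw [norm_real, Real.norm_of_nonneg (by positivity)] at e1
    rw [e1]
    refine norm_sum_le_of_le _ fun n hn => ?_
    have e2 : ∀ n' ∈ Finset.Ioc 0 Y, ‖((G n * G n' : ℝ) : ℂ) * T n n'‖ ≤ L ^ 2 * ‖T n n'‖ := by
      intro n' hn'
      rw [Finset.mem_Ioc] at hn hn'
      rw [norm_mul, norm_real, Real.norm_eq_abs, abs_mul, sq]
      have hYN : Y ≤ N := Nat.div_le_self _ _
      have := hG n (hn.2.trans hYN)
      have := hG n' (hn'.2.trans hYN)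
      gcongr
    refine (norm_sum_le_of_le _ e2).trans ?_
    rw [← Finset.mul_sum]
    refine mul_le_mul_of_nonneg_left ?_ (sq_nonneg L)
    exact sum_norm_sum_ex_le hq ha hα M M Y n (fun n' => min (2 * M) (N / max n n'))
      fun _ => (min_le_left _ _).trans (by omega)
  calc _ ≤ (∑ m ∈ Finset.Ioc M (2 * M), ‖A m‖) ^ 2 := by gcongr
    _ ≤ _ := h2
    _ ≤ M * ∑ n ∈ Finset.Ioc 0 Y, (L ^ 2 * ((3 * Y / q + 1) * (2 * M + 2 * q * (1 + Real.log q)))) := by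
        gcongr
    _ = _ := by rw [Finset.sum_const, Nat.card_Ioc, nsmul_eq_mul, Nat.sub_zero]

lemma norm_sum_log_mul_ex_le {θ δ : ℝ} (hδ : 0 < δ) (h : ∀ k : ℤ, δ ≤ |θ - k|) (Z : ℕ) :
    ‖∑ n ∈ Finset.Ioc 0 Z, (Real.log n : ℂ) * ex (n * θ)‖ ≤ Real.log Z / (2 * δ) := by
  have h1 : ∀ n : ℕ, 0 < n → Real.log n = ∑ k ∈ Finset.Ico 1 n, (Real.log (k + 1 : ℕ) - Real.log k) := by
    intro n hn
    rw [Finset.sum_Ico_sub (fun k : ℕ => Real.log k) hn]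
    simp
  have h2 : ∑ n ∈ Finset.Ioc 0 Z, (Real.log n : ℂ) * ex (n * θ) =
      ∑ k ∈ Finset.Ico 1 Z, ((Real.log (k + 1 : ℕ) - Real.log k : ℝ) : ℂ) *
        ∑ n ∈ Finset.Ioc k Z, ex (n * θ) := by
    have e1 : ∀ n ∈ Finset.Ioc 0 Z, (Real.log n : ℂ) * ex (n * θ) = ∑ k ∈ Finset.Ico 1 Z,
        if k < n then ((Real.log (k + 1 : ℕ) - Real.log k : ℝ) : ℂ) * ex (n * θ) else 0 := by
      intro n hn
      rw [Finset.mem_Ioc] at hn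
      rw [h1 n hn.1, ofReal_sum, Finset.sum_mul, ← Finset.sum_filter]
      refine Finset.sum_congr ?_ fun _ _ => rfl
      ext k
      simp only [Finset.mem_filter, Finset.mem_Ico]
      omega
    rw [Finset.sum_congr rfl e1, Finset.sum_comm]
    refine Finset.sum_congr rfl fun k hk => ?_
    rw [Finset.mem_Ico] at hk
    rw [Finset.mul_sum, ← Finset.sum_filter]
    refine Finset.sum_congr ?_ fun _ _ => rfl
    ext n
    simp only [Finset.mem_filter, Finset.mem_Ioc]
    omega
  rw [h2]
  have h3 : ∀ k ∈ Finset.Ico 1 Z, ‖((Real.log (k + 1 : ℕ) - Real.log k : ℝ) : ℂ) *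
      ∑ n ∈ Finset.Ioc k Z, ex (n * θ)‖ ≤ (Real.log (k + 1 : ℕ) - Real.log k) * (1 / (2 * δ)) := by
    intro k hk
    rw [Finset.mem_Ico] at hk
    have h4 : 0 ≤ Real.log (k + 1 : ℕ) - Real.log k := by
      rw [sub_nonneg]
      exact Real.log_le_log (by exact_mod_cast hk.1) (by push_cast; linarith)
    rw [norm_mul, norm_real, Real.norm_of_nonneg h4]
    exact mul_le_mul_of_nonneg_left (norm_sum_ex_le hδ h _ _) h4
  refine (norm_sum_le_of_le _ h3).trans ?_
  rw [← Finset.sum_mul]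
  rcases Nat.eq_zero_or_pos Z with rfl | hZ
  · simp
  · rw [← h1 Z hZ, mul_one_div]

/-- The restriction of an arithmetic function to the integers at most `v`. -/
noncomputable def trunc (f : ArithmeticFunction ℝ) (v : ℕ) : ArithmeticFunction ℝ :=
  ⟨fun n => if n ≤ v then f n else 0, by simp⟩

lemma trunc_apply (f : ArithmeticFunction ℝ) (v n : ℕ) : trunc f v n = if n ≤ v then f n else 0 := rfl

lemma expSum_add_left (s : Finset ℕ) (f g : ArithmeticFunction ℝ) (x : ℝ) :
    expSum s (⇑(f + g)) x = expSum s f x + expSum s g x := by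
  simp [expSum, add_mul, Finset.sum_add_distrib]

lemma expSum_sub_left (s : Finset ℕ) (f g : ArithmeticFunction ℝ) (x : ℝ) :
    expSum s (⇑(f - g)) x = expSum s f x - expSum s g x := by
  simp [expSum, af_sub_apply, sub_mul, Finset.sum_sub_distrib]

/-- Vaughan's identity for the exponential sum over the von Mangoldt function. -/
lemma expSum_vonMangoldt_eq (v N : ℕ) (x : ℝ) :
    expSum (Finset.Ioc 0 N) (⇑Λ) x = expSum (Finset.Ioc 0 N) (⇑(trunc Λ v)) x +
      bilin N (trunc (μ : ArithmeticFunction ℝ) v) ArithmeticFunction.log x -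
      bilin N (⇑(trunc (μ : ArithmeticFunction ℝ) v * trunc Λ v)) (ζ : ArithmeticFunction ℝ) x +
      bilin N (⇑((μ : ArithmeticFunction ℝ) - trunc (μ : ArithmeticFunction ℝ) v))
        (⇑((Λ - trunc Λ v) * (ζ : ArithmeticFunction ℝ))) x := by
  rw [← expSum_mul, ← expSum_mul, ← expSum_mul, ← expSum_add_left, ← expSum_sub_left, ← expSum_add_left]
  congr 2
  have h1 : (μ : ArithmeticFunction ℝ) * (ζ : ArithmeticFunction ℝ) = 1 :=
    ArithmeticFunction.coe_moebius_mul_coe_zeta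
  have h2 : Λ * (ζ : ArithmeticFunction ℝ) = ArithmeticFunction.log :=
    ArithmeticFunction.vonMangoldt_mul_zeta
  linear_combination (-1 : ArithmeticFunction ℝ) * (Λ - trunc Λ v) * h1 +
    trunc (μ : ArithmeticFunction ℝ) v * h2

lemma norm_bilin_le_of_support {f g : ℕ → ℝ} {N D : ℕ} {x A K : ℝ} (hf : ∀ m, D < m → f m = 0)
    (hA : ∀ m ≤ N, |f m| ≤ A) (hA0 : 0 ≤ A) (hK : 0 ≤ K)
    (hg : ∀ m, 0 < m → m ≤ N → m ≤ D → ‖∑ n ∈ Finset.Ioc 0 (N / m), (g n : ℂ) * ex (n * (m * x))‖ ≤ K) :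
    ‖bilin N f g x‖ ≤ D * (A * K) := by
  have h1 : bilin N f g x = ∑ m ∈ Finset.Ioc 0 N, (f m : ℂ) *
      ∑ n ∈ Finset.Ioc 0 (N / m), (g n : ℂ) * ex (n * (m * x)) := by
    unfold bilin
    refine Finset.sum_congr rfl fun m _ => ?_
    rw [Finset.mul_sum]
    refine Finset.sum_congr rfl fun n _ => ?_
    rw [show ((m * n : ℕ) : ℝ) * x = n * (m * x) by push_cast; ring]
    push_cast; ring
  have h2 : bilin N f g x = ∑ m ∈ (Finset.Ioc 0 N).filter (· ≤ D), (f m : ℂ) *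
      ∑ n ∈ Finset.Ioc 0 (N / m), (g n : ℂ) * ex (n * (m * x)) := by
    rw [h1, Finset.sum_filter]
    refine Finset.sum_congr rfl fun m _ => ?_
    split_ifs with h
    · rfl
    · simp [hf m (by omega)]
  rw [h2]
  have h3 : ∀ m ∈ (Finset.Ioc 0 N).filter (· ≤ D), ‖(f m : ℂ) *
      ∑ n ∈ Finset.Ioc 0 (N / m), (g n : ℂ) * ex (n * (m * x))‖ ≤ A * K := by
    intro m hm
    simp only [Finset.mem_filter, Finset.mem_Ioc] at hm
    rw [norm_mul, norm_real, Real.norm_eq_abs]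
    exact mul_le_mul (hA m hm.1.2) (hg m hm.1.1 hm.1.2 hm.2) (norm_nonneg _) hA0
  refine (norm_sum_le_of_le _ h3).trans ?_
  rw [Finset.sum_const, nsmul_eq_mul]
  refine mul_le_mul_of_nonneg_right ?_ (by positivity)
  have : (Finset.Ioc 0 N).filter (· ≤ D) ⊆ Finset.Ioc 0 D := by
    intro m; simp only [Finset.mem_filter, Finset.mem_Ioc]; omega
  exact_mod_cast (Finset.card_le_card this).trans (by simp)

lemma abs_moebius_le (n : ℕ) : |((μ : ArithmeticFunction ℝ) n)| ≤ 1 := by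
  rw [ArithmeticFunction.intCoe_apply]
  exact_mod_cast ArithmeticFunction.abs_moebius_le_one

lemma abs_trunc_moebius_le (v n : ℕ) : |trunc (μ : ArithmeticFunction ℝ) v n| ≤ 1 := by
  rw [trunc_apply]; split_ifs
  · exact abs_moebius_le n
  · simp

lemma trunc_vonMangoldt_nonneg (v n : ℕ) : 0 ≤ trunc Λ v n := by
  rw [trunc_apply]; split_ifs
  · exact ArithmeticFunction.vonMangoldt_nonneg
  · simp

lemma trunc_vonMangoldt_le (v n : ℕ) : trunc Λ v n ≤ Λ n := by
  rw [trunc_apply]; split_ifs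
  · exact le_rfl
  · exact ArithmeticFunction.vonMangoldt_nonneg

lemma sum_antidiagonal_vonMangoldt (n : ℕ) : ∑ y ∈ n.divisorsAntidiagonal, Λ y.2 = Real.log n := by
  rw [Nat.sum_divisorsAntidiagonal' (fun _ b => Λ b)]
  exact ArithmeticFunction.vonMangoldt_sum

lemma abs_trunc_mul_trunc_le (v n : ℕ) :
    |(trunc (μ : ArithmeticFunction ℝ) v * trunc Λ v) n| ≤ Real.log n := by
  rw [ArithmeticFunction.mul_apply, ← sum_antidiagonal_vonMangoldt]
  refine (Finset.abs_sum_le_sum_abs _ _).trans (Finset.sum_le_sum fun y _ => ?_)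
  rw [abs_mul, abs_of_nonneg (trunc_vonMangoldt_nonneg v y.2)]
  have := abs_trunc_moebius_le v y.1
  have := trunc_vonMangoldt_le v y.2
  have := trunc_vonMangoldt_nonneg v y.2
  nlinarith

lemma trunc_mul_trunc_eq_zero {f g : ArithmeticFunction ℝ} {v n : ℕ} (h : v * v < n) :
    (trunc f v * trunc g v) n = 0 := by
  rw [ArithmeticFunction.mul_apply]
  refine Finset.sum_eq_zero fun y hy => ?_
  rw [trunc_apply, trunc_apply]
  split_ifs with h1 h2 <;> simp
  have := (Nat.mem_divisorsAntidiagonal.1 hy).1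
  exact absurd (Nat.mul_le_mul h1 h2) (by omega)

lemma sub_trunc_vonMangoldt_mul_zeta_apply (v n : ℕ) :
    ((Λ - trunc Λ v) * (ζ : ArithmeticFunction ℝ)) n =
      ∑ d ∈ n.divisors, (Λ - trunc Λ v) d := by
  rw [ArithmeticFunction.coe_mul_zeta_apply]

lemma sub_trunc_vonMangoldt_mul_zeta_eq_zero {v n : ℕ} (h : n ≤ v) :
    ((Λ - trunc Λ v) * (ζ : ArithmeticFunction ℝ)) n = 0 := by
  rw [sub_trunc_vonMangoldt_mul_zeta_apply]
  refine Finset.sum_eq_zero fun d hd => ?_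
  rw [af_sub_apply, trunc_apply, if_pos ((Nat.divisor_le hd).trans h), sub_self]

lemma abs_sub_trunc_vonMangoldt_mul_zeta_le (v n : ℕ) :
    |((Λ - trunc Λ v) * (ζ : ArithmeticFunction ℝ)) n| ≤ Real.log n := by
  rw [sub_trunc_vonMangoldt_mul_zeta_apply, ← ArithmeticFunction.vonMangoldt_sum]
  refine (Finset.abs_sum_le_sum_abs _ _).trans (Finset.sum_le_sum fun d _ => ?_)
  have := trunc_vonMangoldt_le v d
  have := trunc_vonMangoldt_nonneg v d
  rw [af_sub_apply, abs_of_nonneg (by linarith)]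
  linarith

lemma log_natCast_le_log {m n : ℕ} (h : m ≤ n) : Real.log m ≤ Real.log n := by
  rcases Nat.eq_zero_or_pos m with rfl | hm
  · simpa using Real.log_natCast_nonneg n
  · exact Real.log_le_log (by exact_mod_cast hm) (by exact_mod_cast h)

lemma norm_vaughan_typeI_le {q a v N : ℕ} {α : ℝ} (hq : 0 < q) (ha : a.Coprime q)
    (hα : |α - a / q| ≤ 1 / (q : ℝ) ^ 2) (hv : 0 < v) (hvq : 2 * (v * v) ≤ q) :
    ‖expSum (Finset.Ioc 0 N) (⇑(trunc Λ v)) α +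
      bilin N (trunc (μ : ArithmeticFunction ℝ) v) ArithmeticFunction.log α -
      bilin N (⇑(trunc (μ : ArithmeticFunction ℝ) v * trunc Λ v)) (ζ : ArithmeticFunction ℝ) α‖ ≤
    6 * v + 2 * (v ^ 2 * (Real.log N * q)) := by
  have hv1 : (1 : ℝ) ≤ v := by exact_mod_cast hv
  have hq0 : (0 : ℝ) < q := by exact_mod_cast hq
  have hL : 0 ≤ Real.log N := Real.log_natCast_nonneg N
  have hδ : (0 : ℝ) < 1 / (2 * q) := by positivity
  have hsep : ∀ m : ℕ, 0 < m → m ≤ v * v → ∀ k : ℤ, 1 / (2 * (q : ℝ)) ≤ |m * α - k| := by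
    intro m hm hmv k
    have := le_abs_mul_sub_int hq ha hα (d := (m : ℤ)) (by omega) (by rw [Nat.abs_cast]; omega) k
    exact_mod_cast this
  have h1 : ‖expSum (Finset.Ioc 0 N) (⇑(trunc Λ v)) α‖ ≤ 6 * v := by
    refine (norm_expSum_le _ (fun n _ => trunc_vonMangoldt_nonneg v n) α).trans ?_
    refine le_trans ?_ (sum_vonMangoldt_le v)
    simp only [trunc_apply]
    rw [← Finset.sum_filter]
    refine Finset.sum_le_sum_of_subset_of_nonneg ?_ fun _ _ _ => ArithmeticFunction.vonMangoldt_nonneg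
    intro m; simp only [Finset.mem_filter, Finset.mem_Ioc]; omega
  have h2 : ‖bilin N (trunc (μ : ArithmeticFunction ℝ) v) ArithmeticFunction.log α‖ ≤
      v * (1 * (Real.log N * q)) := by
    refine norm_bilin_le_of_support (fun m hm => by rw [trunc_apply, if_neg (by omega)])
      (fun m _ => abs_trunc_moebius_le v m) zero_le_one (by positivity) fun m hm hmN hmv => ?_
    simp only [ArithmeticFunction.log_apply]
    refine (norm_sum_log_mul_ex_le hδ (hsep m hm (by nlinarith)) _).trans ?_
    rw [show 2 * (1 / (2 * (q : ℝ))) = 1 / q by field_simp, div_div_eq_mul_div, div_one]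
    exact mul_le_mul_of_nonneg_right (log_natCast_le_log (Nat.div_le_self _ _)) hq0.le
  have h3 : ‖bilin N (⇑(trunc (μ : ArithmeticFunction ℝ) v * trunc Λ v)) (ζ : ArithmeticFunction ℝ) α‖ ≤
      (v * v : ℕ) * (Real.log N * q) := by
    refine norm_bilin_le_of_support (fun m hm => trunc_mul_trunc_eq_zero hm)
      (fun m hm => (abs_trunc_mul_trunc_le v m).trans (log_natCast_le_log hm)) hL hq0.le
      fun m hm hmN hmv => ?_
    have e1 : ∑ n ∈ Finset.Ioc 0 (N / m), (((ζ : ArithmeticFunction ℝ) n : ℝ) : ℂ) * ex (n * (m * α)) =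
        ∑ n ∈ Finset.Ioc 0 (N / m), ex (n * (m * α)) := by
      refine Finset.sum_congr rfl fun n hn => ?_
      rw [ArithmeticFunction.natCoe_apply, ArithmeticFunction.zeta_apply_ne (by simp at hn; omega)]
      simp
    rw [e1]
    refine (norm_sum_ex_le hδ (hsep m hm hmv) _ _).trans (le_of_eq ?_)
    field_simp
  refine (norm_sub_le _ _).trans ((add_le_add ((norm_add_le _ _).trans (add_le_add h1 h2)) h3).trans ?_)
  have h4 : 0 ≤ Real.log N * q := by positivity
  push_cast
  nlinarith [mul_nonneg h4 (mul_nonneg (by linarith : (0 : ℝ) ≤ v) (sub_nonneg.2 hv1))]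

/-- Type II estimate, summing the dyadic blocks by Cauchy-Schwarz. -/
lemma norm_sq_vaughan_typeII_le {q a v N : ℕ} {α : ℝ} (ha : a.Coprime q)
    (hα : |α - a / q| ≤ 1 / (q : ℝ) ^ 2) (hv : 0 < v) (hvq : 2 * (v * v) ≤ q) (hqN : q * v ≤ N)
    (hL : 1 ≤ Real.log N) :
    ‖bilin N (⇑((μ : ArithmeticFunction ℝ) - trunc (μ : ArithmeticFunction ℝ) v))
        (⇑((Λ - trunc Λ v) * (ζ : ArithmeticFunction ℝ))) α‖ ^ 2 ≤
      306 * N ^ 2 * Real.log N ^ 5 / v := by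
  set F : ℕ → ℝ := ⇑((μ : ArithmeticFunction ℝ) - trunc (μ : ArithmeticFunction ℝ) v) with hF
  set G : ℕ → ℝ := ⇑((Λ - trunc Λ v) * (ζ : ArithmeticFunction ℝ)) with hG
  set L := Real.log N with hLdef
  have hv1 : (1 : ℝ) ≤ v := by exact_mod_cast hv
  have hq2 : 2 ≤ q := by nlinarith
  have hqR : (0 : ℝ) < q := by positivity
  have hNq : q ≤ N := by nlinarith
  have hN : 0 < N := by omega
  have hF0 : ∀ m ≤ v, F m = 0 := fun m hm => by
    rw [hF, af_sub_apply, trunc_apply, if_pos hm, sub_self]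
  have hF1 : ∀ m, |F m| ≤ 1 := fun m => by
    rw [hF, af_sub_apply, trunc_apply]; split_ifs
    · simp
    · simpa using abs_moebius_le m
  have hG0 : ∀ n ≤ v, G n = 0 := fun n hn => sub_trunc_vonMangoldt_mul_zeta_eq_zero hn
  have hG1 : ∀ n ≤ N, |G n| ≤ L := fun n hn =>
    (abs_sub_trunc_vonMangoldt_mul_zeta_le v n).trans (log_natCast_le_log hn)
  set T : ℕ → ℂ := fun m => ∑ n ∈ Finset.Ioc 0 (N / m), ((F m * G n : ℝ) : ℂ) * ex ((m * n : ℕ) * α) with hT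
  set K := Nat.log 2 N + 1 with hK
  have hpart : bilin N F G α = ∑ i ∈ Finset.range K, ∑ m ∈ Finset.Ioc (2 ^ i) (2 * 2 ^ i), T m := by
    have e1 : ∀ k, ∑ i ∈ Finset.range k, ∑ m ∈ Finset.Ioc (2 ^ i) (2 * 2 ^ i), T m =
        ∑ m ∈ Finset.Ioc 1 (2 ^ k), T m := by
      intro k
      induction k with
      | zero => simp
      | succ k ih =>
        rw [Finset.sum_range_succ, ih, ← pow_succ',
          Finset.sum_Ioc_consecutive _ Nat.one_le_two_pow (Nat.pow_le_pow_right two_pos k.le_succ)]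
    rw [e1]
    have hNK : N ≤ 2 ^ K := (Nat.lt_pow_succ_log_self one_lt_two N).le
    have e2 : bilin N F G α = ∑ m ∈ Finset.Ioc 0 N, T m := rfl
    rw [e2, ← Finset.sum_Ioc_consecutive T (Nat.zero_le 1) hN,
      ← Finset.sum_Ioc_consecutive T hN hNK]
    have e3 : ∑ m ∈ Finset.Ioc 0 1, T m = 0 := by
      simp [hT, hF0 1 hv]
    have e4 : ∑ m ∈ Finset.Ioc N (2 ^ K), T m = 0 := by
      refine Finset.sum_eq_zero fun m hm => ?_
      simp [hT, Nat.div_eq_of_lt (Finset.mem_Ioc.1 hm).1]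
    rw [e3, e4, zero_add, add_zero]
  have hblock : ∀ i ∈ Finset.range K, ‖∑ m ∈ Finset.Ioc (2 ^ i) (2 * 2 ^ i), T m‖ ^ 2 ≤
      34 * N ^ 2 * L ^ 3 / v := by
    intro i _
    set M := 2 ^ i with hM
    have hMpos : 0 < M := by positivity
    have hMR : (0 : ℝ) < M := by exact_mod_cast hMpos
    have hNR : (0 : ℝ) < N := by exact_mod_cast hN
    rcases le_or_gt (2 * M) v with h | h
    · have : ∑ m ∈ Finset.Ioc M (2 * M), T m = 0 := by
        refine Finset.sum_eq_zero fun m hm => ?_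
        simp [hT, hF0 m ((Finset.mem_Ioc.1 hm).2.trans h)]
      rw [this]; simp; positivity
    rcases le_or_gt (N / M) v with h' | h'
    · have : ∑ m ∈ Finset.Ioc M (2 * M), T m = 0 := by
        refine Finset.sum_eq_zero fun m hm => Finset.sum_eq_zero fun n hn => ?_
        have : n ≤ v := (Finset.mem_Ioc.1 hn).2.trans
          ((Nat.div_le_div_left (Finset.mem_Ioc.1 hm).1.le hMpos).trans h')
        simp [hG0 n this]
      rw [this]; simp; positivity
    refine (norm_sq_sum_dyadic_le (L := L) hq2 ha hα hMpos hF1 (by linarith) hG1).trans ?_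
    set Y := N / M with hY
    have hYM : (Y : ℝ) * M ≤ N := by exact_mod_cast Nat.div_mul_le_self N M
    have hY0 : (0 : ℝ) ≤ Y := Y.cast_nonneg
    have hlq : Real.log q ≤ L := log_natCast_le_log hNq
    have hvM : (v : ℝ) ≤ 2 * M := by exact_mod_cast h.le
    have hvY : (v : ℝ) ≤ Y := by exact_mod_cast h'.le
    have hvqR : 2 * ((v : ℝ) * v) ≤ q := by exact_mod_cast hvq
    have hqNR : (q : ℝ) * v ≤ N := by exact_mod_cast hqN
    have hlq0 : 0 ≤ Real.log q := Real.log_natCast_nonneg q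
    have key : (3 * (Y : ℝ) / q + 1) * (2 * M + 2 * q * (1 + Real.log q)) ≤ 34 * N * L / v := by
      have s1 : (3 * (Y : ℝ) / q + 1) * (2 * M + 2 * q * (1 + Real.log q)) =
          6 * (Y * M) / q + 6 * Y * (1 + Real.log q) + 2 * M + 2 * q * (1 + Real.log q) := by
        field_simp; ring
      have hv0 : (0 : ℝ) < v := by linarith
      rw [s1, le_div_iff₀ hv0]
      have t1 : 6 * ((Y : ℝ) * M) / q * v ≤ 3 * N := by
        rw [div_mul_eq_mul_div, div_le_iff₀ hqR]
        have : 2 * (v : ℝ) ≤ q := by nlinarith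
        have := mul_le_mul hYM this (by positivity) hNR.le
        linarith
      have t2 : (Y : ℝ) * v ≤ 2 * N := by nlinarith
      have t3 : (M : ℝ) * v ≤ N := by nlinarith
      have t2' : 6 * (Y : ℝ) * (1 + Real.log q) * v ≤ 24 * N * L := by
        have : (1 + Real.log q) ≤ 2 * L := by linarith
        have := mul_le_mul this t2 (by positivity) (by linarith)
        nlinarith
      have t4 : 2 * (q : ℝ) * (1 + Real.log q) * v ≤ 4 * N * L := by
        have : (1 + Real.log q) ≤ 2 * L := by linarith
        have := mul_le_mul this hqNR (by positivity) (by linarith)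
        nlinarith
      have t5 : (N : ℝ) ≤ N * L := le_mul_of_one_le_right hNR.le hL
      nlinarith
    have hL0 : 0 ≤ L := by linarith
    calc (M : ℝ) * (Y * (L ^ 2 * ((3 * (Y : ℝ) / q + 1) * (2 * M + 2 * q * (1 + Real.log q)))))
        = (Y * M) * (L ^ 2 * ((3 * (Y : ℝ) / q + 1) * (2 * M + 2 * q * (1 + Real.log q)))) := by ring
      _ ≤ N * (L ^ 2 * (34 * N * L / v)) := by gcongr
      _ = 34 * N ^ 2 * L ^ 3 / v := by ring
  rw [hpart]
  have hKL : (K : ℝ) ≤ 3 * L := by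
    rw [hK]; push_cast
    have := natLog_two_le hN
    linarith
  have hL0 : 0 ≤ L := by linarith
  calc ‖∑ i ∈ Finset.range K, ∑ m ∈ Finset.Ioc (2 ^ i) (2 * 2 ^ i), T m‖ ^ 2
      ≤ (∑ i ∈ Finset.range K, ‖∑ m ∈ Finset.Ioc (2 ^ i) (2 * 2 ^ i), T m‖) ^ 2 := by
        gcongr; exact norm_sum_le _ _
    _ ≤ (Finset.range K).card * ∑ i ∈ Finset.range K, ‖∑ m ∈ Finset.Ioc (2 ^ i) (2 * 2 ^ i), T m‖ ^ 2 :=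
        sq_sum_le_card_mul_sum_sq
    _ ≤ K * (K * (34 * N ^ 2 * L ^ 3 / v)) := by
        rw [Finset.card_range]
        refine mul_le_mul_of_nonneg_left ((Finset.sum_le_sum hblock).trans (le_of_eq ?_)) K.cast_nonneg
        rw [Finset.sum_const, Finset.card_range, nsmul_eq_mul]
    _ ≤ (3 * L) * ((3 * L) * (34 * N ^ 2 * L ^ 3 / v)) := by gcongr
    _ = 306 * N ^ 2 * L ^ 5 / v := by ring

/-- Vinogradov's minor arc bound for the exponential sum over primes. -/
lemma exists_norm_expSum_primes_minor_le : ∃ C : ℝ, 0 ≤ C ∧ ∀ᶠ N : ℕ in atTop, ∀ (q a : ℕ) (α : ℝ),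
    a.Coprime q → Real.log N ^ 25 ≤ q → q * Real.log N ^ 25 ≤ N → |α - a / q| ≤ 1 / (q : ℝ) ^ 2 →
      ‖expSum (primesIoc 0 N) (fun n => Real.log n) α‖ ≤ C * (N / Real.log N ^ 2) := by
  obtain ⟨K, hK0, hK⟩ := exists_sum_prime_powers_le
  refine ⟨K + 12 + 8 + 18, by positivity, ?_⟩
  filter_upwards [tendsto_log_nat.eventually_ge_atTop 8,
    eventually_log_pow_le 12 1 (ε := 1 / 2) (by norm_num)] with N hL hN12 q a α ha hq1 hq2 hα
  set L := Real.log N with hLdef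
  have hL0 : 0 < L := by linarith
  have hL1 : 1 ≤ L := by linarith
  rw [one_mul, ← Real.sqrt_eq_rpow] at hN12
  have hN0 : (0 : ℝ) ≤ N := N.cast_nonneg
  have hsq := Real.mul_self_sqrt hN0
  set v := ⌈L ^ 10⌉₊ with hv
  have hv1 : L ^ 10 ≤ v := Nat.le_ceil _
  have hv2 : (v : ℝ) ≤ 2 * L ^ 10 := by
    have := (Nat.ceil_lt_add_one (show 0 ≤ L ^ 10 by positivity)).le
    have : 1 ≤ L ^ 10 := one_le_pow₀ hL1
    linarith
  have hv0 : 0 < v := Nat.ceil_pos.2 (by positivity)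
  have hvR : (0 : ℝ) < v := by exact_mod_cast hv0
  have hL5 : 8 ≤ L ^ 5 := hL.trans (le_self_pow₀ hL1 (by norm_num))
  have hL15 : 2 ≤ L ^ 15 := by nlinarith [le_self_pow₀ hL1 (show 15 ≠ 0 by norm_num)]
  have hq0 : 0 < q := by
    have : (0 : ℝ) < q := lt_of_lt_of_le (by positivity) hq1
    exact_mod_cast this
  have hvq : 2 * (v * v) ≤ q := by
    have : 2 * ((v : ℝ) * v) ≤ q := by
      calc 2 * ((v : ℝ) * v) ≤ 2 * ((2 * L ^ 10) * (2 * L ^ 10)) := by gcongr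
        _ = 8 * L ^ 20 := by ring
        _ ≤ L ^ 5 * L ^ 20 := by gcongr
        _ = L ^ 25 := by ring
        _ ≤ q := hq1
    exact_mod_cast this
  have hqv : q * v ≤ N := by
    have : (q : ℝ) * v ≤ N := by
      calc (q : ℝ) * v ≤ q * (2 * L ^ 10) := by gcongr
        _ ≤ q * (L ^ 15 * L ^ 10) := by gcongr
        _ = q * L ^ 25 := by ring
        _ ≤ N := hq2
    exact_mod_cast this
  have hI := norm_vaughan_typeI_le (N := N) hq0 ha hα hv0 hvq
  have hII := norm_sq_vaughan_typeII_le ha hα hv0 hvq hqv hL1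
  rw [← hLdef] at hI hII
  have hsqrt : √(N : ℝ) ≤ N / L ^ 2 := by
    rw [le_div_iff₀ (by positivity)]
    have : L ^ 2 ≤ √N := (pow_le_pow_right₀ hL1 (by norm_num)).trans hN12
    nlinarith [Real.sqrt_nonneg (N : ℝ)]
  have hI' : 6 * (v : ℝ) + 2 * (v ^ 2 * (L * q)) ≤ 12 * (N / L ^ 2) + 8 * (N / L ^ 2) := by
    refine add_le_add ?_ ?_
    · have : L ^ 10 ≤ √N := (pow_le_pow_right₀ hL1 (by norm_num)).trans hN12
      linarith
    · rw [← mul_div_assoc, le_div_iff₀ (by positivity)]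
      calc 2 * ((v : ℝ) ^ 2 * (L * q)) * L ^ 2 ≤ 2 * ((2 * L ^ 10) ^ 2 * (L * q)) * L ^ 2 := by gcongr
        _ = 8 * (q * L ^ 23) := by ring
        _ ≤ 8 * (q * L ^ 25) := by gcongr <;> norm_num
        _ ≤ 8 * N := by linarith
  have hII' : ‖bilin N (⇑((μ : ArithmeticFunction ℝ) - trunc (μ : ArithmeticFunction ℝ) v))
        (⇑((Λ - trunc Λ v) * (ζ : ArithmeticFunction ℝ))) α‖ ≤ 18 * (N / L ^ 2) := by
    refine (pow_le_pow_iff_left₀ (norm_nonneg _) (by positivity) two_ne_zero).1 ?_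
    refine hII.trans ?_
    calc 306 * (N : ℝ) ^ 2 * L ^ 5 / v ≤ 306 * (N : ℝ) ^ 2 * L ^ 5 / L ^ 10 := by gcongr
      _ = 306 * (N / L ^ 2) ^ 2 / L := by field_simp
      _ ≤ 306 * (N / L ^ 2) ^ 2 / 1 := by gcongr
      _ ≤ (18 * (N / L ^ 2)) ^ 2 := by nlinarith [sq_nonneg ((N : ℝ) / L ^ 2)]
  have hpp : ‖expSum (Finset.Ioc 0 N) (⇑(Λ - primeLog)) α‖ ≤ K * (N / L ^ 2) := by
    refine (norm_expSum_le _ (fun n _ => ?_) α).trans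
      ((hK N).trans (mul_le_mul_of_nonneg_left hsqrt hK0))
    rw [af_sub_apply]; exact sub_nonneg.2 (primeLog_le n)
  rw [← expSum_primeLog]
  have e1 : expSum (Finset.Ioc 0 N) (⇑primeLog) α =
      expSum (Finset.Ioc 0 N) (⇑Λ) α - expSum (Finset.Ioc 0 N) (⇑(Λ - primeLog)) α := by
    rw [expSum_sub_left]; ring
  rw [e1, expSum_vonMangoldt_eq v]
  refine (norm_sub_le _ _).trans ((add_le_add ((norm_add_le _ _).trans (add_le_add hI hII')) hpp).trans ?_)
  linarith

/-- The exponential sum over the primes in `(X, Y]`, with logarithmic weights. -/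
noncomputable def primeExpSum (X Y : ℕ) (α : ℝ) : ℂ := expSum (primesIoc X Y) (fun n => Real.log n) α

lemma continuous_primeExpSum (X Y : ℕ) : Continuous (primeExpSum X Y) := continuous_expSum _ _

lemma primeExpSum_eq_sub {X Y : ℕ} (h : X ≤ Y) (α : ℝ) :
    primeExpSum X Y α = primeExpSum 0 Y α - primeExpSum 0 X α := by
  have : primesIoc 0 Y = primesIoc 0 X ∪ primesIoc X Y := by
    ext p; simp only [mem_primesIoc, Finset.mem_union]; grind
  have hd : Disjoint (primesIoc 0 X) (primesIoc X Y) := by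
    rw [Finset.disjoint_left]; intro p; simp only [mem_primesIoc]; omega
  simp only [primeExpSum, expSum]
  rw [this, Finset.sum_union hd]; ring

lemma norm_primeExpSum_le_two_mul (X Y : ℕ) (α : ℝ) : ‖primeExpSum X Y α‖ ≤ 2 * Y :=
  (norm_expSum_le _ (fun n _ => Real.log_natCast_nonneg n) α).trans (sum_primesIoc_log_le X Y)

/-- `α` is within `2 ^ j / N` of a fraction with denominator at most `2 ^ j`. -/
def NearFraction (j N : ℕ) (α : ℝ) : Prop :=
  ∃ q a : ℕ, 0 < q ∧ q ≤ 2 ^ j ∧ |α - a / q| ≤ 2 ^ j / N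

lemma exists_coprime_of_nearFraction {j N : ℕ} {α : ℝ} (h : NearFraction j N α) :
    ∃ q a : ℕ, 0 < q ∧ a.Coprime q ∧ q ≤ 2 ^ j ∧ |α - a / q| ≤ 2 ^ j / N := by
  obtain ⟨q, a, hq, hq2, h⟩ := h
  have hg : 0 < a.gcd q := Nat.gcd_pos_of_pos_right _ hq
  refine ⟨q / a.gcd q, a / a.gcd q, Nat.div_pos (Nat.gcd_le_right _ hq) hg,
    Nat.coprime_div_gcd_div_gcd hg, (Nat.div_le_self _ _).trans hq2, ?_⟩
  rw [Nat.cast_div (Nat.gcd_dvd_left a q) (by positivity), Nat.cast_div (Nat.gcd_dvd_right a q) (by positivity),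
    div_div_div_cancel_right₀ (by positivity)]
  exact h

lemma eventually_of_le_four_mul {P : ℕ → Prop} (h : ∀ᶠ Z in atTop, P Z) :
    ∀ᶠ N : ℕ in atTop, ∀ Z, N ≤ 4 * Z → P Z := by
  obtain ⟨Z₀, hZ⟩ := eventually_atTop.1 h
  filter_upwards [eventually_ge_atTop (4 * Z₀)] with N hN Z hNZ
  exact hZ Z (by omega)

lemma eventually_half_log_le : ∀ᶠ N : ℕ in atTop, ∀ Z : ℕ, N ≤ 4 * Z → Real.log N / 2 ≤ Real.log Z := by
  filter_upwards [tendsto_log_nat.eventually_ge_atTop (2 * Real.log 4), eventually_gt_atTop 0] with N hN hN0 Z hZ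
  have hZ0 : (0 : ℝ) < Z := by exact_mod_cast (by omega : 0 < Z)
  have : Real.log N ≤ Real.log (4 * Z) := Real.log_le_log (by exact_mod_cast hN0) (by exact_mod_cast hZ)
  rw [Real.log_mul (by norm_num) hZ0.ne'] at this
  linarith

/-- The rate of decay of the exponential sum across dyadic major arcs. -/
noncomputable def arcDecay : ℝ := √√(1 / 2)

lemma arcDecay_pow_four : arcDecay ^ 4 = 1 / 2 := by
  rw [arcDecay, show 4 = 2 * 2 by norm_num, pow_mul, Real.sq_sqrt (Real.sqrt_nonneg _), Real.sq_sqrt (by norm_num)]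

lemma arcDecay_pos : 0 < arcDecay := by unfold arcDecay; positivity

lemma arcDecay_lt_one : arcDecay < 1 := by
  by_contra! h
  have := one_le_pow₀ h (n := 4)
  rw [arcDecay_pow_four] at this
  norm_num at this

lemma exists_norm_primeExpSum_zero_le : ∃ C : ℝ, 0 ≤ C ∧ ∀ᶠ N : ℕ in atTop, ∀ Z, N ≤ 4 * Z → Z ≤ N →
    ∀ (j : ℕ) (α : ℝ), 1 ≤ j → (2 : ℝ) ^ j ≤ Real.log N ^ 26 → NearFraction j N α →
      ¬ NearFraction (j - 1) N α →
      ‖primeExpSum 0 Z α‖ ≤ C * (N * (arcDecay ^ j + 1 / √(Real.log N))) := by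
  obtain ⟨C, hC0, hC⟩ := exists_norm_expSum_primes_le
  refine ⟨2 * C, by positivity, ?_⟩
  filter_upwards [eventually_of_le_four_mul (hC 27), eventually_half_log_le,
    tendsto_log_nat.eventually_ge_atTop (2 ^ 27), eventually_gt_atTop 0]
    with N hN hhalf hL hN0 Z hZ hZN j α hj hjL hmaj hnot
  obtain ⟨q, a, hq, ha, hqj, hα⟩ := exists_coprime_of_nearFraction hmaj
  set L := Real.log N with hLdef
  have hL0 : 0 < L := lt_of_lt_of_le (by norm_num) hL
  have hlogZ := hhalf Z hZ
  have hNR : (0 : ℝ) < N := by exact_mod_cast hN0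
  have hZR : (Z : ℝ) ≤ N := by exact_mod_cast hZN
  have hZ4 : (N : ℝ) ≤ 4 * Z := by exact_mod_cast hZ
  have hpow : L ^ 26 ≤ Real.log Z ^ 27 := by
    calc L ^ 26 ≤ L ^ 26 * (L / 2 ^ 27) := le_mul_of_one_le_right (by positivity)
          ((one_le_div (by norm_num)).2 hL)
      _ = (L / 2) ^ 27 := by ring
      _ ≤ Real.log Z ^ 27 := by gcongr
  set β := α - a / q with hβ
  have hqR : (q : ℝ) ≤ 2 ^ j := by exact_mod_cast hqj
  have hNβ : N * |β| ≤ 2 ^ j := by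
    rw [le_div_iff₀ hNR] at hα; linarith
  have hβ0 := abs_nonneg β
  have hmax : (2 : ℝ) ^ j / 8 ≤ max (q : ℝ) (Z * |β|) := by
    obtain ⟨i, rfl⟩ : ∃ i, j = i + 1 := ⟨j - 1, by omega⟩
    rw [pow_succ]
    rcases le_or_gt q (2 ^ i) with h | h
    · have : ¬ |α - a / q| ≤ 2 ^ i / N := fun hh => hnot ⟨q, a, hq, by simpa using h, by simpa using hh⟩
      rw [not_le, div_lt_iff₀ hNR, ← hβ] at this
      exact le_max_of_le_right (by nlinarith)
    · have : (2 : ℝ) ^ i < q := by exact_mod_cast h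
      exact le_max_of_le_left (by linarith [show (0 : ℝ) < 2 ^ i by positivity])
  set m := max (q : ℝ) (Z * |β|) with hm
  have hm0 : 0 < m := lt_of_lt_of_le (by positivity) hmax
  set ρ := √(1 / √m) with hρ
  have hρ2 : ρ ^ 2 * √m = 1 := by
    rw [hρ, Real.sq_sqrt (by positivity)]; field_simp
  have hρ4 : ρ ^ 4 * m = 1 := by
    have := congrArg (· ^ 2) hρ2
    simp only [mul_pow, Real.sq_sqrt hm0.le] at this
    linarith [show (ρ ^ 2) ^ 2 = ρ ^ 4 by ring]
  have hρ0 : 0 ≤ ρ := Real.sqrt_nonneg _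
  have hρle : ρ ≤ 2 * arcDecay ^ j := by
    have h0 := arcDecay_pos
    refine (pow_le_pow_iff_left₀ hρ0 (by positivity) four_ne_zero).1 ?_
    rw [mul_pow, ← pow_mul, mul_comm j 4, pow_mul, arcDecay_pow_four]
    have h1 : ρ ^ 4 * (2 ^ j / 8) ≤ 1 := by
      rw [← hρ4]; gcongr
    have h2 : (1 / 2 : ℝ) ^ j = 1 / 2 ^ j := by rw [one_div_pow]
    rw [h2, mul_one_div, le_div_iff₀ (by positivity)]
    linarith
  have hsum := hN Z hZ q a β ρ hq ha (hqR.trans (hjL.trans hpow))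
    ((mul_le_mul_of_nonneg_right hZR hβ0).trans (hNβ.trans (hjL.trans hpow))) hρ0 hρ2
  rw [hβ, add_sub_cancel] at hsum
  refine hsum.trans ?_
  have hsq : 1 / √(Real.log Z) ≤ 2 * (1 / √L) := by
    have h1 : √L ≤ 2 * √(Real.log Z) := by
      refine Real.sqrt_le_iff.2 ⟨by positivity, ?_⟩
      rw [mul_pow, Real.sq_sqrt (by linarith)]; linarith
    have h3 : 0 < √L := by positivity
    have h2 : 0 < √(Real.log Z) := by linarith
    rw [mul_one_div, div_le_div_iff₀ h2 h3]; linarith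
  have h0 : 0 ≤ ρ + 1 / √(Real.log Z) := by positivity
  calc C * (Z * (ρ + 1 / √(Real.log Z))) ≤ C * (N * (2 * arcDecay ^ j + 2 * (1 / √L))) := by gcongr
    _ = _ := by ring

lemma exists_norm_primeExpSum_zero_minor_le : ∃ C : ℝ, 0 ≤ C ∧ ∀ᶠ N : ℕ in atTop, ∀ Z, N ≤ 4 * Z → Z ≤ N →
    ∀ (j : ℕ) (α : ℝ), 0 ≤ α → α ≤ 1 → 4 * Real.log N ^ 25 ≤ 2 ^ j → ¬ NearFraction j N α →
      ‖primeExpSum 0 Z α‖ ≤ C * (N / Real.log N ^ 2) := by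
  obtain ⟨C, hC0, hC⟩ := exists_norm_expSum_primes_minor_le
  refine ⟨4 * C, by positivity, ?_⟩
  filter_upwards [eventually_of_le_four_mul hC, eventually_half_log_le,
    tendsto_log_nat.eventually_ge_atTop 1, eventually_gt_atTop 0,
    eventually_log_pow_le 25 4 (ε := 1) (by norm_num)] with N hN hhalf hL hN0 hLN Z hZ hZN j α hα0 hα1 hj hnot
  rw [Real.rpow_one] at hLN
  set L := Real.log N with hLdef
  have hL0 : 0 < L := by linarith
  have hNR : (0 : ℝ) < N := by exact_mod_cast hN0
  have hZR : (Z : ℝ) ≤ N := by exact_mod_cast hZN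
  have hZ4 : (N : ℝ) ≤ 4 * Z := by exact_mod_cast hZ
  have hlogZ := hhalf Z hZ
  have hlogZ' : Real.log Z ≤ L := log_natCast_le_log hZN
  have hZ0 : (0 : ℝ) ≤ Real.log Z := by linarith
  set n := ⌊(N : ℝ) / (4 * L ^ 25)⌋₊ with hn
  have hn0 : 0 < n := Nat.floor_pos.2 ((one_le_div (by positivity)).2 hLN)
  have hn1 : (n : ℝ) ≤ N / (4 * L ^ 25) := Nat.floor_le (by positivity)
  have hn2 : (N : ℝ) / (4 * L ^ 25) < n + 1 := Nat.lt_floor_add_one _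
  obtain ⟨r, hr, hrn⟩ := Real.exists_rat_abs_sub_le_and_den_le α hn0
  have hd0 : (0 : ℝ) < r.den := by exact_mod_cast r.pos
  have hd1 : (1 : ℝ) ≤ r.den := by exact_mod_cast r.pos
  have hrq : (r : ℝ) = r.num / r.den := Rat.cast_def r
  have hn0' : (1 : ℝ) ≤ n := by exact_mod_cast hn0
  have hnum : 0 ≤ r.num := by
    have h1 := (abs_le.1 hr).2
    rw [hrq] at h1
    by_contra! h
    have h2 : (r.num : ℝ) ≤ -1 := by exact_mod_cast (by omega : r.num ≤ -1)
    have h3 : (r.num : ℝ) / r.den ≤ -1 / r.den := by gcongr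
    have h4 : 1 / (((n : ℝ) + 1) * r.den) < 1 / r.den := by
      refine one_div_lt_one_div_of_lt hd0 ?_
      nlinarith
    have h5 : (-1 : ℝ) / r.den = -(1 / r.den) := by ring
    linarith
  obtain ⟨a, ha⟩ := Int.eq_ofNat_of_zero_le hnum
  rw [hrq, ha, Int.cast_natCast] at hr
  have hcop : a.Coprime r.den := by simpa [ha] using r.reduced
  set q := r.den with hq
  have hqn : (q : ℝ) ≤ n := by exact_mod_cast hrn
  have hβ : |α - a / q| ≤ 1 / (q : ℝ) ^ 2 :=
    hr.trans (one_div_le_one_div_of_le (by positivity) (by nlinarith))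
  have hβ' : |α - a / q| ≤ 4 * L ^ 25 / N := by
    refine hr.trans ?_
    rw [div_le_div_iff₀ (by positivity) hNR]
    rw [div_lt_iff₀ (by positivity)] at hn2
    nlinarith
  have hqL : L ^ 25 ≤ q := by
    by_contra! h
    refine hnot ⟨q, a, r.pos, ?_, hβ'.trans (by gcongr)⟩
    have : (q : ℝ) ≤ 2 ^ j := by
      have : 0 ≤ L ^ 25 := by positivity
      linarith
    exact_mod_cast this
  have hqZ : (q : ℝ) * Real.log Z ^ 25 ≤ (Z : ℝ) := by
    calc (q : ℝ) * Real.log Z ^ 25 ≤ N / (4 * L ^ 25) * L ^ 25 := by gcongr; exact hqn.trans hn1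
      _ = (N : ℝ) / 4 := by field_simp
      _ ≤ (Z : ℝ) := by linarith
  refine (hN Z hZ q a α hcop (le_trans (by gcongr) hqL) hqZ hβ).trans ?_
  calc C * (Z / Real.log Z ^ 2) ≤ C * (N / (L / 2) ^ 2) := by gcongr
    _ = 4 * C * (N / L ^ 2) := by field_simp; ring

/-- The mass of `‖primeExpSum‖²` concentrated near fractions with denominator at most `2 ^ j`. -/
noncomputable def nearMass (X Y j N : ℕ) (α : ℝ) : ℝ :=
  ∑ x ∈ insert 1 (farey (2 ^ j)),
    (Set.Icc (x - 2 ^ j / N) (x + 2 ^ j / N)).indicator (fun α => ‖primeExpSum X Y α‖ ^ 2) α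

lemma nearMass_nonneg (X Y j N : ℕ) (α : ℝ) : 0 ≤ nearMass X Y j N α :=
  Finset.sum_nonneg fun _ _ => Set.indicator_nonneg (fun _ _ => by positivity) _

lemma intervalIntegrable_indicator_Icc {f : ℝ → ℝ} (hf : Continuous f) (a b c d : ℝ) :
    IntervalIntegrable ((Set.Icc a b).indicator f) volume c d := by
  have h : IntervalIntegrable f volume c d := hf.intervalIntegrable c d
  rw [intervalIntegrable_iff] at h ⊢
  exact h.indicator measurableSet_Icc

lemma intervalIntegrable_nearMass (X Y j N : ℕ) (c d : ℝ) :
    IntervalIntegrable (nearMass X Y j N) volume c d := by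
  have := IntervalIntegrable.sum (a := c) (b := d) (insert 1 (farey (2 ^ j))) (fun x _ =>
    intervalIntegrable_indicator_Icc (f := fun α => ‖primeExpSum X Y α‖ ^ 2)
    ((continuous_primeExpSum X Y).norm.pow 2) (x - 2 ^ j / N) (x + 2 ^ j / N) c d)
  have e : nearMass X Y j N = ∑ x ∈ insert 1 (farey (2 ^ j)),
      (Set.Icc (x - 2 ^ j / (N : ℝ)) (x + 2 ^ j / N)).indicator (fun α => ‖primeExpSum X Y α‖ ^ 2) := by
    funext α
    simp [nearMass, Finset.sum_apply]
  rw [e]; exact this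

lemma integral_indicator_Icc_le {f : ℝ → ℝ} (hf : Continuous f) (h0 : ∀ x, 0 ≤ f x) {r : ℝ} (hr : 0 ≤ r)
    (x : ℝ) :
    ∫ α in (0 : ℝ)..1, (Set.Icc (x - r) (x + r)).indicator f α ≤ ∫ b in (-r)..r, f (x + b) := by
  rw [intervalIntegral.integral_comp_add_left (f := f) (d := x), ← sub_eq_add_neg,
    intervalIntegral.integral_of_le zero_le_one, intervalIntegral.integral_of_le (by linarith),
    ← integral_Icc_eq_integral_Ioc, ← integral_Icc_eq_integral_Ioc,
    ← integral_indicator measurableSet_Icc, ← integral_indicator measurableSet_Icc]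
  have hi : IntegrableOn f (Set.Icc (x - r) (x + r)) :=
    (hf.integrableOn_Icc)
  refine integral_mono_of_nonneg (ae_of_all _ fun α => ?_) (hi.integrable_indicator measurableSet_Icc)
    (ae_of_all _ fun α => ?_)
  · exact Set.indicator_nonneg (fun _ _ => Set.indicator_nonneg (fun _ _ => h0 _) _) _
  · exact Set.indicator_le_self' (fun _ _ => Set.indicator_nonneg (fun _ _ => h0 _) _) _

lemma one_notMem_farey (Q : ℕ) : (1 : ℝ) ∉ farey Q := by
  rw [mem_farey]
  rintro ⟨q, a, hq, -, ha, h⟩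
  have : (q : ℝ) ≠ 0 := by positivity
  rw [eq_div_iff this, one_mul] at h
  have : q = a := by exact_mod_cast h
  omega

lemma integral_nearMass_le : ∀ᶠ N : ℕ in atTop, ∀ X Y j : ℕ, N ≤ 4 * X → Y ≤ N → 1 ≤ j →
    (2 : ℝ) ^ j ≤ Real.log N ^ 26 →
    ∫ α in (0 : ℝ)..1, nearMass X Y j N α ≤ 40000 * j ^ 4 * N := by
  filter_upwards [sum_integral_farey_le 26] with N hN X Y j hX hY hj hjL
  have hmain := hN X Y j hX hY hj hjL
  set r : ℝ := 2 ^ j / N with hr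
  have hr0 : 0 ≤ r := by positivity
  have hc : Continuous fun α => ‖primeExpSum X Y α‖ ^ 2 := (continuous_primeExpSum X Y).norm.pow 2
  have h1 : ∫ α in (0 : ℝ)..1, nearMass X Y j N α ≤
      ∑ x ∈ insert 1 (farey (2 ^ j)), ∫ b in (-r)..r, ‖primeExpSum X Y (x + b)‖ ^ 2 := by
    unfold nearMass
    rw [intervalIntegral.integral_finsetSum fun x _ => intervalIntegrable_indicator_Icc hc _ _ _ _]
    exact Finset.sum_le_sum fun x _ => integral_indicator_Icc_le hc (fun _ => by positivity) hr0 x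
  have h2 : ∫ b in (-r)..r, ‖primeExpSum X Y (1 + b)‖ ^ 2 = ∫ b in (-r)..r, ‖primeExpSum X Y (0 + b)‖ ^ 2 := by
    refine intervalIntegral.integral_congr fun b _ => ?_
    have := expSum_add_int (primesIoc X Y) (fun n => Real.log n) b 1
    simp only [primeExpSum, zero_add]
    rw [← this, add_comm]; norm_num
  have h3 : ∫ b in (-r)..r, ‖primeExpSum X Y (0 + b)‖ ^ 2 ≤
      ∑ x ∈ farey (2 ^ j), ∫ b in (-r)..r, ‖primeExpSum X Y (x + b)‖ ^ 2 := by
    refine Finset.single_le_sum (f := fun x => ∫ b in (-r)..r, ‖primeExpSum X Y (x + b)‖ ^ 2)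
      (fun x _ => intervalIntegral.integral_nonneg (by linarith) fun _ _ => by positivity) ?_
    exact mem_farey.2 ⟨1, 0, one_pos, Nat.one_le_two_pow, one_pos, by simp⟩
  rw [Finset.sum_insert (one_notMem_farey _), h2] at h1
  have h4 : ∑ x ∈ farey (2 ^ j), ∫ b in (-r)..r, ‖primeExpSum X Y (x + b)‖ ^ 2 ≤ 20000 * j ^ 4 * N := hmain
  linarith

lemma norm_sq_le_nearMass {X Y j N : ℕ} {α : ℝ} (h1 : α ≤ 1)
    (h : NearFraction j N α) : ‖primeExpSum X Y α‖ ^ 2 ≤ nearMass X Y j N α := by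
  obtain ⟨q, a, hq, hqj, hα⟩ := h
  have hqR : (0 : ℝ) < q := by exact_mod_cast hq
  obtain ⟨x, hx, hαx⟩ : ∃ x ∈ insert 1 (farey (2 ^ j)), |α - x| ≤ 2 ^ j / N := by
    rcases lt_or_ge a q with ha | ha
    · exact ⟨a / q, Finset.mem_insert_of_mem (mem_farey.2 ⟨q, a, hq, hqj, ha, rfl⟩), hα⟩
    · refine ⟨1, Finset.mem_insert_self _ _, le_trans ?_ hα⟩
      have : 1 ≤ (a : ℝ) / q := (one_le_div hqR).2 (by exact_mod_cast ha)
      rw [abs_of_nonpos (by linarith), abs_of_nonpos (by linarith)]; linarith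
  rw [abs_le] at hαx
  have hmem : α ∈ Set.Icc (x - 2 ^ j / (N : ℝ)) (x + 2 ^ j / N) := ⟨by linarith [hαx.1], by linarith [hαx.2]⟩
  have := Finset.single_le_sum (f := fun x : ℝ => (Set.Icc (x - 2 ^ j / (N : ℝ)) (x + 2 ^ j / N)).indicator
    (fun α : ℝ => ‖primeExpSum X Y α‖ ^ 2) α)
    (fun x _ => Set.indicator_nonneg (fun _ _ => by positivity) _) hx
  simp only [Set.indicator_of_mem hmem] at this
  exact this

lemma nearFraction_mono {i j N : ℕ} (h : i ≤ j) {α : ℝ} (hi : NearFraction i N α) : NearFraction j N α := by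
  obtain ⟨q, a, hq, hqi, hα⟩ := hi
  exact ⟨q, a, hq, hqi.trans (Nat.pow_le_pow_right two_pos h), hα.trans (by gcongr; norm_num)⟩

lemma eventually_log_log_pow_le_sqrt (B : ℕ) {c ε : ℝ} (hc : 0 < c) (hε : 0 < ε) :
    ∀ᶠ N : ℕ in atTop, c * Real.log (Real.log N) ^ B ≤ ε * √(Real.log N) := by
  have h := ((isLittleO_log_rpow_rpow_atTop (B : ℝ) (show (0 : ℝ) < 1 / 2 by norm_num)).bound
    (show (0 : ℝ) < ε / c by positivity))
  filter_upwards [tendsto_log_nat.eventually h, tendsto_log_nat.eventually_ge_atTop 1] with N hN hN1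
  have hl : 0 ≤ Real.log (Real.log N) := Real.log_nonneg hN1
  rw [Real.rpow_natCast, ← Real.sqrt_eq_rpow, Real.norm_of_nonneg (by positivity),
    Real.norm_of_nonneg (Real.sqrt_nonneg _), div_mul_eq_mul_div, le_div_iff₀ hc] at hN
  linarith

lemma eventually_sum_pow_mul_arcDecay_le {δ : ℝ} (hδ : 0 < δ) :
    ∀ᶠ j₀ : ℕ in atTop, ∀ J, ∑ j ∈ Finset.Ico (j₀ + 1) (J + 1), (j : ℝ) ^ 4 * arcDecay ^ j ≤ δ := by
  have hs : Summable fun j : ℕ => (j : ℝ) ^ 4 * arcDecay ^ j :=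
    summable_pow_mul_geometric_of_norm_lt_one 4
      (by rw [Real.norm_of_nonneg arcDecay_pos.le]; exact arcDecay_lt_one)
  obtain ⟨n₀, hn⟩ := Metric.cauchySeq_iff.1 hs.hasSum.tendsto_sum_nat.cauchySeq δ hδ
  filter_upwards [eventually_ge_atTop n₀] with j₀ hj J
  rcases le_or_gt J j₀ with h | h
  · rw [Finset.Ico_eq_empty (by omega)]; simpa using hδ.le
  · rw [Finset.sum_Ico_eq_sub _ (by omega)]
    have := hn (J + 1) (by omega) (j₀ + 1) (by omega)
    rw [Real.dist_eq] at this
    exact (le_abs_self _).trans this.le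

lemma eventually_pow_four_div_two_pow_le {δ : ℝ} (hδ : 0 < δ) :
    ∀ᶠ j : ℕ in atTop, (j : ℝ) ^ 4 / 2 ^ j ≤ δ := by
  have h := tendsto_pow_const_div_const_pow_of_one_lt 4 (show (1 : ℝ) < 2 by norm_num)
  exact (h.eventually (gt_mem_nhds hδ)).mono fun _ h => h.le

/-- The contribution of the complement of the arcs of level `j₀` to the cube of the exponential sum
over primes is negligible. -/
theorem integral_primeExpSum_cube_le {δ : ℝ} (hδ : 0 < δ) :
    ∀ᶠ j₀ : ℕ in atTop, ∀ᶠ N : ℕ in atTop, ∀ (X Y : ℕ) (κ : ℝ → ℂ), N ≤ 4 * X → X ≤ Y → Y ≤ N →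
      Continuous κ → (∀ α, ‖κ α‖ ≤ 1) → (∀ α, NearFraction j₀ N α → ‖1 - κ α‖ ≤ 7 / 2 ^ j₀) →
      ∫ α in (0 : ℝ)..1, ‖primeExpSum X Y α‖ ^ 3 * ‖1 - κ α‖ ≤ δ * N ^ 2 := by
  obtain ⟨C₁, hC₁, h₁⟩ := exists_norm_primeExpSum_zero_le
  obtain ⟨C₂, hC₂, h₂⟩ := exists_norm_primeExpSum_zero_minor_le
  filter_upwards [eventually_pow_four_div_two_pow_le (show 0 < δ / 4 / 560000 by positivity),
    eventually_sum_pow_mul_arcDecay_le (show 0 < δ / 4 / (160000 * (C₁ + 1)) by positivity),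
    eventually_ge_atTop 1] with j₀ hj₀ htail hj₁
  filter_upwards [h₁, h₂, integral_nearMass_le, tendsto_log_nat.eventually_ge_atTop (2 ^ j₀ + 8),
    tendsto_log_nat.eventually_ge_atTop (16 * C₂ / (δ / 4)), eventually_gt_atTop 0,
    eventually_log_log_pow_le_sqrt 5 (show (0 : ℝ) < 160000 * (C₁ + 1) * 53 ^ 5 by positivity)
      (show 0 < δ / 4 by positivity)]
    with N h₁ h₂ hmass hL hL' hN hloglog X Y κ hX hXY hY hκ hκ1 hκ2
  set L := Real.log N with hLdef
  have hpow0 : (0 : ℝ) < 2 ^ j₀ := by positivity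
  have hL8 : 8 ≤ L := by linarith
  have hL0 : 0 < L := by linarith
  have hNR : (0 : ℝ) < N := by exact_mod_cast hN
  have hYR : (Y : ℝ) ≤ N := by exact_mod_cast hY
  obtain ⟨n, hn1, hn2⟩ := exists_nat_pow_near (one_le_pow₀ (show (1 : ℝ) ≤ L by linarith) (n := 25)) (one_lt_two)
  set J := n + 3 with hJ
  have hJ1 : 4 * L ^ 25 ≤ 2 ^ J := by rw [hJ, pow_add]; rw [pow_succ 2] at hn2; linarith
  have hJ2 : (2 : ℝ) ^ J ≤ L ^ 26 := by
    rw [hJ, pow_add, pow_succ L 25]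
    calc (2 : ℝ) ^ n * 2 ^ 3 ≤ L ^ 25 * 8 := by gcongr; norm_num
      _ ≤ L ^ 25 * L := by gcongr
  have hJlog : (J : ℝ) ≤ 53 * Real.log L := by
    have h := Real.log_le_log (by positivity) hJ2
    rw [Real.log_pow, Real.log_pow] at h
    have := Real.log_two_gt_d9
    have : (0 : ℝ) ≤ J := J.cast_nonneg
    push_cast at h
    nlinarith
  have hjL : ∀ j ≤ J, (2 : ℝ) ^ j ≤ L ^ 26 := fun j hj =>
    (pow_le_pow_right₀ one_le_two hj).trans hJ2
  have hj₀L : (2 : ℝ) ^ j₀ ≤ L ^ 26 := by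
    have : L ≤ L ^ 26 := le_self_pow₀ (by linarith) (by norm_num)
    linarith
  have hr0 := arcDecay_pos
  have hκ2' : ∀ α, ‖1 - κ α‖ ≤ 2 := fun α => by
    refine (norm_sub_le _ _).trans ?_
    rw [norm_one]; linarith [hκ1 α]
  set c : ℕ → ℝ := fun j => 4 * C₁ * (N * (arcDecay ^ j + 1 / √L)) with hc
  have hc0 : ∀ j, 0 ≤ c j := fun j => by positivity
  set g : ℕ → ℝ → ℝ := fun j => nearMass X Y j N with hg
  have hg0 : ∀ j α, 0 ≤ g j α := fun j α => nearMass_nonneg X Y j N α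
  have hpt : ∀ α ∈ Set.Icc (0 : ℝ) 1, ‖primeExpSum X Y α‖ ^ 3 * ‖1 - κ α‖ ≤
      14 * N / 2 ^ j₀ * g j₀ α + ∑ j ∈ Finset.Ico (j₀ + 1) (J + 1), c j * g j α +
        4 * C₂ * (N / L ^ 2) * ‖primeExpSum X Y α‖ ^ 2 := by
    rintro α ⟨hα0, hα1⟩
    have t1 : 0 ≤ 14 * N / 2 ^ j₀ * g j₀ α := mul_nonneg (by positivity) (hg0 _ _)
    have t2 : 0 ≤ ∑ j ∈ Finset.Ico (j₀ + 1) (J + 1), c j * g j α :=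
      Finset.sum_nonneg fun j _ => mul_nonneg (hc0 j) (hg0 j α)
    have t3 : 0 ≤ 4 * C₂ * (N / L ^ 2) * ‖primeExpSum X Y α‖ ^ 2 := by positivity
    have hS0 := norm_nonneg (primeExpSum X Y α)
    have hsplit : ∀ K, ‖primeExpSum X Y α‖ * ‖1 - κ α‖ ≤ K → ∀ G, ‖primeExpSum X Y α‖ ^ 2 ≤ G →
        ‖primeExpSum X Y α‖ ^ 3 * ‖1 - κ α‖ ≤ K * G := by
      intro K hK G hG
      calc ‖primeExpSum X Y α‖ ^ 3 * ‖1 - κ α‖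
          = (‖primeExpSum X Y α‖ * ‖1 - κ α‖) * ‖primeExpSum X Y α‖ ^ 2 := by ring
        _ ≤ K * G := mul_le_mul hK hG (by positivity) (le_trans (by positivity) hK)
    by_cases hn₀ : NearFraction j₀ N α
    · have := hsplit (14 * N / 2 ^ j₀) (by
        calc ‖primeExpSum X Y α‖ * ‖1 - κ α‖ ≤ (2 * N) * (7 / 2 ^ j₀) :=
              mul_le_mul ((norm_primeExpSum_le_two_mul X Y α).trans (by linarith)) (hκ2 α hn₀)
                (norm_nonneg _) (by positivity)
          _ = _ := by ring) _ (norm_sq_le_nearMass hα1 hn₀)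
      linarith
    by_cases hnJ : NearFraction J N α
    · classical
      have hex : ∃ j, NearFraction j N α := ⟨J, hnJ⟩
      set j := Nat.find hex with hj
      have hjn : NearFraction j N α := Nat.find_spec hex
      have hj0 : j₀ < j := by
        by_contra! h
        exact hn₀ (nearFraction_mono h hjn)
      have hjJ : j ≤ J := Nat.find_min' hex hnJ
      have hjp : ¬ NearFraction (j - 1) N α := Nat.find_min hex (by omega)
      have hb : ∀ Z, N ≤ 4 * Z → Z ≤ N → ‖primeExpSum 0 Z α‖ ≤ C₁ * (N * (arcDecay ^ j + 1 / √L)) :=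
        fun Z hZ hZN => h₁ Z hZ hZN j α (by omega) (hjL j hjJ) hjn hjp
      have := hsplit (c j) (by
        rw [primeExpSum_eq_sub hXY]
        calc ‖primeExpSum 0 Y α - primeExpSum 0 X α‖ * ‖1 - κ α‖
            ≤ (C₁ * (N * (arcDecay ^ j + 1 / √L)) + C₁ * (N * (arcDecay ^ j + 1 / √L))) * 2 := by
              refine mul_le_mul ((norm_sub_le _ _).trans (add_le_add (hb Y (by omega) hY)
                (hb X hX (by omega)))) (hκ2' α) (norm_nonneg _) (by positivity)
          _ = c j := by rw [hc]; ring) _ (norm_sq_le_nearMass hα1 hjn)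
      have := Finset.single_le_sum (f := fun j => c j * g j α) (fun i _ => mul_nonneg (hc0 i) (hg0 i α))
        (show j ∈ Finset.Ico (j₀ + 1) (J + 1) by rw [Finset.mem_Ico]; omega)
      simp only [hg] at this t1 t3 ⊢
      linarith
    · have hb : ∀ Z, N ≤ 4 * Z → Z ≤ N → ‖primeExpSum 0 Z α‖ ≤ C₂ * (N / L ^ 2) :=
        fun Z hZ hZN => h₂ Z hZ hZN J α hα0 hα1 hJ1 hnJ
      have := hsplit (4 * C₂ * (N / L ^ 2)) (by
        rw [primeExpSum_eq_sub hXY]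
        calc ‖primeExpSum 0 Y α - primeExpSum 0 X α‖ * ‖1 - κ α‖
            ≤ (C₂ * (N / L ^ 2) + C₂ * (N / L ^ 2)) * 2 := by
              refine mul_le_mul ((norm_sub_le _ _).trans (add_le_add (hb Y (by omega) hY)
                (hb X hX (by omega)))) (hκ2' α) (norm_nonneg _) (by positivity)
          _ = _ := by ring) _ le_rfl
      linarith
  have hcont : Continuous fun α => ‖primeExpSum X Y α‖ ^ 2 := (continuous_primeExpSum X Y).norm.pow 2
  have hcont' : Continuous fun α => ‖primeExpSum X Y α‖ ^ 3 * ‖1 - κ α‖ :=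
    ((continuous_primeExpSum X Y).norm.pow 3).mul (continuous_const.sub hκ).norm
  have hgi : ∀ j, IntervalIntegrable (g j) volume 0 1 := fun j => intervalIntegrable_nearMass X Y j N 0 1
  have hi1 : IntervalIntegrable (fun α => 14 * N / 2 ^ j₀ * g j₀ α) volume 0 1 := (hgi j₀).const_mul _
  have hi2' : ∀ j ∈ Finset.Ico (j₀ + 1) (J + 1), IntervalIntegrable (fun α => c j * g j α) volume 0 1 :=
    fun j _ => (hgi j).const_mul _
  have hi2 : IntervalIntegrable (fun α => ∑ j ∈ Finset.Ico (j₀ + 1) (J + 1), c j * g j α) volume 0 1 := by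
    have := IntervalIntegrable.sum _ hi2'
    have e : (fun α => ∑ j ∈ Finset.Ico (j₀ + 1) (J + 1), c j * g j α) =
        ∑ j ∈ Finset.Ico (j₀ + 1) (J + 1), fun α => c j * g j α := by
      funext α; simp [Finset.sum_apply]
    rw [e]; exact this
  have hi3 : IntervalIntegrable (fun α => 4 * C₂ * (N / L ^ 2) * ‖primeExpSum X Y α‖ ^ 2) volume 0 1 :=
    (continuous_const.mul hcont).intervalIntegrable _ _
  have h_int := intervalIntegral.integral_mono_on zero_le_one (hcont'.intervalIntegrable 0 1)
    ((hi1.add hi2).add hi3) hpt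
  rw [intervalIntegral.integral_add (hi1.add hi2) hi3, intervalIntegral.integral_add hi1 hi2,
    intervalIntegral.integral_const_mul, intervalIntegral.integral_const_mul,
    intervalIntegral.integral_finsetSum hi2'] at h_int
  simp only [intervalIntegral.integral_const_mul] at h_int
  have hm : ∀ j, 1 ≤ j → (2 : ℝ) ^ j ≤ L ^ 26 → ∫ α in (0 : ℝ)..1, g j α ≤ 40000 * j ^ 4 * N :=
    fun j h1 h2 => hmass X Y j hX hY h1 h2
  have b1 : 14 * N / 2 ^ j₀ * ∫ α in (0 : ℝ)..1, g j₀ α ≤ δ / 4 * N ^ 2 := by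
    calc 14 * N / 2 ^ j₀ * ∫ α in (0 : ℝ)..1, g j₀ α ≤ 14 * N / 2 ^ j₀ * (40000 * j₀ ^ 4 * N) := by
          gcongr; exact hm j₀ hj₁ hj₀L
      _ = 560000 * ((j₀ : ℝ) ^ 4 / 2 ^ j₀) * N ^ 2 := by ring
      _ ≤ 560000 * (δ / 4 / 560000) * N ^ 2 := by gcongr
      _ = _ := by ring
  have b2 : ∑ j ∈ Finset.Ico (j₀ + 1) (J + 1), c j * ∫ α in (0 : ℝ)..1, g j α ≤
      δ / 4 * N ^ 2 + δ / 4 * N ^ 2 := by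
    have hterm : ∀ j ∈ Finset.Ico (j₀ + 1) (J + 1), c j * ∫ α in (0 : ℝ)..1, g j α ≤
        160000 * C₁ * N ^ 2 * ((j : ℝ) ^ 4 * arcDecay ^ j) + 160000 * C₁ * N ^ 2 * ((J : ℝ) ^ 4 / √L) := by
      intro j hj
      rw [Finset.mem_Ico] at hj
      calc c j * ∫ α in (0 : ℝ)..1, g j α ≤ c j * (40000 * j ^ 4 * N) :=
            mul_le_mul_of_nonneg_left (hm j (by omega) (hjL j (by omega))) (hc0 j)
        _ = 160000 * C₁ * N ^ 2 * ((j : ℝ) ^ 4 * arcDecay ^ j) + 160000 * C₁ * N ^ 2 * ((j : ℝ) ^ 4 / √L) := by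
            rw [hc]; ring
        _ ≤ _ := by gcongr; omega
    refine (Finset.sum_le_sum hterm).trans ?_
    rw [Finset.sum_add_distrib, ← Finset.mul_sum, Finset.sum_const, nsmul_eq_mul, Nat.card_Ico]
    refine add_le_add ?_ ?_
    · calc 160000 * C₁ * N ^ 2 * ∑ j ∈ Finset.Ico (j₀ + 1) (J + 1), (j : ℝ) ^ 4 * arcDecay ^ j
          ≤ 160000 * (C₁ + 1) * N ^ 2 * (δ / 4 / (160000 * (C₁ + 1))) := by
            refine mul_le_mul (by gcongr; linarith) (htail J) ?_ (by positivity)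
            exact Finset.sum_nonneg fun j _ => by positivity
        _ = δ / 4 * N ^ 2 := by field_simp
    · have hs : 0 < √L := by positivity
      have : ((J + 1 - (j₀ + 1) : ℕ) : ℝ) ≤ J := by exact_mod_cast (by omega)
      calc ((J + 1 - (j₀ + 1) : ℕ) : ℝ) * (160000 * C₁ * N ^ 2 * ((J : ℝ) ^ 4 / √L))
          ≤ J * (160000 * (C₁ + 1) * N ^ 2 * ((J : ℝ) ^ 4 / √L)) := by gcongr; linarith
        _ = 160000 * (C₁ + 1) * (J : ℝ) ^ 5 / √L * N ^ 2 := by ring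
        _ ≤ δ / 4 * N ^ 2 := by
            refine mul_le_mul_of_nonneg_right ?_ (by positivity)
            rw [div_le_iff₀ hs]
            refine le_trans ?_ hloglog
            calc 160000 * (C₁ + 1) * (J : ℝ) ^ 5 ≤ 160000 * (C₁ + 1) * (53 * Real.log L) ^ 5 := by gcongr
              _ = _ := by ring
  have b3 : 4 * C₂ * (N / L ^ 2) * ∫ α in (0 : ℝ)..1, ‖primeExpSum X Y α‖ ^ 2 ≤ δ / 4 * N ^ 2 := by
    have h2 : ∫ α in (0 : ℝ)..1, ‖primeExpSum X Y α‖ ^ 2 ≤ L * (2 * N) := by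
      rw [show ∫ α in (0 : ℝ)..1, ‖primeExpSum X Y α‖ ^ 2 = _ from
        integral_norm_sq_expSum (primesIoc X Y) (fun n => Real.log n)]
      calc ∑ p ∈ primesIoc X Y, Real.log p ^ 2 ≤ ∑ p ∈ primesIoc X Y, L * Real.log p := by
            refine Finset.sum_le_sum fun p hp => ?_
            rw [sq]
            exact mul_le_mul_of_nonneg_right (log_natCast_le_log ((mem_primesIoc.1 hp).1.2.trans hY))
              (Real.log_natCast_nonneg p)
        _ = L * ∑ p ∈ primesIoc X Y, Real.log p := by rw [Finset.mul_sum]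
        _ ≤ L * (2 * N) := by
            gcongr; exact (sum_primesIoc_log_le X Y).trans (by linarith)
    calc 4 * C₂ * (N / L ^ 2) * ∫ α in (0 : ℝ)..1, ‖primeExpSum X Y α‖ ^ 2
        ≤ 4 * C₂ * (N / L ^ 2) * (L * (2 * N)) := by gcongr
      _ = 8 * C₂ / L * N ^ 2 := by field_simp; ring
      _ ≤ δ / 4 * N ^ 2 := by
          refine mul_le_mul_of_nonneg_right ?_ (by positivity)
          rw [div_le_iff₀ hL0]
          rw [div_le_iff₀ (by positivity)] at hL'
          nlinarith
  linarith

/-- The number of ways, weighted by `w`, to write `M` as a sum of three elements of `s`. -/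
noncomputable def tripleSum (s : Finset ℕ) (w : ℕ → ℝ) (M : ℕ) : ℝ :=
  ∑ a ∈ s, ∑ b ∈ s, ∑ c ∈ s, if a + b + c = M then w a * w b * w c else 0

lemma integral_expSum_cube (s : Finset ℕ) (w : ℕ → ℝ) (M : ℕ) :
    ∫ α in (0 : ℝ)..1, expSum s w α ^ 3 * ex (-M * α) = tripleSum s w M := by
  have e : ∀ α : ℝ, expSum s w α ^ 3 * ex (-M * α) =
      ∑ a ∈ s, ∑ b ∈ s, ∑ c ∈ s, (w a * w b * w c : ℂ) * ex (((a : ℤ) + b + c - M : ℤ) * α) := by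
    intro α
    rw [expSum, pow_three, Finset.sum_mul_sum, Finset.sum_mul_sum, Finset.sum_mul]
    refine Finset.sum_congr rfl fun a _ => ?_
    rw [Finset.sum_mul]
    refine Finset.sum_congr rfl fun b _ => ?_
    rw [Finset.mul_sum, Finset.sum_mul]
    refine Finset.sum_congr rfl fun c _ => ?_
    rw [show (((a : ℤ) + b + c - M : ℤ) : ℝ) * α = a * α + (b * α + (c * α + -M * α)) by push_cast; ring,
      ex_add, ex_add, ex_add]
    ring
  have hc : ∀ z : ℂ, ∀ k : ℤ, IntervalIntegrable (fun α : ℝ => z * ex (k * α)) volume 0 1 := fun z k =>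
    (continuous_const.mul (continuous_ex.comp (continuous_const.mul continuous_id))).intervalIntegrable _ _
  simp_rw [e]
  rw [intervalIntegral.integral_finsetSum, tripleSum, ofReal_sum]
  · refine Finset.sum_congr rfl fun a _ => ?_
    rw [intervalIntegral.integral_finsetSum, ofReal_sum]
    · refine Finset.sum_congr rfl fun b _ => ?_
      rw [intervalIntegral.integral_finsetSum, ofReal_sum]
      · refine Finset.sum_congr rfl fun c _ => ?_
        rw [intervalIntegral.integral_const_mul, integral_ex_int]
        by_cases h : a + b + c = M
        · rw [if_pos (by omega), if_pos h]; push_cast; ring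
        · rw [if_neg (by omega), if_neg h]; simp
      · exact fun c _ => hc _ _
    · intro b _
      exact Continuous.intervalIntegrable (continuous_finsetSum _ fun c _ => continuous_const.mul
        (continuous_ex.comp (continuous_const.mul continuous_id))) _ _
  · intro a _
    exact Continuous.intervalIntegrable (continuous_finsetSum _ fun b _ => continuous_finsetSum _ fun c _ =>
      continuous_const.mul (continuous_ex.comp (continuous_const.mul continuous_id))) _ _

lemma norm_one_sub_cube_le {z : ℂ} (hz : ‖z‖ ≤ 1) : ‖1 - z ^ 3‖ ≤ 3 * ‖1 - z‖ := by
  have e : 1 - z ^ 3 = (1 - z) * (1 + z + z ^ 2) := by ring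
  have h2 : ‖z ^ 2‖ ≤ 1 := by rw [norm_pow]; exact pow_le_one₀ (norm_nonneg _) hz
  have h : ‖1 + z + z ^ 2‖ ≤ 3 := by
    refine (norm_add_le _ _).trans ((add_le_add (norm_add_le _ _) le_rfl).trans ?_)
    rw [norm_one]; linarith
  rw [e, norm_mul, mul_comm]
  exact mul_le_mul_of_nonneg_right h (norm_nonneg _)

lemma norm_integral_cube_sub_le {S κ : ℝ → ℂ} (hS : Continuous S) (hκ : Continuous κ)
    (hκ1 : ∀ α, ‖κ α‖ ≤ 1) (M : ℕ) :
    ‖(∫ α in (0 : ℝ)..1, S α ^ 3 * ex (-M * α)) - ∫ α in (0 : ℝ)..1, (S α * κ α) ^ 3 * ex (-M * α)‖ ≤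
      3 * ∫ α in (0 : ℝ)..1, ‖S α‖ ^ 3 * ‖1 - κ α‖ := by
  have hex : Continuous fun α : ℝ => ex (-M * α) := continuous_ex.comp (continuous_const.mul continuous_id)
  have i1 : IntervalIntegrable (fun α => S α ^ 3 * ex (-M * α)) volume 0 1 :=
    ((hS.pow 3).mul hex).intervalIntegrable _ _
  have i2 : IntervalIntegrable (fun α => (S α * κ α) ^ 3 * ex (-M * α)) volume 0 1 :=
    (((hS.mul hκ).pow 3).mul hex).intervalIntegrable _ _
  rw [← intervalIntegral.integral_sub i1 i2, ← intervalIntegral.integral_const_mul]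
  refine intervalIntegral.norm_integral_le_of_norm_le zero_le_one (ae_of_all _ fun α _ => ?_)
    ((continuous_const.mul ((hS.norm.pow 3).mul (continuous_const.sub hκ).norm)).intervalIntegrable _ _)
  have e : S α ^ 3 * ex (-M * α) - (S α * κ α) ^ 3 * ex (-M * α) =
      S α ^ 3 * (1 - κ α ^ 3) * ex (-M * α) := by ring
  rw [e, norm_mul, norm_ex, mul_one, norm_mul, norm_pow]
  nlinarith [norm_one_sub_cube_le (hκ1 α), show 0 ≤ ‖S α‖ ^ 3 by positivity]

/-- The average of the exponentials `ex (W j α)` over `j < J`. -/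
noncomputable def avgKernel (W J : ℕ) (α : ℝ) : ℂ := (J : ℂ)⁻¹ * ∑ j ∈ Finset.range J, ex ((W * j : ℕ) * α)

lemma continuous_avgKernel (W J : ℕ) : Continuous (avgKernel W J) :=
  continuous_const.mul (continuous_finsetSum _ fun _ _ =>
    continuous_ex.comp (continuous_const.mul continuous_id))

lemma norm_avgKernel_le (W J : ℕ) (α : ℝ) : ‖avgKernel W J α‖ ≤ 1 := by
  rw [avgKernel, norm_mul, norm_inv, norm_natCast]
  have : ‖∑ j ∈ Finset.range J, ex ((W * j : ℕ) * α)‖ ≤ J := by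
    refine (norm_sum_le _ _).trans ?_
    simp [norm_ex]
  rcases Nat.eq_zero_or_pos J with rfl | hJ
  · simp
  · rw [inv_mul_le_iff₀ (by exact_mod_cast hJ)]; linarith

lemma norm_one_sub_avgKernel_le {j₀ N W J : ℕ} {α : ℝ} (hJ : 0 < J) (hN : 0 < N)
    (hW : ∀ q, 0 < q → q ≤ 2 ^ j₀ → q ∣ W) (hWJ : (W * J : ℝ) ≤ N / 4 ^ j₀) (h : NearFraction j₀ N α) :
    ‖1 - avgKernel W J α‖ ≤ 7 / 2 ^ j₀ := by
  obtain ⟨q, a, hq, hqj, hα⟩ := h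
  obtain ⟨k, hk⟩ := hW q hq hqj
  have hqR : (0 : ℝ) < q := by exact_mod_cast hq
  have hJC : (J : ℂ) ≠ 0 := by exact_mod_cast hJ.ne'
  have hJR : (0 : ℝ) < J := by exact_mod_cast hJ
  have hNR : (0 : ℝ) < N := by exact_mod_cast hN
  have hp : (0 : ℝ) < 2 ^ j₀ := by positivity
  have e : 1 - avgKernel W J α = (J : ℂ)⁻¹ * ∑ j ∈ Finset.range J, (1 - ex ((W * j : ℕ) * α)) := by
    rw [avgKernel, Finset.sum_sub_distrib]
    simp only [Finset.sum_const, Finset.card_range, nsmul_eq_mul, mul_one]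
    rw [mul_sub, inv_mul_cancel₀ hJC]
  rw [e, norm_mul, norm_inv, norm_natCast, inv_mul_le_iff₀ hJR]
  have hterm : ∀ j ∈ Finset.range J, ‖1 - ex ((W * j : ℕ) * α)‖ ≤ 7 / 2 ^ j₀ := by
    intro j hj
    have hjJ : (j : ℝ) ≤ J := by exact_mod_cast (Finset.mem_range.1 hj).le
    have e1 : ((W * j : ℕ) : ℝ) * α = (W * j : ℕ) * (α - a / q) + ((k * j * a : ℕ) : ℤ) := by
      rw [hk]; push_cast; field_simp; ring
    rw [e1, ex_add_int]
    have h0 := norm_ex_sub_le 0 ((W * j : ℕ) * (α - a / q))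
    rw [ex_zero] at h0
    refine h0.trans ?_
    rw [zero_sub, abs_neg, abs_mul, Nat.abs_cast]
    push_cast
    calc 7 * ((W : ℝ) * j * |α - a / q|) ≤ 7 * ((W : ℝ) * J * (2 ^ j₀ / N)) := by gcongr
      _ ≤ 7 * (N / 4 ^ j₀ * (2 ^ j₀ / N)) := by gcongr
      _ = 7 / 2 ^ j₀ := by
        rw [show (4 : ℝ) ^ j₀ = 2 ^ j₀ * 2 ^ j₀ by rw [← mul_pow]; norm_num]
        field_simp
  refine (norm_sum_le_of_le _ hterm).trans ?_
  rw [Finset.sum_const, Finset.card_range, nsmul_eq_mul]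

/-- The weight `w` averaged over translates by multiples of `W`. -/
noncomputable def avgWeight (s : Finset ℕ) (w : ℕ → ℝ) (W J n : ℕ) : ℝ :=
  ∑ x ∈ (s ×ˢ Finset.range J) with x.1 + W * x.2 = n, w x.1 / J

lemma avgWeight_nonneg {s : Finset ℕ} {w : ℕ → ℝ} (hw : ∀ n ∈ s, 0 ≤ w n) (W J n : ℕ) :
    0 ≤ avgWeight s w W J n := by
  refine Finset.sum_nonneg fun x hx => div_nonneg (hw _ ?_) J.cast_nonneg
  exact (Finset.mem_product.1 (Finset.mem_filter.1 hx).1).1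

lemma expSum_mul_avgKernel {s : Finset ℕ} (w : ℕ → ℝ) {W J K : ℕ}
    (hK : ∀ p ∈ s, ∀ j < J, p + W * j < K) (α : ℝ) :
    expSum s w α * avgKernel W J α = expSum (Finset.range K) (avgWeight s w W J) α := by
  have h1 : expSum s w α * avgKernel W J α =
      ∑ x ∈ s ×ˢ Finset.range J, ((w x.1 / J : ℝ) : ℂ) * ex ((x.1 + W * x.2 : ℕ) * α) := by
    rw [expSum, avgKernel, mul_left_comm, Finset.sum_mul_sum, Finset.sum_product, Finset.mul_sum]
    refine Finset.sum_congr rfl fun p _ => ?_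
    rw [Finset.mul_sum]
    refine Finset.sum_congr rfl fun j _ => ?_
    rw [show ((p + W * j : ℕ) : ℝ) * α = p * α + (W * j : ℕ) * α by push_cast; ring, ex_add]
    push_cast
    ring
  rw [h1, expSum, ← Finset.sum_fiberwise_of_maps_to (t := Finset.range K) (g := fun x => x.1 + W * x.2)]
  · refine Finset.sum_congr rfl fun n _ => ?_
    rw [avgWeight, ofReal_sum, Finset.sum_mul]
    refine Finset.sum_congr rfl fun x hx => ?_
    rw [(Finset.mem_filter.1 hx).2]
  · intro x hx
    rw [Finset.mem_product, Finset.mem_range] at hx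
    exact Finset.mem_range.2 (hK _ hx.1 _ hx.2)

lemma exists_of_tripleSum_ne_zero {s : Finset ℕ} {w : ℕ → ℝ} {M : ℕ} (h : tripleSum s w M ≠ 0) :
    ∃ a ∈ s, ∃ b ∈ s, ∃ c ∈ s, a + b + c = M := by
  by_contra! hno
  refine h (Finset.sum_eq_zero fun a ha => Finset.sum_eq_zero fun b hb => Finset.sum_eq_zero fun c hc => ?_)
  rw [if_neg (hno a ha b hb c hc)]

/-- If the averaged prime weight represents `M` often enough, then `M` is a sum of three primes
in `(X, Y]`. -/
theorem eventually_exists_triple_of_lt {δ : ℝ} (hδ : 0 < δ) :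
    ∀ᶠ j₀ : ℕ in atTop, ∀ᶠ N : ℕ in atTop, ∀ X Y W J K M : ℕ, N ≤ 4 * X → X ≤ Y → Y ≤ N → 0 < J →
      (∀ q, 0 < q → q ≤ 2 ^ j₀ → q ∣ W) → (W * J : ℝ) ≤ N / 4 ^ j₀ →
      (∀ p ∈ primesIoc X Y, ∀ j < J, p + W * j < K) →
      δ * N ^ 2 < tripleSum (Finset.range K) (avgWeight (primesIoc X Y) (fun n => Real.log n) W J) M →
      ∃ a ∈ primesIoc X Y, ∃ b ∈ primesIoc X Y, ∃ c ∈ primesIoc X Y, a + b + c = M := by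
  filter_upwards [integral_primeExpSum_cube_le (show 0 < δ / 3 by positivity)] with j₀ hj₀
  filter_upwards [hj₀, eventually_gt_atTop 0] with N hmain hN X Y W J K M hX hXY hY hJ hW hWJ hK hlt
  by_contra hno
  have h0 : tripleSum (primesIoc X Y) (fun n => Real.log n) M = 0 := by
    by_contra h
    exact hno (exists_of_tripleSum_ne_zero h)
  have h1 := hmain X Y (avgKernel W J) hX hXY hY (continuous_avgKernel W J) (norm_avgKernel_le W J)
    fun α hα => norm_one_sub_avgKernel_le hJ hN hW hWJ hα
  have h2 := norm_integral_cube_sub_le (continuous_primeExpSum X Y) (continuous_avgKernel W J)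
    (norm_avgKernel_le W J) M
  simp only [primeExpSum] at h1 h2
  rw [integral_expSum_cube, h0] at h2
  simp only [expSum_mul_avgKernel _ hK] at h2
  rw [integral_expSum_cube, ofReal_zero, zero_sub, norm_neg, norm_real] at h2
  have := Real.le_norm_self
    (tripleSum (Finset.range K) (avgWeight (primesIoc X Y) (fun n => Real.log n) W J) M)
  linarith

end TernaryPrimes

namespace TernaryPrimes

/-- The number of representations of `t` as an ordered sum of three units. -/
noncomputable def unitTripleCount (R : Type*) [CommRing R] (t : R) : ℕ :=
  Nat.card {x : R × R // IsUnit x.1 ∧ IsUnit x.2 ∧ IsUnit (t - x.1 - x.2)}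

lemma unitTripleCount_congr {R R' : Type*} [CommRing R] [CommRing R'] (f : R ≃+* R') (t : R) :
    unitTripleCount R t = unitTripleCount R' (f t) := by
  refine Nat.card_congr ((f.toEquiv.prodCongr f.toEquiv).subtypeEquiv fun x => ?_)
  have h : ∀ y : R, IsUnit (f y) ↔ IsUnit y := fun y => isUnit_map_iff f y
  simp only [RingEquiv.toEquiv_eq_coe, Equiv.prodCongr_apply, EquivLike.coe_coe, Prod.map_fst,
    Prod.map_snd, ← map_sub, h]

lemma unitTripleCount_prod {R R' : Type*} [CommRing R] [CommRing R'] (t : R) (t' : R') :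
    unitTripleCount (R × R') (t, t') = unitTripleCount R t * unitTripleCount R' t' := by
  rw [unitTripleCount, unitTripleCount, unitTripleCount, ← Nat.card_prod]
  refine Nat.card_congr
    { toFun := fun x => (⟨(x.1.1.1, x.1.2.1), ?_⟩, ⟨(x.1.1.2, x.1.2.2), ?_⟩)
      invFun := fun y => ⟨((y.1.1.1, y.2.1.1), (y.1.1.2, y.2.1.2)), ?_⟩
      left_inv := fun _ => rfl
      right_inv := fun _ => rfl }
  · obtain ⟨x, h1, h2, h3⟩ := x
    rw [Prod.isUnit_iff] at h1 h2 h3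
    exact ⟨h1.1, h2.1, h3.1⟩
  · obtain ⟨x, h1, h2, h3⟩ := x
    rw [Prod.isUnit_iff] at h1 h2 h3
    exact ⟨h1.2, h2.2, h3.2⟩
  · obtain ⟨⟨y, h1, h2, h3⟩, ⟨z, k1, k2, k3⟩⟩ := y
    simp only [Prod.isUnit_iff]
    exact ⟨⟨h1, k1⟩, ⟨h2, k2⟩, ⟨h3, k3⟩⟩

lemma unitTripleCount_eq_sum {R : Type*} [CommRing R] [Fintype R] [DecidablePred (IsUnit : R → Prop)] (t : R) :
    unitTripleCount R t = ∑ x with IsUnit x, (Finset.univ.filter fun y : R => IsUnit y ∧ IsUnit (t - x - y)).card := by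
  classical
  rw [unitTripleCount, Nat.card_eq_fintype_card, Fintype.card_subtype, ← Finset.card_sigma]
  refine Finset.card_bij (fun x _ => ⟨x.1, x.2⟩) ?_ ?_ ?_
  · rintro x hx
    simpa using hx
  · rintro ⟨a, b⟩ _ ⟨c, d⟩ _ h
    simpa using h
  · rintro ⟨a, b⟩ h
    exact ⟨(a, b), by simpa using h, rfl⟩

lemma card_filter_isUnit {m : ℕ} [NeZero m] : (Finset.univ.filter fun y : ZMod m => IsUnit y).card = m.totient := by
  classical
  rw [← ZMod.card_units_eq_totient m, ← Finset.card_univ]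
  refine (Finset.card_bij (fun (x : (ZMod m)ˣ) _ => (x : ZMod m)) ?_ ?_ ?_).symm
  · intro a _; simp
  · intro a _ b _ h; exact Units.ext h
  · intro b hb
    obtain ⟨x, rfl⟩ := (Finset.mem_filter.1 hb).2
    exact ⟨x, Finset.mem_univ _, rfl⟩

/-- Inclusion–exclusion lower bound for the number of representations as a sum of three units. -/
lemma le_unitTripleCount_add {m : ℕ} [NeZero m] (t : ZMod m) :
    m.totient * (2 * m.totient) ≤ unitTripleCount (ZMod m) t + m.totient * m := by
  classical
  rw [unitTripleCount_eq_sum]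
  have h : ∀ x ∈ Finset.univ.filter fun x : ZMod m => IsUnit x, 2 * m.totient ≤
      (Finset.univ.filter fun y : ZMod m => IsUnit y ∧ IsUnit (t - x - y)).card + m := by
    intro x _
    have h1 := Finset.card_union_add_card_inter (Finset.univ.filter fun y : ZMod m => IsUnit y)
      (Finset.univ.filter fun y : ZMod m => IsUnit (t - x - y))
    have h2 : (Finset.univ.filter fun y : ZMod m => IsUnit (t - x - y)).card = m.totient := by
      rw [← card_filter_isUnit (m := m)]
      refine Finset.card_bij (fun y _ => t - x - y) (by simp) (by simp) fun y hy => ?_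
      exact ⟨t - x - y, by simpa using hy, by ring⟩
    have h3 := Finset.card_le_univ ((Finset.univ.filter fun y : ZMod m => IsUnit y) ∪
      (Finset.univ.filter fun y : ZMod m => IsUnit (t - x - y)))
    rw [← Finset.filter_and, h2, card_filter_isUnit] at h1
    rw [ZMod.card] at h3
    omega
  have := Finset.sum_le_sum h
  rw [Finset.sum_add_distrib, Finset.sum_const, Finset.sum_const, card_filter_isUnit] at this
  simpa using this

lemma isUnit_two_pow_iff {k : ℕ} (hk : 0 < k) (a : ℤ) : IsUnit (a : ZMod (2 ^ k)) ↔ Odd a := by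
  rw [ZMod.coe_int_isUnit_iff_isCoprime]
  push_cast
  rw [IsCoprime.pow_left_iff hk, Int.isCoprime_two_left]

lemma unitTripleCount_two_pow {k : ℕ} (hk : 0 < k) {t : ℤ} (ht : Odd t) :
    unitTripleCount (ZMod (2 ^ k)) t = (2 ^ k).totient ^ 2 := by
  classical
  rw [unitTripleCount_eq_sum]
  have : ∀ x ∈ Finset.univ.filter fun x : ZMod (2 ^ k) => IsUnit x,
      (Finset.univ.filter fun y : ZMod (2 ^ k) => IsUnit y ∧ IsUnit ((t : ZMod (2 ^ k)) - x - y)).card =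
        (2 ^ k).totient := by
    intro x hx
    rw [← card_filter_isUnit]
    congr 1
    refine Finset.filter_congr fun y _ => ?_
    obtain ⟨a, rfl⟩ := ZMod.intCast_surjective x
    obtain ⟨b, rfl⟩ := ZMod.intCast_surjective y
    have ha := (Finset.mem_filter.1 hx).2
    rw [← Int.cast_sub, ← Int.cast_sub]
    rw [isUnit_two_pow_iff hk] at *
    rw [isUnit_two_pow_iff hk]
    refine ⟨fun h => h.1, fun h => ⟨h, ?_⟩⟩
    exact (ht.sub_odd ha).sub_odd h
  rw [Finset.sum_congr rfl this, Finset.sum_const, card_filter_isUnit, smul_eq_mul, sq]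

/-- The ternary singular factor of `m`. -/
noncomputable def singularFactor (m : ℕ) : ℝ := ∏ p ∈ m.primeFactors.erase 2, (1 - 1 / ((p : ℝ) - 1) ^ 2)

lemma singularFactor_mul {a b : ℕ} (h : a.Coprime b) :
    singularFactor (a * b) = singularFactor a * singularFactor b := by
  rw [singularFactor, h.primeFactors_mul, Finset.erase_union_distrib, Finset.prod_union, singularFactor, singularFactor]
  exact (h.disjoint_primeFactors.mono (Finset.erase_subset _ _) (Finset.erase_subset _ _))

lemma singularFactor_factor_mem {p : ℕ} (hp : 3 ≤ p) :
    0 ≤ 1 - 1 / ((p : ℝ) - 1) ^ 2 ∧ 1 - 1 / ((p : ℝ) - 1) ^ 2 ≤ 1 := by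
  have h : (3 : ℝ) ≤ p := by exact_mod_cast hp
  have : 1 / ((p : ℝ) - 1) ^ 2 ≤ 1 := by
    rw [div_le_one (by nlinarith)]; nlinarith
  have h2 : 0 ≤ 1 / ((p : ℝ) - 1) ^ 2 := by positivity
  constructor <;> linarith

lemma prod_Icc_one_sub_eq (n : ℕ) :
    ∏ p ∈ Finset.Ico 3 (n + 3), (1 - 1 / ((p : ℝ) - 1) ^ 2) = ((n : ℝ) + 2) / (2 * (n + 1)) := by
  induction n with
  | zero => norm_num
  | succ n ih =>
    rw [show n + 1 + 3 = (n + 3) + 1 by ring, Finset.prod_Ico_succ_top (by omega), ih]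
    push_cast
    have : (n : ℝ) + 3 - 1 = n + 2 := by ring
    rw [this, show (n : ℝ) + 1 + 2 = n + 3 by ring, show (n : ℝ) + 1 + 1 = n + 2 by ring]
    field_simp
    ring

lemma three_le_of_mem_primeFactors_erase {m p : ℕ} (h : p ∈ m.primeFactors.erase 2) : 3 ≤ p := by
  have h2 := (Nat.prime_of_mem_primeFactors (Finset.mem_of_mem_erase h)).two_le
  have := Finset.ne_of_mem_erase h
  omega

lemma half_le_singularFactor (m : ℕ) : 1 / 2 ≤ singularFactor m := by
  have hsub : m.primeFactors.erase 2 ⊆ Finset.Ico 3 (m + 3) := fun p hp => by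
    have := Nat.le_of_mem_primeFactors (Finset.mem_of_mem_erase hp)
    exact Finset.mem_Ico.2 ⟨three_le_of_mem_primeFactors_erase hp, by omega⟩
  have h : ∏ p ∈ Finset.Ico 3 (m + 3), (1 - 1 / ((p : ℝ) - 1) ^ 2) ≤ singularFactor m := by
    rw [singularFactor, ← Finset.prod_sdiff hsub]
    refine mul_le_of_le_one_left (Finset.prod_nonneg fun p hp =>
      (singularFactor_factor_mem (three_le_of_mem_primeFactors_erase hp)).1) ?_
    refine Finset.prod_le_one (fun p hp => ?_) fun p hp => ?_
    · exact (singularFactor_factor_mem (Finset.mem_Ico.1 (Finset.mem_sdiff.1 hp).1).1).1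
    · exact (singularFactor_factor_mem (Finset.mem_Ico.1 (Finset.mem_sdiff.1 hp).1).1).2
  refine le_trans ?_ h
  rw [prod_Icc_one_sub_eq, div_le_div_iff₀ (by norm_num) (by positivity)]
  linarith

lemma singularFactor_mul_le_of_prime_pow {p k : ℕ} (hp : p.Prime) (hk : 0 < k) {t : ℤ} (ht : Odd t) :
    singularFactor (p ^ k) * ((p ^ k).totient : ℝ) ^ 3 ≤ (p ^ k : ℕ) * unitTripleCount (ZMod (p ^ k)) t := by
  rcases hp.eq_two_or_odd' with rfl | hodd
  · have h1 : singularFactor (2 ^ k) = 1 := by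
      simp [singularFactor, Nat.primeFactors_prime_pow hk.ne' Nat.prime_two]
    rw [h1, unitTripleCount_two_pow hk ht, one_mul]
    have : ((2 ^ k).totient : ℝ) ≤ (2 ^ k : ℕ) := by exact_mod_cast Nat.totient_le _
    rw [Nat.cast_pow _ 2, pow_succ', ]
    exact mul_le_mul_of_nonneg_right this (by positivity)
  · have h3 : 3 ≤ p := by
      have := hp.two_le
      rcases hodd with ⟨r, rfl⟩
      omega
    have : NeZero (p ^ k) := ⟨pow_ne_zero _ hp.ne_zero⟩
    have h1 : singularFactor (p ^ k) = 1 - 1 / ((p : ℝ) - 1) ^ 2 := by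
      rw [singularFactor, Nat.primeFactors_prime_pow hk.ne' hp, Finset.erase_eq_of_notMem, Finset.prod_singleton]
      simp; omega
    have h2 : (((p ^ k).totient * (2 * (p ^ k).totient) : ℕ) : ℝ) ≤ _ :=
      Nat.cast_le.2 (le_unitTripleCount_add (t : ZMod (p ^ k)))
    obtain ⟨j, rfl⟩ : ∃ j, k = j + 1 := ⟨k - 1, by omega⟩
    have hp1 : (0 : ℝ) < (p : ℝ) - 1 := by
      have : (3 : ℝ) ≤ p := by exact_mod_cast h3
      linarith
    have hφ : ((p ^ (j + 1)).totient : ℝ) = (p : ℝ) ^ j * ((p : ℝ) - 1) := by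
      rw [Nat.totient_prime_pow hp hk]
      push_cast [Nat.cast_sub hp.one_le]
      simp
    rw [h1]
    push_cast at h2 ⊢
    rw [hφ] at h2 ⊢
    have hP : (0 : ℝ) ≤ (p : ℝ) ^ j := by positivity
    generalize (unitTripleCount (ZMod (p ^ (j + 1))) (t : ZMod (p ^ (j + 1))) : ℝ) = F at h2 ⊢
    have e1 : (1 - 1 / ((p : ℝ) - 1) ^ 2) * ((p : ℝ) ^ j * ((p : ℝ) - 1)) ^ 3 =
        (p : ℝ) ^ (j + 1) * (((p : ℝ) ^ j * ((p : ℝ) - 1)) * ((p : ℝ) ^ j * ((p : ℝ) - 2))) := by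
      field_simp
      ring
    rw [e1]
    refine mul_le_mul_of_nonneg_left ?_ (by positivity)
    rw [pow_succ] at h2
    nlinarith

/-- The number of representations of an odd residue as a sum of three units is of the expected order. -/
theorem singularFactor_mul_le {m : ℕ} (hm : 0 < m) {t : ℤ} (ht : Odd t) :
    singularFactor m * (m.totient : ℝ) ^ 3 ≤ m * unitTripleCount (ZMod m) t := by
  induction m using Nat.recOnPosPrimePosCoprime with
  | prime_pow p k hp hk => exact singularFactor_mul_le_of_prime_pow hp hk ht
  | zero => exact absurd hm (lt_irrefl _)
  | one =>
    have : unitTripleCount (ZMod 1) (t : ZMod 1) = 1 := by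
      rw [unitTripleCount, Nat.card_eq_one_iff_unique]
      refine ⟨⟨fun a b => Subsingleton.elim _ _⟩, ⟨⟨(1, 1), ?_⟩⟩⟩
      exact ⟨isUnit_of_subsingleton _, isUnit_of_subsingleton _, isUnit_of_subsingleton _⟩
    rw [this]
    simp [singularFactor]
  | coprime a b ha hb hab iha ihb =>
    have ha' := iha (by omega)
    have hb' := ihb (by omega)
    rw [singularFactor_mul hab, Nat.totient_mul hab,
      unitTripleCount_congr (ZMod.chineseRemainder hab), map_intCast]
    have : ((t : ZMod a × ZMod b)) = ((t : ZMod a), (t : ZMod b)) := rfl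
    rw [this, unitTripleCount_prod]
    push_cast
    have h0 : 0 ≤ singularFactor b := by linarith [half_le_singularFactor b]
    have := mul_le_mul ha' hb' (by positivity) (by positivity)
    calc _ = _ := by ring
      _ ≤ _ := this
      _ = _ := by ring

end TernaryPrimes

namespace TernaryPrimes

open scoped ArithmeticFunction.vonMangoldt

/-- Chebyshev's theta function restricted to a residue class. -/
noncomputable def thetaMod (q : ℕ) (a : ZMod q) (n : ℕ) : ℝ :=
  ∑ p ∈ primesIoc 0 n with ((p : ℕ) : ZMod q) = a, Real.log p

lemma thetaMod_eq_sum (q : ℕ) (a : ZMod q) (n : ℕ) :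
    thetaMod q a n = ∑ k ∈ Finset.Ioc 0 n with ((k : ℕ) : ZMod q) = a, primeLog k := by
  rw [thetaMod, Finset.sum_filter, Finset.sum_filter]
  refine Finset.sum_subset_zero_on_sdiff (fun p hp => ?_) (fun p hp => ?_) (fun p hp => ?_)
  · exact Finset.mem_Ioc.2 (mem_primesIoc.1 hp).1
  · rw [Finset.mem_sdiff, mem_primesIoc, Finset.mem_Ioc] at hp
    rw [primeLog_apply, if_neg fun h => hp.2 ⟨hp.1, h⟩, ite_self]
  · rw [primeLog_apply, if_pos (mem_primesIoc.1 hp).2]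

lemma eventually_abs_thetaMod_sub_le {q : ℕ} [NeZero q] {a : ZMod q} (ha : IsUnit a) {ε : ℝ} (hε : 0 < ε) :
    ∀ᶠ n : ℕ in atTop, |thetaMod q a n - n / q.totient| ≤ ε * n := by
  obtain ⟨K, hK, hKn⟩ := exists_sum_prime_powers_le
  have h1 := (tendsto_sum_residueClass ha).eventually (Metric.closedBall_mem_nhds _ (half_pos hε))
  have h2 : Tendsto (fun n : ℕ => √(n : ℝ)) atTop atTop :=
    Real.tendsto_sqrt_atTop.comp tendsto_natCast_atTop_atTop
  filter_upwards [h1, h2.eventually_ge_atTop (2 * K / ε), eventually_gt_atTop 0] with n hn hs hn0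
  have hnR : (0 : ℝ) < n := by exact_mod_cast hn0
  rw [Real.dist_eq] at hn
  have e1 : ∑ k ∈ Finset.Icc 1 n, ArithmeticFunction.vonMangoldt.residueClass a k =
      ∑ k ∈ Finset.Ioc 0 n with ((k : ℕ) : ZMod q) = a, Λ k := by
    rw [Finset.sum_filter]
    refine Finset.sum_congr rfl fun k _ => ?_
    by_cases h : (k : ZMod q) = a <;>
      simp [ArithmeticFunction.vonMangoldt.residueClass, Set.indicator, h]
  have e2 : 0 ≤ (∑ k ∈ Finset.Ioc 0 n with ((k : ℕ) : ZMod q) = a, Λ k) - thetaMod q a n := by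
    rw [thetaMod_eq_sum, ← Finset.sum_sub_distrib]
    exact Finset.sum_nonneg fun k _ => sub_nonneg.2 (primeLog_le k)
  have e3 : (∑ k ∈ Finset.Ioc 0 n with ((k : ℕ) : ZMod q) = a, Λ k) - thetaMod q a n ≤ K * √n := by
    refine le_trans ?_ (hKn n)
    rw [thetaMod_eq_sum, ← Finset.sum_sub_distrib]
    refine Finset.sum_le_sum_of_subset_of_nonneg (Finset.filter_subset _ _) fun k _ _ => ?_
    exact sub_nonneg.2 (primeLog_le k)
  have e4 : K * √n ≤ ε / 2 * n := by
    rw [div_le_iff₀ hε] at hs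
    have := Real.mul_self_sqrt hnR.le
    nlinarith [Real.sqrt_nonneg (n : ℝ)]
  rw [e1] at hn
  generalize (∑ k ∈ Finset.Ioc 0 n with ((k : ℕ) : ZMod q) = a, Λ k) = T at *
  have e5 : |T - n / q.totient| ≤ ε / 2 * n := by
    have : T - n / q.totient = (T / n - (q.totient : ℝ)⁻¹) * n := by
      field_simp
    rw [this, abs_mul, abs_of_pos hnR]
    exact mul_le_mul_of_nonneg_right hn hnR.le
  rw [abs_le] at e5 ⊢
  constructor <;> linarith [e5.1, e5.2]

lemma thetaMod_sub_le_avgWeight {W J X Y n : ℕ} (hW : 0 < W) (hJ : 0 < J) (hX : X + W * J ≤ n) (hY : n ≤ Y) :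
    (thetaMod W n n - thetaMod W n (n - W * J)) / J ≤
      avgWeight (primesIoc X Y) (fun n => Real.log n) W J n := by
  classical
  have hJR : (0 : ℝ) < J := by exact_mod_cast hJ
  have hsub : (primesIoc 0 (n - W * J)).filter (fun p : ℕ => (p : ZMod W) = n) ⊆
      (primesIoc 0 n).filter fun p : ℕ => (p : ZMod W) = n := by
    refine Finset.filter_subset_filter _ fun p hp => ?_
    rw [mem_primesIoc] at hp ⊢
    exact ⟨⟨hp.1.1, hp.1.2.trans (Nat.sub_le _ _)⟩, hp.2⟩
  rw [thetaMod, thetaMod, ← Finset.sum_sdiff hsub, add_sub_cancel_right, Finset.sum_div, avgWeight]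
  set T := (primesIoc 0 n).filter (fun p : ℕ => (p : ZMod W) = n) \
    (primesIoc 0 (n - W * J)).filter fun p : ℕ => (p : ZMod W) = n with hT
  have hmem : ∀ p ∈ T, p.Prime ∧ n < p + W * J ∧ p ≤ n ∧ p + W * ((n - p) / W) = n := by
    intro p hp
    rw [hT, Finset.mem_sdiff, Finset.mem_filter, Finset.mem_filter, mem_primesIoc, mem_primesIoc] at hp
    obtain ⟨⟨⟨⟨h0, hpn⟩, hp1⟩, hmod⟩, hnot⟩ := hp
    have hlt : ¬ p ≤ n - W * J := fun h => hnot ⟨⟨⟨h0, h⟩, hp1⟩, hmod⟩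
    have hdvd : W ∣ n - p := (Nat.modEq_iff_dvd' hpn).1 ((ZMod.natCast_eq_natCast_iff _ _ _).1 hmod)
    refine ⟨hp1, by omega, hpn, ?_⟩
    rw [Nat.mul_div_cancel' hdvd]
    omega
  have hinj : Set.InjOn (fun p => (p, (n - p) / W)) (T : Set ℕ) := fun a _ b _ h => (Prod.ext_iff.1 h).1
  calc ∑ p ∈ T, Real.log p / J = ∑ x ∈ T.image fun p => (p, (n - p) / W), Real.log x.1 / J := by
        rw [Finset.sum_image hinj]
    _ ≤ _ := by
        refine Finset.sum_le_sum_of_subset_of_nonneg ?_ fun x _ _ => by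
          have := Real.log_natCast_nonneg x.1
          positivity
        intro x hx
        obtain ⟨p, hp, rfl⟩ := Finset.mem_image.1 hx
        obtain ⟨h1, h2, h3, h4⟩ := hmem p hp
        refine Finset.mem_filter.2 ⟨Finset.mem_product.2 ⟨?_, ?_⟩, h4⟩
        · exact mem_primesIoc.2 ⟨⟨by omega, by omega⟩, h1⟩
        · refine Finset.mem_range.2 ((Nat.div_lt_iff_lt_mul hW).2 ?_)
          rw [mul_comm J W]
          omega

lemma eventually_le_avgWeight {W : ℕ} (hW : 0 < W) {η : ℝ} (hη : 0 < η) :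
    ∀ᶠ N : ℕ in atTop, ∀ X Y J n : ℕ, N ≤ 4 * X → X + W * J ≤ n → n ≤ Y → n ≤ N →
      η * N ≤ W * J → 0 < J → IsUnit (n : ZMod W) →
      (W : ℝ) / (2 * W.totient) ≤ avgWeight (primesIoc X Y) (fun n => Real.log n) W J n := by
  have : NeZero W := ⟨hW.ne'⟩
  have hφ : (0 : ℝ) < (W.totient : ℝ) := by exact_mod_cast Nat.totient_pos.2 hW
  have h : ∀ᶠ Z : ℕ in atTop, ∀ a : ZMod W, IsUnit a →
      |thetaMod W a Z - Z / W.totient| ≤ η / (4 * W.totient) * Z := by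
    refine eventually_all.2 fun a => ?_
    by_cases ha : IsUnit a
    · exact (eventually_abs_thetaMod_sub_le ha (by positivity)).mono fun _ h _ => h
    · exact Eventually.of_forall fun _ h => absurd h ha
  filter_upwards [eventually_of_le_four_mul h] with N hN X Y J n hX hXn hnY hnN hηN hJ hn
  refine le_trans ?_ (thetaMod_sub_le_avgWeight hW hJ hXn hnY)
  have hJR : (0 : ℝ) < J := by exact_mod_cast hJ
  have h1 := abs_le.1 (hN n (by omega) n hn)
  have h2 := abs_le.1 (hN (n - W * J) (by omega) n hn)
  have h3 : ((n - W * J : ℕ) : ℝ) = n - W * J := by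
    rw [Nat.cast_sub (by omega)]; push_cast; ring
  rw [h3] at h2
  rw [le_div_iff₀ hJR]
  have h4 : η / (4 * W.totient) * (n : ℝ) ≤ W * J / (4 * W.totient) := by
    have : η * (n : ℝ) ≤ W * J := (mul_le_mul_of_nonneg_left (by exact_mod_cast hnN) hη.le).trans hηN
    calc η / (4 * W.totient) * (n : ℝ) = η * n / (4 * W.totient) := by ring
      _ ≤ _ := by gcongr
  have h5 : η / (4 * W.totient) * ((n : ℝ) - W * J) ≤ η / (4 * W.totient) * (n : ℝ) := by
    refine mul_le_mul_of_nonneg_left ?_ (by positivity)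
    have : (0 : ℝ) ≤ W * J := by positivity
    linarith
  have e : (W : ℝ) / (2 * W.totient) * J =
      (n / W.totient - (n - W * J) / W.totient) - 2 * (W * J / (4 * W.totient)) := by
    field_simp
    ring
  rw [e]
  linarith [h1.1, h2.2]

end TernaryPrimes

namespace TernaryPrimes

lemma sum_Ioc_natCast_zmod {W : ℕ} [NeZero W] (h : ZMod W → ℝ) (B : ℕ) :
    ∑ n ∈ Finset.Ioc B (B + W), h n = ∑ x, h x := by
  classical
  have hinj : Set.InjOn (fun n : ℕ => (n : ZMod W)) (Finset.Ioc B (B + W) : Finset ℕ) := by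
    intro a ha b hb hab
    simp only [Finset.coe_Ioc, Set.mem_Ioc] at ha hb
    have := (ZMod.natCast_eq_natCast_iff a b W).1 hab
    rcases le_total a b with hle | hle
    · have hd := Nat.eq_zero_of_dvd_of_lt ((Nat.modEq_iff_dvd' hle).1 this) (by omega)
      omega
    · have hd := Nat.eq_zero_of_dvd_of_lt ((Nat.modEq_iff_dvd' hle).1 this.symm) (by omega)
      omega
  have himg : (Finset.Ioc B (B + W)).image (fun n : ℕ => (n : ZMod W)) = Finset.univ := by
    rw [← Finset.card_eq_iff_eq_univ, Finset.card_image_of_injOn hinj, ZMod.card]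
    simp
  rw [← himg, Finset.sum_image hinj]

lemma sum_Ioc_mul_natCast_zmod {W : ℕ} [NeZero W] (h : ZMod W → ℝ) (A J : ℕ) :
    ∑ n ∈ Finset.Ioc A (A + J * W), h n = J * ∑ x, h x := by
  rw [sum_Ioc_add_mul (fun n : ℕ => h n), Finset.sum_congr rfl fun j _ => sum_Ioc_natCast_zmod h _]
  simp

lemma sum_sum_le_tripleSum {w : ℕ → ℝ} (hw : ∀ n, 0 ≤ w n) {K M : ℕ} {I : Finset ℕ}
    (hI : ∀ a ∈ I, ∀ b ∈ I, a < K ∧ b < K ∧ a + b ≤ M ∧ M - a - b < K) :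
    ∑ a ∈ I, ∑ b ∈ I, w a * w b * w (M - a - b) ≤ tripleSum (Finset.range K) w M := by
  have hpos : ∀ a b c : ℕ, 0 ≤ if a + b + c = M then w a * w b * w c else 0 := fun a b c => by
    split_ifs
    · exact mul_nonneg (mul_nonneg (hw _) (hw _)) (hw _)
    · exact le_rfl
  have hIK : I ⊆ Finset.range K := fun a ha => Finset.mem_range.2 (hI a ha a ha).1
  rw [tripleSum]
  calc _ ≤ ∑ a ∈ I, ∑ b ∈ I, ∑ c ∈ Finset.range K, if a + b + c = M then w a * w b * w c else 0 := by
        refine Finset.sum_le_sum fun a ha => Finset.sum_le_sum fun b hb => ?_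
        obtain ⟨-, -, h1, h2⟩ := hI a ha b hb
        refine le_trans ?_ (Finset.single_le_sum (fun c _ => hpos a b c) (Finset.mem_range.2 h2))
        rw [if_pos (by omega)]
    _ ≤ ∑ a ∈ I, ∑ b ∈ Finset.range K, ∑ c ∈ Finset.range K,
        if a + b + c = M then w a * w b * w c else 0 :=
        Finset.sum_le_sum fun a _ => Finset.sum_le_sum_of_subset_of_nonneg hIK fun b _ _ =>
          Finset.sum_nonneg fun c _ => hpos a b c
    _ ≤ _ := Finset.sum_le_sum_of_subset_of_nonneg hIK fun a _ _ =>
          Finset.sum_nonneg fun b _ => Finset.sum_nonneg fun c _ => hpos a b c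

lemma unitTripleCount_mul_le_tripleSum {w : ℕ → ℝ} (hw : ∀ n, 0 ≤ w n) {W A J K M : ℕ} [NeZero W] {l : ℝ}
    (hl : 0 ≤ l)
    (hI : ∀ a ∈ Finset.Ioc A (A + J * W), ∀ b ∈ Finset.Ioc A (A + J * W),
      a < K ∧ b < K ∧ a + b ≤ M ∧ M - a - b < K)
    (hlow : ∀ a ∈ Finset.Ioc A (A + J * W), IsUnit (a : ZMod W) → l ≤ w a)
    (hlow' : ∀ a ∈ Finset.Ioc A (A + J * W), ∀ b ∈ Finset.Ioc A (A + J * W),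
      IsUnit ((M - a - b : ℕ) : ZMod W) → l ≤ w (M - a - b)) :
    l ^ 3 * (J ^ 2 * unitTripleCount (ZMod W) M) ≤ tripleSum (Finset.range K) w M := by
  classical
  refine le_trans ?_ (sum_sum_le_tripleSum hw hI)
  let g : ZMod W → ZMod W → ℝ := fun x y =>
    if IsUnit x ∧ IsUnit y ∧ IsUnit ((M : ZMod W) - x - y) then 1 else 0
  have hg : (unitTripleCount (ZMod W) M : ℝ) = ∑ x, ∑ y, g x y := by
    rw [unitTripleCount_eq_sum, Nat.cast_sum, Finset.sum_filter]
    refine Finset.sum_congr rfl fun x _ => ?_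
    split_ifs with hx
    · rw [Finset.card_filter, Nat.cast_sum]
      refine Finset.sum_congr rfl fun y _ => ?_
      simp [g, hx]
    · simp [g, hx]
  have hsum : ∑ a ∈ Finset.Ioc A (A + J * W), ∑ b ∈ Finset.Ioc A (A + J * W), l ^ 3 * g a b =
      l ^ 3 * (J ^ 2 * unitTripleCount (ZMod W) M) := by
    simp_rw [← Finset.mul_sum]
    rw [hg, Finset.sum_congr rfl fun (a : ℕ) _ => sum_Ioc_mul_natCast_zmod (g (a : ZMod W)) A J,
      ← Finset.mul_sum, sum_Ioc_mul_natCast_zmod (fun x => ∑ y, g x y) A J]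
    ring
  rw [← hsum]
  refine Finset.sum_le_sum fun a ha => Finset.sum_le_sum fun b hb => ?_
  by_cases h : IsUnit (a : ZMod W) ∧ IsUnit (b : ZMod W) ∧ IsUnit ((M : ZMod W) - a - b)
  · obtain ⟨-, -, h1, -⟩ := hI a ha b hb
    have e : ((M - a - b : ℕ) : ZMod W) = (M : ZMod W) - a - b := by
      rw [Nat.cast_sub (by omega), Nat.cast_sub (by omega)]
    have e1 := hlow a ha h.1
    have e2 := hlow b hb h.2.1
    have e3 := hlow' a ha b hb (e ▸ h.2.2)
    simp only [g, if_pos h, mul_one]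
    rw [pow_succ, sq]
    exact mul_le_mul (mul_le_mul e1 e2 hl (hw _)) e3 hl (mul_nonneg (hw _) (hw _))
  · simp only [g, if_neg h, mul_zero]
    exact mul_nonneg (mul_nonneg (hw _) (hw _)) (hw _)

set_option maxHeartbeats 800000 in
/-- Every large odd number is a sum of three almost equal primes. -/
theorem eventually_exists_almost_equal_primes {ε : ℝ} (hε : 0 < ε) (hε8 : ε ≤ 1 / 8) :
    ∀ᶠ M : ℕ in atTop, Odd M → ∃ a b c : ℕ, a.Prime ∧ b.Prime ∧ c.Prime ∧ a + b + c = M ∧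
      (1 - ε) * M / 3 ≤ a ∧ (1 - ε) * M / 3 ≤ b ∧ (1 - ε) * M / 3 ≤ c := by
  have hpow : ∀ᶠ j : ℕ in atTop, 9 / ε ≤ (4 : ℝ) ^ j :=
    (tendsto_pow_atTop_atTop_of_one_lt (by norm_num)).eventually_ge_atTop _
  obtain ⟨j₀, hmain, hj₀⟩ :=
    ((eventually_exists_triple_of_lt (show 0 < ε ^ 2 / 6000 by positivity)).and hpow).exists
  set P : ℝ := 4 ^ j₀ with hP
  have hP0 : 0 < P := by positivity
  set W : ℕ := (2 ^ j₀).factorial with hW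
  have hW0 : 0 < W := Nat.factorial_pos _
  have : NeZero W := ⟨hW0.ne'⟩
  have hWR : (0 : ℝ) < (W : ℝ) := by exact_mod_cast hW0
  have hφ : (0 : ℝ) < (W.totient : ℝ) := by exact_mod_cast Nat.totient_pos.2 hW0
  have hlarge : ∀ B : ℝ, ∀ᶠ M : ℕ in atTop, B ≤ M := fun B =>
    tendsto_natCast_atTop_atTop.eventually_ge_atTop B
  filter_upwards [hmain, eventually_le_avgWeight hW0 (show 0 < 1 / (2 * P) by positivity), hlarge 24,
    hlarge (2 * P * W), hlarge (18 * W / ε), hlarge (3 / ε)] with M hM hwt h24 hPW hWε h3ε hodd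
  have hMR : (0 : ℝ) < M := by linarith
  have hεM8 : ε * M ≤ M / 8 := by
    have := mul_le_mul_of_nonneg_right hε8 hMR.le
    linarith
  have hεM0 : 0 < ε * M := by positivity
  set X := ⌊(1 - ε) * M / 3⌋₊ with hX
  set Y := ⌊(1 + ε) * M / 3⌋₊ with hY
  set J := ⌊(M : ℝ) / (P * W)⌋₊ with hJ
  set J' := ⌊ε * M / (9 * W)⌋₊ with hJ'
  have hX1 : (X : ℝ) ≤ (1 - ε) * M / 3 := Nat.floor_le (by linarith)
  have hX2 : (1 - ε) * M / 3 < X + 1 := Nat.lt_floor_add_one _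
  have hY1 : (Y : ℝ) ≤ (1 + ε) * M / 3 := Nat.floor_le (by positivity)
  have hY2 : (1 + ε) * M / 3 < Y + 1 := Nat.lt_floor_add_one _
  have hJ1 : (W : ℝ) * J ≤ M / P := by
    have : (J : ℝ) ≤ M / (P * W) := Nat.floor_le (by positivity)
    rw [le_div_iff₀ (by positivity)] at this ⊢
    linarith
  have hJ2 : 1 / (2 * P) * M ≤ (W : ℝ) * J := by
    have : (M : ℝ) / (P * W) < J + 1 := Nat.lt_floor_add_one _
    rw [div_lt_iff₀ (by positivity)] at this
    rw [div_mul_eq_mul_div, one_mul, div_le_iff₀ (by positivity)]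
    nlinarith
  have hJ'1 : (J' : ℝ) * W ≤ ε * M / 9 := by
    have : (J' : ℝ) ≤ ε * M / (9 * W) := Nat.floor_le (by positivity)
    rw [le_div_iff₀ (by positivity)] at this
    linarith
  have hJ'2 : ε * M / 18 ≤ (J' : ℝ) * W := by
    have : ε * M / (9 * W) < (J' : ℝ) + 1 := Nat.lt_floor_add_one _
    rw [div_lt_iff₀ (by positivity)] at this
    rw [div_le_iff₀ hε] at hWε
    nlinarith
  have hPε : M / P ≤ ε * M / 9 := by
    rw [div_le_iff₀ hε] at hj₀
    rw [div_le_div_iff₀ hP0 (by norm_num)]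
    nlinarith
  have hJ0 : 0 < J := by
    rcases Nat.eq_zero_or_pos J with h | h
    · rw [h] at hJ2
      have : 0 < 1 / (2 * P) * M := by positivity
      simp only [Nat.cast_zero, mul_zero] at hJ2
      linarith
    · exact h
  have hA1 : (M : ℝ) < 3 * ((M / 3 : ℕ) : ℝ) + 3 := by exact_mod_cast (by omega : M < 3 * (M / 3) + 3)
  have hA2 : 3 * ((M / 3 : ℕ) : ℝ) ≤ M := by exact_mod_cast (by omega : 3 * (M / 3) ≤ M)
  have hεM : 3 ≤ ε * M := by rwa [div_le_iff₀ hε, mul_comm] at h3ε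
  have hmem : ∀ a ∈ Finset.Ioc (M / 3) (M / 3 + J' * W), (M : ℝ) / 3 ≤ a ∧ (a : ℝ) ≤ M / 3 + ε * M / 9 := by
    intro a ha
    rw [Finset.mem_Ioc] at ha
    have h1 : ((M / 3 : ℕ) : ℝ) + 1 ≤ a := by exact_mod_cast ha.1
    have h2 : (a : ℝ) ≤ ((M / 3 : ℕ) : ℝ) + J' * W := by exact_mod_cast ha.2
    constructor <;> linarith
  have hfit : ∀ n : ℕ, (M : ℝ) / 3 - 2 * (ε * M) / 9 ≤ n → (n : ℝ) ≤ M / 3 + ε * M / 9 →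
      X + W * J ≤ n ∧ n ≤ Y ∧ n ≤ M := by
    intro n h1 h2
    refine ⟨?_, Nat.le_floor (by linarith), ?_⟩
    · have : (X : ℝ) + W * J ≤ n := by linarith
      exact_mod_cast this
    · have : (n : ℝ) ≤ M := by linarith
      exact_mod_cast this
  have hthird : ∀ a ∈ Finset.Ioc (M / 3) (M / 3 + J' * W), ∀ b ∈ Finset.Ioc (M / 3) (M / 3 + J' * W),
      a + b ≤ M ∧ (M : ℝ) / 3 - 2 * (ε * M) / 9 ≤ (M - a - b : ℕ) ∧ ((M - a - b : ℕ) : ℝ) ≤ M / 3 + ε * M / 9 := by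
    intro a ha b hb
    have h1 := hmem a ha
    have h2 := hmem b hb
    have hab : a + b ≤ M := by
      have : (a : ℝ) + b ≤ M := by linarith
      exact_mod_cast this
    have e : ((M - a - b : ℕ) : ℝ) = M - a - b := by
      rw [Nat.cast_sub (by omega), Nat.cast_sub (by omega)]
    rw [e]
    refine ⟨hab, ?_, ?_⟩ <;> linarith [h1.1, h1.2, h2.1, h2.2]
  have hX4 : M ≤ 4 * X := by
    have : (M : ℝ) ≤ 4 * X := by linarith
    exact_mod_cast this
  have hXY : X ≤ Y := Nat.floor_mono (by linarith)
  have hYM : Y ≤ M := by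
    have : (Y : ℝ) ≤ M := by linarith
    exact_mod_cast this
  have hlow : (W / (2 * W.totient) : ℝ) ^ 3 * (J' ^ 2 * unitTripleCount (ZMod W) M) ≤
      tripleSum (Finset.range (Y + W * J + 1)) (avgWeight (primesIoc X Y) (fun n => Real.log n) W J) M := by
    refine unitTripleCount_mul_le_tripleSum (A := M / 3)
      (fun n => avgWeight_nonneg (fun n _ => Real.log_natCast_nonneg n) W J n) (by positivity) ?_ ?_ ?_
    · intro a ha b hb
      have h1 := hmem a ha
      have h2 := hmem b hb
      have h3 := hthird a ha b hb
      have f1 := hfit a (by linarith [h1.1]) h1.2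
      have f2 := hfit b (by linarith [h2.1]) h2.2
      have f3 := hfit _ h3.2.1 h3.2.2
      exact ⟨by omega, by omega, h3.1, by omega⟩
    · intro a ha hu
      have h1 := hmem a ha
      have f1 := hfit a (by linarith [h1.1]) h1.2
      exact hwt X Y J a hX4 f1.1 f1.2.1 f1.2.2 hJ2 hJ0 hu
    · intro a ha b hb hu
      have h3 := hthird a ha b hb
      have f3 := hfit _ h3.2.1 h3.2.2
      exact hwt X Y J _ hX4 f3.1 f3.2.1 f3.2.2 hJ2 hJ0 hu
  have hcount : (W.totient : ℝ) ^ 3 / 2 ≤ W * unitTripleCount (ZMod W) M := by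
    have h1 := singularFactor_mul_le hW0 (t := (M : ℤ)) (by exact_mod_cast hodd)
    rw [Int.cast_natCast] at h1
    refine le_trans ?_ h1
    have := mul_le_mul_of_nonneg_right (half_le_singularFactor W) (show 0 ≤ (W.totient : ℝ) ^ 3 by positivity)
    linarith
  have hbig : ε ^ 2 / 6000 * (M : ℝ) ^ 2 <
      (W / (2 * W.totient) : ℝ) ^ 3 * (J' ^ 2 * unitTripleCount (ZMod W) M) := by
    have e : (W / (2 * W.totient) : ℝ) ^ 3 * (J' ^ 2 * unitTripleCount (ZMod W) M) =
        (J' * W) ^ 2 * (W * unitTripleCount (ZMod W) M) / (8 * (W.totient : ℝ) ^ 3) := by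
      field_simp
      ring
    rw [e, lt_div_iff₀ (by positivity)]
    have h1 : (ε * M / 18) ^ 2 ≤ ((J' : ℝ) * W) ^ 2 := by gcongr
    have h2 := mul_le_mul h1 hcount (by positivity) (by positivity)
    refine lt_of_lt_of_le ?_ h2
    have h3 : 0 < ε ^ 2 * (M : ℝ) ^ 2 * (W.totient : ℝ) ^ 3 := by positivity
    linarith
  obtain ⟨a, ha, b, hb, c, hc, habc⟩ := hM X Y W J (Y + W * J + 1) M hX4 hXY hYM hJ0
    (fun q hq hqj => Nat.dvd_factorial hq hqj) hJ1 (fun p hp j hj => by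
      have h1 := (mem_primesIoc.1 hp).1.2
      have h2 := Nat.mul_le_mul_left W hj.le
      omega) (hbig.trans_le hlow)
  have hfin : ∀ p ∈ primesIoc X Y, p.Prime ∧ (1 - ε) * M / 3 ≤ p := fun p hp => by
    rw [mem_primesIoc] at hp
    have : (X : ℝ) + 1 ≤ p := by exact_mod_cast hp.1.1
    exact ⟨hp.2, by linarith⟩
  exact ⟨a, b, c, (hfin a ha).1, (hfin b hb).1, (hfin c hc).1, habc, (hfin a ha).2, (hfin b hb).2, (hfin c hc).2⟩

lemma eventually_exists_prime_near {η : ℝ} (hη : 0 < η) (hη2 : η ≤ 1 / 2) :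
    ∀ᶠ n : ℕ in atTop, ∃ p : ℕ, p.Prime ∧ (1 - η) * n ≤ p ∧ p ≤ n := by
  have h : ∀ᶠ n : ℕ in atTop, |thetaMod 1 0 n - n / (1 : ℕ).totient| ≤ η / 4 * n :=
    eventually_abs_thetaMod_sub_le (isUnit_of_subsingleton _) (by positivity)
  filter_upwards [eventually_of_le_four_mul h, eventually_ge_atTop 4] with n hn hn4
  have hnR : (4 : ℝ) ≤ n := by exact_mod_cast hn4
  set m := ⌊(1 - η) * n⌋₊ with hm
  have hm1 : (m : ℝ) ≤ (1 - η) * n := Nat.floor_le (by nlinarith)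
  have hm2 : (1 - η) * n < m + 1 := Nat.lt_floor_add_one _
  have hnm : n ≤ 4 * m := by
    have : (n : ℝ) ≤ 4 * m := by nlinarith
    exact_mod_cast this
  have h1 := abs_le.1 (hn n (by omega))
  have h2 := abs_le.1 (hn m hnm)
  rw [Nat.totient_one, Nat.cast_one, div_one] at h1 h2
  by_contra! hno
  have hle : thetaMod 1 0 n ≤ thetaMod 1 0 m := by
    refine Finset.sum_le_sum_of_subset_of_nonneg (Finset.filter_subset_filter _ fun p hp => ?_)
      fun p _ _ => Real.log_natCast_nonneg p
    rw [mem_primesIoc] at hp ⊢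
    refine ⟨⟨hp.1.1, Nat.le_floor ?_⟩, hp.2⟩
    by_contra! hlt
    exact absurd hp.1.2 (not_le.2 (hno p hp.2 hlt.le))
  have h3 : η / 4 * (m : ℝ) ≤ η / 4 * n := by
    refine mul_le_mul_of_nonneg_left ?_ (by positivity)
    nlinarith
  have : 0 < η * n := by positivity
  linarith [h1.1, h2.2]

lemma tendsto_nthPrime : Tendsto nthPrime atTop atTop :=
  (Nat.nth_strictMono Nat.infinite_setOfPred_prime).tendsto_atTop.comp (tendsto_sub_atTop_nat 1)

lemma mem_S_of_prime {n q : ℕ} (hq : q.Prime) (h : nthPrime n ≤ q) : q ∈ S n :=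
  AddSubmonoid.subset_closure ⟨hq, h⟩

lemma eq_zero_or_prime_or_add_of_mem_S {n x : ℕ} (hx : x ∈ S n) :
    x = 0 ∨ (x.Prime ∧ nthPrime n ≤ x) ∨ x ∈ ((S n : Set ℕ) \ {0}) + ((S n : Set ℕ) \ {0}) := by
  induction hx using AddSubmonoid.closure_induction with
  | mem x hx => exact Or.inr (Or.inl hx)
  | zero => exact Or.inl rfl
  | add x y hx hy ihx ihy =>
    rcases eq_or_ne x 0 with rfl | hx0
    · simpa using ihy
    rcases eq_or_ne y 0 with rfl | hy0
    · simpa using ihx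
    exact Or.inr (Or.inr (Set.add_mem_add ⟨hx, hx0⟩ ⟨hy, hy0⟩))

lemma le_of_mem_S {n x : ℕ} (hx : x ∈ S n) : x = 0 ∨ nthPrime n ≤ x := by
  induction hx using AddSubmonoid.closure_induction with
  | mem x hx => exact Or.inr hx.2
  | zero => exact Or.inl rfl
  | add x y hx hy ihx ihy => omega

lemma prime_of_mem_atoms {n x : ℕ} (hx : x ∈ atoms n) : x.Prime ∧ nthPrime n ≤ x := by
  rcases eq_zero_or_prime_or_add_of_mem_S hx.1.1 with h | h | h
  · exact absurd h hx.1.2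
  · exact h
  · exact absurd h hx.2

lemma mem_atoms_of_prime {n q : ℕ} (hn : 3 ≤ nthPrime n) (hq : q.Prime) (h1 : nthPrime n ≤ q)
    (h2 : q < 3 * nthPrime n) : q ∈ atoms n := by
  refine ⟨⟨mem_S_of_prime hq h1, hq.ne_zero⟩, ?_⟩
  rintro ⟨a, ⟨ha, ha0⟩, b, ⟨hb, hb0⟩, hab⟩
  have hab : a + b = q := hab
  have hge : ∀ x ∈ (S n : Set ℕ) \ {0}, nthPrime n ≤ x := fun x hx => (le_of_mem_S hx.1).resolve_left hx.2
  have hodd : ∀ x ∈ (S n : Set ℕ) \ {0}, x < 2 * nthPrime n → Odd x := by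
    intro x hx hlt
    rcases eq_zero_or_prime_or_add_of_mem_S hx.1 with h | h | ⟨y, hy, z, hz, hyz⟩
    · exact absurd h hx.2
    · exact h.1.odd_of_ne_two (by omega)
    · have := hge y hy
      have := hge z hz
      have hyz : y + z = x := hyz
      omega
  have h3 := hge a ⟨ha, ha0⟩
  have h4 := hge b ⟨hb, hb0⟩
  have h5 := (hodd a ⟨ha, ha0⟩ (by omega)).add_odd (hodd b ⟨hb, hb0⟩ (by omega))
  rw [hab] at h5
  exact Nat.not_even_iff_odd.2 (hq.odd_of_ne_two (by omega)) h5

lemma add_add_notMem_atoms {n a b c : ℕ} (ha : a.Prime) (hb : b.Prime) (hc : c.Prime)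
    (ha' : nthPrime n ≤ a) (hb' : nthPrime n ≤ b) (hc' : nthPrime n ≤ c) : a + b + c ∉ atoms n := by
  intro h
  refine h.2 (Set.add_mem_add ⟨add_mem (mem_S_of_prime ha ha') (mem_S_of_prime hb hb'), ?_⟩
    ⟨mem_S_of_prime hc hc', hc.ne_zero⟩)
  have := ha.pos
  simp only [Set.mem_singleton_iff]
  omega

end TernaryPrimes

open TernaryPrimes

theorem u_asymptotic :
    Filter.Tendsto (fun n => (u n : ℝ) / (nthPrime n : ℝ)) Filter.atTop (nhds 3) := by
  rw [Metric.tendsto_nhds]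
  intro ε' hε'
  set ε : ℝ := min (ε' / 12) (1 / 8) with hε
  have hε0 : 0 < ε := by positivity
  have hε1 : ε ≤ ε' / 12 := min_le_left _ _
  have hε2 : ε ≤ 1 / 8 := min_le_right _ _
  obtain ⟨M₀, hM₀⟩ := eventually_atTop.1 (eventually_exists_almost_equal_primes hε0 hε2)
  obtain ⟨N₀, hN₀⟩ := eventually_atTop.1 (eventually_exists_prime_near hε0 (by linarith))
  filter_upwards [tendsto_nthPrime.eventually_ge_atTop (max 3 (max M₀ N₀))] with n hn
  have hp3 : 3 ≤ nthPrime n := by omega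
  have hpM : M₀ ≤ nthPrime n := by omega
  have hpN : N₀ ≤ nthPrime n := by omega
  have hpR : (0 : ℝ) < (nthPrime n : ℝ) := by exact_mod_cast (by omega : 0 < nthPrime n)
  have hup : ∀ q ∈ atoms n, (q : ℝ) ≤ (3 + ε' / 2) * nthPrime n := by
    intro q hq
    by_contra! hlt
    obtain ⟨hqp, hle⟩ := prime_of_mem_atoms hq
    obtain ⟨a, b, c, ha, hb, hc, habc, ha', hb', hc'⟩ :=
      hM₀ q (hpM.trans hle) (hqp.odd_of_ne_two (by omega))
    have hbig : (nthPrime n : ℝ) ≤ (1 - ε) * q / 3 := by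
      have h1 : (1 - ε) * ((3 + ε' / 2) * nthPrime n) ≤ (1 - ε) * q :=
        mul_le_mul_of_nonneg_left hlt.le (by linarith)
      have h2 : 3 ≤ (1 - ε) * (3 + ε' / 2) := by nlinarith
      have h3 := mul_le_mul_of_nonneg_right h2 hpR.le
      linarith
    refine add_add_notMem_atoms ha hb hc ?_ ?_ ?_ (habc.symm ▸ hq)
    · exact_mod_cast hbig.trans ha'
    · exact_mod_cast hbig.trans hb'
    · exact_mod_cast hbig.trans hc'
  have hbdd : BddAbove (atoms n) := ⟨⌊(3 + ε' / 2) * nthPrime n⌋₊, fun q hq => Nat.le_floor (hup q hq)⟩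
  obtain ⟨r, hr, hr1, hr2⟩ := hN₀ (3 * nthPrime n) (by omega)
  push_cast at hr1
  have hrp : nthPrime n ≤ r := by
    have : (nthPrime n : ℝ) ≤ r := by nlinarith
    exact_mod_cast this
  have hr3 : r ≠ 3 * nthPrime n := by
    rintro rfl
    exact Nat.not_prime_mul (by norm_num) (by omega) hr
  have hratom : r ∈ atoms n := mem_atoms_of_prime hp3 hr hrp (by omega)
  have hur : (r : ℝ) ≤ u n := by exact_mod_cast le_csSup hbdd hratom
  have hu : (u n : ℝ) ≤ (3 + ε' / 2) * nthPrime n := hup _ (Nat.sSup_mem ⟨r, hratom⟩ hbdd)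
  have hlow : (3 - ε' / 2) * nthPrime n ≤ (u n : ℝ) := by nlinarith
  rw [Real.dist_eq, abs_lt]
  have k1 : 3 - ε' / 2 ≤ (u n : ℝ) / nthPrime n := (le_div_iff₀ hpR).2 hlow
  have k2 : (u n : ℝ) / nthPrime n ≤ 3 + ε' / 2 := (div_le_iff₀ hpR).2 hu
  constructor <;> linarith
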